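/- Let P be a finite chiral n-polytope whose facets and vertex-figures are all chiral. If n = 7, then P has at least 55296 flags. If n ≥ 8, then P has at least 48(n−2)·(n−2)! flags. -/

import Mathlib

open scoped Classical

/-- An abstract polytope of rank `n`: a partially ordered set with a unique minimal
element (of rank `-1`) and a unique maximal element (of rank `n`), all of whose
maximal chains (flags) have exactly `n + 2` elements, equipped with the induced
rank function, satisfying the diamond condition and strong connectivity. -/
structure AbstractPolytope (n : ℕ) where
  Face : Type
  [instPartialOrder : PartialOrder Face]
  rank : Face → ℤ
  bot : Face
  top : Face
  bot_le : ∀ F : Face, bot ≤ F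
  le_top : ∀ F : Face, F ≤ top
  rank_bot : rank bot = -1
  rank_top : rank top = n
  rank_strictMono : ∀ F G : Face, F < G → rank F < rank G
  flag_card : ∀ Φ : Flag Face, Nat.card Φ = n + 2
  flag_ranks : ∀ (Φ : Flag Face) (j : ℤ), -1 ≤ j → j ≤ (n : ℤ) →
    ∃ F ∈ Φ, rank F = j
  diamond : ∀ F G : Face, F < G → rank G = rank F + 2 →
    Nat.card {H : Face // F < H ∧ H < G} = 2
  strongly_connected : ∀ F G : Face, F < G → rank F + 3 ≤ rank G →
    ∀ H H' : Face, F < H → H < G → F < H' → H' < G →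
    Relation.ReflTransGen
      (fun A B : Face => F < A ∧ A < G ∧ F < B ∧ B < G ∧ (A ≤ B ∨ B ≤ A)) H H'

attribute [instance] AbstractPolytope.instPartialOrder

namespace AbstractPolytope

variable {n : ℕ} (P : AbstractPolytope n)

/-- The number of flags of `P`. -/
noncomputable def numFlags : ℕ := Nat.card (Flag P.Face)

/-- A vertex is a face of rank `0`. -/
def IsVertex (F : P.Face) : Prop := P.rank F = 0

/-- A facet is a face of rank `n - 1`. -/
def IsFacet (F : P.Face) : Prop := P.rank F = (n : ℤ) - 1

/-- The number of vertices of `P`. -/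
noncomputable def numVertices : ℕ := Nat.card {F : P.Face // P.IsVertex F}

/-- The number of facets of `P`. -/
noncomputable def numFacets : ℕ := Nat.card {F : P.Face // P.IsFacet F}

/-- Two faces are incident when they are comparable. -/
def Incident (F G : P.Face) : Prop := F ≤ G ∨ G ≤ F

/-- `P` is `(k, m)`-flat when every face of rank `k` is incident with every face of
rank `m`. -/
def IsKMFlat (k m : ℤ) : Prop :=
  ∀ F G : P.Face, P.rank F = k → P.rank G = m → P.Incident F G

/-- `P` is flat when every vertex is incident with every facet. -/
def IsFlat : Prop := P.IsKMFlat 0 ((n : ℤ) - 1)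

/-- Two flags are adjacent when they differ in exactly one element. -/
def AdjacentFlags (Φ Ψ : Flag P.Face) : Prop :=
  Φ ≠ Ψ ∧ ((Φ : Set P.Face) \ (Ψ : Set P.Face)).ncard = 1 ∧
    ((Ψ : Set P.Face) \ (Φ : Set P.Face)).ncard = 1

/-- Two flags lie in the same orbit of the automorphism group `Γ(P)` (the group of
order automorphisms of `P`). -/
def SameOrbit (Φ Ψ : Flag P.Face) : Prop :=
  ∃ f : P.Face ≃o P.Face, f '' (Φ : Set P.Face) = (Ψ : Set P.Face)

/-- `P` is regular when `Γ(P)` is transitive on flags. -/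
def IsRegular : Prop := ∀ Φ Ψ : Flag P.Face, P.SameOrbit Φ Ψ

/-- `P` is chiral when its flags fall into exactly two orbits under `Γ(P)` and
adjacent flags always lie in different orbits. -/
def IsChiral : Prop :=
  (∃ Φ₁ Φ₂ : Flag P.Face, ¬ P.SameOrbit Φ₁ Φ₂ ∧
      ∀ Φ : Flag P.Face, P.SameOrbit Φ Φ₁ ∨ P.SameOrbit Φ Φ₂) ∧
  ∀ Φ Ψ : Flag P.Face, P.AdjacentFlags Φ Ψ → ¬ P.SameOrbit Φ Ψ

/-- The polytope `Q` is (isomorphic to) the section `G/F` of `P`: there is an order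
isomorphism from `Q` onto the interval `[F, G]` of `P`, shifting ranks by
`rank F + 1`. -/
def IsSection {m : ℕ} (Q : AbstractPolytope m) (F G : P.Face) : Prop :=
  F ≤ G ∧ ∃ e : Q.Face ≃o (Set.Icc F G),
    ∀ x : Q.Face, P.rank (e x : P.Face) = Q.rank x + P.rank F + 1

/-- `P` is equivelar of Schläfli type `{p 1, …, p (n-1)}`: every section between a
face of rank `i - 2` and a face of rank `i + 1` is a polygon with exactly `p i`
vertices (i.e. it contains exactly `p i` faces of rank `i - 1`). -/
def IsSchlafli (p : ℕ → ℕ) : Prop :=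
  ∀ i : ℕ, 1 ≤ i → i ≤ n - 1 →
    ∀ F G : P.Face, F < G → P.rank F = (i : ℤ) - 2 → P.rank G = (i : ℤ) + 1 →
      Nat.card {H : P.Face // F < H ∧ H < G ∧ P.rank H = (i : ℤ) - 1} = p i

/-- `P` is tight of type `{p 1, …, p (n-1)}`: it is equivelar of that type and has
exactly `2 p₁ ⋯ p_{n-1}` flags. -/
def IsTight (p : ℕ → ℕ) : Prop :=
  P.IsSchlafli p ∧ P.numFlags = 2 * ∏ i ∈ Finset.Icc 1 (n - 1), p i

end AbstractPolytope

open scoped Classical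

namespace AbstractPolytope
variable {n : ℕ} (P : AbstractPolytope n)

theorem rank_mono {F G : P.Face} (h : F ≤ G) : P.rank F ≤ P.rank G := by
  rcases h.eq_or_lt with h | h
  · rw [h]
  · exact (P.rank_strictMono _ _ h).le

theorem rank_ge (F : P.Face) : -1 ≤ P.rank F := by
  rw [← P.rank_bot]; exact P.rank_mono (P.bot_le F)

theorem rank_le (F : P.Face) : P.rank F ≤ n := by
  rw [← P.rank_top]; exact P.rank_mono (P.le_top F)

/-- the face of a flag in position `i` (rank `i - 1`) -/
noncomputable def fc (Φ : Flag P.Face) (i : ℕ) : P.Face :=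
  if h : i ≤ n + 1 then (P.flag_ranks Φ ((i : ℤ) - 1) (by omega) (by omega)).choose else P.bot

theorem fc_mem {Φ : Flag P.Face} {i : ℕ} (h : i ≤ n + 1) : P.fc Φ i ∈ Φ := by
  unfold fc; rw [dif_pos h]
  exact (P.flag_ranks Φ ((i : ℤ) - 1) (by omega) (by omega)).choose_spec.1

theorem rank_fc {Φ : Flag P.Face} {i : ℕ} (h : i ≤ n + 1) : P.rank (P.fc Φ i) = (i : ℤ) - 1 := by
  unfold fc; rw [dif_pos h]
  exact (P.flag_ranks Φ ((i : ℤ) - 1) (by omega) (by omega)).choose_spec.2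

theorem eq_of_rank {F G : P.Face} (h : F ≤ G ∨ G ≤ F) (hr : P.rank F = P.rank G) : F = G := by
  rcases h with h | h
  · rcases h.eq_or_lt with h | h
    · exact h
    · have := P.rank_strictMono _ _ h; omega
  · rcases h.eq_or_lt with h | h
    · exact h.symm
    · have := P.rank_strictMono _ _ h; omega

theorem eq_fc {Φ : Flag P.Face} {x : P.Face} (hx : x ∈ Φ) {i : ℕ} (h : i ≤ n + 1)
    (hr : P.rank x = (i : ℤ) - 1) : x = P.fc Φ i :=
  P.eq_of_rank (Φ.le_or_le hx (P.fc_mem h)) (by rw [hr, P.rank_fc h])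

theorem mem_iff_fc {Φ : Flag P.Face} {x : P.Face} : x ∈ Φ ↔ ∃ i ≤ n + 1, x = P.fc Φ i := by
  constructor
  · intro hx
    have h1 := P.rank_ge x
    have h2 := P.rank_le x
    exact ⟨(P.rank x + 1).toNat, by omega, P.eq_fc hx (by omega) (by omega)⟩
  · rintro ⟨i, hi, rfl⟩; exact P.fc_mem hi

theorem fc_lt {Φ : Flag P.Face} {i j : ℕ} (hij : i < j) (hj : j ≤ n + 1) :
    P.fc Φ i < P.fc Φ j := by
  have h1 := P.rank_fc (Φ := Φ) (i := i) (by omega)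
  have h2 := P.rank_fc (Φ := Φ) hj
  rcases Φ.le_or_le (P.fc_mem (Φ := Φ) (i := i) (by omega)) (P.fc_mem hj) with h | h
  · rcases h.eq_or_lt with h | h
    · rw [h] at h1; omega
    · exact h
  · have := P.rank_mono h; omega

theorem fc_le {Φ : Flag P.Face} {i j : ℕ} (hij : i ≤ j) (hj : j ≤ n + 1) :
    P.fc Φ i ≤ P.fc Φ j := by
  rcases hij.eq_or_lt with h | h
  · rw [h]
  · exact (P.fc_lt h hj).le

theorem flag_ext {Φ Ψ : Flag P.Face} (h : ∀ i ≤ n + 1, P.fc Φ i = P.fc Ψ i) : Φ = Ψ := by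
  apply Flag.ext
  ext x
  show x ∈ Φ ↔ x ∈ Ψ
  rw [P.mem_iff_fc, P.mem_iff_fc]
  constructor
  · rintro ⟨i, hi, rfl⟩; exact ⟨i, hi, h i hi⟩
  · rintro ⟨i, hi, rfl⟩; exact ⟨i, hi, (h i hi).symm⟩

theorem fc_zero (Φ : Flag P.Face) : P.fc Φ 0 = P.bot :=
  P.eq_of_rank (Or.inr (P.bot_le _)) (by rw [P.rank_fc (by omega), P.rank_bot]; norm_num)

theorem fc_top (Φ : Flag P.Face) : P.fc Φ (n+1) = P.top :=
  P.eq_of_rank (Or.inl (P.le_top _)) (by rw [P.rank_fc (by omega), P.rank_top]; push_cast; ring)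

theorem seq_lt {g : ℕ → P.Face} (hlt : ∀ i ≤ n, g i < g (i+1)) :
    ∀ j ≤ n + 1, ∀ i < j, g i < g j := by
  intro j
  induction j with
  | zero => intro _ i hi; omega
  | succ j ih =>
    intro hj i hi
    rcases (Nat.lt_succ_iff.mp hi).eq_or_lt with h | h
    · rw [h]; exact hlt j (by omega)
    · exact (ih (by omega) i h).trans (hlt j (by omega))

theorem exists_mk (g : ℕ → P.Face) (hlt : ∀ i ≤ n, g i < g (i+1))
    (hr : ∀ i ≤ n + 1, P.rank (g i) = (i : ℤ) - 1) :
    ∃ Φ : Flag P.Face, ∀ i ≤ n + 1, P.fc Φ i = g i := by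
  have hl := P.seq_lt hlt
  have hch : IsChain (· ≤ ·) (g '' {i | i ≤ n + 1}) := by
    rintro _ ⟨i, hi, rfl⟩ _ ⟨j, hj, rfl⟩ _
    rcases lt_trichotomy i j with h | h | h
    · exact Or.inl (hl j hj i h).le
    · exact Or.inl (h ▸ le_rfl)
    · exact Or.inr (hl i hi j h).le
  obtain ⟨M, hM, hsub⟩ := hch.exists_maxChain
  refine ⟨Flag.ofIsMaxChain M hM, fun i hi => ?_⟩
  exact (P.eq_fc (show g i ∈ M from hsub ⟨i, hi, rfl⟩) hi (hr i hi)).symm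

/-- extend a chain to a flag -/
theorem exists_flag_of_chain {c : Set P.Face} (hc : IsChain (· ≤ ·) c) :
    ∃ Φ : Flag P.Face, ∀ x ∈ c, x ∈ Φ := by
  obtain ⟨M, hM, hsub⟩ := hc.exists_maxChain
  exact ⟨Flag.ofIsMaxChain M hM, fun x hx => hsub hx⟩

theorem exists_adj (Φ : Flag P.Face) {i : ℕ} (hi : i < n) :
    ∃ Ψ : Flag P.Face, P.fc Ψ (i+1) ≠ P.fc Φ (i+1) ∧
      ∀ j ≤ n + 1, j ≠ i + 1 → P.fc Ψ j = P.fc Φ j := by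
  have hd := P.diamond (P.fc Φ i) (P.fc Φ (i+2)) (P.fc_lt (by omega) (by omega))
    (by rw [P.rank_fc (by omega), P.rank_fc (by omega)]; push_cast; ring)
  rw [Nat.card_eq_two_iff'
    (⟨P.fc Φ (i+1), P.fc_lt (by omega) (by omega), P.fc_lt (by omega) (by omega)⟩ :
      {H : P.Face // P.fc Φ i < H ∧ H < P.fc Φ (i+2)})] at hd
  obtain ⟨⟨H, h1, h2⟩, hne, -⟩ := hd
  have hne' : H ≠ P.fc Φ (i+1) := fun h => hne (Subtype.ext h)
  have r1 := P.rank_strictMono _ _ h1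
  have r2 := P.rank_strictMono _ _ h2
  rw [P.rank_fc (by omega)] at r1 r2
  obtain ⟨Ψ, hΨ⟩ := P.exists_mk (fun j => if j = i + 1 then H else P.fc Φ j) (by
    intro j hj
    by_cases e1 : j = i + 1
    · subst e1; simpa using h2
    · by_cases e2 : j = i
      · subst e2; simpa using h1
      · simp [e1, e2]; exact P.fc_lt (by omega) (by omega)) (by
    intro j hj
    by_cases e1 : j = i + 1
    · subst e1; simp; push_cast at r1 r2; omega
    · simp [e1]; exact P.rank_fc hj)
  refine ⟨Ψ, ?_, fun j hj hne => ?_⟩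
  · rw [hΨ _ (by omega)]; simpa using hne'
  · rw [hΨ _ hj]; simp [hne]

theorem adj_unique {Φ Ψ Ψ' : Flag P.Face} {i : ℕ} (hi : i < n)
    (h1 : P.fc Ψ (i+1) ≠ P.fc Φ (i+1)) (h2 : ∀ j ≤ n + 1, j ≠ i + 1 → P.fc Ψ j = P.fc Φ j)
    (h1' : P.fc Ψ' (i+1) ≠ P.fc Φ (i+1)) (h2' : ∀ j ≤ n + 1, j ≠ i + 1 → P.fc Ψ' j = P.fc Φ j) :
    Ψ = Ψ' := by
  have hd := P.diamond (P.fc Φ i) (P.fc Φ (i+2)) (P.fc_lt (by omega) (by omega))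
    (by rw [P.rank_fc (by omega), P.rank_fc (by omega)]; push_cast; ring)
  rw [Nat.card_eq_two_iff'
    (⟨P.fc Φ (i+1), P.fc_lt (by omega) (by omega), P.fc_lt (by omega) (by omega)⟩ :
      {H : P.Face // P.fc Φ i < H ∧ H < P.fc Φ (i+2)})] at hd
  have key := hd.unique
    (y₁ := ⟨P.fc Ψ (i+1), by
      rw [← h2 i (by omega) (by omega), ← h2 (i+2) (by omega) (by omega)]
      exact ⟨P.fc_lt (by omega) (by omega), P.fc_lt (by omega) (by omega)⟩⟩)
    (y₂ := ⟨P.fc Ψ' (i+1), by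
      rw [← h2' i (by omega) (by omega), ← h2' (i+2) (by omega) (by omega)]
      exact ⟨P.fc_lt (by omega) (by omega), P.fc_lt (by omega) (by omega)⟩⟩)
    (fun h => h1 (congrArg Subtype.val h)) (fun h => h1' (congrArg Subtype.val h))
  have key' : P.fc Ψ (i+1) = P.fc Ψ' (i+1) := congrArg Subtype.val key
  apply P.flag_ext
  intro j hj
  by_cases e : j = i + 1
  · rw [e, key']
  · rw [h2 j hj e, h2' j hj e]

/-- the `i`-adjacent flag -/
noncomputable def adj (i : ℕ) (Φ : Flag P.Face) : Flag P.Face :=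
  if h : i < n then (P.exists_adj Φ h).choose else Φ

theorem adj_ne {i : ℕ} (hi : i < n) (Φ : Flag P.Face) :
    P.fc (P.adj i Φ) (i+1) ≠ P.fc Φ (i+1) := by
  unfold adj; rw [dif_pos hi]; exact (P.exists_adj Φ hi).choose_spec.1

theorem adj_fc {i : ℕ} (Φ : Flag P.Face) {j : ℕ} (hj : j ≤ n + 1) (h : j ≠ i + 1) :
    P.fc (P.adj i Φ) j = P.fc Φ j := by
  unfold adj
  split_ifs with hi
  · exact (P.exists_adj Φ hi).choose_spec.2 j hj h
  · rfl

theorem adj_eq {i : ℕ} (hi : i < n) {Φ Ψ : Flag P.Face}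
    (h1 : P.fc Ψ (i+1) ≠ P.fc Φ (i+1)) (h2 : ∀ j ≤ n + 1, j ≠ i + 1 → P.fc Ψ j = P.fc Φ j) :
    P.adj i Φ = Ψ :=
  P.adj_unique hi (P.adj_ne hi Φ) (fun _ hj h => P.adj_fc Φ hj h) h1 h2

theorem adj_adj (i : ℕ) (Φ : Flag P.Face) : P.adj i (P.adj i Φ) = Φ := by
  by_cases hi : i < n
  · exact P.adj_eq hi (P.adj_ne hi Φ).symm (fun j hj h => (P.adj_fc Φ hj h).symm)
  · unfold adj; simp [hi]

/-- the monodromy generators -/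
noncomputable def mon (i : ℕ) : Equiv.Perm (Flag P.Face) :=
  ⟨P.adj i, P.adj i, P.adj_adj i, P.adj_adj i⟩

theorem mon_apply (i : ℕ) (Φ : Flag P.Face) : P.mon i Φ = P.adj i Φ := rfl

theorem adj_pos {i : ℕ} (hi : i < n) {Φ Ψ : Flag P.Face} (h0 : P.fc Φ i = P.fc Ψ i)
    (h1 : P.fc Φ (i+1) = P.fc Ψ (i+1)) (h2 : P.fc Φ (i+2) = P.fc Ψ (i+2)) :
    P.fc (P.adj i Φ) (i+1) = P.fc (P.adj i Ψ) (i+1) := by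
  have hd := P.diamond (P.fc Φ i) (P.fc Φ (i+2)) (P.fc_lt (by omega) (by omega))
    (by rw [P.rank_fc (by omega), P.rank_fc (by omega)]; push_cast; ring)
  rw [Nat.card_eq_two_iff'
    (⟨P.fc Φ (i+1), P.fc_lt (by omega) (by omega), P.fc_lt (by omega) (by omega)⟩ :
      {H : P.Face // P.fc Φ i < H ∧ H < P.fc Φ (i+2)})] at hd
  have key := hd.unique
    (y₁ := ⟨P.fc (P.adj i Φ) (i+1), by
      rw [← P.adj_fc (i := i) Φ (j := i) (by omega) (by omega),
        ← P.adj_fc (i := i) Φ (j := i+2) (by omega) (by omega)]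
      exact ⟨P.fc_lt (by omega) (by omega), P.fc_lt (by omega) (by omega)⟩⟩)
    (y₂ := ⟨P.fc (P.adj i Ψ) (i+1), by
      rw [h0, h2, ← P.adj_fc (i := i) Ψ (j := i) (by omega) (by omega),
        ← P.adj_fc (i := i) Ψ (j := i+2) (by omega) (by omega)]
      exact ⟨P.fc_lt (by omega) (by omega), P.fc_lt (by omega) (by omega)⟩⟩)
    (fun h => P.adj_ne hi Φ (congrArg Subtype.val h))
    (fun h => P.adj_ne hi Ψ ((congrArg Subtype.val h).trans h1))
  exact congrArg Subtype.val key

theorem adj_comm {i j : ℕ} (hij : i + 1 < j) (hj : j < n) (Φ : Flag P.Face) :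
    P.adj i (P.adj j Φ) = P.adj j (P.adj i Φ) := by
  apply P.flag_ext
  intro k hk
  by_cases e : k = i + 1
  · subst e
    rw [P.adj_fc (i := j) _ hk (by omega)]
    apply P.adj_pos (by omega) <;> exact P.adj_fc _ (by omega) (by omega)
  · by_cases e' : k = j + 1
    · subst e'
      rw [P.adj_fc (i := i) _ hk (by omega)]
      apply P.adj_pos (by omega) <;> exact (P.adj_fc _ (by omega) (by omega)).symm
    · rw [P.adj_fc _ hk e, P.adj_fc _ hk e', P.adj_fc _ hk e', P.adj_fc _ hk e]

/-- the group generated by the generators with index in `[a, b)` -/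
def WW {Ω : Type} (r : ℕ → Equiv.Perm Ω) (a b : ℕ) : Subgroup (Equiv.Perm Ω) :=
  Subgroup.closure {g | ∃ i, a ≤ i ∧ i < b ∧ g = r i}

theorem WW_mono {Ω : Type} {r : ℕ → Equiv.Perm Ω} {a b c d : ℕ} (h : ∀ i, a ≤ i → i < b → c ≤ i ∧ i < d) :
    WW r a b ≤ WW r c d := by
  apply Subgroup.closure_mono
  rintro g ⟨i, h1, h2, rfl⟩
  exact ⟨i, (h i h1 h2).1, (h i h1 h2).2, rfl⟩

theorem mem_WW {Ω : Type} {r : ℕ → Equiv.Perm Ω} {a b i : ℕ} (h1 : a ≤ i) (h2 : i < b) :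
    r i ∈ WW r a b := Subgroup.subset_closure ⟨i, h1, h2, rfl⟩

/-- agreeing outside `[a,b)` -/
def Agree (a b : ℕ) (Φ Ψ : Flag P.Face) : Prop :=
  ∀ j < n, (j < a ∨ b ≤ j) → P.fc Φ (j+1) = P.fc Ψ (j+1)

theorem Agree.pos {P : AbstractPolytope n} {a b : ℕ} {Φ Ψ : Flag P.Face} (h : P.Agree a b Φ Ψ) {i : ℕ}
    (hi : i ≤ n + 1) (hh : i < a + 1 ∨ b < i) : P.fc Φ i = P.fc Ψ i := by
  rcases Nat.eq_zero_or_pos i with rfl | h0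
  · rw [P.fc_zero, P.fc_zero]
  · obtain ⟨j, rfl⟩ := Nat.exists_eq_succ_of_ne_zero h0.ne'
    by_cases hj : j = n
    · subst hj; rw [P.fc_top, P.fc_top]
    · exact h j (by omega) (by omega)

theorem exists_mix {Φ Ψ : Flag P.Face} {c : ℕ} (hc : c ≤ n + 1) (h : P.fc Φ c = P.fc Ψ c) :
    ∃ Θ : Flag P.Face, (∀ i ≤ c, P.fc Θ i = P.fc Φ i) ∧
      (∀ i ≤ n + 1, c ≤ i → P.fc Θ i = P.fc Ψ i) := by
  obtain ⟨Θ, hΘ⟩ := P.exists_mk (fun i => if i ≤ c then P.fc Φ i else P.fc Ψ i) (by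
    intro i hi
    by_cases h1 : i + 1 ≤ c
    · simp only [h1, show i ≤ c by omega, if_true]; exact P.fc_lt (by omega) (by omega)
    · by_cases h2 : i = c
      · subst h2; simp [h]; exact P.fc_lt (by omega) (by omega)
      · simp only [h1, show ¬ i ≤ c by omega, if_false]; exact P.fc_lt (by omega) (by omega)) (by
    intro i hi
    split_ifs
    · exact P.rank_fc hi
    · exact P.rank_fc hi)
  refine ⟨Θ, fun i hi => ?_, fun i hi hci => ?_⟩
  · rw [hΘ i (by omega)]; simp [hi]
  · rw [hΘ i hi]
    by_cases e : i ≤ c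
    · have : i = c := by omega
      subst this; simp [h]
    · simp [e]

theorem exists_ext (Φ : Flag P.Face) {a b : ℕ} (hab : a ≤ b) (hb : b ≤ n) {A B : P.Face}
    (hA1 : P.fc Φ a ≤ A) (hA2 : A ≤ P.fc Φ (b+1)) (hB1 : P.fc Φ a ≤ B)
    (hB2 : B ≤ P.fc Φ (b+1)) (hAB : A ≤ B ∨ B ≤ A) :
    ∃ Θ : Flag P.Face, P.Agree a b Φ Θ ∧ A ∈ Θ ∧ B ∈ Θ := by
  have hch : IsChain (· ≤ ·)
      ((P.fc Φ '' {i | i ≤ n + 1 ∧ (i ≤ a ∨ b + 1 ≤ i)}) ∪ {A, B}) := by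
    have key : ∀ X : P.Face, P.fc Φ a ≤ X → X ≤ P.fc Φ (b+1) → ∀ i ≤ n + 1, (i ≤ a ∨ b + 1 ≤ i) →
        P.fc Φ i ≤ X ∨ X ≤ P.fc Φ i := by
      intro X h1 h2 i hi hh
      rcases hh with hh | hh
      · exact Or.inl ((P.fc_le hh (by omega)).trans h1)
      · exact Or.inr (h2.trans (P.fc_le hh hi))
    rintro x hx y hy _
    rcases hx with ⟨i, ⟨hi, hi'⟩, rfl⟩ | hx
    · rcases hy with ⟨j, ⟨hj, hj'⟩, rfl⟩ | hy
      · exact Φ.le_or_le (P.fc_mem hi) (P.fc_mem hj)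
      · rcases hy with rfl | rfl
        · exact key _ hA1 hA2 i hi hi'
        · exact key _ hB1 hB2 i hi hi'
    · rcases hy with ⟨j, ⟨hj, hj'⟩, rfl⟩ | hy
      · rcases hx with rfl | rfl
        · exact (key _ hA1 hA2 j hj hj').symm
        · exact (key _ hB1 hB2 j hj hj').symm
      · rcases hx with rfl | rfl <;> rcases hy with rfl | rfl
        · exact Or.inl le_rfl
        · exact hAB
        · exact hAB.symm
        · exact Or.inl le_rfl
  obtain ⟨Θ, hΘ⟩ := P.exists_flag_of_chain hch
  refine ⟨Θ, ?_, hΘ _ (Or.inr (Or.inl rfl)), hΘ _ (Or.inr (Or.inr rfl))⟩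
  intro j hj hh
  exact P.eq_fc (hΘ _ (Or.inl ⟨j+1, ⟨by omega, by omega⟩, rfl⟩)) (by omega) (P.rank_fc (by omega))

theorem Agree.symm {P : AbstractPolytope n} {a b : ℕ} {Φ Ψ : Flag P.Face} (h : P.Agree a b Φ Ψ) :
    P.Agree a b Ψ Φ := fun j hj hh => (h j hj hh).symm

theorem Agree.trans {P : AbstractPolytope n} {a b : ℕ} {Φ Ψ Θ : Flag P.Face} (h : P.Agree a b Φ Ψ)
    (h' : P.Agree a b Ψ Θ) : P.Agree a b Φ Θ := fun j hj hh => (h j hj hh).trans (h' j hj hh)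

theorem conn_mix {a b c : ℕ} (hac : a ≤ c) (hcb : c < b) (hb : b ≤ n)
    {Φ Ψ : Flag P.Face} (h : P.Agree a b Φ Ψ) (hc : P.fc Φ (c+1) = P.fc Ψ (c+1)) :
    ∃ Θ, P.Agree (c+1) b Φ Θ ∧ P.Agree a c Θ Ψ := by
  obtain ⟨Θ, h1, h2⟩ := P.exists_mix (by omega) hc
  refine ⟨Θ, fun j hj hh => ?_, fun j hj hh => ?_⟩
  · rcases hh with hh | hh
    · exact (h1 _ (by omega)).symm
    · rw [h2 _ (by omega) (by omega), h.pos (by omega) (by omega)]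
  · rcases hh with hh | hh
    · rw [h1 _ (by omega), h.pos (by omega) (by omega)]
    · rw [h2 _ (by omega) (by omega)]

theorem conn : ∀ (d a b : ℕ), b = a + d → b ≤ n → ∀ Φ Ψ : Flag P.Face, P.Agree a b Φ Ψ →
    ∃ w ∈ WW P.mon a b, w Φ = Ψ := by
  intro d
  induction d using Nat.strong_induction_on with
  | _ d ih =>
  intro a b hd hb Φ Ψ hag
  have share : ∀ Φ Ψ : Flag P.Face, P.Agree a b Φ Ψ → ∀ c, a ≤ c → c < b →
      P.fc Φ (c+1) = P.fc Ψ (c+1) → ∃ w ∈ WW P.mon a b, w Φ = Ψ := by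
    intro Φ Ψ hag c hac hcb hc
    obtain ⟨Θ, h1, h2⟩ := P.conn_mix hac hcb hb hag hc
    obtain ⟨w1, hw1, e1⟩ := ih (b - (c+1)) (by omega) (c+1) b (by omega) hb _ _ h1
    obtain ⟨w2, hw2, e2⟩ := ih (c - a) (by omega) a c (by omega) (by omega) _ _ h2
    refine ⟨w2 * w1, mul_mem (WW_mono (by omega) hw2) (WW_mono (by omega) hw1), ?_⟩
    rw [Equiv.Perm.mul_apply, e1, e2]
  rcases Nat.lt_or_ge d 2 with hd2 | hd2
  · interval_cases d
    · refine ⟨1, one_mem _, ?_⟩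
      exact P.flag_ext fun i hi => hag.pos hi (by omega)
    · by_cases e : P.fc Ψ (a+1) = P.fc Φ (a+1)
      · refine ⟨1, one_mem _, ?_⟩
        apply P.flag_ext fun i hi => ?_
        by_cases hi' : i = a + 1
        · rw [hi']; exact e.symm
        · exact hag.pos hi (by omega)
      · exact ⟨P.mon a, mem_WW le_rfl (by omega), P.adj_eq (by omega) e
          fun j hj hh => (hag.pos hj (by omega)).symm⟩
  · have hc := P.strongly_connected (P.fc Φ a) (P.fc Φ (b+1)) (P.fc_lt (by omega) (by omega))
      (by rw [P.rank_fc (by omega), P.rank_fc (by omega)]; push_cast; omega)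
      (P.fc Φ (a+1)) (P.fc Ψ (a+1)) (P.fc_lt (by omega) (by omega)) (P.fc_lt (by omega) (by omega))
      (by rw [hag.pos (i := a) (by omega) (by omega)]; exact P.fc_lt (by omega) (by omega))
      (by rw [hag.pos (i := b+1) (by omega) (by omega)]; exact P.fc_lt (by omega) (by omega))
    have key : ∀ X, Relation.ReflTransGen
        (fun A B : P.Face => P.fc Φ a < A ∧ A < P.fc Φ (b+1) ∧ P.fc Φ a < B ∧ B < P.fc Φ (b+1) ∧
          (A ≤ B ∨ B ≤ A)) (P.fc Φ (a+1)) X →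
        (P.fc Φ a < X ∧ X < P.fc Φ (b+1)) ∧
        ∀ Ψ, P.Agree a b Φ Ψ → X ∈ Ψ → ∃ w ∈ WW P.mon a b, w Φ = Ψ := by
      intro X hX
      have pos : ∀ X, P.fc Φ a < X → X < P.fc Φ (b+1) →
          ∃ c, a ≤ c ∧ c < b ∧ P.rank X = ((c+1 : ℕ) : ℤ) - 1 := by
        intro X h1 h2
        have r1 := P.rank_strictMono _ _ h1
        have r2 := P.rank_strictMono _ _ h2
        rw [P.rank_fc (by omega)] at r1 r2
        push_cast at r2
        exact ⟨(P.rank X).toNat, by omega, by omega, by push_cast; omega⟩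
      induction hX with
      | refl =>
        refine ⟨⟨P.fc_lt (by omega) (by omega), P.fc_lt (by omega) (by omega)⟩, ?_⟩
        intro Ψ h1 h2
        exact share Φ Ψ h1 a le_rfl (by omega) (P.eq_fc h2 (by omega) (P.rank_fc (by omega)))
      | tail hX' hs ihX =>
        rename_i A B
        refine ⟨⟨hs.2.2.1, hs.2.2.2.1⟩, ?_⟩
        intro Ψ h1 h2
        obtain ⟨Θ, t1, t2, t3⟩ := P.exists_ext Φ (show a ≤ b by omega) hb hs.1.le hs.2.1.le
          hs.2.2.1.le hs.2.2.2.1.le hs.2.2.2.2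
        obtain ⟨w, hw, ew⟩ := ihX.2 Θ t1 t2
        obtain ⟨c, c1, c2, c3⟩ := pos B hs.2.2.1 hs.2.2.2.1
        obtain ⟨w', hw', ew'⟩ := share Θ Ψ (t1.symm.trans h1) c c1 c2
          ((P.eq_fc t3 (by omega) c3).symm.trans (P.eq_fc h2 (by omega) c3))
        exact ⟨w' * w, mul_mem hw' hw, by rw [Equiv.Perm.mul_apply, ew, ew']⟩
    exact (key _ hc).2 Ψ hag (P.fc_mem (by omega))

end AbstractPolytope

open scoped Classical

/-- Combinatorial data extracted from a chiral polytope with chiral facets and vertex-figures. -/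
structure Sys (n : ℕ) (Ω : Type) where
  r : ℕ → Equiv.Perm Ω
  T : Type
  f : ℕ → Ω → T
  χ : Ω → Prop
  r_sq : ∀ i Φ, r i (r i Φ) = Φ
  f_r : ∀ i j Φ, j ≠ i → f j (r i Φ) = f j Φ
  f_r_self : ∀ i Φ, i < n → f i (r i Φ) ≠ f i Φ
  comm : ∀ i j Φ, i + 1 < j → j < n → r i (r j Φ) = r j (r i Φ)
  conn : ∀ a b Φ Ψ, a ≤ b → b ≤ n → (∀ j < n, (j < a ∨ b ≤ j) → f j Φ = f j Ψ) →
    ∃ w ∈ AbstractPolytope.WW r a b, w Φ = Ψ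
  χ_r : ∀ i Φ, i < n → (χ (r i Φ) ↔ ¬ χ Φ)
  aut : ∀ Φ Ψ, (χ Φ ↔ χ Ψ) → ∃ g : Equiv.Perm Ω, g Φ = Ψ ∧ ∀ i < n, ∀ Θ, g (r i Θ) = r i (g Θ)
  nf1 : ¬ ∀ w ∈ AbstractPolytope.WW r 0 (n-1), ∀ Φ, w Φ = Φ → w = 1
  nf2 : ¬ ∀ w ∈ AbstractPolytope.WW r 1 n, ∀ Φ, w Φ = Φ → w = 1

namespace AbstractPolytope
variable {n : ℕ} (P : AbstractPolytope n)

theorem mem_fcs {Φ : Flag P.Face} {i : ℕ} (h : i ≤ n + 1) : P.fc Φ i ∈ (Φ : Set P.Face) :=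
  P.fc_mem h

theorem fc_inj {Φ : Flag P.Face} {i j : ℕ} (hi : i ≤ n + 1) (hj : j ≤ n + 1)
    (h : P.fc Φ i = P.fc Φ j) : i = j := by
  have h1 := P.rank_fc (Φ := Φ) hi
  have h2 := P.rank_fc (Φ := Φ) hj
  rw [h] at h1; omega

theorem diff_adj {i : ℕ} (hi : i < n) (Φ : Flag P.Face) :
    ((Φ : Set P.Face) \ (P.adj i Φ : Set P.Face)) = {P.fc Φ (i+1)} := by
  ext x
  simp only [Set.mem_sdiff, Set.mem_singleton_iff, SetLike.mem_coe]
  constructor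
  · rintro ⟨h1, h2⟩
    obtain ⟨j, hj, rfl⟩ := P.mem_iff_fc.1 h1
    by_cases e : j = i + 1
    · rw [e]
    · exact absurd (P.mem_iff_fc.2 ⟨j, hj, (P.adj_fc Φ hj e).symm⟩) h2
  · rintro rfl
    refine ⟨P.fc_mem (by omega), fun h => ?_⟩
    exact P.adj_ne hi Φ (P.eq_fc h (by omega) (P.rank_fc (by omega))).symm

theorem adjacent_adj {i : ℕ} (hi : i < n) (Φ : Flag P.Face) :
    P.AdjacentFlags Φ (P.adj i Φ) := by
  refine ⟨fun h => P.adj_ne hi Φ (by rw [← h]), ?_, ?_⟩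
  · rw [P.diff_adj hi]; exact Set.ncard_singleton _
  · have := P.diff_adj hi (P.adj i Φ)
    rw [P.adj_adj] at this
    rw [this]; exact Set.ncard_singleton _

theorem SameOrbit.refl (Φ : Flag P.Face) : P.SameOrbit Φ Φ := ⟨OrderIso.refl _, by simp⟩

theorem SameOrbit.symm {P : AbstractPolytope n} {Φ Ψ : Flag P.Face} (h : P.SameOrbit Φ Ψ) :
    P.SameOrbit Ψ Φ := by
  obtain ⟨e, he⟩ := h
  refine ⟨e.symm, ?_⟩
  rw [← he, ← Set.image_comp]
  simp

theorem SameOrbit.trans {P : AbstractPolytope n} {Φ Ψ Θ : Flag P.Face} (h : P.SameOrbit Φ Ψ)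
    (h' : P.SameOrbit Ψ Θ) : P.SameOrbit Φ Θ := by
  obtain ⟨e, he⟩ := h
  obtain ⟨e', he'⟩ := h'
  refine ⟨e.trans e', ?_⟩
  rw [← he', ← he, ← Set.image_comp]
  rfl

theorem rank_aut (e : P.Face ≃o P.Face) (x : P.Face) : P.rank (e x) = P.rank x := by
  obtain ⟨Φ, hΦ⟩ := P.exists_flag_of_chain (c := {x}) (by simp [IsChain])
  obtain ⟨i, hi, rfl⟩ := P.mem_iff_fc.1 (hΦ x rfl)
  have key : ∀ i ≤ n + 1, P.rank (e (P.fc Φ i)) ≥ (i : ℤ) - 1 := by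
    intro i
    induction i with
    | zero => intro _; have := P.rank_ge (e (P.fc Φ 0)); simpa using this
    | succ i ih =>
      intro hi
      have h1 := ih (by omega)
      have h2 := P.rank_strictMono _ _ (e.strictMono (P.fc_lt (Φ := Φ) (i := i) (j := i+1) (by omega) hi))
      push_cast; omega
  have key2 : ∀ d ≤ n + 1, P.rank (e (P.fc Φ (n + 1 - d))) ≤ (n : ℤ) - d := by
    intro d
    induction d with
    | zero => intro _; have := P.rank_le (e (P.fc Φ (n+1))); simpa using this
    | succ i ih =>
      intro hi
      have h1 := ih (by omega)
      have h2 := P.rank_strictMono _ _ (e.strictMono (P.fc_lt (Φ := Φ) (i := n+1-(i+1))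
        (j := n+1-i) (by omega) (by omega)))
      rw [Nat.cast_succ]; omega
  have h1 := key i hi
  have h2 := key2 (n+1-i) (by omega)
  rw [show n + 1 - (n + 1 - i) = i by omega] at h2
  rw [P.rank_fc hi]
  push_cast [Nat.cast_sub hi] at h2
  omega

theorem fc_map (e : P.Face ≃o P.Face) (Φ : Flag P.Face) {i : ℕ} (hi : i ≤ n + 1) :
    P.fc (Flag.map e Φ) i = e (P.fc Φ i) := by
  symm
  apply P.eq_fc _ hi
  · rw [P.rank_aut, P.rank_fc hi]
  · exact ⟨_, P.fc_mem hi, rfl⟩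

theorem map_adj (e : P.Face ≃o P.Face) {i : ℕ} (hi : i < n) (Φ : Flag P.Face) :
    Flag.map e (P.adj i Φ) = P.adj i (Flag.map e Φ) := by
  symm
  apply P.adj_eq hi
  · rw [P.fc_map _ _ (by omega), P.fc_map _ _ (by omega)]
    exact fun h => P.adj_ne hi Φ (e.injective h)
  · intro j hj hne
    rw [P.fc_map _ _ hj, P.fc_map _ _ hj, P.adj_fc _ hj hne]

theorem aut_of_sameOrbit {Φ Ψ : Flag P.Face} (h : P.SameOrbit Φ Ψ) :
    ∃ g : Equiv.Perm (Flag P.Face), g Φ = Ψ ∧ ∀ i < n, ∀ Θ, g (P.mon i Θ) = P.mon i (g Θ) := by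
  obtain ⟨e, he⟩ := h
  refine ⟨Flag.map e, ?_, fun i hi Θ => P.map_adj e hi Θ⟩
  apply Flag.ext
  exact he

/-- The section between two faces as a polytope. -/
noncomputable def sect (F G : P.Face) (hFG : F ≤ G) (m : ℕ) (hm : P.rank G = P.rank F + 1 + m) :
    AbstractPolytope m where
  Face := Set.Icc F G
  rank x := P.rank x - P.rank F - 1
  bot := ⟨F, le_rfl, hFG⟩
  top := ⟨G, hFG, le_rfl⟩
  bot_le x := x.2.1
  le_top x := x.2.2
  rank_bot := by simp
  rank_top := by rw [hm]; ring
  rank_strictMono x y h := by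
    have := P.rank_strictMono _ _ (show (x : P.Face) < y from h)
    omega
  flag_card Φ := by
    have hcov : ∀ j : ℤ, P.rank F ≤ j → j ≤ P.rank G → ∃ x ∈ Φ, P.rank (x : P.Face) = j := by
      intro j h1 h2
      obtain ⟨Θ, hΘ⟩ := P.exists_flag_of_chain (c := Subtype.val '' (Φ : Set (Set.Icc F G)) ∪ {F, G}) (by
        have key : ∀ z : P.Face, F ≤ z → z ≤ G → ∀ y ∈ ({F, G} : Set P.Face), z ≤ y ∨ y ≤ z := by
          rintro z h1 h2 y (rfl | rfl)
          · exact Or.inr h1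
          · exact Or.inl h2
        rintro x hx y hy _
        rcases hx with ⟨x, hx, rfl⟩ | hx
        · rcases hy with ⟨y, hy, rfl⟩ | hy
          · exact Φ.le_or_le hx hy
          · exact key _ x.2.1 x.2.2 _ hy
        · rcases hy with ⟨y, hy, rfl⟩ | hy
          · exact (key _ y.2.1 y.2.2 _ hx).symm
          · rcases hx with rfl | rfl
            · exact key _ le_rfl hFG _ hy
            · exact key _ hFG le_rfl _ hy)
      have g1 := P.rank_ge F
      have g2 := P.rank_le G
      obtain ⟨x, hx, hxr⟩ := P.flag_ranks Θ j (by omega) (by omega)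
      have hFx : F ≤ x := by
        rcases Θ.le_or_le (hΘ F (by simp)) hx with h | h
        · exact h
        · rw [P.eq_of_rank (Or.inl h) (by have := P.rank_mono h; omega)]
      have hxG : x ≤ G := by
        rcases Θ.le_or_le (hΘ G (by simp)) hx with h | h
        · rw [P.eq_of_rank (Or.inl h) (by have := P.rank_mono h; omega)]
        · exact h
      refine ⟨⟨x, hFx, hxG⟩, ?_, hxr⟩
      rw [Flag.mem_iff_forall_le_or_ge]
      intro y hy
      exact Θ.le_or_le hx (hΘ y (Or.inl ⟨y, hy, rfl⟩))
    have : Nat.card Φ = Nat.card (Fin (m+2)) := by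
      apply Nat.card_congr
      refine Equiv.ofBijective (fun x => (⟨(P.rank (x.1 : P.Face) - P.rank F).toNat, by
        have a := P.rank_mono x.1.2.1
        have b := P.rank_mono x.1.2.2
        omega⟩ : Fin (m+2))) ⟨?_, ?_⟩
      · intro x y hxy
        have := congrArg Fin.val hxy
        dsimp at this
        have a := P.rank_mono x.1.2.1
        have b := P.rank_mono y.1.2.1
        apply Subtype.ext; apply Subtype.ext
        exact P.eq_of_rank (Φ.le_or_le x.2 y.2) (by omega)
      · intro j
        obtain ⟨x, hx, hxr⟩ := hcov (P.rank F + j) (by omega) (by have := j.2; omega)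
        refine ⟨⟨x, hx⟩, ?_⟩
        apply Fin.ext
        dsimp
        omega
    rw [this]; simp
  flag_ranks Φ := by
    intro j h1 h2
    obtain ⟨Θ, hΘ⟩ := P.exists_flag_of_chain (c := Subtype.val '' (Φ : Set (Set.Icc F G)) ∪ {F, G}) (by
      have key : ∀ z : P.Face, F ≤ z → z ≤ G → ∀ y ∈ ({F, G} : Set P.Face), z ≤ y ∨ y ≤ z := by
        rintro z h1 h2 y (rfl | rfl)
        · exact Or.inr h1
        · exact Or.inl h2
      rintro x hx y hy _
      rcases hx with ⟨x, hx, rfl⟩ | hx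
      · rcases hy with ⟨y, hy, rfl⟩ | hy
        · exact Φ.le_or_le hx hy
        · exact key _ x.2.1 x.2.2 _ hy
      · rcases hy with ⟨y, hy, rfl⟩ | hy
        · exact (key _ y.2.1 y.2.2 _ hx).symm
        · rcases hx with rfl | rfl
          · exact key _ le_rfl hFG _ hy
          · exact key _ hFG le_rfl _ hy)
    have g1 := P.rank_ge F
    have g2 := P.rank_le G
    obtain ⟨x, hx, hxr⟩ := P.flag_ranks Θ (j + P.rank F + 1) (by omega) (by omega)
    have hFx : F ≤ x := by
      rcases Θ.le_or_le (hΘ F (by simp)) hx with h | h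
      · exact h
      · rw [P.eq_of_rank (Or.inl h) (by have := P.rank_mono h; omega)]
    have hxG : x ≤ G := by
      rcases Θ.le_or_le (hΘ G (by simp)) hx with h | h
      · rw [P.eq_of_rank (Or.inl h) (by have := P.rank_mono h; omega)]
      · exact h
    refine ⟨⟨x, hFx, hxG⟩, ?_, by simp [hxr]; ring⟩
    rw [Flag.mem_iff_forall_le_or_ge]
    intro y hy
    exact Θ.le_or_le hx (hΘ y (Or.inl ⟨y, hy, rfl⟩))
  diamond x y hxy hr := by
    rw [← P.diamond x y hxy (by omega)]
    apply Nat.card_congr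
    exact ⟨fun z => ⟨z.1.1, z.2⟩, fun z => ⟨⟨z.1, x.2.1.trans z.2.1.le, z.2.2.le.trans y.2.2⟩, z.2⟩,
      fun _ => rfl, fun _ => rfl⟩
  strongly_connected x y hxy hr z z' h1 h2 h3 h4 := by
    have := P.strongly_connected x y hxy (by omega) z z' h1 h2 h3 h4
    have key : ∀ u : P.Face, Relation.ReflTransGen (fun A B : P.Face => x.1 < A ∧ A < y.1 ∧ x.1 < B ∧
        B < y.1 ∧ (A ≤ B ∨ B ≤ A)) z u → ∀ (hu : u ∈ Set.Icc F G),
        Relation.ReflTransGen (fun A B : Set.Icc F G => x < A ∧ A < y ∧ x < B ∧ B < y ∧ (A ≤ B ∨ B ≤ A))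
          z ⟨u, hu⟩ := by
      intro u hu
      induction hu with
      | refl => intro _; exact .refl
      | tail h1 h2 ih =>
        intro hu
        exact (ih ⟨x.2.1.trans h2.1.le, h2.2.1.le.trans y.2.2⟩).tail h2
    exact key _ this z'.2

theorem sect_isSection (F G : P.Face) (hFG : F ≤ G) (m : ℕ) (hm : P.rank G = P.rank F + 1 + m) :
    P.IsSection (P.sect F G hFG m hm) F G :=
  ⟨hFG, OrderIso.refl _, fun x => by
    show P.rank x.1 = (P.rank x.1 - P.rank F - 1) + P.rank F + 1
    ring⟩

theorem mon_fc_W {a b : ℕ} {w : Equiv.Perm (Flag P.Face)} (hw : w ∈ WW P.mon a b) :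
    ∀ (Φ : Flag P.Face) {j : ℕ}, j ≤ n + 1 → (j ≤ a ∨ b < j) → P.fc (w Φ) j = P.fc Φ j := by
  induction hw using Subgroup.closure_induction with
  | mem x hx =>
    obtain ⟨i, h1, h2, rfl⟩ := hx
    intro Φ j hj hh
    exact P.adj_fc Φ hj (by omega)
  | one => intro Φ j _ _; rfl
  | mul x y _ _ hx hy =>
    intro Φ j hj hh
    rw [Equiv.Perm.mul_apply, hx _ hj hh, hy _ hj hh]
  | inv x _ hx =>
    intro Φ j hj hh
    have := hx (x⁻¹ Φ) hj hh
    simpa using this.symm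

theorem not_free {a b : ℕ} (hab : a < b) (hb : b ≤ n) (Φ : Flag P.Face)
    (hQ : ∀ Q : AbstractPolytope (b - a), P.IsSection Q (P.fc Φ a) (P.fc Φ (b+1)) → Q.IsChiral) :
    ¬ ∀ w ∈ WW P.mon a b, w Φ = Φ → w = 1 := by
  intro hfree
  set F := P.fc Φ a with hF
  set G := P.fc Φ (b+1) with hG
  have hFG : F ≤ G := P.fc_le (by omega) (by omega)
  have hm : P.rank G = P.rank F + 1 + ((b - a : ℕ) : ℤ) := by
    rw [hF, hG, P.rank_fc (by omega), P.rank_fc (by omega)]; push_cast [Nat.cast_sub hab.le]; ring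
  have hch := (hQ _ (P.sect_isSection F G hFG (b-a) hm)).2
  have hfree' : ∀ w ∈ WW P.mon a b, ∀ w' ∈ WW P.mon a b, w Φ = w' Φ → w = w' := by
    intro w hw w' hw' h
    have := hfree (w'⁻¹ * w) (mul_mem (inv_mem hw') hw) (by simp [h])
    rw [inv_mul_eq_one] at this; exact this.symm
  -- faces of the section: each is in some `w Φ`
  have hex : ∀ x : Set.Icc F G, ∃ w ∈ WW P.mon a b, x.1 ∈ w Φ := by
    intro x
    obtain ⟨Θ, h1, h2, -⟩ := P.exists_ext Φ hab.le hb x.2.1 x.2.2 x.2.1 x.2.2 (Or.inl le_rfl)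
    obtain ⟨w, hw, e⟩ := P.conn (b - a) a b (by omega) hb _ _ h1
    exact ⟨w, hw, e ▸ h2⟩
  have hex2 : ∀ x y : Set.Icc F G, x ≤ y → ∃ w ∈ WW P.mon a b, x.1 ∈ w Φ ∧ y.1 ∈ w Φ := by
    intro x y hxy
    obtain ⟨Θ, h1, h2, h3⟩ := P.exists_ext Φ hab.le hb x.2.1 x.2.2 y.2.1 y.2.2 (Or.inl hxy)
    obtain ⟨w, hw, e⟩ := P.conn (b - a) a b (by omega) hb _ _ h1
    exact ⟨w, hw, e ▸ h2, e ▸ h3⟩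
  have hpos : ∀ x : Set.Icc F G, ∃ i, a ≤ i ∧ i ≤ b + 1 ∧ P.rank x.1 = (i : ℤ) - 1 := by
    intro x
    have h1 := P.rank_mono x.2.1
    have h2 := P.rank_mono x.2.2
    have h3 : P.rank F = (a : ℤ) - 1 := P.rank_fc (by omega)
    have h4 : P.rank G = ((b + 1 : ℕ) : ℤ) - 1 := P.rank_fc (by omega)
    push_cast at h4
    exact ⟨(P.rank x.1 + 1).toNat, by omega, by omega, by omega⟩
  -- agreement
  have hagW : ∀ w ∈ WW P.mon a b, ∀ w' ∈ WW P.mon a b, P.Agree a b (w Φ) (w' Φ) := by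
    intro w hw w' hw' j hj hh
    rw [P.mon_fc_W hw _ (by omega) (by omega), P.mon_fc_W hw' _ (by omega) (by omega)]
  have hag : ∀ w ∈ WW P.mon a b, ∀ w' ∈ WW P.mon a b, ∀ i, a ≤ i → i ≤ b + 1 →
      P.fc (w Φ) i = P.fc (w' Φ) i → P.fc (w (P.adj a Φ)) i = P.fc (w' (P.adj a Φ)) i := by
    intro w hw w' hw' i hi1 hi2 h
    by_cases e1 : i = a
    · rw [P.mon_fc_W hw _ (by omega) (by omega), P.mon_fc_W hw' _ (by omega) (by omega)]
    by_cases e2 : i = b + 1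
    · rw [P.mon_fc_W hw _ (by omega) (by omega), P.mon_fc_W hw' _ (by omega) (by omega)]
    obtain ⟨c, rfl⟩ : ∃ c, i = c + 1 := ⟨i - 1, by omega⟩
    obtain ⟨Θ, h1, h2⟩ := P.conn_mix (a := a) (b := b) (c := c) (by omega) (by omega) hb
      (hagW w hw w' hw') h
    obtain ⟨u, hu, eu⟩ := P.conn (b - (c+1)) (c+1) b (by omega) hb _ _ h1
    obtain ⟨t, ht, et⟩ := P.conn (c - a) a c (by omega) (by omega) _ _ h2
    have hw'eq : w' = t * u * w := by
      apply hfree' _ hw' _ (mul_mem (mul_mem (WW_mono (by omega) ht) (WW_mono (by omega) hu)) hw)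
      rw [Equiv.Perm.mul_apply, Equiv.Perm.mul_apply, eu, et]
    rw [hw'eq, Equiv.Perm.mul_apply, Equiv.Perm.mul_apply,
      P.mon_fc_W ht _ (by omega) (by omega), P.mon_fc_W hu _ (by omega) (by omega)]
  have hgs : ∀ w ∈ WW P.mon a b, ∀ i, a ≤ i → i ≤ b + 1 → P.fc (w (P.adj a Φ)) i ∈ Set.Icc F G := by
    intro w hw i h1 h2
    constructor
    · rw [hF, ← P.adj_fc (i := a) Φ (j := a) (by omega) (by omega), ← P.mon_fc_W hw (P.adj a Φ) (j := a) (by omega) (by omega)]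
      exact P.fc_le h1 (by omega)
    · rw [hG, ← P.adj_fc (i := a) Φ (j := b+1) (by omega) (by omega), ← P.mon_fc_W hw (P.adj a Φ) (j := b+1) (by omega) (by omega)]
      exact P.fc_le h2 (by omega)
  choose W hW hWm using hex
  choose p hp1 hp2 hp3 using hpos
  let E : Set.Icc F G → Set.Icc F G := fun x => ⟨P.fc (W x (P.adj a Φ)) (p x), hgs _ (hW x) _ (hp1 x) (hp2 x)⟩
  have hE : ∀ w ∈ WW P.mon a b, ∀ x : Set.Icc F G, x.1 ∈ w Φ → (E x).1 = P.fc (w (P.adj a Φ)) (p x) := by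
    intro w hw x hx
    have hpb := hp2 x
    apply hag _ (hW x) _ hw _ (hp1 x) (hp2 x)
    rw [← P.eq_fc hx (by omega) (hp3 x), ← P.eq_fc (hWm x) (by omega) (hp3 x)]
  have hpE : ∀ x, p (E x) = p x := by
    intro x
    have h1 := hp3 (E x)
    have := hp2 x
    have h2 : P.rank (E x).1 = (p x : ℤ) - 1 := P.rank_fc (by omega)
    omega
  have hmon : Monotone E := by
    intro x y hxy
    obtain ⟨w, hw, h1, h2⟩ := hex2 x y hxy
    show (E x).1 ≤ (E y).1
    rw [hE w hw x h1, hE w hw y h2]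
    have a1 := hp3 x
    have a2 := hp3 y
    have a3 := P.rank_mono (show x.1 ≤ y.1 from hxy)
    have := hp2 y
    exact P.fc_le (by omega) (by omega)
  have hmona : P.mon a ∈ WW P.mon a b := mem_WW le_rfl hab
  have hinv : ∀ x, E (E x) = x := by
    intro x
    apply Subtype.ext
    have h2 := hp2 x
    rw [hE (W x * P.mon a) (mul_mem (hW x) hmona) (E x) (by
      show (E x).1 ∈ W x (P.adj a Φ)
      exact P.fc_mem (by omega)), hpE]
    rw [Equiv.Perm.mul_apply]
    show P.fc (W x (P.adj a (P.adj a Φ))) _ = _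
    rw [P.adj_adj]
    exact (P.eq_fc (hWm x) (by omega) (hp3 x)).symm
  let e : Set.Icc F G ≃o Set.Icc F G :=
    { toFun := E, invFun := E, left_inv := hinv, right_inv := hinv
      map_rel_iff' := by
        intro x y
        constructor
        · intro h
          have := hmon h
          change E (E x) ≤ E (E y) at this
          rwa [hinv, hinv] at this
        · intro h; exact hmon h }
  -- flags of the section
  have hmaxc : ∀ Θ : Flag P.Face, F ∈ Θ → G ∈ Θ →
      IsMaxChain (· ≤ ·) {x : Set.Icc F G | x.1 ∈ Θ} := by
    intro Θ h1 h2
    refine ⟨fun x hx y hy _ => Θ.le_or_le hx hy, fun s hs hsub => ?_⟩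
    apply Set.Subset.antisymm hsub
    intro x hx
    show x.1 ∈ Θ
    rw [P.mem_iff_fc]
    obtain hb2 := hp2 x
    refine ⟨p x, by omega, ?_⟩
    have hmem : P.fc Θ (p x) ∈ Set.Icc F G := by
      rw [P.eq_fc h1 (i := a) (by omega) (by rw [hF, P.rank_fc (by omega)]),
        P.eq_fc h2 (i := b+1) (by omega) (by rw [hG, P.rank_fc (by omega)])]
      exact ⟨P.fc_le (hp1 x) (by omega), P.fc_le hb2 (by omega)⟩
    apply P.eq_of_rank _ (by rw [P.rank_fc (by omega)]; exact hp3 x)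
    by_cases heq : x = ⟨_, hmem⟩
    · left; exact (congrArg Subtype.val heq).le
    · exact hs hx (hsub (show P.fc Θ (p x) ∈ Θ from P.fc_mem (by omega))) heq
  let Q := P.sect F G hFG (b-a) hm
  have hFΦ : F ∈ Φ := P.fc_mem (by omega)
  have hGΦ : G ∈ Φ := P.fc_mem (by omega)
  have hFa : F ∈ P.adj a Φ := by
    rw [hF, ← P.adj_fc (i := a) Φ (j := a) (by omega) (by omega)]; exact P.fc_mem (by omega)
  have hGa : G ∈ P.adj a Φ := by
    rw [hG, ← P.adj_fc (i := a) Φ (j := b+1) (by omega) (by omega)]; exact P.fc_mem (by omega)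
  let Φ1 : Flag Q.Face := Flag.ofIsMaxChain _ (hmaxc Φ hFΦ hGΦ)
  let Φ2 : Flag Q.Face := Flag.ofIsMaxChain _ (hmaxc (P.adj a Φ) hFa hGa)
  have hm1 : ∀ x : Set.Icc F G, x ∈ (Φ1 : Set Q.Face) ↔ x.1 ∈ Φ := fun x => Iff.rfl
  have hm2 : ∀ x : Set.Icc F G, x ∈ (Φ2 : Set Q.Face) ↔ x.1 ∈ P.adj a Φ := fun x => Iff.rfl
  have hE1 : ∀ x : Set.Icc F G, x.1 ∈ Φ → (E x).1 ∈ P.adj a Φ := by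
    intro x hx
    have := hp2 x
    rw [hE 1 (one_mem _) x hx]
    exact P.fc_mem (by omega)
  have hE2 : ∀ x : Set.Icc F G, x.1 ∈ P.adj a Φ → (E x).1 ∈ Φ := by
    intro x hx
    have := hp2 x
    rw [hE (P.mon a) hmona x hx]
    show P.fc (P.adj a (P.adj a Φ)) _ ∈ _
    rw [P.adj_adj]
    exact P.fc_mem (by omega)
  have hdiff : ∀ Ψ : Flag P.Face, ∀ (hs : Set.Icc F G), P.fc Ψ (a+1) = hs.1 →
      {x : Set.Icc F G | x.1 ∈ Ψ} \ {x : Set.Icc F G | x.1 ∈ P.adj a Ψ} = {hs} := by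
    intro Ψ hs hh
    ext x
    have := P.diff_adj (i := a) (by omega) Ψ
    have h2 := Set.ext_iff.1 this x.1
    simp only [Set.mem_sdiff, Set.mem_singleton_iff, SetLike.mem_coe, Set.mem_ofPred_eq] at h2 ⊢
    rw [h2, hh]; exact Subtype.ext_iff.symm
  have hadj : Q.AdjacentFlags Φ1 Φ2 := by
    have d1 : (Φ1 : Set Q.Face) \ Φ2 = {(⟨P.fc Φ (a+1), P.fc_le (by omega) (by omega), P.fc_le (by omega) (by omega)⟩ : Set.Icc F G)} :=
      hdiff Φ _ rfl
    have hmm : P.fc (P.adj a Φ) (a+1) ∈ Set.Icc F G := by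
      rw [P.eq_fc hFa (i := a) (by omega) (by rw [hF, P.rank_fc (by omega)]),
        P.eq_fc hGa (i := b+1) (by omega) (by rw [hG, P.rank_fc (by omega)])]
      exact ⟨P.fc_le (by omega) (by omega), P.fc_le (by omega) (by omega)⟩
    have d2 : (Φ2 : Set Q.Face) \ Φ1 = {(⟨P.fc (P.adj a Φ) (a+1), hmm⟩ : Set.Icc F G)} := by
      have := hdiff (P.adj a Φ) ⟨_, hmm⟩ rfl
      rw [P.adj_adj] at this
      exact this
    refine ⟨?_, ?_, ?_⟩
    · intro h
      rw [h, Set.sdiff_self] at d1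
      exact Set.singleton_ne_empty _ d1.symm
    · rw [d1]; exact Set.ncard_singleton _
    · rw [d2]; exact Set.ncard_singleton _
  apply hch Φ1 Φ2 hadj
  refine ⟨e, ?_⟩
  apply Set.Subset.antisymm
  · rintro _ ⟨x, hx, rfl⟩
    exact hE1 x hx
  · intro x hx
    exact ⟨E x, hE2 x hx, hinv x⟩

/-- extraction of the combinatorial data -/
theorem exists_sys (hn : 2 ≤ n) (hchiral : P.IsChiral)
    (hfacets : ∀ (F : P.Face) (Q : AbstractPolytope (n - 1)),
      P.IsFacet F → P.IsSection Q P.bot F → Q.IsChiral)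
    (hvfs : ∀ (v : P.Face) (Q : AbstractPolytope (n - 1)),
      P.IsVertex v → P.IsSection Q v P.top → Q.IsChiral) :
    Nonempty (Sys n (Flag P.Face)) := by
  obtain ⟨⟨Φ₁, Φ₂, h12, hor⟩, hadj⟩ := hchiral
  refine ⟨{
    r := P.mon
    T := P.Face
    f := fun j Φ => P.fc Φ (j+1)
    χ := fun Φ => P.SameOrbit Φ Φ₁
    r_sq := fun i Φ => P.adj_adj i Φ
    f_r := ?_
    f_r_self := fun i Φ hi => P.adj_ne hi Φ
    comm := fun i j Φ hij hj => P.adj_comm hij hj Φ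
    conn := fun a b Φ Ψ hab hb h => P.conn (b-a) a b (by omega) hb Φ Ψ h
    χ_r := ?_
    aut := ?_
    nf1 := ?_
    nf2 := ?_ }⟩
  · intro i j Φ hij
    by_cases hj : j + 1 ≤ n + 1
    · exact P.adj_fc Φ hj (by omega)
    · unfold fc; simp [hj]
  · intro i Φ hi
    constructor
    · intro h1 h2
      exact hadj _ _ (P.adjacent_adj hi Φ) (h2.trans h1.symm)
    · intro h
      have h1 : P.SameOrbit Φ Φ₂ := (hor Φ).resolve_left h
      refine (hor _).resolve_right fun h2 => ?_
      exact hadj _ _ (P.adjacent_adj hi Φ) (h1.trans h2.symm)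
  · intro Φ Ψ h
    apply P.aut_of_sameOrbit
    by_cases h1 : P.SameOrbit Φ Φ₁
    · exact h1.trans (h.1 h1).symm
    · exact ((hor Φ).resolve_left h1).trans ((hor Ψ).resolve_left (fun h2 => h1 (h.2 h2))).symm
  · intro h
    refine P.not_free (a := 0) (b := n - 1) (by omega) (by omega) Φ₁ ?_ (fun w hw e => h w hw Φ₁ e)
    intro Q hQ
    rw [P.fc_zero] at hQ
    refine hfacets _ Q ?_ hQ
    unfold IsFacet
    rw [P.rank_fc (by omega)]
    push_cast [Nat.cast_sub (show 1 ≤ n by omega)]; ring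
  · intro h
    refine P.not_free (a := 1) (b := n) (by omega) (by omega) Φ₁ ?_ (fun w hw e => h w hw Φ₁ e)
    intro Q hQ
    rw [P.fc_top] at hQ
    refine hvfs _ Q ?_ hQ
    unfold IsVertex
    rw [P.rank_fc (by omega)]
    simp

end AbstractPolytope

open scoped Classical
set_option linter.unusedSectionVars false
set_option linter.unusedVariables false

open AbstractPolytope (WW WW_mono mem_WW)

theorem ncard_fiber {α β : Type*} [Finite α] (s : Set α) (g : α → β) (k : ℕ)
    (h : ∀ x ∈ s, {y | y ∈ s ∧ g y = g x}.ncard = k) : s.ncard = (g '' s).ncard * k := by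
  have hs : s.Finite := Set.toFinite s
  rw [Set.ncard_eq_toFinset_card s hs, Set.ncard_eq_toFinset_card (g '' s) (hs.image g)]
  rw [Finset.card_eq_sum_card_fiberwise (f := g) (t := (hs.image g).toFinset)]
  · rw [Finset.sum_const_nat (m := k)]
    intro b hb
    simp only [Set.Finite.mem_toFinset, Set.mem_image] at hb
    obtain ⟨x, hx, rfl⟩ := hb
    rw [← h x hx, ← Set.ncard_coe_finset]
    congr 1
    ext y
    simp
  · intro x hx
    simp only [Set.Finite.coe_toFinset] at hx ⊢
    exact ⟨x, hx, rfl⟩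

namespace Sys
variable {n : ℕ} {Ω : Type} (S : Sys n Ω)

def W (a b : ℕ) : Subgroup (Equiv.Perm Ω) := WW S.r a b

theorem r_mem {a b i : ℕ} (h1 : a ≤ i) (h2 : i < b) : S.r i ∈ S.W a b := mem_WW h1 h2

theorem W_mono {a b c d : ℕ} (h : ∀ i, a ≤ i → i < b → c ≤ i ∧ i < d) : S.W a b ≤ S.W c d :=
  WW_mono h

theorem W_le {a b c d : ℕ} (h1 : c ≤ a) (h2 : b ≤ d) : S.W a b ≤ S.W c d :=
  WW_mono (by omega)

theorem W_ind {a b : ℕ} {p : Equiv.Perm Ω → Prop} (h1 : p 1)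
    (h2 : ∀ i, a ≤ i → i < b → ∀ w ∈ S.W a b, p w → p (S.r i * w)) : ∀ w ∈ S.W a b, p w := by
  intro w hw
  induction hw using Subgroup.closure_induction_left with
  | one => exact h1
  | mul_left x hx y hy hp =>
    obtain ⟨i, hi1, hi2, rfl⟩ := hx
    exact h2 i hi1 hi2 y hy hp
  | inv_mul_cancel x hx y hy hp =>
    obtain ⟨i, hi1, hi2, rfl⟩ := hx
    have : (S.r i)⁻¹ = S.r i := by
      rw [inv_eq_iff_mul_eq_one]; ext Φ; simp [S.r_sq]
    rw [this]
    exact h2 i hi1 hi2 y hy hp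

theorem r_mul_self (i : ℕ) : S.r i * S.r i = 1 := by ext Φ; simp [S.r_sq]

theorem r_inv (i : ℕ) : (S.r i)⁻¹ = S.r i := by
  rw [inv_eq_iff_mul_eq_one]; exact S.r_mul_self i

theorem r_comm {i j : ℕ} (h : i + 1 < j) (hj : j < n) : S.r i * S.r j = S.r j * S.r i := by
  ext Φ; simp [S.comm i j Φ h hj]

def O (a b : ℕ) (Φ : Ω) : Set Ω := {Ψ | ∃ w ∈ S.W a b, w Φ = Ψ}

theorem O_self (a b : ℕ) (Φ : Ω) : Φ ∈ S.O a b Φ := ⟨1, one_mem _, rfl⟩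

variable {S}

theorem O_symm {a b : ℕ} {Φ Ψ : Ω} (h : Ψ ∈ S.O a b Φ) : Φ ∈ S.O a b Ψ := by
  obtain ⟨w, hw, rfl⟩ := h
  exact ⟨w⁻¹, inv_mem hw, by simp⟩

theorem O_trans {a b : ℕ} {Φ Ψ Θ : Ω} (h : Ψ ∈ S.O a b Φ) (h' : Θ ∈ S.O a b Ψ) : Θ ∈ S.O a b Φ := by
  obtain ⟨w, hw, rfl⟩ := h
  obtain ⟨w', hw', rfl⟩ := h'
  exact ⟨w' * w, mul_mem hw' hw, by simp⟩

theorem O_eq {a b : ℕ} {Φ Ψ : Ω} (h : Ψ ∈ S.O a b Φ) : S.O a b Ψ = S.O a b Φ := by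
  ext Θ; exact ⟨fun h' => O_trans h h', fun h' => O_trans (O_symm h) h'⟩

theorem O_le {a b c d : ℕ} {Φ Ψ : Ω} (h1 : c ≤ a) (h2 : b ≤ d) (h : Ψ ∈ S.O a b Φ) : Ψ ∈ S.O c d Φ := by
  obtain ⟨w, hw, rfl⟩ := h
  exact ⟨w, S.W_le h1 h2 hw, rfl⟩

theorem O_r {a b i : ℕ} {Φ : Ω} (h1 : a ≤ i) (h2 : i < b) : S.r i Φ ∈ S.O a b Φ :=
  ⟨_, S.r_mem h1 h2, rfl⟩

theorem O_r' {a b i : ℕ} {Φ Ψ : Ω} (h1 : a ≤ i) (h2 : i < b) (h : Ψ ∈ S.O a b Φ) :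
    S.r i Ψ ∈ S.O a b Φ := O_trans h (O_r h1 h2)

theorem W_f {a b : ℕ} {w : Equiv.Perm Ω} (hw : w ∈ S.W a b) (Φ : Ω) {j : ℕ} (h : j < a ∨ b ≤ j) :
    S.f j (w Φ) = S.f j Φ := by
  refine S.W_ind (p := fun w => S.f j (w Φ) = S.f j Φ) rfl ?_ w hw
  intro i h1 h2 w _ ih
  rw [Equiv.Perm.mul_apply, S.f_r i j _ (by omega), ih]

theorem O_f {a b : ℕ} {Φ Ψ : Ω} (h : Ψ ∈ S.O a b Φ) {j : ℕ} (hj : j < a ∨ b ≤ j) :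
    S.f j Ψ = S.f j Φ := by
  obtain ⟨w, hw, rfl⟩ := h
  exact W_f hw Φ hj

theorem O_of_f {a b : ℕ} {Φ Ψ : Ω} (hab : a ≤ b) (hb : b ≤ n)
    (h : ∀ j < n, (j < a ∨ b ≤ j) → S.f j Ψ = S.f j Φ) : Ψ ∈ S.O a b Φ :=
  S.conn a b Φ Ψ hab hb (fun j hj hh => (h j hj hh).symm)

theorem O_empty {a b : ℕ} (h : b ≤ a) {Φ Ψ : Ω} (hΨ : Ψ ∈ S.O a b Φ) : Ψ = Φ := by
  obtain ⟨w, hw, rfl⟩ := hΨ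
  refine S.W_ind (p := fun w => w Φ = Φ) rfl ?_ w hw
  intro i h1 h2; omega

theorem eq_of_f {Φ Ψ : Ω} (h : ∀ j < n, S.f j Ψ = S.f j Φ) : Ψ = Φ :=
  O_empty (a := 0) (b := 0) le_rfl (O_of_f le_rfl (Nat.zero_le _) (fun j hj _ => h j hj))

theorem O_inter {a b c d : ℕ} (hb : b ≤ n) (hd : d ≤ n) {Φ Ψ : Ω}
    (h1 : Ψ ∈ S.O a b Φ) (h2 : Ψ ∈ S.O c d Φ) {e f : ℕ} (he : e ≤ max a c) (hf : min b d ≤ f)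
    (hfn : f ≤ n) : Ψ ∈ S.O e f Φ := by
  by_cases hh : max a c ≤ min b d
  · apply O_of_f (by omega) hfn
    intro j hj hjj
    by_cases g : j < a ∨ b ≤ j
    · exact O_f h1 g
    · exact O_f h2 (by omega)
  · rw [eq_of_f (S := S) (Ψ := Ψ) (Φ := Φ)]
    · exact S.O_self _ _ _
    intro j hj
    by_cases g : j < a ∨ b ≤ j
    · exact O_f h1 g
    · exact O_f h2 (by omega)

theorem O_vertex {a b : ℕ} (hab : a < b) (hb : b ≤ n) {Φ Ψ : Ω} (h : Ψ ∈ S.O a b Φ) :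
    S.f a Ψ = S.f a Φ ↔ Ψ ∈ S.O (a+1) b Φ := by
  constructor
  · intro hf
    apply O_of_f (by omega) hb
    intro j hj hh
    by_cases e : j = a
    · rw [e, hf]
    · exact O_f h (by omega)
  · intro h; exact O_f h (by omega)

/-- automorphisms -/
theorem aut_W {g : Equiv.Perm Ω} (hg : ∀ i < n, ∀ Θ, g (S.r i Θ) = S.r i (g Θ)) {a b : ℕ} (hb : b ≤ n)
    {w : Equiv.Perm Ω} (hw : w ∈ S.W a b) (Φ : Ω) : g (w Φ) = w (g Φ) := by
  refine S.W_ind (p := fun w => g (w Φ) = w (g Φ)) rfl ?_ w hw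
  intro i h1 h2 w _ ih
  rw [Equiv.Perm.mul_apply, hg i (by omega), ih]; rfl

theorem aut_O {g : Equiv.Perm Ω} (hg : ∀ i < n, ∀ Θ, g (S.r i Θ) = S.r i (g Θ)) {a b : ℕ} (hb : b ≤ n)
    {Φ Ψ : Ω} : g Ψ ∈ S.O a b (g Φ) ↔ Ψ ∈ S.O a b Φ := by
  constructor
  · rintro ⟨w, hw, e⟩
    rw [← aut_W hg hb hw] at e
    exact ⟨w, hw, g.injective e⟩
  · rintro ⟨w, hw, rfl⟩
    exact ⟨w, hw, (aut_W hg hb hw Φ).symm⟩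

theorem aut_f {g : Equiv.Perm Ω} (hg : ∀ i < n, ∀ Θ, g (S.r i Θ) = S.r i (g Θ)) {a b : ℕ} (hab : a < b)
    (hb : b ≤ n) {Φ Ψ : Ω} (h : Ψ ∈ S.O a b Φ) : S.f a (g Ψ) = S.f a (g Φ) ↔ S.f a Ψ = S.f a Φ := by
  rw [O_vertex hab hb h, O_vertex hab hb ((aut_O hg hb).2 h), aut_O hg hb]

theorem nonempty (S : Sys n Ω) : Nonempty Ω := by
  by_contra h
  rw [not_nonempty_iff] at h
  exact S.nf1 (fun w _ _ _ => Equiv.ext (fun x => h.elim x))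

variable [Finite Ω]

variable (S) in
noncomputable def N (a b : ℕ) : ℕ := (S.O a b S.nonempty.some).ncard

theorem ncard_O {a b : ℕ} (hb : b ≤ n) (Φ : Ω) : (S.O a b Φ).ncard = S.N a b := by
  have key : ∀ Φ Ψ, (S.χ Φ ↔ S.χ Ψ) → (S.O a b Φ).ncard = (S.O a b Ψ).ncard := by
    intro Φ Ψ h
    obtain ⟨g, rfl, hg⟩ := S.aut Φ Ψ h
    rw [← Set.ncard_image_of_injective _ g.injective]
    congr 1
    ext Θ
    constructor
    · rintro ⟨x, hx, rfl⟩; exact (aut_O hg hb).2 hx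
    · intro h
      refine ⟨g.symm Θ, (aut_O hg hb).1 (by simpa using h), by simp⟩
  unfold N
  by_cases h : (S.χ Φ ↔ S.χ S.nonempty.some)
  · exact key _ _ h
  · by_cases hab : a < b
    · rw [← O_eq (O_r (S := S) (Φ := Φ) (i := a) le_rfl hab)]
      apply key
      rw [S.χ_r a Φ (by omega)]
      tauto
    · have : ∀ Φ, S.O a b Φ = {Φ} := by
        intro Φ; ext Ψ
        exact ⟨fun h => O_empty (by omega) h, fun h => by rw [h]; exact S.O_self _ _ _⟩
      rw [this, this]; simp

theorem N_pos (S : Sys n Ω) (a b : ℕ) : 0 < S.N a b := by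
  unfold N; rw [Set.ncard_pos]; exact ⟨_, S.O_self _ _ _⟩

theorem N_empty {a b : ℕ} (h : b ≤ a) : S.N a b = 1 := by
  unfold N
  rw [Set.ncard_eq_one]
  exact ⟨_, Set.eq_singleton_iff_unique_mem.2 ⟨S.O_self _ _ _, fun _ h' => O_empty h h'⟩⟩

variable (S) in
/-- number of vertices of the section `[a,b)` -/
noncomputable def v (a b : ℕ) : ℕ := S.N a b / S.N (a+1) b

theorem ncard_vlab {a b : ℕ} (hab : a < b) (hb : b ≤ n) (Φ : Ω) :
    (S.f a '' S.O a b Φ).ncard * S.N (a+1) b = S.N a b := by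
  rw [← ncard_O (a := a) hb Φ]
  symm
  apply ncard_fiber
  intro Ψ hΨ
  rw [← ncard_O (a := a+1) hb Ψ]
  congr 1
  ext Θ
  constructor
  · rintro ⟨h1, h2⟩
    exact (O_vertex hab hb (O_trans (O_symm hΨ) h1)).1 h2
  · intro h
    have this : Θ ∈ S.O a b Ψ := O_le (a := a+1) (by omega) le_rfl h
    exact ⟨O_trans hΨ this, (O_vertex hab hb this).2 h⟩

theorem ncard_v {a b : ℕ} (hab : a < b) (hb : b ≤ n) (Φ : Ω) :
    (S.f a '' S.O a b Φ).ncard = S.v a b := by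
  unfold v
  rw [← ncard_vlab hab hb Φ, Nat.mul_div_cancel _ (S.N_pos _ _)]

theorem v_mul {a b : ℕ} (hab : a < b) (hb : b ≤ n) : S.v a b * S.N (a+1) b = S.N a b := by
  rw [← ncard_v hab hb S.nonempty.some]; exact ncard_vlab hab hb _

theorem v_mono {a b c : ℕ} (hab : a < b) (hbc : b ≤ c) (hc : c ≤ n) : S.v a b ≤ S.v a c := by
  rw [← ncard_v hab (by omega) S.nonempty.some, ← ncard_v (by omega) hc S.nonempty.some]
  apply Set.ncard_le_ncard
  · apply Set.image_mono
    intro x hx; exact O_le le_rfl hbc hx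
  · exact Set.toFinite _ |>.image _

theorem N_one {a : ℕ} (ha : a < n) : S.N a (a+1) = 2 := by
  have Φ := S.nonempty.some
  rw [← ncard_O (by omega) Φ]
  have : S.O a (a+1) Φ = {Φ, S.r a Φ} := by
    ext Ψ
    constructor
    · rintro ⟨w, hw, rfl⟩
      refine S.W_ind (p := fun w => w Φ ∈ ({Φ, S.r a Φ} : Set Ω)) (Or.inl rfl) ?_ w hw
      intro i h1 h2 w _ ih
      have : i = a := by omega
      subst this
      rcases ih with ih | ih
      · right; rw [Equiv.Perm.mul_apply, ih]; rfl
      · left; rw [Equiv.Perm.mul_apply, ih]; exact S.r_sq _ _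
    · rintro (rfl | rfl)
      · exact S.O_self _ _ _
      · exact O_r le_rfl (by omega)
  rw [this, Set.ncard_pair]
  intro h
  exact S.f_r_self a Φ ha (by rw [← h])

theorem v_one {a : ℕ} (ha : a < n) : S.v a (a+1) = 2 := by
  unfold v; rw [N_one ha, N_empty le_rfl]

variable (S) in
def Free (a b : ℕ) : Prop := ∀ w ∈ S.W a b, ∀ Φ, w Φ = Φ → w = 1

theorem Free.mono {a b c d : ℕ} (h : S.Free a b) (h1 : a ≤ c) (h2 : d ≤ b) : S.Free c d :=
  fun w hw Φ e => h w (S.W_le h1 h2 hw) Φ e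

theorem Free.eq {a b : ℕ} (h : S.Free a b) {w w' : Equiv.Perm Ω} (hw : w ∈ S.W a b) (hw' : w' ∈ S.W a b)
    {Φ : Ω} (e : w Φ = w' Φ) : w = w' := by
  have := h (w'⁻¹ * w) (mul_mem (inv_mem hw') hw) Φ (by simp [e])
  rw [inv_mul_eq_one] at this; exact this.symm

/-- an element fixing flags of both classes is trivial -/
theorem eq_one_of_fix {a b : ℕ} (hb : b ≤ n) {w : Equiv.Perm Ω} (hw : w ∈ S.W a b) {Φ Ψ : Ω}
    (hχ : ¬ (S.χ Φ ↔ S.χ Ψ)) (h1 : w Φ = Φ) (h2 : w Ψ = Ψ) : w = 1 := by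
  ext Θ
  by_cases h : S.χ Φ ↔ S.χ Θ
  · obtain ⟨g, rfl, hg⟩ := S.aut _ _ h
    rw [← aut_W hg hb hw, h1]; rfl
  · obtain ⟨g, rfl, hg⟩ := S.aut Ψ Θ (by tauto)
    rw [← aut_W hg hb hw, h2]; rfl

theorem free_of_comm {a b : ℕ} (hb : b ≤ n) {i : ℕ} (hi : i < n)
    (hc : ∀ j, a ≤ j → j < b → S.r i * S.r j = S.r j * S.r i) : S.Free a b := by
  intro w hw Φ h
  have hcw : S.r i * w = w * S.r i := by
    refine S.W_ind (p := fun w => S.r i * w = w * S.r i) (by simp) ?_ w hw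
    intro j h1 h2 w _ ih
    rw [← mul_assoc, hc j h1 h2, mul_assoc, ih, mul_assoc]
  refine eq_one_of_fix hb hw (Φ := Φ) (Ψ := S.r i Φ) ?_ h ?_
  · rw [S.χ_r i Φ hi]; tauto
  · rw [← Equiv.Perm.mul_apply, ← hcw, Equiv.Perm.mul_apply, h]

theorem free_right {a b : ℕ} (hb : b + 1 < n) : S.Free a b :=
  free_of_comm (by omega) (i := b + 1) hb (fun j h1 h2 => (S.r_comm (by omega) hb).symm)

theorem free_left {a b : ℕ} (ha : 2 ≤ a) (hb : b ≤ n) (hab : a < b) : S.Free a b :=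
  free_of_comm hb (i := 0) (by omega) (fun j h1 h2 => S.r_comm (by omega) (by omega))

theorem card_W_eq {a b : ℕ} (hb : b ≤ n) (h : S.Free a b) : Nat.card (S.W a b) = S.N a b := by
  rw [← ncard_O hb S.nonempty.some, ← Nat.card_coe_set_eq]
  apply Nat.card_congr
  refine Equiv.ofBijective (fun w => ⟨w.1 S.nonempty.some, w.1, w.2, rfl⟩) ⟨?_, ?_⟩
  · intro w w' e
    exact Subtype.ext (h.eq w.2 w'.2 (congrArg Subtype.val e))
  · rintro ⟨_, w, hw, rfl⟩; exact ⟨⟨w, hw⟩, rfl⟩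

theorem free_of_card {a b : ℕ} (hb : b ≤ n) (h : Nat.card (S.W a b) < 2 * S.N a b) : S.Free a b := by
  intro w hw Φ hΦ
  have := Fintype.ofFinite (S.W a b)
  have := Fintype.ofFinite (MulAction.orbit (S.W a b) Φ)
  have := Fintype.ofFinite (MulAction.stabilizer (S.W a b) Φ)
  have h1 := MulAction.card_orbit_mul_card_stabilizer_eq_card_group (S.W a b) Φ
  have h2 : Nat.card (MulAction.orbit (S.W a b) Φ) = S.N a b := by
    rw [← ncard_O hb Φ, ← Nat.card_coe_set_eq]
    congr 2
    ext Ψ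
    constructor
    · rintro ⟨w, rfl⟩; exact ⟨w.1, w.2, rfl⟩
    · rintro ⟨w, hw, rfl⟩; exact ⟨⟨w, hw⟩, rfl⟩
  rw [← Nat.card_eq_fintype_card, ← Nat.card_eq_fintype_card, ← Nat.card_eq_fintype_card, h2] at h1
  have h3 : Nat.card (MulAction.stabilizer (S.W a b) Φ) = 1 := by
    have := S.N_pos a b
    have hp : 0 < Nat.card (MulAction.stabilizer (S.W a b) Φ) := Nat.card_pos
    by_contra hne
    have : 2 ≤ Nat.card (MulAction.stabilizer (S.W a b) Φ) := by omega
    nlinarith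
  rw [Subgroup.card_eq_one] at h3
  have : (⟨w, hw⟩ : S.W a b) ∈ MulAction.stabilizer (S.W a b) Φ := hΦ
  rw [h3, Subgroup.mem_bot] at this
  exact congrArg Subtype.val this

theorem Free.ip {a b : ℕ} (h : S.Free a b) {c d : ℕ} (hb : b ≤ n) (hd : d ≤ n) {w : Equiv.Perm Ω}
    (hw : w ∈ S.W a b) (hw' : w ∈ S.W c d) {e f : ℕ} (he : e ≤ max a c) (hf : min b d ≤ f)
    (hae : a ≤ e) (hfb : f ≤ b) : w ∈ S.W e f := by
  have Φ := S.nonempty.some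
  have := O_inter (S := S) hb hd ⟨w, hw, rfl⟩ ⟨w, hw', rfl⟩ he hf (by omega) (Φ := Φ)
  obtain ⟨u, hu, eu⟩ := this
  rw [← h.eq (S.W_le hae hfb hu) hw eu]
  exact hu

/-- flatness -/
def Flat (S : Sys n Ω) (a b : ℕ) : Prop :=
  ∀ Φ, ∀ Ψ ∈ S.O a b Φ, ∃ Θ ∈ S.O a (b-1) Φ, Ψ ∈ S.O (a+1) b Θ

theorem Flat.symm {a b : ℕ} (h : S.Flat a b) :
    ∀ Φ, ∀ Ψ ∈ S.O a b Φ, ∃ Θ ∈ S.O (a+1) b Φ, Ψ ∈ S.O a (b-1) Θ := by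
  intro Φ Ψ hΨ
  obtain ⟨Θ, h1, h2⟩ := h Ψ Φ (O_symm hΨ)
  exact ⟨Θ, O_symm h2, O_symm h1⟩

theorem v_lt {a b : ℕ} (hab : a + 1 < b) (hb : b ≤ n) (h : ¬ S.Flat a b) : S.v a (b-1) < S.v a b := by
  unfold Flat at h
  push Not at h
  obtain ⟨Φ, Ψ, hΨ, hn⟩ := h
  rw [← ncard_v (by omega) (by omega) Φ, ← ncard_v (by omega) hb Φ]
  apply Set.ncard_lt_ncard
  · refine ⟨Set.image_mono (fun x hx => O_le le_rfl (by omega) hx), fun hsub => ?_⟩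
    obtain ⟨Θ, h1, h2⟩ := hsub ⟨Ψ, hΨ, rfl⟩
    have h3 : Ψ ∈ S.O a b Θ := O_trans (O_symm (O_le le_rfl (by omega) h1)) hΨ
    exact hn Θ h1 ((O_vertex (by omega) hb h3).1 h2.symm)
  · exact (Set.toFinite _).image _

theorem flat_of_v {a b : ℕ} (hab : a + 1 < b) (hb : b ≤ n) (h : S.v a b ≤ S.v a (b-1)) : S.Flat a b := by
  by_contra hh
  have := v_lt hab hb hh
  omega

theorem v_of_flat {a b : ℕ} (hab : a + 1 < b) (hb : b ≤ n) (h : S.Flat a b) : S.v a b = S.v a (b-1) := by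
  apply le_antisymm _ (v_mono (by omega) (by omega) hb)
  rw [← ncard_v (b := b-1) (by omega) (by omega) S.nonempty.some, ← ncard_v (b := b) (by omega) hb S.nonempty.some]
  apply Set.ncard_le_ncard _ ((Set.toFinite _).image _)
  rintro _ ⟨Ψ, hΨ, rfl⟩
  obtain ⟨Θ, h1, h2⟩ := h _ Ψ hΨ
  exact ⟨Θ, h1, (O_f h2 (by omega)).symm⟩

theorem r_W_comm {a b i : ℕ} (hi : i < n) (hb : b < i) {w : Equiv.Perm Ω} (hw : w ∈ S.W a b) :
    S.r i * w = w * S.r i := by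
  refine S.W_ind (p := fun w => S.r i * w = w * S.r i) (by simp) ?_ w hw
  intro j h1 h2 w _ ih
  rw [← mul_assoc, ← S.r_comm (show j + 1 < i by omega) hi, mul_assoc, ih, mul_assoc]

theorem flat_succ {a b : ℕ} (hab : a + 1 < b) (hb : b < n) (h : S.Flat a b) : S.Flat a (b+1) := by
  intro Φ Ψ hΨ
  suffices hs : ∃ Θ ∈ S.O (a+1) (b+1) Ψ, Φ ∈ S.O a b Θ by
    obtain ⟨Θ, h1, h2⟩ := hs
    exact ⟨Θ, by simpa using O_symm h2, O_symm h1⟩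
  obtain ⟨w, hw, rfl⟩ := O_symm hΨ
  refine S.W_ind (p := fun w => ∃ Θ ∈ S.O (a+1) (b+1) Ψ, w Ψ ∈ S.O a b Θ)
    ⟨Ψ, S.O_self _ _ _, S.O_self _ _ _⟩ ?_ w hw
  rintro i h1 h2 w _ ⟨Θ, h3, h4⟩
  by_cases e : i < b
  · exact ⟨Θ, h3, O_r' h1 e h4⟩
  · have : i = b := by omega
    subst this
    obtain ⟨Λ, l1, l2⟩ := h.symm Θ _ h4
    obtain ⟨u, hu, eu⟩ := l2
    refine ⟨S.r i Λ, ?_, u, S.W_le le_rfl (by omega) hu, ?_⟩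
    · exact O_r' (by omega) (by omega) (O_trans h3 (O_le le_rfl (by omega) l1))
    · rw [Equiv.Perm.mul_apply, ← eu, ← Equiv.Perm.mul_apply, ← Equiv.Perm.mul_apply,
        r_W_comm (b := i - 1) (by omega) (by omega) hu]

/-- Theorem A' -/
theorem free_of_flat {a b : ℕ} (hab : a + 1 < b) (hb : b < n) (h1 : S.Free a b)
    (h2 : S.Free (a+1) (b+1)) (h : S.Flat a b) : S.Free a (b+1) := by
  have key : ∀ w ∈ S.W a (b+1), ∃ u ∈ S.W a b, ∃ t ∈ S.W (a+1) (b+1), w = u * t := by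
    refine S.W_ind ⟨1, one_mem _, 1, one_mem _, by simp⟩ ?_
    rintro i i1 i2 w _ ⟨u, hu, t, ht, rfl⟩
    by_cases e : i < b
    · exact ⟨S.r i * u, mul_mem (S.r_mem i1 e) hu, t, ht, by rw [mul_assoc]⟩
    · have : i = b := by omega
      subst this
      obtain ⟨Θ, ⟨x, hx, rfl⟩, ⟨y, hy, ey⟩⟩ := h.symm S.nonempty.some (u S.nonempty.some) ⟨u, hu, rfl⟩
      have : u = y * x := h1.eq hu (mul_mem (S.W_le le_rfl (by omega) hy) (S.W_le (by omega) le_rfl hx))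
        (by rw [Equiv.Perm.mul_apply, ey])
      refine ⟨y, S.W_le le_rfl (by omega) hy, S.r i * x * t,
        mul_mem (mul_mem (S.r_mem (by omega) (by omega)) (S.W_le le_rfl (by omega) hx)) ht, ?_⟩
      rw [this, ← mul_assoc, ← mul_assoc, ← mul_assoc, ← mul_assoc,
        r_W_comm (b := i - 1) (by omega) (by omega) hy]
  intro w hw Φ e
  obtain ⟨u, hu, t, ht, rfl⟩ := key w hw
  have e1 : t Φ = u⁻¹ Φ := by
    rw [Equiv.Perm.mul_apply] at e
    rw [Equiv.Perm.eq_inv_iff_eq, e]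
  obtain ⟨x, hx, ex⟩ := O_inter (S := S) (e := a+1) (f := b) (a := a+1) (b := b+1) (c := a) (d := b) hb (by omega) ⟨t, ht, rfl⟩ ⟨u⁻¹, inv_mem hu, e1.symm⟩
    (by omega) (by omega) (by omega)
  have t1 : t = x := h2.eq ht (S.W_le le_rfl (by omega) hx) ex.symm
  have t2 : u⁻¹ = x := h1.eq (inv_mem hu) (S.W_le (by omega) le_rfl hx) (by rw [ex, e1])
  rw [t1, ← t2]; simp

/-- dual system -/
noncomputable def dual (S : Sys n Ω) : Sys n Ω where
  r i := if i < n then S.r (n-1-i) else 1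
  T := S.T
  f j := if j < n then S.f (n-1-j) else S.f j
  χ := S.χ
  r_sq i Φ := by split_ifs <;> simp [S.r_sq]
  f_r i j Φ h := by
    split_ifs
    · exact S.f_r _ _ _ (by omega)
    · rfl
    · exact S.f_r _ _ _ (by omega)
    · rfl
  f_r_self i Φ hi := by simp only [hi, if_true]; exact S.f_r_self _ _ (by omega)
  comm i j Φ hij hj := by
    simp only [hj, show i < n by omega, if_true]
    exact (S.comm _ _ _ (by omega) (by omega)).symm
  conn a b Φ Ψ hab hb h := by
    obtain ⟨w, hw, e⟩ := S.conn (n-b) (n-a) Φ Ψ (by omega) (by omega) (by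
      intro j hj hh
      have := h (n-1-j) (by omega) (by omega)
      simpa [show n-1-j < n by omega, show n - 1 - (n-1-j) = j by omega] using this)
    refine ⟨w, ?_, e⟩
    refine Subgroup.closure_mono ?_ hw
    rintro g ⟨i, h1, h2, rfl⟩
    refine ⟨n-1-i, by omega, by omega, ?_⟩
    simp [show n-1-i < n by omega, show n - 1 - (n-1-i) = i by omega]
  χ_r i Φ hi := by simp only [hi, if_true]; exact S.χ_r _ _ (by omega)
  aut Φ Ψ h := by
    obtain ⟨g, h1, h2⟩ := S.aut Φ Ψ h
    refine ⟨g, h1, fun i hi Θ => ?_⟩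
    simp only [hi, if_true]; exact h2 _ (by omega) _
  nf1 h := by
    refine S.nf2 fun w hw Φ e => h w ?_ Φ e
    refine Subgroup.closure_mono ?_ hw
    rintro g ⟨i, h1, h2, rfl⟩
    refine ⟨n-1-i, by omega, by omega, ?_⟩
    simp [show n-1-i < n by omega, show n - 1 - (n-1-i) = i by omega]
  nf2 h := by
    refine S.nf1 fun w hw Φ e => h w ?_ Φ e
    refine Subgroup.closure_mono ?_ hw
    rintro g ⟨i, h1, h2, rfl⟩
    refine ⟨n-1-i, by omega, by omega, ?_⟩
    simp [show n-1-i < n by omega, show n - 1 - (n-1-i) = i by omega]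

theorem dual_r (i : ℕ) (hi : i < n) : S.dual.r i = S.r (n-1-i) := by
  simp [dual, hi]

theorem dual_W {a b : ℕ} (hb : b ≤ n) : S.dual.W a b = S.W (n-b) (n-a) := by
  apply le_antisymm
  · refine (Subgroup.closure_le _).2 ?_
    rintro g ⟨i, h1, h2, rfl⟩
    rw [dual_r _ (by omega)]
    exact S.r_mem (by omega) (by omega)
  · refine (Subgroup.closure_le _).2 ?_
    rintro g ⟨i, h1, h2, rfl⟩
    have := S.dual.r_mem (a := a) (b := b) (i := n-1-i) (by omega) (by omega)
    rwa [dual_r _ (by omega), show n - 1 - (n-1-i) = i by omega] at this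

theorem dual_O {a b : ℕ} (hb : b ≤ n) (Φ : Ω) : S.dual.O a b Φ = S.O (n-b) (n-a) Φ := by
  unfold O; rw [dual_W hb]

theorem dual_N {a b : ℕ} (hb : b ≤ n) : S.dual.N a b = S.N (n-b) (n-a) := by
  unfold N; rw [dual_O hb, ncard_O (by omega)]

theorem dual_free {a b : ℕ} (hb : b ≤ n) : S.dual.Free a b ↔ S.Free (n-b) (n-a) := by
  unfold Free; rw [dual_W hb]

theorem dual_flat {a b : ℕ} (hb : b ≤ n) (hab : a < b) : S.dual.Flat a b ↔ S.Flat (n-b) (n-a) := by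
  have e : n - b + 1 = n - (b-1) := by omega
  have e' : n - (a+1) = n - a - 1 := by omega
  constructor
  · intro h Φ Ψ hΨ
    have := h.symm Φ Ψ (by rwa [dual_O hb])
    rw [dual_O (by omega)] at this
    obtain ⟨Θ, h1, h2⟩ := this
    rw [dual_O (by omega)] at h2
    exact ⟨Θ, by rwa [← e'], by rwa [e]⟩
  · intro h Φ Ψ hΨ
    rw [dual_O hb] at hΨ
    obtain ⟨Θ, h1, h2⟩ := h.symm Φ Ψ hΨ
    rw [e] at h1
    rw [← e'] at h2
    exact ⟨Θ, by rwa [dual_O (by omega)], by rwa [dual_O (by omega)]⟩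

end Sys

open scoped Classical
set_option linter.unusedSectionVars false
set_option linter.unusedVariables false
namespace Sys
variable {n : ℕ} {Ω : Type} {S : Sys n Ω} [Finite Ω]

variable (S) in
/-- the other end of the edge -/
def kap (a : ℕ) (Ψ : Ω) : S.T := S.f a (S.r a Ψ)

variable (S) in
def Q3 (a : ℕ) : Prop := ∀ Ψ, S.kap a (S.r (a+1) Ψ) ≠ S.kap a Ψ

variable (S) in
def Kf (a b : ℕ) (Φ : Ω) : Set Ω := {Ψ | Ψ ∈ S.O (a+1) b Φ ∧ S.kap a Ψ = S.kap a Φ}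

theorem kap_r {a j : ℕ} (h : a + 1 < j) (hj : j < n) (Ψ : Ω) : S.kap a (S.r j Ψ) = S.kap a Ψ := by
  unfold kap; rw [S.comm a j _ h hj, S.f_r _ _ _ (by omega)]

theorem kap_O {a b : ℕ} (hb : b ≤ n) {Φ Ψ : Ω} (h : Ψ ∈ S.O (a+2) b Φ) : S.kap a Ψ = S.kap a Φ := by
  obtain ⟨w, hw, rfl⟩ := h
  refine S.W_ind (p := fun w => S.kap a (w Φ) = S.kap a Φ) rfl ?_ w hw
  intro i h1 h2 w _ ih
  rw [Equiv.Perm.mul_apply, kap_r (by omega) (by omega), ih]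

theorem kap_mem {a b : ℕ} (hab : a < b) {Φ Ψ : Ω} (h : Ψ ∈ S.O (a+1) b Φ) :
    S.r a Ψ ∈ S.O a b (S.r a Φ) := by
  have h1 : S.r a Φ ∈ S.O a b Φ := O_r le_rfl hab
  have h2 : Ψ ∈ S.O a b Φ := O_le (by omega) le_rfl h
  exact O_r' le_rfl hab (O_trans (O_symm h1) h2)

theorem kap_aut {g : Equiv.Perm Ω} (hg : ∀ i < n, ∀ Θ, g (S.r i Θ) = S.r i (g Θ)) {a b : ℕ} (hab : a < b)
    (hb : b ≤ n) {Φ Ψ : Ω} (h : Ψ ∈ S.O (a+1) b Φ) :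
    S.kap a (g Ψ) = S.kap a (g Φ) ↔ S.kap a Ψ = S.kap a Φ := by
  unfold kap
  rw [← hg a (by omega), ← hg a (by omega), aut_f hg hab hb (kap_mem hab h)]

variable (S) in
noncomputable def k (a b : ℕ) : ℕ := (S.Kf a b S.nonempty.some).ncard

theorem ncard_K {a b : ℕ} (hQ : S.Q3 a) (hab : a + 2 ≤ b) (hb : b ≤ n) (Φ : Ω) :
    (S.Kf a b Φ).ncard = S.k a b := by
  have key : ∀ Φ Ψ, (S.χ Φ ↔ S.χ Ψ) → (S.Kf a b Φ).ncard = (S.Kf a b Ψ).ncard := by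
    intro Φ Ψ h
    obtain ⟨g, rfl, hg⟩ := S.aut Φ Ψ h
    rw [← Set.ncard_image_of_injective _ g.injective]
    congr 1
    ext Θ
    constructor
    · rintro ⟨x, ⟨hx, hx'⟩, rfl⟩
      exact ⟨(aut_O hg hb).2 hx, (kap_aut hg (by omega) hb hx).2 hx'⟩
    · rintro ⟨h, h'⟩
      have e : Θ = g (g.symm Θ) := by simp
      rw [e] at h h'
      have h2 := (aut_O hg hb).1 h
      exact ⟨g.symm Θ, ⟨h2, (kap_aut hg (by omega) hb h2).1 h'⟩, by simp⟩
  unfold k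
  by_cases h : (S.χ Φ ↔ S.χ S.nonempty.some)
  · exact key _ _ h
  · rcases hab.eq_or_lt with e | hab'
    · subst e
      have : ∀ Φ, S.Kf a (a+2) Φ = {Φ} := by
        intro Φ
        apply Set.eq_singleton_iff_unique_mem.2
        refine ⟨⟨S.O_self _ _ _, rfl⟩, ?_⟩
        rintro Ψ ⟨⟨w, hw, rfl⟩, h2⟩
        have := S.W_ind (a := a+1) (b := a+2) (p := fun w => w Φ = Φ ∨ w Φ = S.r (a+1) Φ) (Or.inl rfl) (by
          intro i h1 h2 w _ ih
          have : i = a+1 := by omega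
          subst this
          rcases ih with ih | ih
          · right; rw [Equiv.Perm.mul_apply, ih]
          · left; rw [Equiv.Perm.mul_apply, ih]; exact S.r_sq _ _) w hw
        rcases this with this | this
        · exact this
        · rw [this] at h2; exact absurd h2 (hQ Φ)
      rw [this, this]; simp
    · have : S.Kf a b Φ = S.Kf a b (S.r (b-1) Φ) := by
        unfold Kf
        rw [O_eq (O_r (S := S) (Φ := Φ) (i := b-1) (by omega) (by omega)), kap_r (by omega) (by omega)]
      rw [this]
      apply key
      rw [S.χ_r _ Φ (by omega)]
      tauto

variable (S) in
noncomputable def c (a b : ℕ) : ℕ := S.N (a+1) b / S.k a b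

variable (S) in
noncomputable def s (a b : ℕ) : ℕ := S.k a b / S.N (a+2) b

theorem k_pos (a b : ℕ) : 0 < S.k a b := by
  unfold k; rw [Set.ncard_pos]; exact ⟨_, S.O_self _ _ _, rfl⟩

section



theorem ncard_kap {a b : ℕ} (hQ : S.Q3 a) (hab : a + 2 ≤ b) (hb : b ≤ n) (Φ : Ω) : (S.kap a '' S.O (a+1) b Φ).ncard = S.c a b := by
  have : S.N (a+1) b = (S.kap a '' S.O (a+1) b Φ).ncard * S.k a b := by
    rw [← ncard_O (a := a+1) hb Φ]
    apply ncard_fiber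
    intro Ψ hΨ
    rw [← ncard_K hQ hab hb Ψ]
    unfold Kf
    rw [O_eq hΨ]
  unfold c
  rw [this, Nat.mul_div_cancel _ (k_pos a b)]

theorem c_mul_k {a b : ℕ} (hQ : S.Q3 a) (hab : a + 2 ≤ b) (hb : b ≤ n) : S.c a b * S.k a b = S.N (a+1) b := by
  have := ncard_kap hQ hab hb S.nonempty.some
  rw [← this]
  rw [← ncard_O (a := a+1) hb S.nonempty.some]
  symm
  apply ncard_fiber
  intro Ψ hΨ
  rw [← ncard_K hQ hab hb Ψ]
  unfold Kf
  rw [O_eq hΨ]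

theorem ncard_s {a b : ℕ} (hQ : S.Q3 a) (hab : a + 2 ≤ b) (hb : b ≤ n) (Φ : Ω) : (S.f (a+1) '' S.Kf a b Φ).ncard * S.N (a+2) b = S.k a b := by
  rw [← ncard_K hQ hab hb Φ]
  symm
  apply ncard_fiber
  rintro Ψ ⟨h1, h2⟩
  rw [← ncard_O (a := a+2) hb Ψ]
  congr 1
  ext Θ
  constructor
  · rintro ⟨⟨h3, h4⟩, h5⟩
    exact (O_vertex (by omega) hb (O_trans (O_symm h1) h3)).1 h5
  · intro h
    have h' : Θ ∈ S.O (a+1) b Ψ := O_le (by omega) le_rfl h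
    exact ⟨⟨O_trans h1 h', (kap_O hb h).trans h2⟩, (O_vertex (by omega) hb h').2 h⟩

theorem ncard_s' {a b : ℕ} (hQ : S.Q3 a) (hab : a + 2 ≤ b) (hb : b ≤ n) (Φ : Ω) : (S.f (a+1) '' S.Kf a b Φ).ncard = S.s a b := by
  unfold s
  rw [← ncard_s hQ hab hb Φ, Nat.mul_div_cancel _ (S.N_pos _ _)]

theorem s_mul {a b : ℕ} (hQ : S.Q3 a) (hab : a + 2 ≤ b) (hb : b ≤ n) : S.s a b * S.N (a+2) b = S.k a b := by
  rw [← ncard_s' hQ hab hb S.nonempty.some]; exact ncard_s hQ hab hb _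

theorem c_mul_s {a b : ℕ} (hQ : S.Q3 a) (hab : a + 2 ≤ b) (hb : b ≤ n) : S.c a b * S.s a b = S.v (a+1) b := by
  have h1 := c_mul_k hQ hab hb
  rw [← s_mul hQ hab hb, ← mul_assoc] at h1
  unfold v
  rw [← h1, Nat.mul_div_cancel _ (S.N_pos _ _)]

theorem c_lt_v {a b : ℕ} (hQ : S.Q3 a) (hab : a + 2 ≤ b) (hb : b ≤ n) : S.c a b + 1 ≤ S.v a b := by
  have Φ := S.nonempty.some
  rw [← ncard_kap hQ hab hb Φ, ← ncard_v (by omega) hb Φ]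
  have hnot : S.f a Φ ∉ S.kap a '' S.O (a+1) b Φ := by
    rintro ⟨Ψ, hΨ, e⟩
    have h1 : S.f a Ψ = S.f a Φ := O_f hΨ (by omega)
    exact S.f_r_self a Ψ (by omega) (e.trans h1.symm)
  rw [← Set.ncard_insert_of_notMem hnot ((Set.toFinite _).image _)]
  apply Set.ncard_le_ncard _ ((Set.toFinite _).image _)
  rintro x (rfl | ⟨Ψ, hΨ, rfl⟩)
  · exact ⟨Φ, S.O_self _ _ _, rfl⟩
  · exact ⟨S.r a Ψ, O_r' le_rfl (by omega) (O_le (by omega) le_rfl hΨ), rfl⟩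

theorem c_mono {a b : ℕ} (hQ : S.Q3 a) (hab : a + 2 ≤ b) (hb : b ≤ n) {b' : ℕ} (h : b ≤ b') (hb' : b' ≤ n) : S.c a b ≤ S.c a b' := by
  rw [← ncard_kap hQ hab hb S.nonempty.some, ← ncard_kap hQ (by omega) hb' S.nonempty.some]
  apply Set.ncard_le_ncard _ ((Set.toFinite _).image _)
  apply Set.image_mono
  intro x hx; exact O_le le_rfl h hx

theorem s_mono {a b : ℕ} (hQ : S.Q3 a) (hab : a + 2 ≤ b) (hb : b ≤ n) {b' : ℕ} (h : b ≤ b') (hb' : b' ≤ n) : S.s a b ≤ S.s a b' := by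
  rw [← ncard_s' hQ hab hb S.nonempty.some, ← ncard_s' hQ (by omega) hb' S.nonempty.some]
  apply Set.ncard_le_ncard _ ((Set.toFinite _).image _)
  apply Set.image_mono
  rintro x ⟨hx, hx'⟩; exact ⟨O_le le_rfl h hx, hx'⟩

theorem c_pos {a b : ℕ} (hQ : S.Q3 a) (hab : a + 2 ≤ b) (hb : b ≤ n) : 0 < S.c a b := by
  have := c_mul_k hQ hab hb
  have := S.N_pos (a+1) b
  by_contra h
  have : S.c a b = 0 := by omega
  simp_all

theorem s_pos {a b : ℕ} (hQ : S.Q3 a) (hab : a + 2 ≤ b) (hb : b ≤ n) : 0 < S.s a b := by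
  have := s_mul hQ hab hb
  have := k_pos (S := S) a b
  by_contra h
  have : S.s a b = 0 := by omega
  simp_all

theorem flat_of_c {a b : ℕ} (hQ : S.Q3 a) (hab : a + 2 ≤ b) (hb : b ≤ n) (hab' : a + 3 ≤ b) (h : S.c a b ≤ S.c a (b-1)) : S.Flat a b := by
  have heq : ∀ Φ, S.kap a '' S.O (a+1) (b-1) Φ = S.kap a '' S.O (a+1) b Φ := by
    intro Φ
    apply Set.eq_of_subset_of_ncard_le
    · apply Set.image_mono
      intro x hx; exact O_le le_rfl (by omega) hx
    · rw [ncard_kap hQ hab hb, ncard_kap hQ (by omega) (by omega)]; exact h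
    · exact (Set.toFinite _).image _
  rintro Φ Ψ ⟨w, hw, rfl⟩
  refine S.W_ind (p := fun w => ∃ Θ ∈ S.O a (b-1) Φ, w Φ ∈ S.O (a+1) b Θ)
    ⟨Φ, S.O_self _ _ _, S.O_self _ _ _⟩ ?_ w hw
  rintro i h1 h2 w hw ⟨Θ, h3, h4⟩
  by_cases e : i = a
  · subst e
    have : S.kap i (w Φ) ∈ S.kap i '' S.O (i+1) b Θ := ⟨_, h4, rfl⟩
    rw [← heq] at this
    obtain ⟨Λ, hΛ, e⟩ := this
    refine ⟨S.r i Λ, O_r' le_rfl (by omega) (O_trans h3 (O_le (by omega) le_rfl hΛ)), ?_⟩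
    rw [Equiv.Perm.mul_apply]
    refine (O_vertex (by omega) hb ?_).1 e.symm
    have hh : w Φ ∈ S.O (i+1) b Λ := O_trans (O_symm (O_le le_rfl (by omega) hΛ)) h4
    exact kap_mem (by omega) hh
  · exact ⟨Θ, h3, O_r' (by omega) h2 h4⟩

theorem handshake {a b : ℕ} (hQ : S.Q3 a) (hab : a + 2 ≤ b) (hb : b ≤ n) : 2 ∣ S.v a b * S.c a b := by
  have Φ := S.nonempty.some
  let g : Ω → S.T × S.T := fun Ψ => (S.f a Ψ, S.kap a Ψ)
  have h1 : (g '' S.O a b Φ).ncard = S.v a b * S.c a b := by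
    rw [← ncard_v (by omega) hb Φ]
    have e : S.f a '' S.O a b Φ = Prod.fst '' (g '' S.O a b Φ) := by
      rw [← Set.image_comp]; rfl
    rw [e]
    have hfin : Finite (g '' S.O a b Φ) := ((Set.toFinite _).image _).to_subtype
    have := ncard_fiber (α := g '' S.O a b Φ) Set.univ (fun x => x.1.1) (S.c a b) (by
      rintro ⟨_, Ψ, hΨ, rfl⟩ -
      rw [← ncard_kap hQ hab hb Ψ]
      refine (Set.ncard_image_of_injective (f := fun x : (g '' S.O a b Φ) => x.1) _
        Subtype.val_injective).symm.trans (Eq.trans ?_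
        (Set.ncard_image_of_injective (f := fun x => (S.f a Ψ, x)) _ (fun x y h => (Prod.mk.inj h).2)))
      congr 1
      ext ⟨x, y⟩
      constructor
      · rintro ⟨⟨_, Θ, hΘ, rfl⟩, ⟨-, h2⟩, h3⟩
        dsimp [g] at h2 h3
        have : Θ ∈ S.O (a+1) b Ψ := (O_vertex (by omega) hb (O_trans (O_symm hΨ) hΘ)).1 h2
        exact ⟨S.kap a Θ, ⟨Θ, this, rfl⟩, by rw [← h3, h2]⟩
      · rintro ⟨_, ⟨Θ, hΘ, rfl⟩, h3⟩
        refine ⟨⟨g Θ, Θ, O_trans hΨ (O_le (by omega) le_rfl hΘ), rfl⟩, ⟨trivial, ?_⟩, ?_⟩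
        · exact O_f hΘ (by omega)
        · rw [← h3]; dsimp [g]; rw [O_f hΘ (by omega)])
    rw [Set.ncard_univ, Nat.card_coe_set_eq] at this
    rw [this]
    congr 2
    ext x
    simp
  rw [← h1]
  have hfin : (g '' S.O a b Φ).Finite := (Set.toFinite _).image _
  rw [Set.ncard_eq_toFinset_card _ hfin]
  have : ((hfin.toFinset.card : ℕ) : ZMod 2) = 0 := by
    rw [Finset.cast_card]
    refine Finset.sum_involution (fun x _ => x.swap) ?_ ?_ ?_ ?_
    · intros; decide
    · rintro x hx -
      rw [Set.Finite.mem_toFinset] at hx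
      obtain ⟨Ψ, hΨ, rfl⟩ := hx
      intro h
      exact S.f_r_self a Ψ (by omega) (congrArg Prod.fst h)
    · intro x hx
      rw [Set.Finite.mem_toFinset] at hx ⊢
      obtain ⟨Ψ, hΨ, rfl⟩ := hx
      refine ⟨S.r a Ψ, O_r' le_rfl (by omega) hΨ, ?_⟩
      dsimp [g, kap]; rw [S.r_sq]
    · intro x _; simp
  exact (ZMod.natCast_eq_zero_iff _ 2).1 this

end

theorem O_one {a : ℕ} {Φ Ψ : Ω} (h : Ψ ∈ S.O a (a+1) Φ) : Ψ = Φ ∨ Ψ = S.r a Φ := by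
  obtain ⟨w, hw, rfl⟩ := h
  refine S.W_ind (p := fun w => w Φ = Φ ∨ w Φ = S.r a Φ) (Or.inl rfl) ?_ w hw
  intro i h1 h2 w _ ih
  have : i = a := by omega
  subst this
  rcases ih with ih | ih
  · right; rw [Equiv.Perm.mul_apply, ih]
  · left; rw [Equiv.Perm.mul_apply, ih]; exact S.r_sq _ _

theorem c_two {a : ℕ} (hQ : S.Q3 a) (ha : a + 2 ≤ n) : S.c a (a+2) = 2 := by
  have Φ := S.nonempty.some
  rw [← ncard_kap hQ le_rfl ha Φ]
  have : S.kap a '' S.O (a+1) (a+2) Φ = {S.kap a Φ, S.kap a (S.r (a+1) Φ)} := by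
    ext x
    constructor
    · rintro ⟨Ψ, hΨ, rfl⟩
      rcases O_one hΨ with rfl | rfl <;> simp
    · rintro (rfl | rfl)
      · exact ⟨Φ, S.O_self _ _ _, rfl⟩
      · exact ⟨_, O_r le_rfl (by omega), rfl⟩
  rw [this, Set.ncard_pair (hQ Φ).symm]

theorem s_two {a : ℕ} (hQ : S.Q3 a) (ha : a + 2 ≤ n) : S.s a (a+2) = 1 := by
  have h1 := c_mul_s hQ le_rfl ha
  rw [c_two hQ ha, v_one (by omega)] at h1
  omega

theorem comm_of_not_Q3 {a : ℕ} (ha : a + 2 ≤ n) (h : ¬ S.Q3 a) :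
    ∃ Ψ, S.r a (S.r (a+1) Ψ) = S.r (a+1) (S.r a Ψ) := by
  unfold Q3 at h
  push Not at h
  obtain ⟨Ψ, hΨ⟩ := h
  refine ⟨Ψ, ?_⟩
  have h1 : S.r a (S.r (a+1) Ψ) ∈ S.O a (a+2) (S.r a Ψ) :=
    kap_mem (by omega) (O_r (by omega) (by omega))
  rcases O_one ((O_vertex (by omega) ha h1).1 hΨ) with h2 | h2
  · have := (S.r a).injective h2
    exact absurd (by rw [this]) (S.f_r_self (a+1) Ψ (by omega))
  · exact h2

/-- nonflat polygons have at least three vertices -/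
theorem Q3_of_nonflat {a : ℕ} (ha : a + 2 ≤ n) (h : ¬ S.Flat a (a+2)) : S.Q3 a := by
  by_contra hQ
  obtain ⟨Ψ, hΨ⟩ := comm_of_not_Q3 ha hQ
  apply h
  apply flat_of_v (by omega) ha
  rw [show a + 2 - 1 = a + 1 by omega, v_one (by omega), ← ncard_v (by omega) ha Ψ]
  have : S.f a '' S.O a (a+2) Ψ ⊆ {S.f a Ψ, S.kap a Ψ} := by
    rintro _ ⟨Θ, ⟨w, hw, rfl⟩, rfl⟩
    have key : w Ψ = Ψ ∨ w Ψ = S.r a Ψ ∨ w Ψ = S.r (a+1) Ψ ∨ w Ψ = S.r a (S.r (a+1) Ψ) := by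
      refine S.W_ind (p := fun w => w Ψ = Ψ ∨ w Ψ = S.r a Ψ ∨ w Ψ = S.r (a+1) Ψ ∨
        w Ψ = S.r a (S.r (a+1) Ψ)) (Or.inl rfl) ?_ w hw
      intro i h1 h2 w _ ih
      rw [Equiv.Perm.mul_apply]
      rcases (show i = a ∨ i = a+1 by omega) with rfl | rfl
      · rcases ih with ih | ih | ih | ih <;> rw [ih]
        · right; left; rfl
        · left; rw [S.r_sq]
        · right; right; right; rfl
        · right; right; left; rw [S.r_sq]
      · rcases ih with ih | ih | ih | ih <;> rw [ih]
        · right; right; left; rfl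
        · right; right; right; rw [hΨ]
        · left; rw [S.r_sq]
        · right; left; rw [hΨ, S.r_sq]
    rcases key with h | h | h | h <;> rw [h]
    · left; rfl
    · right; rfl
    · left; exact S.f_r _ _ _ (by omega)
    · right; rw [hΨ]; exact S.f_r _ _ _ (by omega)
  exact (Set.ncard_le_ncard this).trans ((Set.ncard_insert_le _ _).trans (by simp))

theorem Q3_zero (hn : 4 ≤ n) (S : Sys n Ω) : S.Q3 0 := by
  by_contra hQ
  obtain ⟨Ψ, hΨ⟩ := comm_of_not_Q3 (by omega) hQ
  have hf : S.Free 0 2 := free_right (by omega)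
  have hc : S.r 0 * S.r 1 = S.r 1 * S.r 0 :=
    hf.eq (Φ := Ψ) (mul_mem (S.r_mem (by omega) (by omega)) (S.r_mem (by omega) (by omega)))
      (mul_mem (S.r_mem (by omega) (by omega)) (S.r_mem (by omega) (by omega))) hΨ
  refine S.nf1 (free_of_comm (S := S) (a := 0) (b := n-1) (by omega) (i := 0) (by omega) ?_)
  intro j h1 h2
  rcases (show j = 0 ∨ j = 1 ∨ 1 < j by omega) with rfl | rfl | h
  · rfl
  · exact hc
  · exact S.r_comm (by omega) (by omega)

/-- nonflatness is hereditary -/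
theorem flat_up {a b c d : ℕ} (hca : c ≤ a) (hab : a + 1 < b) (hbd : b ≤ d) (hd : d ≤ n)
    (h : S.Flat a b) : S.Flat c d := by
  have h1 : ∀ e, b + e ≤ n → S.Flat a (b+e) := by
    intro e
    induction e with
    | zero => intro _; exact h
    | succ e ih => intro he; exact flat_succ (b := b+e) (by omega) (by omega) (ih (by omega))
  have h2 : S.Flat a d := by
    have := h1 (d - b) (by omega)
    rwa [show b + (d-b) = d by omega] at this
  have h3 : ∀ e ≤ a, S.Flat (a - e) d := by
    intro e
    induction e with
    | zero => intro _; exact h2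
    | succ e ih =>
      intro he
      have := ih (by omega)
      have h4 : S.dual.Flat (n-d) (n-(a-e)) := by
        rw [dual_flat (by omega) (by omega)]
        rwa [show n - (n-(a-e)) = a - e by omega, show n - (n-d) = d by omega]
      have h5 := flat_succ (by omega) (by omega) h4
      rw [dual_flat (by omega) (by omega)] at h5
      rwa [show n - (n-(a-e)+1) = a - (e+1) by omega, show n - (n-d) = d by omega] at h5
  have := h3 (a - c) (by omega)
  rwa [show a - (a-c) = c by omega] at this

theorem nonflat_v {a b : ℕ} (hab : a < b) (hb : b ≤ n) (h : ¬ S.Flat a b) : b - a + 1 ≤ S.v a b := by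
  have key : ∀ e, a + 1 + e ≤ b → e + 2 ≤ S.v a (a+1+e) := by
    intro e
    induction e with
    | zero => intro _; rw [Nat.add_zero, v_one (by omega)]
    | succ e ih =>
      intro he
      have h1 := ih (by omega)
      have h2 := v_lt (S := S) (a := a) (b := a+1+(e+1)) (by omega) (by omega)
        (fun hf => h (flat_up le_rfl (by omega) he hb hf))
      rw [show a + 1 + (e+1) - 1 = a + 1 + e by omega] at h2
      omega
  have := key (b - a - 1) (by omega)
  rw [show a + 1 + (b - a - 1) = b by omega] at this
  omega

theorem nonflat_N {a b : ℕ} (hab : a ≤ b) (hb : b ≤ n) (h : ¬ S.Flat a b ∨ b ≤ a + 1) :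
    (b - a + 1).factorial ≤ S.N a b := by
  obtain ⟨d, hd⟩ : ∃ d, d = b - a := ⟨_, rfl⟩
  induction d generalizing a with
  | zero =>
    rw [show b - a = 0 by omega]; simp; exact S.N_pos a b
  | succ d ih =>
    have h1 := ih (a := a+1) (by omega) (by
      rcases h with h | h
      · by_cases e : b ≤ a + 1 + 1
        · right; exact e
        · left; exact fun hf => h (flat_up (by omega) (by omega) le_rfl hb hf)
      · right; omega) (by omega)
    have h2 : b - a + 1 ≤ S.v a b := by
      rcases h with h | h
      · exact nonflat_v (by omega) hb h
      · have : b = a + 1 := by omega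
        subst this; rw [v_one (by omega)]; omega
    rw [← v_mul (by omega) hb, show b - a + 1 = (b - (a+1) + 1) + 1 by omega, Nat.factorial_succ]
    apply Nat.mul_le_mul _ h1
    omega

end Sys

open scoped Classical
set_option linter.unusedSectionVars false
set_option linter.unusedVariables false

/-- the subgroup generated by `s i`, `a ≤ i < b` -/
def GW {G : Type*} [Group G] (s : ℕ → G) (a b : ℕ) : Subgroup G :=
  Subgroup.closure {x | ∃ i, a ≤ i ∧ i < b ∧ x = s i}

/-- type A Coxeter relations -/
structure TA {G : Type*} [Group G] (s : ℕ → G) (a b : ℕ) : Prop where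
  sq : ∀ i, a ≤ i → i < b → s i * s i = 1
  br : ∀ i, a ≤ i → i + 1 < b → s i * s (i+1) * s i = s (i+1) * s i * s (i+1)
  cm : ∀ i j, a ≤ i → i + 1 < j → j < b → s i * s j = s j * s i

namespace TA
variable {G : Type*} [Group G] {s : ℕ → G} {a b : ℕ}

theorem mono {c d : ℕ} (h : TA s a b) (h1 : a ≤ c) (h2 : d ≤ b) : TA s c d where
  sq i hi hi' := h.sq i (by omega) (by omega)
  br i hi hi' := h.br i (by omega) (by omega)
  cm i j hi hij hj := h.cm i j (by omega) hij (by omega)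

theorem mem {i : ℕ} (h1 : a ≤ i) (h2 : i < b) : s i ∈ GW s a b :=
  Subgroup.subset_closure ⟨i, h1, h2, rfl⟩

theorem GW_mono {c d : ℕ} (h1 : c ≤ a) (h2 : b ≤ d) : GW s a b ≤ GW s c d := by
  apply Subgroup.closure_mono
  rintro _ ⟨i, h3, h4, rfl⟩
  exact ⟨i, by omega, by omega, rfl⟩

theorem ind (hsq : ∀ i, a ≤ i → i < b → s i * s i = 1) {p : G → Prop} (h1 : p 1)
    (h2 : ∀ i, a ≤ i → i < b → ∀ w ∈ GW s a b, p w → p (s i * w)) : ∀ w ∈ GW s a b, p w := by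
  intro w hw
  induction hw using Subgroup.closure_induction_left with
  | one => exact h1
  | mul_left x hx y hy hp =>
    obtain ⟨i, hi1, hi2, rfl⟩ := hx
    exact h2 i hi1 hi2 y hy hp
  | inv_mul_cancel x hx y hy hp =>
    obtain ⟨i, hi1, hi2, rfl⟩ := hx
    have : (s i)⁻¹ = s i := by
      rw [inv_eq_iff_mul_eq_one]; exact hsq i hi1 hi2
    rw [this]
    exact h2 i hi1 hi2 y hy hp

/-- coset representatives -/
def cc (s : ℕ → G) (a : ℕ) : ℕ → G
  | 0 => 1
  | j+1 => s (a+j) * cc s a j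

theorem cc_mem {j : ℕ} (hj : a + j ≤ b) : cc s a j ∈ GW s a b := by
  induction j with
  | zero => exact one_mem _
  | succ j ih => exact mul_mem (mem (by omega) (by omega)) (ih (by omega))

theorem cc_comm (h : TA s a b) {i j : ℕ} (hi : a + j < i) (hib : i < b) :
    s i * cc s a j = cc s a j * s i := by
  induction j with
  | zero => simp [cc]
  | succ j ih =>
    have h1 := h.cm (a+j) i (by omega) (by omega) hib
    simp only [cc]
    rw [← mul_assoc, ← h1, mul_assoc, ih (by omega), mul_assoc]

theorem cc_shift (h : TA s a b) {i j : ℕ} (hi : i + 1 < j) (hj : a + j ≤ b) :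
    s (a+i) * cc s a j = cc s a j * s (a+i+1) := by
  induction j with
  | zero => omega
  | succ j ih =>
    rcases (show j = i + 1 ∨ i + 1 < j by omega) with rfl | hlt
    · simp only [cc]
      have h1 := h.br (a+i) (by omega) (by omega)
      have h2 := cc_comm h (i := a+i+1) (j := i) (by omega) (by omega)
      rw [show a + (i+1) = a+i+1 by omega]
      calc s (a+i) * (s (a+i+1) * (s (a+i) * cc s a i))
          = (s (a+i) * s (a+i+1) * s (a+i)) * cc s a i := by group
        _ = s (a+i+1) * s (a+i) * (s (a+i+1) * cc s a i) := by rw [h1]; group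
        _ = _ := by rw [h2]; group
    · simp only [cc]
      have h1 := h.cm (a+i) (a+j) (by omega) (by omega) (by omega)
      rw [← mul_assoc, h1, mul_assoc, ih hlt (by omega), mul_assoc]

theorem decomp (h : TA s a b) (hab : a ≤ b) : ∀ w ∈ GW s a b,
    ∃ j, a + j ≤ b ∧ ∃ k ∈ GW s (a+1) b, w = cc s a j * k := by
  refine ind h.sq ⟨0, by omega, 1, one_mem _, by simp [cc]⟩ ?_
  rintro i h1 h2 w _ ⟨j, hj, k, hk, rfl⟩
  obtain ⟨i, rfl⟩ : ∃ i', i = a + i' := ⟨i - a, by omega⟩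
  rcases (show j < i ∨ i = j ∨ i + 1 = j ∨ i + 1 < j by omega) with c | rfl | rfl | c
  · refine ⟨j, hj, s (a+i) * k, mul_mem (mem (by omega) (by omega)) hk, ?_⟩
    rw [← mul_assoc, cc_comm h (by omega) h2, mul_assoc]
  · exact ⟨i+1, by omega, k, hk, by simp [cc, mul_assoc]⟩
  · refine ⟨i, by omega, k, hk, ?_⟩
    simp only [cc]; rw [← mul_assoc, ← mul_assoc, h.sq _ h1 h2, one_mul]
  · refine ⟨j, hj, s (a+i+1) * k, mul_mem (mem (by omega) (by omega)) hk, ?_⟩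
    rw [← mul_assoc, cc_shift h c hj, mul_assoc]

theorem card_step [Finite G] (h : TA s a b) (hab : a ≤ b) :
    Nat.card (GW s a b) ≤ (b - a + 1) * Nat.card (GW s (a+1) b) := by
  have : Nat.card (GW s a b) ≤ Nat.card (Fin (b-a+1) × GW s (a+1) b) := by
    let F : Fin (b-a+1) × GW s (a+1) b → GW s a b := fun x =>
      ⟨cc s a x.1 * x.2, mul_mem (cc_mem (by have := x.1.2; omega)) (GW_mono (by omega) le_rfl x.2.2)⟩
    apply Nat.card_le_card_of_surjective F
    rintro ⟨w, hw⟩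
    obtain ⟨j, hj, k, hk, rfl⟩ := decomp h hab w hw
    exact ⟨(⟨j, by omega⟩, ⟨k, hk⟩), rfl⟩
  simpa using this

theorem card_le [Finite G] (h : TA s a b) (hab : a ≤ b) :
    Nat.card (GW s a b) ≤ (b - a + 1).factorial := by
  obtain ⟨m, hm⟩ : ∃ m, m = b - a := ⟨_, rfl⟩
  induction m generalizing a with
  | zero =>
    have : GW s a b = ⊥ := by
      unfold GW
      rw [Subgroup.closure_eq_bot_iff]
      rintro _ ⟨i, h1, h2, rfl⟩; omega
    rw [this]; simp; exact Nat.one_le_iff_ne_zero.2 (Nat.factorial_ne_zero _)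
  | succ m ih =>
    have h1 := ih (a := a+1) (h.mono (by omega) le_rfl) (by omega) (by omega)
    refine (card_step h hab).trans ?_
    rw [Nat.factorial_succ (b-a), show b - a = b - (a+1) + 1 by omega]
    exact Nat.mul_le_mul le_rfl h1

theorem exists_iso [Finite G] {m : ℕ} (h : TA s a (a+m))
    (hc : Nat.card (GW s a (a+m)) = (m+1).factorial) :
    ∃ φ : Equiv.Perm (Fin (m+1)) →* G, Function.Injective φ ∧ φ.range = GW s a (a+m) ∧
      ∀ i (hi : i < m), φ (Equiv.swap ⟨i, by omega⟩ ⟨i+1, by omega⟩) = s (a+i) := by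
  set W := GW s a (a+m) with hW
  set K := GW s (a+1) (a+m) with hK
  let KW : Subgroup W := K.subgroupOf W
  have hKW : K ≤ W := GW_mono (by omega) le_rfl
  let e0 : Fin (m+1) → W ⧸ KW := fun j => ((⟨cc s a j, cc_mem (by have := j.2; omega)⟩ : W) : W ⧸ KW)
  have hsurj : Function.Surjective e0 := by
    intro x
    induction x using QuotientGroup.induction_on with
    | H w =>
    obtain ⟨j, hj, k, hk, e⟩ := decomp h (by omega) w.1 w.2
    refine ⟨⟨j, by omega⟩, ?_⟩
    apply QuotientGroup.eq.2
    rw [Subgroup.mem_subgroupOf]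
    simp [e]; exact hk
  have hcK : Nat.card K ≤ m.factorial := by
    rcases Nat.eq_zero_or_pos m with rfl | hm
    · have := card_le (s := s) (a := a+1) (b := a+1) ⟨by intros; omega, by intros; omega, by intros; omega⟩ le_rfl
      have h2 : K ≤ GW s (a+1) (a+1) := GW_mono le_rfl (by omega)
      have := (Subgroup.card_le_of_le h2).trans this
      simpa using this
    · have := card_le (s := s) (h.mono (c := a+1) (d := a+m) (by omega) (by omega)) (by omega)
      rwa [show a + m - (a+1) + 1 = m by omega] at this
  have hcq : Nat.card (W ⧸ KW) = m + 1 := by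
    have h1 : Nat.card (W ⧸ KW) ≤ m + 1 := by
      have := Nat.card_le_card_of_surjective e0 hsurj
      simpa using this
    have h2 := Subgroup.card_eq_card_quotient_mul_card_subgroup KW
    rw [hc, show Nat.card KW = Nat.card K from Nat.card_congr (Subgroup.subgroupOfEquivOfLe hKW).toEquiv,
      Nat.factorial_succ] at h2
    by_contra hne
    have h3 : Nat.card (W ⧸ KW) ≤ m := by omega
    have h4 := Nat.mul_le_mul h3 hcK
    have := Nat.factorial_pos m
    nlinarith
  have hbij : Function.Bijective e0 := by
    rw [Nat.bijective_iff_surjective_and_card]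
    exact ⟨hsurj, by simp [hcq]⟩
  let e := Equiv.ofBijective e0 hbij
  let ψ : W →* Equiv.Perm (Fin (m+1)) :=
    (e.symm.permCongrHom.toMonoidHom).comp (MulAction.toPermHom W (W ⧸ KW))
  have hψ : ∀ i (hi : i < m), ψ ⟨s (a+i), mem (by omega) (by omega)⟩ = Equiv.swap ⟨i, by omega⟩ ⟨i+1, by omega⟩ := by
    intro i hi
    ext1 j
    have : ψ ⟨s (a+i), mem (by omega) (by omega)⟩ j = e.symm ((⟨s (a+i), mem (by omega) (by omega)⟩ : W) • e j) := rfl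
    rw [this, Equiv.symm_apply_eq]
    obtain ⟨j, hj⟩ := j
    change (((⟨s (a+i), mem (by omega) (by omega)⟩ : W) * ⟨cc s a j, cc_mem (by omega)⟩ : W) : W ⧸ KW) = _
    rcases (show (j:ℕ) < i ∨ i = (j:ℕ) ∨ i + 1 = (j:ℕ) ∨ i + 1 < j by omega) with c | c | c | c
    · rw [Equiv.swap_apply_of_ne_of_ne (by intro h; have h := congrArg Fin.val h; dsimp at h; omega) (by intro h; have h := congrArg Fin.val h; dsimp at h; omega)]
      apply QuotientGroup.eq.2
      rw [Subgroup.mem_subgroupOf]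
      simp only [Subgroup.coe_mul, Subgroup.coe_inv]
      rw [cc_comm h (by omega) (by omega)]
      rw [mul_inv_rev, mul_assoc, inv_mul_cancel, mul_one]
      exact inv_mem (mem (by omega) (by omega))
    · have c : i = j := c
      subst c
      rw [Equiv.swap_apply_left]
      rfl
    · have c : i + 1 = j := c
      subst c
      rw [Equiv.swap_apply_right]
      change _ = ((⟨cc s a i, cc_mem (by omega)⟩ : W) : W ⧸ KW)
      congr 1
      apply Subtype.ext
      simp only [Subgroup.coe_mul, cc]
      rw [← mul_assoc, h.sq _ (by omega) (by omega), one_mul]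
    · rw [Equiv.swap_apply_of_ne_of_ne (by intro h; have h := congrArg Fin.val h; dsimp at h; omega) (by intro h; have h := congrArg Fin.val h; dsimp at h; omega)]
      apply QuotientGroup.eq.2
      rw [Subgroup.mem_subgroupOf]
      simp only [Subgroup.coe_mul, Subgroup.coe_inv]
      rw [cc_shift h c (by omega)]
      rw [mul_inv_rev, mul_assoc, inv_mul_cancel, mul_one]
      exact inv_mem (mem (by omega) (by omega))
  have hsurjψ : Function.Surjective ψ := by
    rw [← MonoidHom.range_eq_top]
    have h1 := Equiv.Perm.mclosure_swap_castSucc_succ m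
    have h2 : Submonoid.closure (Set.range fun i : Fin m ↦ Equiv.swap i.castSucc i.succ) ≤ ψ.range.toSubmonoid := by
      rw [Submonoid.closure_le]
      rintro _ ⟨i, rfl⟩
      exact ⟨_, hψ i i.2⟩
    rw [h1] at h2
    rw [eq_top_iff]
    intro x _
    exact h2 trivial
  have hbijψ : Function.Bijective ψ := by
    rw [Nat.bijective_iff_surjective_and_card]
    refine ⟨hsurjψ, ?_⟩
    rw [hc, Nat.card_perm]; simp
  let E := MulEquiv.ofBijective ψ hbijψ
  refine ⟨W.subtype.comp E.symm.toMonoidHom, ?_, ?_, ?_⟩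
  · exact W.subtype_injective.comp E.symm.injective
  · ext x
    constructor
    · rintro ⟨y, rfl⟩; exact (E.symm y).2
    · intro hx
      exact ⟨E ⟨x, hx⟩, by simp⟩
  · intro i hi
    rw [← hψ i hi]
    change W.subtype (E.symm (E _)) = _
    simp

end TA

open scoped Classical
set_option linter.unusedSectionVars false
set_option linter.unusedVariables false

section GroupLemmas
variable {G : Type*} [Group G]

/-- `H ∩ g H g⁻¹` -/
def CC (H : Subgroup G) (g : G) : Subgroup G where
  carrier := {l | l ∈ H ∧ g⁻¹ * l * g ∈ H}
  one_mem' := ⟨one_mem _, by simp⟩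
  mul_mem' := by
    rintro x y ⟨h1, h2⟩ ⟨h3, h4⟩
    refine ⟨mul_mem h1 h3, ?_⟩
    have := mul_mem h2 h4
    rwa [show g⁻¹ * x * g * (g⁻¹ * y * g) = g⁻¹ * (x * y) * g by group] at this
  inv_mem' := by
    rintro x ⟨h1, h2⟩
    refine ⟨inv_mem h1, ?_⟩
    have := inv_mem h2
    rwa [show (g⁻¹ * x * g)⁻¹ = g⁻¹ * x⁻¹ * g by group] at this

theorem mem_CC {H : Subgroup G} {g l : G} : l ∈ CC H g ↔ l ∈ H ∧ g⁻¹ * l * g ∈ H := Iff.rfl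

/-- the `H`-orbit of the coset `g H` -/
def dcs (H : Subgroup G) (g : G) : Set (G ⧸ H) := {x | ∃ h ∈ H, x = ((h * g : G) : G ⧸ H)}

theorem mem_dcs_self (H : Subgroup G) (g : G) : (g : G ⧸ H) ∈ dcs H g := ⟨1, one_mem _, by simp⟩

theorem dcs_eq {H : Subgroup G} {g g' : G} {x : G ⧸ H} (h1 : x ∈ dcs H g) (h2 : x ∈ dcs H g') :
    dcs H g = dcs H g' := by
  have key : ∀ g g' : G, x ∈ dcs H g → x ∈ dcs H g' → dcs H g ⊆ dcs H g' := by
    rintro g g' ⟨h, hh, rfl⟩ ⟨h', hh', e⟩ _ ⟨h'', hh'', rfl⟩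
    refine ⟨h'' * h⁻¹ * h', mul_mem (mul_mem hh'' (inv_mem hh)) hh', ?_⟩
    rw [QuotientGroup.eq] at e ⊢
    convert e using 1; group
  exact Set.Subset.antisymm (key _ _ h1 h2) (key _ _ h2 h1)

theorem dcs_disj {H : Subgroup G} {g g' : G} (h : dcs H g ≠ dcs H g') : Disjoint (dcs H g) (dcs H g') := by
  rw [Set.disjoint_left]
  intro x h1 h2
  exact h (dcs_eq h1 h2)

theorem ncard_coe_sub (H : Subgroup G) : ((H : Set G)).ncard = Nat.card H := rfl

variable [Finite G]

theorem card_dcs (H : Subgroup G) (g : G) : (dcs H g).ncard * Nat.card (CC H g) = Nat.card H := by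
  have e : dcs H g = (fun h : G => ((h * g : G) : G ⧸ H)) '' (H : Set G) := by
    ext x; constructor
    · rintro ⟨h, hh, rfl⟩; exact ⟨h, hh, rfl⟩
    · rintro ⟨h, hh, rfl⟩; exact ⟨h, hh, rfl⟩
  rw [e, ← ncard_coe_sub H]
  symm
  apply ncard_fiber
  intro x hx
  rw [← ncard_coe_sub (CC H g)]
  have : {y | y ∈ (H : Set G) ∧ ((y * g : G) : G ⧸ H) = ((x * g : G) : G ⧸ H)} = (fun l => x * l) '' (CC H g : Set G) := by
    ext y
    constructor
    · rintro ⟨h1, h2⟩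
      refine ⟨x⁻¹ * y, ⟨mul_mem (inv_mem hx) h1, ?_⟩, by simp⟩
      rw [eq_comm, QuotientGroup.eq] at h2
      convert h2 using 1; group
    · rintro ⟨l, ⟨h1, h2⟩, rfl⟩
      refine ⟨mul_mem hx h1, ?_⟩
      rw [eq_comm, QuotientGroup.eq]
      convert h2 using 1; group
  rw [this, Set.ncard_image_of_injective _ (mul_right_injective x)]

/-- cosets of `H` in `W` -/
def cos (W H : Subgroup G) : Set (G ⧸ H) := (fun g : G => (g : G ⧸ H)) '' (W : Set G)

theorem card_cos {W H : Subgroup G} (h : H ≤ W) : (cos W H).ncard * Nat.card H = Nat.card W := by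
  rw [← ncard_coe_sub W]
  symm
  apply ncard_fiber
  intro x hx
  rw [← ncard_coe_sub H]
  have : {y | y ∈ (W : Set G) ∧ (y : G ⧸ H) = (x : G ⧸ H)} = (fun l => x * l) '' (H : Set G) := by
    ext y
    constructor
    · rintro ⟨h1, h2⟩
      refine ⟨x⁻¹ * y, ?_, by simp⟩
      rw [eq_comm, QuotientGroup.eq] at h2
      exact h2
    · rintro ⟨l, h1, rfl⟩
      refine ⟨mul_mem hx (h h1), ?_⟩
      rw [eq_comm, QuotientGroup.eq]
      simpa using h1
  rw [this, Set.ncard_image_of_injective _ (mul_right_injective x)]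

theorem dcs_sub {W H : Subgroup G} (h : H ≤ W) {g : G} (hg : g ∈ W) : dcs H g ⊆ cos W H := by
  rintro _ ⟨x, hx, rfl⟩
  exact ⟨x * g, mul_mem (h hx) hg, rfl⟩

theorem dcs_one (H : Subgroup G) : (dcs H 1).ncard = 1 := by
  rw [Set.ncard_eq_one]
  refine ⟨((1 : G) : G ⧸ H), ?_⟩
  ext x; constructor
  · rintro ⟨h, hh, rfl⟩
    rw [Set.mem_singleton_iff, eq_comm, QuotientGroup.eq]; simpa using hh
  · rintro rfl; exact mem_dcs_self _ _

theorem dcs_finite (H : Subgroup G) (g : G) : (dcs H g).Finite := Set.toFinite _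

theorem three_dcs {W H : Subgroup G} (h : H ≤ W) {g1 g2 : G} (h1 : g1 ∈ W) (h2 : g2 ∈ W)
    (n1 : dcs H g1 ≠ dcs H 1) (n2 : dcs H g2 ≠ dcs H 1) (n3 : dcs H g1 ≠ dcs H g2) :
    1 + (dcs H g1).ncard + (dcs H g2).ncard ≤ (cos W H).ncard := by
  rw [← dcs_one H, ← Set.ncard_union_eq (dcs_disj n1.symm), ← Set.ncard_union_eq]
  · exact Set.ncard_le_ncard (Set.union_subset (Set.union_subset (dcs_sub h (one_mem _)) (dcs_sub h h1)) (dcs_sub h h2))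
  · exact Set.disjoint_union_left.2 ⟨dcs_disj n2.symm, dcs_disj n3⟩

theorem two_dcs {W H : Subgroup G} (h : H ≤ W) {g1 : G} (h1 : g1 ∈ W)
    (n1 : dcs H g1 ≠ dcs H 1) :
    1 + (dcs H g1).ncard ≤ (cos W H).ncard := by
  rw [← dcs_one H, ← Set.ncard_union_eq (dcs_disj n1.symm)]
  · exact Set.ncard_le_ncard (Set.union_subset (dcs_sub h (one_mem _)) (dcs_sub h h1))

theorem dcs_ne_one {H : Subgroup G} {g : G} (hg : g ∉ H) : dcs H g ≠ dcs H 1 := by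
  intro h
  have := mem_dcs_self H g
  rw [h] at this
  obtain ⟨x, hx, e⟩ := this
  rw [eq_comm, QuotientGroup.eq] at e
  apply hg
  have := mul_mem hx e
  simpa using this

/-- one central twist -/
theorem card_twist {r s : ℕ → G} {y : G} {a b : ℕ} (hy : y * y = 1) (hsq : ∀ i, a ≤ i → i < b → r i * r i = 1)
    (hc : ∀ i, a ≤ i → i < b → y * s i = s i * y)
    (hr : ∀ i, a ≤ i → i < b → r i = s i ∨ r i = s i * y) :
    Nat.card (GW r a b) ≤ Nat.card (GW s a b) * orderOf y := by
  have hcc : ∀ w ∈ GW s a b, y * w = w * y := by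
    intro w hw
    induction hw using Subgroup.closure_induction with
    | mem x hx => obtain ⟨i, h1, h2, rfl⟩ := hx; exact hc i h1 h2
    | one => simp
    | mul x z _ _ hx hz => rw [← mul_assoc, hx, mul_assoc, hz, mul_assoc]
    | inv x _ hx => rw [eq_inv_mul_iff_mul_eq, ← mul_assoc, ← hx]; simp
  have key : ∀ w ∈ GW r a b, ∃ u ∈ GW s a b, ∃ t ∈ Subgroup.zpowers y, w = u * t := by
    refine TA.ind hsq ⟨1, one_mem _, 1, one_mem _, by simp⟩ ?_
    rintro i h1 h2 w _ ⟨u, hu, t, ht, rfl⟩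
    rcases hr i h1 h2 with e | e
    · exact ⟨s i * u, mul_mem (TA.mem h1 h2) hu, t, ht, by rw [e, mul_assoc]⟩
    · refine ⟨s i * u, mul_mem (TA.mem h1 h2) hu, y * t, mul_mem (Subgroup.mem_zpowers y) ht, ?_⟩
      rw [e]
      calc s i * y * (u * t) = s i * (y * u) * t := by group
        _ = _ := by rw [hcc u hu]; group
  rw [← Nat.card_zpowers, ← Nat.card_prod]
  let F : (GW s a b × Subgroup.zpowers y) → G := fun x => x.1.1 * x.2.1
  have : (GW r a b : Set G) ⊆ Set.range F := by
    intro w hw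
    obtain ⟨u, hu, t, ht, rfl⟩ := key w hw
    exact ⟨(⟨u, hu⟩, ⟨t, ht⟩), rfl⟩
  calc Nat.card (GW r a b) = (GW r a b : Set G).ncard := rfl
    _ ≤ (Set.range F).ncard := Set.ncard_le_ncard this
    _ ≤ _ := by
      rw [← Nat.card_coe_set_eq]
      exact Nat.card_le_card_of_surjective (fun x => (⟨F x, x, rfl⟩ : Set.range F)) (by rintro ⟨_, x, rfl⟩; exact ⟨x, rfl⟩)

/-- elementary abelian complement: cosets form a power of two -/
theorem pow_two_index {W H : Subgroup G} {u : G} (hH : H ≤ W) (hu : u ∈ W) (hsq : u * u = 1)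
    (hgen : ∀ p : G → Prop, p 1 → (∀ w ∈ W, p w → p (u * w)) → (∀ h ∈ H, ∀ w ∈ W, p w → p (h * w)) → ∀ w ∈ W, p w)
    (hc : ∀ h ∈ H, u * (h * u * h⁻¹) = (h * u * h⁻¹) * u) :
    ∃ e, (cos W H).ncard = 2 ^ e := by
  let C : Set G := {x | ∃ h ∈ H, x = h * u * h⁻¹}
  let A : Subgroup G := Subgroup.closure C
  have hA : IsMulCommutative A := by
    apply Subgroup.isMulCommutative_closure
    rintro _ ⟨h, hh, rfl⟩ _ ⟨h', hh', rfl⟩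
    have := hc (h⁻¹ * h') (mul_mem (inv_mem hh) hh')
    have e := congrArg (fun x => h * x * h⁻¹) this
    beta_reduce at e
    convert e using 1 <;> group
  have hA2 : ∀ x ∈ A, x ^ 2 = 1 := by
    intro x hx
    induction hx using Subgroup.closure_induction with
    | mem x hx =>
      obtain ⟨h, hh, rfl⟩ := hx
      rw [pow_two]
      calc h * u * h⁻¹ * (h * u * h⁻¹) = h * (u * u) * h⁻¹ := by group
        _ = 1 := by rw [hsq]; group
    | one => simp
    | mul x z hx0 hz0 hx hz =>
      have : x * z = z * x := congrArg Subtype.val (mul_comm' (M := A) (⟨x, hx0⟩) (⟨z, hz0⟩))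
      rw [pow_two] at *
      calc x * z * (x * z) = x * (z * x) * z := by group
        _ = (x * x) * (z * z) := by rw [← this]; group
        _ = 1 := by rw [hx, hz]; simp
    | inv x _ hx => rw [inv_pow, hx, inv_one]
  have hnorm : ∀ h ∈ H, ∀ x ∈ A, h * x * h⁻¹ ∈ A := by
    intro h hh x hx
    induction hx using Subgroup.closure_induction with
    | mem x hx =>
      obtain ⟨h', hh', rfl⟩ := hx
      exact Subgroup.subset_closure ⟨h * h', mul_mem hh hh', by group⟩
    | one => simp
    | mul x z _ _ hx hz =>
      have := mul_mem hx hz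
      convert this using 1; group
    | inv x _ hx =>
      have := inv_mem hx
      convert this using 1; group
  have huA : u ∈ A := Subgroup.subset_closure ⟨1, one_mem _, by simp⟩
  have key : ∀ w ∈ W, ∃ x ∈ A, ∃ h ∈ H, w = x * h := by
    apply hgen
    · exact ⟨1, one_mem _, 1, one_mem _, by simp⟩
    · rintro w _ ⟨x, hx, h, hh, rfl⟩
      exact ⟨u * x, mul_mem huA hx, h, hh, by group⟩
    · rintro h' hh' w _ ⟨x, hx, h, hh, rfl⟩
      exact ⟨h' * x * h'⁻¹, hnorm h' hh' x hx, h' * h, mul_mem hh' hh, by group⟩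
  have hAW : A ≤ W := by
    rw [Subgroup.closure_le]
    rintro _ ⟨h, hh, rfl⟩
    exact mul_mem (mul_mem (hH hh) hu) (inv_mem (hH hh))
  have hcos : cos W H = (fun g : G => (g : G ⧸ H)) '' (A : Set G) := by
    apply Set.Subset.antisymm
    · rintro _ ⟨w, hw, rfl⟩
      obtain ⟨x, hx, h, hh, rfl⟩ := key w hw
      refine ⟨x, hx, ?_⟩
      rw [QuotientGroup.eq]; simpa using hh
    · exact Set.image_mono hAW
  have hfib : (A : Set G).ncard = (cos W H).ncard * Nat.card (A ⊓ H : Subgroup G) := by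
    rw [hcos]
    apply ncard_fiber
    intro x hx
    rw [← ncard_coe_sub]
    have : {y | y ∈ (A : Set G) ∧ (y : G ⧸ H) = (x : G ⧸ H)} = (fun l => x * l) '' ((A ⊓ H : Subgroup G) : Set G) := by
      ext y
      constructor
      · rintro ⟨h1, h2⟩
        rw [eq_comm, QuotientGroup.eq] at h2
        exact ⟨x⁻¹ * y, ⟨A.mul_mem (A.inv_mem hx) h1, h2⟩, by simp⟩
      · rintro ⟨l, ⟨h1, h1'⟩, rfl⟩
        refine ⟨mul_mem hx h1, ?_⟩
        rw [eq_comm, QuotientGroup.eq]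
        simpa using h1'
    rw [this, Set.ncard_image_of_injective _ (mul_right_injective x)]
  have hp : IsPGroup 2 A := by
    intro x
    exact ⟨1, by ext; simpa using hA2 x.1 x.2⟩
  obtain ⟨e, he⟩ := IsPGroup.iff_card.1 hp
  have hd : (cos W H).ncard ∣ 2 ^ e := by
    rw [← he, ← ncard_coe_sub, hfib]; exact dvd_mul_right _ _
  obtain ⟨e', _, h⟩ := (Nat.dvd_prime_pow Nat.prime_two).1 hd
  exact ⟨e', h⟩

end GroupLemmas

section PermLemmas
open Equiv

theorem perm_mem_of_swaps {α : Type*} [DecidableEq α] [Finite α] (A : Subgroup (Perm α)) (T : Set α)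
    (h : ∀ x ∈ T, ∀ y ∈ T, swap x y ∈ A) {σ : Perm α} (hσ : ∀ x, x ∉ T → σ x = x) : σ ∈ A := by
  let Z : Set (Perm α) := {g | ∃ x ∈ T, ∃ y ∈ T, x ≠ y ∧ g = swap x y}
  have hZ : ∀ f ∈ Z, f.IsSwap := by
    rintro _ ⟨x, _, y, _, hxy, rfl⟩; exact ⟨x, y, hxy, rfl⟩
  have : Subgroup.closure Z ≤ A := by
    rw [Subgroup.closure_le]; rintro _ ⟨x, hx, y, hy, _, rfl⟩; exact h x hx y hy
  apply this
  rw [_root_.mem_closure_isSwap hZ]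
  refine ⟨Set.toFinite _, fun x => ?_⟩
  by_cases hx : σ x = x
  · rw [hx]; exact MulAction.mem_orbit_self _
  have hxT : x ∈ T := by by_contra hh; exact hx (hσ x hh)
  have hxT' : σ x ∈ T := by
    by_contra hh; exact hx (σ.injective (hσ _ hh))
  exact ⟨⟨swap x (σ x), Subgroup.subset_closure ⟨x, hxT, σ x, hxT', Ne.symm hx, rfl⟩⟩, swap_apply_left _ _⟩

theorem swaps_of_adj {k : ℕ} (A : Subgroup (Perm (Fin k))) (m : ℕ)
    (h : ∀ i (hi : i + 1 < k), m ≤ i → swap (⟨i, by omega⟩ : Fin k) ⟨i+1, hi⟩ ∈ A) :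
    ∀ x y : Fin k, m ≤ x.1 → m ≤ y.1 → swap x y ∈ A := by
  have key : ∀ d, ∀ x y : Fin k, m ≤ x.1 → x.1 + d = y.1 → swap x y ∈ A := by
    intro d
    induction d with
    | zero =>
      intro x y hx hxy
      have : x = y := Fin.ext (by omega)
      subst this; rw [swap_self]; exact one_mem _
    | succ d ih =>
      rintro ⟨x, hx0⟩ ⟨y, hy0⟩ hx hxy
      simp only at hx hxy
      subst hxy
      rcases Nat.eq_zero_or_pos d with rfl | hd
      · exact h x (by omega) hx
      have h1 := ih ⟨x, hx0⟩ ⟨x+d, by omega⟩ hx rfl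
      have h2 := h (x+d) (by omega) (by omega)
      have h3 := mul_mem (mul_mem h2 h1) h2
      rw [swap_mul_swap_mul_swap (by simp; omega) (by simp; omega)] at h3
      rw [swap_comm]
      exact h3
  intro x y hx hy
  rcases le_total x.1 y.1 with hh | hh
  · exact key (y.1 - x.1) x y hx (by omega)
  · rw [swap_comm]; exact key (x.1 - y.1) y x hy (by omega)

end PermLemmas

open scoped Classical
set_option linter.unusedSectionVars false
set_option linter.unusedVariables false

section PermFix
open Equiv

theorem perm_fix {m : ℕ} (A : Subgroup (Perm (Fin (m+4))))
    (h : ∀ x y : Fin (m+4), 2 ≤ x.1 → 2 ≤ y.1 → swap x y ∈ A)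
    (h01 : swap (0 : Fin (m+4)) 1 ∉ A) (h12 : swap (1 : Fin (m+4)) 2 ∉ A) (h02 : swap (0 : Fin (m+4)) 2 ∉ A) :
    ∀ σ ∈ A, σ 0 = 0 ∧ σ 1 = 1 := by
  have hlt : ∀ x : Fin (m+4), ¬ 2 ≤ x.1 → x = 0 ∨ x = 1 := by
    intro x hx
    rcases (show x.1 = 0 ∨ x.1 = 1 by omega) with e | e
    · left; exact Fin.ext e
    · right; exact Fin.ext e
  have h2 : (2 : Fin (m+4)).1 = 2 := rfl
  have hno : ∀ e j : Fin (m+4), ¬ 2 ≤ e.1 → 2 ≤ j.1 → swap e j ∉ A := by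
    intro e j he hj hA
    have hej : e ≠ j := by rintro rfl; exact he hj
    have he2 : e ≠ 2 := by rintro rfl; exact he (by rw [h2])
    have h3 := mul_mem (mul_mem (h j 2 hj (by rw [h2])) hA) (h j 2 hj (by rw [h2]))
    rw [swap_mul_swap_mul_swap hej he2, swap_comm] at h3
    rcases hlt e he with rfl | rfl
    · exact h02 h3
    · exact h12 h3
  have hpres : ∀ σ ∈ A, ∀ i : Fin (m+4), 2 ≤ i.1 → 2 ≤ (σ i).1 := by
    intro σ hσ i hi
    by_contra hc
    obtain ⟨j, hj, hij⟩ : ∃ j : Fin (m+4), 2 ≤ j.1 ∧ i ≠ j := by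
      by_cases hi2 : i.1 = 2
      · exact ⟨⟨3, by omega⟩, by simp, fun e => by rw [e] at hi2; simp at hi2⟩
      · exact ⟨⟨2, by omega⟩, by simp, fun e => by rw [e] at hi2; simp at hi2⟩
    have h3 : swap (σ i) (σ j) ∈ A := by
      rw [swap_apply_apply]
      exact mul_mem (mul_mem hσ (h i j hi hj)) (inv_mem hσ)
    by_cases hc' : 2 ≤ (σ j).1
    · exact hno _ _ hc hc' h3
    · have hne : σ i ≠ σ j := fun e => hij (σ.injective e)
      rcases hlt _ hc with e | e <;> rcases hlt _ hc' with e' | e' <;> rw [e, e'] at h3 hne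
      · exact hne rfl
      · exact h01 h3
      · rw [swap_comm] at h3; exact h01 h3
      · exact hne rfl
  intro σ hσ
  have hpres' : ∀ i : Fin (m+4), ¬ 2 ≤ i.1 → ¬ 2 ≤ (σ i).1 := by
    intro i hi hc
    have := hpres σ⁻¹ (inv_mem hσ) _ hc
    simp at this; exact hi this
  have h0 := hlt _ (hpres' 0 (by simp))
  have h1 := hlt _ (hpres' 1 (by simp))
  have hne : σ 0 ≠ σ 1 := fun e => by have := σ.injective e; simp at this
  rcases h0 with e0 | e0 <;> rcases h1 with e1 | e1 <;> rw [e0, e1] at hne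
  · exact absurd rfl hne
  · exact ⟨e0, e1⟩
  · exfalso
    have : swap 0 1 * σ ∈ A := by
      apply perm_mem_of_swaps A {x | 2 ≤ x.1} (fun x hx y hy => h x y hx hy)
      intro x hx
      rcases hlt x hx with rfl | rfl
      · simp [e0]
      · simp [e1]
    have h3 := mul_mem this (inv_mem hσ)
    rw [mul_inv_cancel_right] at h3
    exact h01 h3
  · exact absurd rfl hne

/-- a permutation with prescribed images of `0` and `1` -/
def pij {m : ℕ} (i j : Fin (m+4)) : Perm (Fin (m+4)) := swap 0 i * swap 1 (swap 0 i j)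

theorem pij_zero {m : ℕ} {i j : Fin (m+4)} (h : i ≠ j) : pij i j 0 = i := by
  unfold pij
  have h0 : swap 0 i j ≠ 0 := by
    intro e
    have := congrArg (swap 0 i) e
    simp at this
    exact h this.symm
  rw [Perm.mul_apply, swap_apply_of_ne_of_ne (a := 1) (by simp) h0.symm, swap_apply_left]

theorem pij_one {m : ℕ} (i j : Fin (m+4)) : pij i j 1 = j := by
  simp [pij]

end PermFix

/-- the group-theoretic setting of the path lemma -/
structure PS {G : Type*} [Group G] {m : ℕ} (φ : Equiv.Perm (Fin (m+4)) →* G) (u : G) : Prop where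
  inj : Function.Injective φ
  usq : u * u = 1
  hcm : ∀ i (hi : i + 1 < m + 4), 1 ≤ i →
    u * φ (Equiv.swap (⟨i, by omega⟩ : Fin (m+4)) ⟨i+1, hi⟩) = φ (Equiv.swap (⟨i, by omega⟩ : Fin (m+4)) ⟨i+1, hi⟩) * u
  hK : ∀ σ, u * φ σ * u ∈ φ.range → σ 0 = 0

namespace PS
open Equiv
variable {G : Type*} [Group G] {m : ℕ} {φ : Perm (Fin (m+4)) →* G} {u : G}

theorem uinv (h : PS φ u) : u⁻¹ = u := by rw [inv_eq_iff_mul_eq_one]; exact h.usq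

theorem cent (h : PS φ u) {σ : Perm (Fin (m+4))} (hσ : σ 0 = 0) : u * φ σ = φ σ * u := by
  let A : Subgroup (Perm (Fin (m+4))) := (Subgroup.centralizer {u}).comap φ
  have hA : ∀ τ, τ ∈ A ↔ u * φ τ = φ τ * u := by
    intro τ
    rw [Subgroup.mem_comap, Subgroup.mem_centralizer_singleton_iff]
    exact ⟨fun e => e.symm, fun e => e.symm⟩
  have hs := swaps_of_adj A 1 (fun i hi h1 => (hA _).2 (h.hcm i hi h1))
  rw [← hA]
  apply perm_mem_of_swaps A {x | 1 ≤ x.1} (fun x hx y hy => hs x y hx hy)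
  intro x hx
  have : x = 0 := Fin.ext (by simp at hx ⊢; exact hx)
  rw [this, hσ]

/-- `σ` with `σ 0 ≠ 0` is `π s₀ κ` -/
theorem fact {σ : Perm (Fin (m+4))} (hσ : σ 0 ≠ 0) : ∃ π κ : Perm (Fin (m+4)), π 0 = 0 ∧ κ 0 = 0 ∧
    σ = π * swap 0 1 * κ := by
  refine ⟨swap 1 (σ 0), swap 0 1 * swap 1 (σ 0) * σ, ?_, ?_, ?_⟩
  · exact swap_apply_of_ne_of_ne (by simp) hσ.symm
  · simp
  · simp [← mul_assoc]

theorem comm_conj (h : PS φ u) (h4 : u * (φ (swap 0 1) * u * φ (swap 0 1)) = (φ (swap 0 1) * u * φ (swap 0 1)) * u)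
    (σ : Perm (Fin (m+4))) : u * (φ σ * u * (φ σ)⁻¹) = (φ σ * u * (φ σ)⁻¹) * u := by
  by_cases hσ : σ 0 = 0
  · rw [← h.cent hσ]; group
  obtain ⟨π, κ, hπ, hκ, rfl⟩ := fact hσ
  have e1 : φ (π * swap 0 1 * κ) * u * (φ (π * swap 0 1 * κ))⁻¹ =
      φ π * (φ (swap 0 1) * u * φ (swap 0 1)) * (φ π)⁻¹ := by
    rw [map_mul, map_mul, mul_inv_rev, mul_assoc _ (φ κ), ← h.cent hκ, mul_inv_rev, ← map_inv φ (swap 0 1), swap_inv]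
    group
  rw [e1]
  have e2 := h.cent hπ
  have e3 : u * (φ π)⁻¹ = (φ π)⁻¹ * u := by
    rw [eq_inv_mul_iff_mul_eq, ← mul_assoc, ← e2, mul_assoc, mul_inv_cancel, mul_one]
  generalize φ (swap 0 1) * u * φ (swap 0 1) = z at *
  calc u * (φ π * z * (φ π)⁻¹) = (u * φ π) * z * (φ π)⁻¹ := by group
    _ = φ π * (u * z) * (φ π)⁻¹ := by rw [e2]; group
    _ = φ π * z * (u * (φ π)⁻¹) := by rw [h4]; group
    _ = _ := by rw [e3]; group

theorem u_notin (h : PS φ u) : u ∉ φ.range := by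
  intro hu
  have := h.hK (swap 0 1) (mul_mem (mul_mem hu ⟨_, rfl⟩) hu)
  simp at this

variable [Finite G]

theorem dcs_u (h : PS φ u) : (dcs φ.range u).ncard = m + 4 := by
  have e : dcs φ.range u = (fun i : Fin (m+4) => ((φ (swap 0 i) * u : G) : G ⧸ φ.range)) '' Set.univ := by
    ext x; constructor
    · rintro ⟨_, ⟨σ, rfl⟩, rfl⟩
      refine ⟨σ 0, trivial, ?_⟩
      rw [QuotientGroup.eq]
      have h0 : (swap 0 (σ 0) * σ) 0 = 0 := by simp
      have h1 := h.cent h0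
      have : (φ (swap 0 (σ 0)) * u)⁻¹ * (φ σ * u) = u * φ (swap 0 (σ 0) * σ) * u := by
        rw [mul_inv_rev, h.uinv, ← map_inv, swap_inv, map_mul]; group
      rw [this, h1, mul_assoc, h.usq, mul_one]
      exact ⟨_, rfl⟩
    · rintro ⟨i, _, rfl⟩; exact ⟨_, ⟨_, rfl⟩, rfl⟩
  rw [e, Set.ncard_image_of_injective, Set.ncard_univ]
  · simp
  · intro i j hij
    dsimp only at hij
    rw [QuotientGroup.eq] at hij
    have : (φ (swap 0 i) * u)⁻¹ * (φ (swap 0 j) * u) = u * φ (swap 0 i * swap 0 j) * u := by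
      rw [mul_inv_rev, h.uinv, ← map_inv, swap_inv, map_mul]; group
    rw [this] at hij
    have := h.hK _ hij
    rw [Perm.mul_apply, swap_apply_left] at this
    have h2 := congrArg (swap 0 i) this
    simp at h2
    exact h2.symm

theorem dcs_rho (h : PS φ u) (hL : ∀ σ, (u * φ (swap 0 1) * u) * φ σ * (u * φ (swap 0 1) * u) ∈ φ.range → σ 0 = 0 ∧ σ 1 = 1) :
    (dcs φ.range (u * φ (swap 0 1) * u)).ncard = (m + 4) * (m + 3) := by
  set ρ := u * φ (swap 0 1) * u with hρ
  have hsq : φ (swap 0 1) * φ (swap 0 1) = 1 := by rw [← map_mul, swap_mul_self, map_one]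
  have hρ2 : ρ * ρ = 1 := by
    rw [hρ]
    calc u * φ (swap 0 1) * u * (u * φ (swap 0 1) * u) = u * φ (swap 0 1) * (u * u) * φ (swap 0 1) * u := by group
      _ = u * (φ (swap 0 1) * φ (swap 0 1)) * u := by rw [h.usq]; group
      _ = 1 := by rw [hsq, mul_one, h.usq]
  have hρi : ρ⁻¹ = ρ := by rw [inv_eq_iff_mul_eq_one]; exact hρ2
  have hcen : ∀ σ : Perm (Fin (m+4)), σ 0 = 0 → σ 1 = 1 → ρ * φ σ = φ σ * ρ := by
    intro σ h0 h1
    have e1 := h.cent h0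
    have e2 : φ (swap 0 1) * φ σ = φ σ * φ (swap 0 1) := by
      rw [← map_mul, ← map_mul, mul_swap_eq_swap_mul, h0, h1]
    rw [hρ]
    calc u * φ (swap 0 1) * u * φ σ = u * φ (swap 0 1) * (u * φ σ) := by group
      _ = u * (φ (swap 0 1) * φ σ) * u := by rw [e1]; group
      _ = (u * φ σ) * φ (swap 0 1) * u := by rw [e2]; group
      _ = _ := by rw [e1]; group
  have hdiff : ∀ σ τ, (φ σ * ρ)⁻¹ * (φ τ * ρ) = ρ * φ (σ⁻¹ * τ) * ρ := by
    intro σ τ; rw [mul_inv_rev, hρi, map_mul, map_inv]; group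
  let X : Finset (Fin (m+4) × Fin (m+4)) := Finset.univ.offDiag
  have hX : ((X : Set (Fin (m+4) × Fin (m+4)))).ncard = (m+4)*(m+3) := by
    rw [Set.ncard_coe_finset, Finset.offDiag_card]; simp
    rw [← Nat.mul_sub_one]; rfl
  have e : dcs φ.range ρ = (fun x : Fin (m+4) × Fin (m+4) => ((φ (pij x.1 x.2) * ρ : G) : G ⧸ φ.range)) '' X := by
    ext x; constructor
    · rintro ⟨_, ⟨σ, rfl⟩, rfl⟩
      have hne : σ 0 ≠ σ 1 := fun e => by have := σ.injective e; simp at this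
      refine ⟨(σ 0, σ 1), by simpa [X] using hne, ?_⟩
      rw [QuotientGroup.eq, hdiff, hcen, mul_assoc, hρ2, mul_one]
      · exact ⟨_, rfl⟩
      · rw [Perm.mul_apply, Perm.inv_eq_iff_eq, pij_zero hne]
      · rw [Perm.mul_apply, Perm.inv_eq_iff_eq, pij_one]
    · rintro ⟨i, _, rfl⟩; exact ⟨_, ⟨_, rfl⟩, rfl⟩
  rw [e, Set.InjOn.ncard_image, hX]
  rintro ⟨i, j⟩ hij ⟨i', j'⟩ hij' e
  have hne : i ≠ j := by simpa [X] using hij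
  have hne' : i' ≠ j' := by simpa [X] using hij'
  dsimp only at e
  rw [QuotientGroup.eq, hdiff] at e
  obtain ⟨e0, e1⟩ := hL _ e
  rw [Perm.mul_apply, Perm.inv_eq_iff_eq, pij_zero hne, pij_zero hne'] at e0
  rw [Perm.mul_apply, Perm.inv_eq_iff_eq, pij_one, pij_one] at e1
  rw [e0, e1]

end PS

open scoped Classical
set_option linter.unusedSectionVars false
set_option linter.unusedVariables false

theorem perm4_fix : ∀ π : Equiv.Perm (Fin (0+4)), π 0 = 0 → π 1 = 1 → π = 1 ∨ π = Equiv.swap 2 3 := by decide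

namespace PS
open Equiv
variable {G : Type*} [Group G] {m : ℕ} {φ : Perm (Fin (m+4)) →* G} {u : G} [Finite G]

theorem total (h : PS φ u) (hL : ∀ σ, (u * φ (swap 0 1) * u) * φ σ * (u * φ (swap 0 1) * u) ∈ φ.range → σ 0 = 0 ∧ σ 1 = 1)
    {W : Subgroup G} (hH : φ.range ≤ W) (hu : u ∈ W) :
    (dcs φ.range (u * φ (swap 0 1) * u) ≠ dcs φ.range 1) ∧ (dcs φ.range u ≠ dcs φ.range (u * φ (swap 0 1) * u)) ∧
    1 + (m+4) + (m+4)*(m+3) ≤ (cos W φ.range).ncard := by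
  have h1 := h.dcs_u
  have h2 := h.dcs_rho hL
  have n2 : dcs φ.range (u * φ (swap 0 1) * u) ≠ dcs φ.range 1 := by
    intro e; rw [e, dcs_one] at h2; nlinarith
  have n3 : dcs φ.range u ≠ dcs φ.range (u * φ (swap 0 1) * u) := by
    intro e; rw [e] at h1; nlinarith
  have := three_dcs hH hu (mul_mem (mul_mem hu (hH ⟨_, rfl⟩)) hu) (dcs_ne_one h.u_notin) n2 n3
  rw [h1, h2] at this
  exact ⟨n2, n3, this⟩

theorem even_total (h : PS φ u) (hL : ∀ σ, (u * φ (swap 0 1) * u) * φ σ * (u * φ (swap 0 1) * u) ∈ φ.range → σ 0 = 0 ∧ σ 1 = 1)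
    {E : Subgroup G} (hH : φ.range ≤ E) (hu : u * φ (swap 0 1) * u ∈ E) :
    1 + (m+4)*(m+3) ≤ (cos E φ.range).ncard := by
  have h2 := h.dcs_rho hL
  have n2 : dcs φ.range (u * φ (swap 0 1) * u) ≠ dcs φ.range 1 := by
    intro e; rw [e, dcs_one] at h2; nlinarith
  have := two_dcs hH hu n2
  rwa [h2] at this

theorem total17 {φ : Perm (Fin (0+4)) →* G} (h : PS φ u) (hL : ∀ σ, (u * φ (swap 0 1) * u) * φ σ * (u * φ (swap 0 1) * u) ∈ φ.range → σ 0 = 0 ∧ σ 1 = 1)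
    {W : Subgroup G} (hH : φ.range ≤ W) (hu : u ∈ W)
    (hgen : ∀ p : G → Prop, p 1 → (∀ w ∈ W, p w → p (u * w)) → (∀ h ∈ φ.range, ∀ w ∈ W, p w → p (h * w)) → ∀ w ∈ W, p w) :
    (cos W φ.range).ncard = 17 ∨ 20 ≤ (cos W φ.range).ncard := by
  obtain ⟨n2, n3, htot⟩ := h.total hL hH hu
  have h1 := h.dcs_u
  have h2 := h.dcs_rho hL
  have n1 := dcs_ne_one h.u_notin
  set ρ := u * φ (swap 0 1) * u with hρ
  have hρW : ρ ∈ W := mul_mem (mul_mem hu (hH ⟨_, rfl⟩)) hu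
  have hsq : φ (swap 0 1) * φ (swap 0 1) = 1 := by rw [← map_mul, swap_mul_self, map_one]
  have hρ2 : ρ * ρ = 1 := by
    rw [hρ]
    calc u * φ (swap 0 1) * u * (u * φ (swap 0 1) * u) = u * φ (swap 0 1) * (u * u) * φ (swap 0 1) * u := by group
      _ = u * (φ (swap 0 1) * φ (swap 0 1)) * u := by rw [h.usq]; group
      _ = 1 := by rw [hsq, mul_one, h.usq]
  have hρi : ρ⁻¹ = ρ := by rw [inv_eq_iff_mul_eq_one]; exact hρ2
  let U : Set (G ⧸ φ.range) := dcs φ.range 1 ∪ dcs φ.range u ∪ dcs φ.range ρ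
  have hU : U.ncard = 17 := by
    have : U.ncard = 1 + (0+4) + (0+4)*(0+3) := by
      have e1 : U.ncard = (dcs φ.range 1 ∪ dcs φ.range u).ncard + (dcs φ.range ρ).ncard :=
        Set.ncard_union_eq (Set.disjoint_union_left.2 ⟨dcs_disj n2.symm, dcs_disj n3⟩)
      rw [e1, Set.ncard_union_eq (dcs_disj n1.symm), h1, h2, dcs_one]
    simpa using this
  have hUW : U ⊆ cos W φ.range :=
    Set.union_subset (Set.union_subset (dcs_sub hH (one_mem _)) (dcs_sub hH hu)) (dcs_sub hH hρW)
  have hco : ∀ {g g' : G} (x : G), (g : G ⧸ φ.range) = g' → ((x * g : G) : G ⧸ φ.range) = ((x * g' : G) : G ⧸ φ.range) := by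
    intro g g' x e
    rw [QuotientGroup.eq] at e ⊢
    convert e using 1; group
  by_cases hz : ∀ σ, ((u * φ σ * ρ : G) : G ⧸ φ.range) ∈ U
  · left
    have : cos W φ.range = U := by
      apply Set.Subset.antisymm _ hUW
      rintro _ ⟨w, hw, rfl⟩
      refine hgen (fun w => (w : G ⧸ φ.range) ∈ U) (Or.inl (Or.inl (mem_dcs_self _ _))) ?_ ?_ w hw
      · rintro w _ ((⟨_, ⟨σ, rfl⟩, e⟩ | ⟨_, ⟨σ, rfl⟩, e⟩) | ⟨_, ⟨σ, rfl⟩, e⟩)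
        · change (((_ * w : G)) : G ⧸ φ.range) ∈ U
          rw [hco u e]
          left; right
          refine ⟨1, one_mem _, ?_⟩
          rw [eq_comm, QuotientGroup.eq]
          refine ⟨σ, ?_⟩; group
        · change (((_ * w : G)) : G ⧸ φ.range) ∈ U
          rw [hco u e]
          by_cases hσ : σ 0 = 0
          · left; left
            refine ⟨1, one_mem _, ?_⟩
            rw [eq_comm, QuotientGroup.eq, ← h.cent hσ, ← mul_assoc u u, h.usq]
            refine ⟨σ, ?_⟩; group
          · obtain ⟨π, κ, hπ, hκ, rfl⟩ := fact hσ
            right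
            refine ⟨φ π, ⟨_, rfl⟩, ?_⟩
            rw [eq_comm, QuotientGroup.eq]
            have : u * (φ (π * swap 0 1 * κ) * u) = φ π * ρ * φ κ := by
              rw [map_mul, map_mul, mul_assoc _ (φ κ) u, ← h.cent hκ, hρ, ← mul_assoc, ← mul_assoc, ← mul_assoc, h.cent hπ]
              group
            rw [this, inv_mul_cancel_left]
            exact ⟨_, rfl⟩
        · change (((_ * w : G)) : G ⧸ φ.range) ∈ U
          rw [hco u e]
          have := hz σ
          rwa [mul_assoc] at this
      · rintro _ ⟨τ, rfl⟩ w _ ((⟨_, ⟨σ, rfl⟩, e⟩ | ⟨_, ⟨σ, rfl⟩, e⟩) | ⟨_, ⟨σ, rfl⟩, e⟩)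
        · change (((_ * w : G)) : G ⧸ φ.range) ∈ U
          rw [hco _ e]; left; left; exact ⟨φ τ * φ σ, ⟨τ * σ, by simp⟩, by rw [mul_assoc]⟩
        · change (((_ * w : G)) : G ⧸ φ.range) ∈ U
          rw [hco _ e]; left; right; exact ⟨φ τ * φ σ, ⟨τ * σ, by simp⟩, by rw [mul_assoc]⟩
        · change (((_ * w : G)) : G ⧸ φ.range) ∈ U
          rw [hco _ e]; right; exact ⟨φ τ * φ σ, ⟨τ * σ, by simp⟩, by rw [mul_assoc]⟩
    rw [this]; exact hU
  · right
    push Not at hz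
    obtain ⟨σ, hσ⟩ := hz
    set z := u * φ σ * ρ with hzdef
    have hzW : z ∈ W := mul_mem (mul_mem hu (hH ⟨_, rfl⟩)) hρW
    have hdis : Disjoint U (dcs φ.range z) := by
      have key : ∀ g, dcs φ.range g ⊆ U → Disjoint (dcs φ.range g) (dcs φ.range z) := by
        intro g hg
        apply dcs_disj
        intro e
        apply hσ; apply hg; rw [e]; exact mem_dcs_self _ _
      exact Set.disjoint_union_left.2 ⟨Set.disjoint_union_left.2
        ⟨key _ (fun x hx => Or.inl (Or.inl hx)), key _ (fun x hx => Or.inl (Or.inr hx))⟩, key _ (fun x hx => Or.inr hx)⟩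
    have hle : U.ncard + (dcs φ.range z).ncard ≤ (cos W φ.range).ncard := by
      rw [← Set.ncard_union_eq hdis]
      exact Set.ncard_le_ncard (Set.union_subset hUW (dcs_sub hH hzW))
    have hcard := card_dcs φ.range z
    have hH24 : Nat.card φ.range = 24 := by
      rw [← Nat.card_congr (MonoidHom.ofInjective h.inj).toEquiv, Nat.card_perm]; simp [Nat.factorial]
    have hC : Nat.card (CC φ.range z) ≤ 8 := by
      let s : Finset (Perm (Fin (0+4))) := Finset.univ.filter (fun τ => φ τ ∈ CC φ.range z)
      have hs : Nat.card (CC φ.range z) = s.card := by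
        rw [← ncard_coe_sub, ← Set.ncard_coe_finset]
        have : (CC φ.range z : Set G) = φ '' (s : Set (Perm (Fin (0+4)))) := by
          ext l; constructor
          · rintro hl
            obtain ⟨τ, rfl⟩ := (mem_CC.1 hl).1
            exact ⟨τ, by simp [s]; exact hl, rfl⟩
          · rintro ⟨τ, hτ, rfl⟩
            simpa [s] using hτ
        rw [this, Set.ncard_image_of_injective _ h.inj]
      rw [hs]
      have hb := Finset.card_le_mul_card_image (f := fun τ : Perm (Fin (0+4)) => τ 0) s 2 ?_
      · have : (s.image (fun τ : Perm (Fin (0+4)) => τ 0)).card ≤ 4 := by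
          refine (Finset.card_le_univ _).trans ?_
          simp
        omega
      · intro a ha
        obtain ⟨τ0, hτ0, rfl⟩ := Finset.mem_image.1 ha
        have hsub : (s.filter (fun τ => τ 0 = τ0 0)) ⊆ {τ0, τ0 * (σ * swap 2 3 * σ⁻¹)} := by
          intro τ hτ
          rw [Finset.mem_filter] at hτ
          obtain ⟨hτs, hτ'⟩ := hτ
          have e1 : φ τ0 ∈ CC φ.range z := by simpa [s] using hτ0
          have e2 : φ τ ∈ CC φ.range z := by simpa [s] using hτs
          have e3 : φ (τ0⁻¹ * τ) ∈ CC φ.range z := by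
            rw [map_mul, map_inv]; exact mul_mem (inv_mem e1) e2
          have e4 := h.cent (σ := τ0⁻¹ * τ) (by rw [Perm.mul_apply, hτ']; simp)
          have e5 := (mem_CC.1 e3).2
          have e6 : z⁻¹ * φ (τ0⁻¹ * τ) * z = ρ * φ (σ⁻¹ * (τ0⁻¹ * τ) * σ) * ρ := by
            generalize τ0⁻¹ * τ = κ at *
            have hzi : z⁻¹ = ρ * ((φ σ)⁻¹ * u) := by
              rw [hzdef, mul_inv_rev (u * φ σ) ρ, mul_inv_rev u (φ σ), hρi, h.uinv]
            rw [hzi, hzdef, map_mul, map_mul, map_inv]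
            calc ρ * ((φ σ)⁻¹ * u) * φ κ * (u * φ σ * ρ) = ρ * (φ σ)⁻¹ * (u * φ κ) * u * φ σ * ρ := by group
              _ = ρ * (φ σ)⁻¹ * φ κ * (u * u) * φ σ * ρ := by rw [e4]; group
              _ = _ := by rw [h.usq]; group
          rw [e6] at e5
          obtain ⟨f0, f1⟩ := hL _ e5
          rw [Finset.mem_insert, Finset.mem_singleton]
          rcases perm4_fix _ f0 f1 with e | e
          · left
            have : τ0⁻¹ * τ = 1 := by
              calc τ0⁻¹ * τ = σ * (σ⁻¹ * (τ0⁻¹ * τ) * σ) * σ⁻¹ := by group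
                _ = 1 := by rw [e]; group
            rw [inv_mul_eq_one] at this; exact this.symm
          · right
            rw [← e]; group
        exact (Finset.card_le_card hsub).trans Finset.card_le_two
    rw [hH24] at hcard
    have : 3 ≤ (dcs φ.range z).ncard := by nlinarith
    omega

end PS

open scoped Classical
set_option linter.unusedSectionVars false
set_option linter.unusedVariables false
set_option linter.unusedTactic false
namespace Sys
variable {n : ℕ} {Ω : Type} {S : Sys n Ω} [Finite Ω]

variable (S) in
/-- number of facets of a section -/
noncomputable def fv (a b : ℕ) : ℕ := S.dual.v (n-b) (n-a)

theorem fv_mul {a b : ℕ} (hab : a < b) (hb : b ≤ n) : S.fv a b * S.N a (b-1) = S.N a b := by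
  have h := v_mul (S := S.dual) (a := n-b) (b := n-a) (by omega) (by omega)
  rw [dual_N (by omega), dual_N (by omega)] at h
  unfold fv
  rw [show n - (n-a) = a by omega, show n - (n-b) = b by omega, show n - (n-b+1) = b-1 by omega] at h
  exact h

theorem fv_mono {a b c : ℕ} (hab : a ≤ b) (hbc : b < c) (hc : c ≤ n) : S.fv b c ≤ S.fv a c := by
  unfold fv; exact v_mono (by omega) (by omega) (by omega)

theorem fv_lt {a b : ℕ} (hab : a + 1 < b) (hb : b ≤ n) (h : ¬ S.Flat a b) : S.fv (a+1) b < S.fv a b := by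
  unfold fv
  have := v_lt (S := S.dual) (a := n-b) (b := n-a) (by omega) (by omega) (by
    rw [dual_flat (by omega) (by omega), show n - (n-a) = a by omega, show n - (n-b) = b by omega]; exact h)
  rwa [show n - a - 1 = n - (a+1) by omega] at this

theorem nonflat_fv {a b : ℕ} (hab : a < b) (hb : b ≤ n) (h : ¬ S.Flat a b) : b - a + 1 ≤ S.fv a b := by
  unfold fv
  have := nonflat_v (S := S.dual) (a := n-b) (b := n-a) (by omega) (by omega) (by
    rw [dual_flat (by omega) (by omega), show n - (n-a) = a by omega, show n - (n-b) = b by omega]; exact h)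
  omega

theorem N_left {a b : ℕ} (hab : a < b) (hb : b ≤ n) (h : ¬ S.Flat a b) : (b - a + 1) * S.N (a+1) b ≤ S.N a b := by
  rw [← v_mul hab hb]; exact Nat.mul_le_mul_right _ (nonflat_v hab hb h)

theorem N_right {a b : ℕ} (hab : a < b) (hb : b ≤ n) (h : ¬ S.Flat a b) : (b - a + 1) * S.N a (b-1) ≤ S.N a b := by
  rw [← fv_mul hab hb]; exact Nat.mul_le_mul_right _ (nonflat_fv hab hb h)

theorem N_two {a : ℕ} (ha : a + 2 ≤ n) : S.N a (a+2) = 2 * S.v a (a+2) := by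
  rw [← v_mul (by omega) ha, N_one (by omega), mul_comm]

theorem fv_two {a : ℕ} (ha : a + 2 ≤ n) : S.fv a (a+2) = S.v a (a+2) := by
  have h1 := fv_mul (S := S) (a := a) (b := a+2) (by omega) ha
  rw [show a + 2 - 1 = a + 1 by omega, N_one (by omega), N_two ha] at h1
  omega

theorem dual_v_two {a : ℕ} (ha : a + 2 ≤ n) : S.dual.v (n-(a+2)) (n-a) = S.v a (a+2) := fv_two ha

/-- parity -/
theorem χ_W {a b : ℕ} (hb : b ≤ n) : ∀ w ∈ S.W a b, (∀ Φ, S.χ (w Φ) ↔ S.χ Φ) ∨ (∀ Φ, S.χ (w Φ) ↔ ¬ S.χ Φ) := by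
  refine S.W_ind (Or.inl fun _ => Iff.rfl) ?_
  intro i h1 h2 w _ ih
  rcases ih with ih | ih
  · right; intro Φ; rw [Equiv.Perm.mul_apply, S.χ_r _ _ (by omega), ih]
  · left; intro Φ; rw [Equiv.Perm.mul_apply, S.χ_r _ _ (by omega), ih, not_not]

theorem W_two {a : ℕ} : ∀ w ∈ S.W a (a+2), ∃ k : ℤ, w = (S.r a * S.r (a+1)) ^ k ∨ w = (S.r a * S.r (a+1)) ^ k * S.r a := by
  have h0 : S.r a * (S.r a * S.r (a+1)) * (S.r a)⁻¹ = (S.r a * S.r (a+1))⁻¹ := by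
    rw [mul_inv_rev, S.r_inv, S.r_inv, ← mul_assoc, S.r_mul_self, one_mul]
  have hk : ∀ k : ℤ, S.r a * (S.r a * S.r (a+1)) ^ k = (S.r a * S.r (a+1)) ^ (-k) * S.r a := by
    intro k
    have h1 : (S.r a * (S.r a * S.r (a+1)) * (S.r a)⁻¹) ^ k = ((S.r a * S.r (a+1))⁻¹) ^ k := by rw [h0]
    rw [conj_zpow, inv_zpow'] at h1
    rw [← h1]; group
  have hk' : ∀ k : ℤ, S.r (a+1) * (S.r a * S.r (a+1)) ^ k = (S.r a * S.r (a+1)) ^ (-1-k) * S.r a := by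
    intro k
    have : S.r (a+1) = (S.r a * S.r (a+1))⁻¹ * S.r a := by
      rw [mul_inv_rev, S.r_inv, S.r_inv, mul_assoc, S.r_mul_self, mul_one]
    nth_rw 1 [this]
    rw [mul_assoc, hk, ← mul_assoc, ← zpow_neg_one, ← zpow_add]
    rfl
  refine S.W_ind ⟨0, Or.inl (by simp)⟩ ?_
  rintro i h1 h2 w _ ⟨k, rfl | rfl⟩
  · rcases (show i = a ∨ i = a+1 by omega) with rfl | rfl
    · exact ⟨-k, Or.inr (hk k)⟩
    · exact ⟨-1-k, Or.inr (hk' k)⟩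
  · rcases (show i = a ∨ i = a+1 by omega) with rfl | rfl
    · exact ⟨-k, Or.inl (by rw [← mul_assoc, hk, mul_assoc, S.r_mul_self, mul_one])⟩
    · exact ⟨-1-k, Or.inl (by rw [← mul_assoc, hk', mul_assoc, S.r_mul_self, mul_one])⟩

theorem orderOf_eq {a : ℕ} (ha : a + 2 ≤ n) (hF : S.Free a (a+2)) :
    orderOf (S.r a * S.r (a+1)) = S.v a (a+2) := by
  set o := S.r a * S.r (a+1) with ho
  have hoW : o ∈ S.W a (a+2) := mul_mem (S.r_mem (by omega) (by omega)) (S.r_mem (by omega) (by omega))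
  have hχ : ∀ k : ℤ, ∀ Φ, S.χ ((o^k) Φ) ↔ S.χ Φ := by
    let A : Subgroup (Equiv.Perm Ω) :=
      { carrier := {w | ∀ Φ, S.χ (w Φ) ↔ S.χ Φ}
        one_mem' := fun _ => Iff.rfl
        mul_mem' := fun {x y} hx hy Φ => by rw [Equiv.Perm.mul_apply, hx, hy]
        inv_mem' := fun {x} hx Φ => by
          have := hx (x⁻¹ Φ)
          simp at this; exact this.symm }
    have hoA : o ∈ A := by
      intro Φ; rw [ho, Equiv.Perm.mul_apply, S.χ_r _ _ (by omega), S.χ_r _ _ (by omega), not_not]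
    intro k; exact (zpow_mem hoA k)
  have h1 : (S.W a (a+2) : Set (Equiv.Perm Ω)) = (Subgroup.zpowers o : Set _) ∪ (fun w => w * S.r a) '' (Subgroup.zpowers o : Set _) := by
    ext w; constructor
    · intro hw
      obtain ⟨k, e | e⟩ := W_two w hw
      · left; exact ⟨k, e.symm⟩
      · right; exact ⟨_, ⟨k, rfl⟩, e.symm⟩
    · rintro (⟨k, rfl⟩ | ⟨_, ⟨k, rfl⟩, rfl⟩)
      · exact zpow_mem hoW k
      · exact mul_mem (zpow_mem hoW k) (S.r_mem (by omega) (by omega))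
  have h2 : Disjoint (Subgroup.zpowers o : Set (Equiv.Perm Ω)) ((fun w => w * S.r a) '' (Subgroup.zpowers o : Set _)) := by
    rw [Set.disjoint_left]
    rintro _ ⟨k, rfl⟩ ⟨_, ⟨j, rfl⟩, e⟩
    have Φ := S.nonempty.some
    have e1 := hχ k Φ
    have e2 := hχ j (S.r a Φ)
    have e3 : (o ^ k) Φ = (o ^ j) (S.r a Φ) := by
      have := congrArg (fun w : Equiv.Perm Ω => w Φ) e
      simpa using this.symm
    rw [e3, e2, S.χ_r _ _ (by omega)] at e1
    tauto
  have h3 := congrArg Set.ncard h1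
  rw [Set.ncard_union_eq h2, Set.ncard_image_of_injective _ (mul_left_injective _), ncard_coe_sub, ncard_coe_sub,
    Nat.card_zpowers, card_W_eq ha hF, N_two ha] at h3
  omega

theorem braid_of_three {a : ℕ} (ha : a + 2 ≤ n) (hF : S.Free a (a+2)) (h : S.v a (a+2) = 3) :
    S.r a * S.r (a+1) * S.r a = S.r (a+1) * S.r a * S.r (a+1) := by
  have h1 := orderOf_eq ha hF
  rw [h] at h1
  have h2 := pow_orderOf_eq_one (S.r a * S.r (a+1))
  rw [h1] at h2
  have h3 : (S.r a * S.r (a+1) * S.r a) * (S.r (a+1) * S.r a * S.r (a+1)) = 1 := by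
    rw [← h2]; simp only [pow_succ, pow_zero, one_mul, mul_assoc]
  rw [eq_comm, eq_inv_of_mul_eq_one_right h3, mul_inv_rev, mul_inv_rev, S.r_inv, S.r_inv, mul_assoc]

theorem comm_of_four {a : ℕ} (ha : a + 2 ≤ n) (hF : S.Free a (a+2)) (h : S.v a (a+2) = 4) :
    S.r a * (S.r (a+1) * S.r a * S.r (a+1)) = (S.r (a+1) * S.r a * S.r (a+1)) * S.r a := by
  have h1 := orderOf_eq ha hF
  rw [h] at h1
  have h2 := pow_orderOf_eq_one (S.r a * S.r (a+1))
  rw [h1] at h2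
  have h3 : (S.r a * (S.r (a+1) * S.r a * S.r (a+1))) * (S.r a * (S.r (a+1) * S.r a * S.r (a+1))) = 1 := by
    rw [← h2]; simp only [pow_succ, pow_zero, one_mul, mul_assoc]
  rw [eq_comm, eq_inv_of_mul_eq_one_right h3, mul_inv_rev, mul_inv_rev, mul_inv_rev, S.r_inv, S.r_inv]
  simp only [mul_assoc]

theorem v_three {a : ℕ} (ha : a + 2 ≤ n) (h : ¬ S.Flat a (a+2)) : 3 ≤ S.v a (a+2) := by
  have := nonflat_v (by omega) ha h; omega

/-- links with cosets -/
theorem cos_v {a b : ℕ} (hab : a < b) (hb : b ≤ n) (h : S.Free a b) :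
    (cos (S.W a b) (S.W (a+1) b)).ncard = S.v a b := by
  have h1 := card_cos (S.W_le (show a ≤ a+1 by omega) (le_refl b))
  rw [card_W_eq hb h, card_W_eq hb (h.mono (by omega) le_rfl), ← v_mul hab hb] at h1
  exact Nat.eq_of_mul_eq_mul_right (S.N_pos _ _) h1

theorem card_CC {a b : ℕ} (hQ : S.Q3 a) (hab : a + 2 ≤ b) (hb : b ≤ n) (h : S.Free a b) :
    Nat.card (CC (S.W (a+1) b) (S.r a)) = S.k a b := by
  have Φ := S.nonempty.some
  rw [← ncard_K hQ hab hb Φ, ← ncard_coe_sub]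
  have hinj : Set.InjOn (fun w : Equiv.Perm Ω => w Φ) (CC (S.W (a+1) b) (S.r a) : Set (Equiv.Perm Ω)) := by
    intro x hx y hy e
    exact h.eq (S.W_le (by omega) le_rfl (mem_CC.1 hx).1) (S.W_le (by omega) le_rfl (mem_CC.1 hy).1) e
  rw [← Set.ncard_image_of_injOn hinj]
  congr 1
  ext Ψ; constructor
  · rintro ⟨w, hw, rfl⟩
    obtain ⟨h1, h2⟩ := mem_CC.1 hw
    refine ⟨⟨w, h1, rfl⟩, ?_⟩
    unfold kap
    have : S.r a (w Φ) = ((S.r a)⁻¹ * w * S.r a) (S.r a Φ) := by simp [S.r_inv, S.r_sq]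
    rw [this]
    exact W_f h2 _ (by omega)
  · rintro ⟨⟨w, hw, rfl⟩, hk⟩
    refine ⟨w, mem_CC.2 ⟨hw, ?_⟩, rfl⟩
    unfold kap at hk
    have e : S.r a (w Φ) = ((S.r a)⁻¹ * w * S.r a) (S.r a Φ) := by simp [S.r_inv, S.r_sq]
    have hra : S.r a ∈ S.W a b := S.r_mem (by omega) (by omega)
    have hm : (S.r a)⁻¹ * w * S.r a ∈ S.W a b := mul_mem (mul_mem (inv_mem hra) (S.W_le (by omega) le_rfl hw)) hra
    rw [e] at hk
    obtain ⟨w', hw', e'⟩ := (O_vertex (by omega) hb ⟨_, hm, rfl⟩).1 hk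
    rw [← h.eq (S.W_le (by omega) le_rfl hw') hm e']
    exact hw'

theorem dcs_c {a b : ℕ} (hQ : S.Q3 a) (hab : a + 2 ≤ b) (hb : b ≤ n) (h : S.Free a b) :
    (dcs (S.W (a+1) b) (S.r a)).ncard = S.c a b := by
  have h1 := card_dcs (S.W (a+1) b) (S.r a)
  rw [card_CC hQ hab hb h, card_W_eq hb (h.mono (by omega) le_rfl), ← c_mul_k hQ hab hb] at h1
  exact Nat.eq_of_mul_eq_mul_right (k_pos _ _) h1

theorem r_ne {i j : ℕ} (hi : i < n) (hij : i ≠ j) : S.r i ≠ S.r j := by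
  intro e
  have Φ := S.nonempty.some
  have := S.f_r_self i Φ hi
  rw [e, S.f_r _ _ _ hij] at this
  exact this rfl

theorem r_ne_one {i : ℕ} (hi : i < n) : S.r i ≠ 1 := by
  intro e
  have Φ := S.nonempty.some
  have := S.f_r_self i Φ hi
  rw [e] at this
  exact this rfl

theorem W_one {a : ℕ} : ∀ w ∈ S.W a (a+1), w = 1 ∨ w = S.r a := by
  refine S.W_ind (Or.inl rfl) ?_
  rintro i h1 h2 w _ ih
  have : i = a := by omega
  subst this
  rcases ih with rfl | rfl
  · right; simp
  · left; exact S.r_mul_self _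

/-- if `p ≥ 3` then `r_a r_{a+1} r_a` is not in the vertex stabilizer -/
theorem rho_notin {a b : ℕ} (hab : a + 2 ≤ b) (hb : b ≤ n) (h : S.Free a b) (hp : 3 ≤ S.v a (a+2)) :
    S.r a * S.r (a+1) * S.r a ∉ S.W (a+1) b := by
  intro hm
  have hw : S.r a * S.r (a+1) * S.r a ∈ S.W a (a+2) :=
    mul_mem (mul_mem (S.r_mem (by omega) (by omega)) (S.r_mem (by omega) (by omega))) (S.r_mem (by omega) (by omega))
  have h1 := (h.mono le_rfl hab).ip (by omega) hb hw hm (e := a+1) (f := a+2) (by omega) (by omega) (by omega) le_rfl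
  have ho := orderOf_eq (by omega) (h.mono le_rfl hab)
  rcases W_one _ h1 with e | e
  · have : S.r (a+1) = 1 := by
      calc S.r (a+1) = (S.r a * S.r a) * S.r (a+1) * (S.r a * S.r a) := by rw [S.r_mul_self]; simp
        _ = S.r a * (S.r a * S.r (a+1) * S.r a) * S.r a := by group
        _ = 1 := by rw [e, mul_one, S.r_mul_self]
    exact r_ne_one (by omega) this
  · have : (S.r a * S.r (a+1)) ^ 2 = 1 := by
      rw [pow_two, ← mul_assoc, e, S.r_mul_self]
    have := orderOf_le_of_pow_eq_one (by norm_num) this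
    omega

end Sys

open scoped Classical
set_option linter.unusedSectionVars false
set_option linter.unusedVariables false
set_option linter.unusedTactic false
namespace Sys
variable {n : ℕ} {Ω : Type} {S : Sys n Ω} [Finite Ω]

theorem nonflat_sub {a b c d : ℕ} (h : ¬ S.Flat c d) (hca : c ≤ a) (hab : a + 1 < b) (hbd : b ≤ d) (hd : d ≤ n) :
    ¬ S.Flat a b := fun hf => h (flat_up hca hab hbd hd hf)

theorem Q3_nonflat {a b : ℕ} (h : ¬ S.Flat a b) (hab : a + 2 ≤ b) (hb : b ≤ n) : S.Q3 a :=
  Q3_of_nonflat (by omega) (nonflat_sub h le_rfl (by omega) hab hb)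

theorem c_lt {a b : ℕ} (h : ¬ S.Flat a b) (hab : a + 3 ≤ b) (hb : b ≤ n) : S.c a (b-1) < S.c a b := by
  by_contra hc
  exact h (flat_of_c (Q3_nonflat h (by omega) hb) (by omega) hb hab (by omega))

theorem c_ge {a b : ℕ} (h : ¬ S.Flat a b) (hab : a + 2 ≤ b) (hb : b ≤ n) : b - a ≤ S.c a b := by
  obtain ⟨e, rfl⟩ : ∃ e, b = a + 2 + e := ⟨b - (a+2), by omega⟩
  induction e with
  | zero => have := c_two (Q3_nonflat h (by omega) hb) (by omega); simp only [add_zero]; omega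
  | succ e ih =>
    have h1 := ih (nonflat_sub h le_rfl (by omega) (by omega) hb) (by omega) (by omega)
    have h2 := c_lt h (by omega) hb
    rw [show a + 2 + (e+1) - 1 = a + 2 + e by omega] at h2
    omega

theorem dual_nonflat {a b : ℕ} (h : ¬ S.Flat a b) (hab : a < b) (hb : b ≤ n) : ¬ S.dual.Flat (n-b) (n-a) := by
  rw [dual_flat (by omega) (by omega), show n - (n-a) = a by omega, show n - (n-b) = b by omega]; exact h

theorem dual_free' {a b : ℕ} (h : S.Free a b) (hab : a < b) (hb : b ≤ n) : S.dual.Free (n-b) (n-a) := by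
  rw [dual_free (by omega), show n - (n-a) = a by omega, show n - (n-b) = b by omega]; exact h

theorem rank3_half {a : ℕ} (ha : a + 3 ≤ n) (h : ¬ S.Flat a (a+3)) :
    ∃ c, S.N a (a+3) = S.v a (a+3) * (2 * S.v (a+1) (a+3)) ∧ c + 1 ≤ S.v a (a+3) ∧ 3 ≤ c ∧ c ∣ S.v (a+1) (a+3) ∧
      2 ∣ S.v a (a+3) * c ∧ S.v a (a+2) < S.v a (a+3) := by
  have hQ := Q3_nonflat h (by omega) ha
  refine ⟨S.c a (a+3), ?_, c_lt_v hQ (by omega) ha, ?_, ⟨_, (c_mul_s hQ (by omega) ha).symm⟩, handshake hQ (by omega) ha, ?_⟩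
  · have := N_two (S := S) (a := a+1) (by omega)
    rw [show a + 1 + 2 = a + 3 by omega] at this
    have h2 := v_mul (S := S) (a := a) (b := a+3) (by omega) ha
    rw [this] at h2; exact h2.symm
  · have := c_ge h (by omega) ha; omega
  · have := v_lt (by omega) ha h
    rwa [show a + 3 - 1 = a + 2 by omega] at this

theorem kill44 {a : ℕ} (ha : a + 3 ≤ n) (h : ¬ S.Flat a (a+3)) (hF : S.Free a (a+3))
    (hq : S.v a (a+2) = 4) (ht : S.v (a+1) (a+3) = 4) (hv : S.v a (a+3) = 5) : False := by
  have hQ := Q3_nonflat h (by omega) ha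
  have hc : S.c a (a+3) = 4 := by
    have h1 := c_mul_s hQ (by omega) ha
    have h2 := c_ge h (by omega) ha
    have h3 := c_lt_v hQ (by omega) ha
    have : S.c a (a+3) = 3 ∨ S.c a (a+3) = 4 := by omega
    rcases this with e | e
    · rw [e] at h1; omega
    · exact e
  set H := S.W (a+1) (a+3) with hH
  have hu : S.r a ∈ S.W a (a+3) := S.r_mem (by omega) (by omega)
  have hHW : H ≤ S.W a (a+3) := S.W_le (by omega) le_rfl
  have hcos := cos_v (by omega) ha hF
  have hd := dcs_c hQ (by omega) ha hF
  have hρ := rho_notin (by omega) ha hF (by omega)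
  rw [hv] at hcos
  rw [hc] at hd
  have hrH : S.r a ∉ H := by
    intro hm
    exact hρ (mul_mem (mul_mem hm (S.r_mem le_rfl (by omega))) hm)
  have hr1 : S.r (a+1) ∈ H := S.r_mem le_rfl (by omega)
  have hr2 : S.r (a+2) ∈ H := S.r_mem (by omega) (by omega)
  set ρ := S.r a * S.r (a+1) * S.r a with hρd
  have hρW : ρ ∈ S.W a (a+3) := mul_mem (mul_mem hu (hHW hr1)) hu
  have hdd : dcs H (S.r a) = dcs H ρ := by
    by_contra hne
    have := three_dcs hHW hu hρW (dcs_ne_one hrH) (dcs_ne_one hρ) hne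
    have h5 : 0 < (dcs H ρ).ncard := by
      rw [Set.ncard_pos]; exact ⟨_, mem_dcs_self _ _⟩
    rw [hcos, hd] at this
    omega
  have hmem := mem_dcs_self H ρ
  rw [← hdd] at hmem
  obtain ⟨x, hx, e⟩ := hmem
  rw [QuotientGroup.eq] at e
  -- ρ⁻¹ * (x * r a) ∈ H
  have hρ2 : ρ⁻¹ = ρ := by
    rw [hρd, mul_inv_rev, mul_inv_rev, S.r_inv, S.r_inv, mul_assoc]
  have hcomm : ρ * S.r (a+1) * ρ = S.r (a+1) := by
    have h4 := comm_of_four (by omega) (hF.mono le_rfl (by omega)) hq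
    have h4' : S.r (a+1) * ρ = ρ * S.r (a+1) := by
      have e1 : S.r a * (S.r a * (S.r (a+1) * S.r a * S.r (a+1))) * S.r a = S.r a * ((S.r (a+1) * S.r a * S.r (a+1)) * S.r a) * S.r a := by rw [h4]
      calc S.r (a+1) * ρ = (S.r a * S.r a) * S.r (a+1) * S.r a * S.r (a+1) * S.r a := by rw [S.r_mul_self, hρd]; group
        _ = S.r a * (S.r a * (S.r (a+1) * S.r a * S.r (a+1))) * S.r a := by group
        _ = _ := e1
        _ = ρ * S.r (a+1) * (S.r a * S.r a) := by rw [hρd]; group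
        _ = _ := by rw [S.r_mul_self, mul_one]
    rw [← h4', mul_assoc]
    nth_rw 1 [← hρ2]; simp
  have hCC : x⁻¹ * S.r (a+1) * x ∈ CC H (S.r a) := by
    rw [mem_CC]
    refine ⟨mul_mem (mul_mem (inv_mem hx) hr1) hx, ?_⟩
    have e2 : (S.r a)⁻¹ * (x⁻¹ * S.r (a+1) * x) * S.r a = (ρ⁻¹ * (x * S.r a))⁻¹ * (ρ * S.r (a+1) * ρ) * (ρ⁻¹ * (x * S.r a)) := by
      rw [hρ2]
      have : ρ * ρ = 1 := by nth_rw 1 [← hρ2]; simp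
      calc (S.r a)⁻¹ * (x⁻¹ * S.r (a+1) * x) * S.r a = (S.r a)⁻¹ * x⁻¹ * S.r (a+1) * x * S.r a := by group
        _ = (S.r a)⁻¹ * x⁻¹ * (ρ⁻¹ * ρ) * S.r (a+1) * (ρ * ρ) * x * S.r a := by rw [this]; group
        _ = _ := by group
    rw [e2, hcomm]
    exact mul_mem (mul_mem (inv_mem e) hr1) e
  have hcardCC : Nat.card (CC H (S.r a)) = 2 := by
    have h1 := card_dcs H (S.r a)
    rw [hd, card_W_eq ha (hF.mono (by omega) le_rfl), N_two (by omega), ht] at h1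
    omega
  have h2CC : S.r (a+2) ∈ CC H (S.r a) := by
    rw [mem_CC]
    refine ⟨hr2, ?_⟩
    rw [S.r_inv, S.r_comm (by omega) (by omega), mul_assoc, S.r_mul_self, mul_one]; exact hr2
  have heq : x⁻¹ * S.r (a+1) * x = S.r (a+2) := by
    by_contra hne
    have hsub : ({1, S.r (a+2), x⁻¹ * S.r (a+1) * x} : Set (Equiv.Perm Ω)) ⊆ CC H (S.r a) := by
      rintro y (rfl | rfl | rfl)
      · exact one_mem _
      · exact h2CC
      · exact hCC
    have h3 := Set.ncard_le_ncard hsub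
    have h1x : x⁻¹ * S.r (a+1) * x ≠ 1 := by
      intro e
      have : S.r (a+1) = 1 := by
        calc S.r (a+1) = x * (x⁻¹ * S.r (a+1) * x) * x⁻¹ := by group
          _ = 1 := by rw [e]; group
      exact r_ne_one (by omega) this
    rw [ncard_coe_sub, hcardCC, Set.ncard_eq_three.2 ⟨1, S.r (a+2), x⁻¹ * S.r (a+1) * x, (r_ne_one (by omega)).symm, h1x.symm, Ne.symm hne, rfl⟩] at h3
    omega
  have hcl : ∀ w ∈ H, w * S.r (a+1) * w⁻¹ = S.r (a+1) ∨ w * S.r (a+1) * w⁻¹ = S.r (a+2) * S.r (a+1) * S.r (a+2) := by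
    have h4 := comm_of_four (S := S) (a := a+1) (by omega) (hF.mono (by omega) (by omega)) ht
    rw [show a + 1 + 1 = a + 2 by omega] at h4
    refine S.W_ind (Or.inl (by simp)) ?_
    intro i i1 i2 w _ ih
    have e0 : S.r i * w * S.r (a+1) * (S.r i * w)⁻¹ = S.r i * (w * S.r (a+1) * w⁻¹) * S.r i := by
      rw [mul_inv_rev, S.r_inv]; group
    rw [e0]
    rcases (show i = a+1 ∨ i = a+2 by omega) with rfl | rfl <;> rcases ih with e | e <;> rw [e]
    · left; rw [S.r_mul_self, one_mul]
    · right; rw [h4, mul_assoc, S.r_mul_self, mul_one]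
    · right; rfl
    · left
      calc S.r (a+2) * (S.r (a+2) * S.r (a+1) * S.r (a+2)) * S.r (a+2) = (S.r (a+2) * S.r (a+2)) * S.r (a+1) * (S.r (a+2) * S.r (a+2)) := by group
        _ = _ := by rw [S.r_mul_self]; group
  have := hcl x⁻¹ (inv_mem hx)
  rw [inv_inv, heq] at this
  rcases this with e | e
  · exact r_ne (by omega) (by omega) e
  · have : S.r (a+1) = S.r (a+2) := by
      calc S.r (a+1) = S.r (a+2) * S.r (a+2) * S.r (a+1) * (S.r (a+2) * S.r (a+2)) := by rw [S.r_mul_self]; group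
        _ = S.r (a+2) * (S.r (a+2) * S.r (a+1) * S.r (a+2)) * S.r (a+2) := by group
        _ = _ := by rw [← e, S.r_mul_self, one_mul]
    exact r_ne (by omega) (by omega) this

/-- all consecutive orders are 3 -/
def All3 (S : Sys n Ω) (a b : ℕ) : Prop := ∀ j, a ≤ j → j + 2 ≤ b → S.v j (j+2) = 3

theorem All3.TA {a b : ℕ} (h : S.All3 a b) (hb : b ≤ n) (hF : ∀ j, a ≤ j → j + 2 ≤ b → S.Free j (j+2)) : TA S.r a b where
  sq i _ _ := S.r_mul_self i
  br i h1 h2 := braid_of_three (by omega) (hF i h1 (by omega)) (h i h1 (by omega))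
  cm i j h1 h2 h3 := S.r_comm h2 (by omega)

theorem All3.N {a b : ℕ} (h : S.All3 a b) (hab : a ≤ b) (hb : b ≤ n) (hF : S.Free a b) (hnf : ¬ S.Flat a b ∨ b ≤ a + 1) : S.N a b = (b-a+1).factorial := by
  apply le_antisymm _ (nonflat_N hab hb hnf)
  have := (h.TA hb (fun j h1 h2 => hF.mono h1 h2)).card_le hab
  rw [← card_W_eq hb hF]; exact this

theorem rank3_arith {N v t c s q f c' s' : ℕ} (hN : 0 < N) (hlt : ¬ 48 ≤ N) (h1 : N = v * (2 * t)) (h2 : c + 1 ≤ v) (h3 : 3 ≤ c)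
    (h4 : t = c * s) (h5 : 2 ∣ v * c) (h6 : q < v) (g1 : N = f * (2 * q)) (g2 : c' + 1 ≤ f) (g3 : 3 ≤ c')
    (g4 : q = c' * s') (g5 : 2 ∣ f * c') (g6 : t < f) : (t = 3 ∧ q = 3) ∨ (t = 4 ∧ q = 4 ∧ v = 5) := by
  have key : ∀ {v t c s : ℕ}, v * t < 24 → 0 < t → c + 1 ≤ v → 3 ≤ c → t = c * s → c = t ∧ 3 ≤ t ∧ t ≤ 4 ∧ v ≤ 7 := by
    intro v t c s a1 a0 a2 a3 a4
    have hs : s = 1 := by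
      rcases Nat.lt_or_ge s 2 with hs | hs
      · rcases (show s = 0 ∨ s = 1 by omega) with e | e
        · subst e; omega
        · exact e
      · have : 3 * 2 ≤ t := by rw [a4]; exact Nat.mul_le_mul a3 hs
        have : 4 * 6 ≤ v * t := Nat.mul_le_mul (by omega) this
        omega
    subst hs
    rw [mul_one] at a4
    subst a4
    refine ⟨rfl, a3, ?_, ?_⟩
    · by_contra hh
      have : 6 * 5 ≤ v * t := Nat.mul_le_mul (by omega) (by omega)
      omega
    · by_contra hh
      have : 8 * 3 ≤ v * t := Nat.mul_le_mul (by omega) (by omega)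
      omega
  have e1 : N = 2 * (v * t) := by rw [h1]; ring
  have e2 : N = 2 * (f * q) := by rw [g1]; ring
  have ht : 0 < t := Nat.pos_of_ne_zero (by rintro rfl; omega)
  have hq : 0 < q := Nat.pos_of_ne_zero (by rintro rfl; omega)
  obtain ⟨rfl, b1, b2, b3⟩ := key (by omega) ht h2 h3 h4
  obtain ⟨rfl, d1, d2, d3⟩ := key (by omega) hq g2 g3 g4
  have e3 : v * c = f * c' := by omega
  have hv : 4 ≤ v := by omega
  have hf : 4 ≤ f := by omega
  have e4 : v * c < 24 := by omega
  clear h1 g1 e1 e2 h4 g4 key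
  interval_cases c <;> interval_cases c' <;> first | omega | (interval_cases v <;> omega)

theorem rank3 {a : ℕ} (ha : a + 3 ≤ n) (h : ¬ S.Flat a (a+3)) (hF : S.Free a (a+3)) :
    48 ≤ S.N a (a+3) ∨ (S.v a (a+2) = 3 ∧ S.v (a+1) (a+3) = 3) := by
  by_contra hcon
  rw [not_or] at hcon
  obtain ⟨hlt, hne⟩ := hcon
  obtain ⟨c, h1, h2, h3, ⟨s, h4⟩, h5, h6⟩ := rank3_half ha h
  have hd := rank3_half (S := S.dual) (a := n-(a+3)) (by omega) (by
    have := dual_nonflat h (by omega) ha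
    rwa [show n - a = n - (a+3) + 3 by omega] at this)
  rw [show n - (a+3) + 3 = n - a by omega, show n - (a+3) + 2 = n - (a+1) by omega, show n - (a+3) + 1 = n - (a+2) by omega,
    dual_v_two (by omega), dual_v_two (by omega), dual_N (by omega), show n - (n-a) = a by omega, show n - (n-(a+3)) = a+3 by omega] at hd
  obtain ⟨c', g1, g2, g3, ⟨s', g4⟩, g5, g6⟩ := hd
  rw [show a + 1 + 2 = a + 3 by omega] at *
  generalize hv : S.v a (a+3) = v at *
  generalize hq : S.v a (a+2) = q at *
  generalize ht : S.v (a+1) (a+3) = t at *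
  generalize S.dual.v (n-(a+3)) (n-a) = f at *
  generalize hN : S.N a (a+3) = N at *
  have hkey : (t = 3 ∧ q = 3) ∨ (t = 4 ∧ q = 4 ∧ v = 5) :=
    rank3_arith (hN ▸ S.N_pos a (a+3)) hlt h1 h2 h3 h4 h5 h6 g1 g2 g3 g4 g5 g6
  rcases hkey with ⟨e1, e2⟩ | ⟨e1, e2, e3⟩
  · exact hne ⟨e2, e1⟩
  · subst e1 e2 e3
    exact kill44 ha h hF hq ht hv

theorem not_all3_N {a b : ℕ} (hab : a + 3 ≤ b) (hb : b ≤ n) (h : ¬ S.Flat a b)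
    (hF : ∀ j, a ≤ j → j + 3 ≤ b → S.Free j (j+3)) (hn : ¬ S.All3 a b) : 2 * (b-a+1).factorial ≤ S.N a b := by
  obtain ⟨d, hd⟩ : ∃ d, d = b - a := ⟨_, rfl⟩
  induction d generalizing a b with
  | zero => omega
  | succ d ih =>
    by_cases e : b = a + 3
    · subst e
      rcases rank3 hb h (hF a le_rfl le_rfl) with h1 | ⟨h1, h2⟩
      · rw [show a + 3 - a + 1 = 4 by omega]; simpa [Nat.factorial] using h1
      · exfalso; apply hn
        intro j j1 j2
        rcases (show j = a ∨ j = a + 1 by omega) with rfl | rfl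
        · exact h1
        · exact h2
    · have hj : ∃ j, a ≤ j ∧ j + 2 ≤ b ∧ S.v j (j+2) ≠ 3 := by
        unfold All3 at hn; push Not at hn; exact hn
      obtain ⟨j, j1, j2, j3⟩ := hj
      have hfac : (b-a+1).factorial = (b-a+1) * (b-a).factorial := Nat.factorial_succ _
      by_cases hja : j = a
      · have h1 := ih (a := a) (b := b-1) (by omega) (by omega) (nonflat_sub h le_rfl (by omega) (by omega) hb)
          (fun i i1 i2 => hF i i1 (by omega)) (fun ha3 => j3 (ha3 j j1 (by omega))) (by omega)
        have h2 := N_right (by omega) hb h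
        rw [show b - 1 - a + 1 = b - a by omega] at h1
        rw [hfac]; nlinarith
      · have h1 := ih (a := a+1) (b := b) (by omega) (by omega) (nonflat_sub h (by omega) (by omega) (by omega) hb)
          (fun i i1 i2 => hF i (by omega) (by omega)) (fun ha3 => j3 (ha3 j (by omega) (by omega))) (by omega)
        have h2 := N_left (by omega) hb h
        rw [show b - (a+1) + 1 = b - a by omega] at h1
        rw [hfac]; nlinarith

end Sys

open scoped Classical
set_option linter.unusedSectionVars false
set_option linter.unusedVariables false
set_option linter.unusedTactic false
set_option linter.unusedSimpArgs false

/-- group computations for type K -/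
theorem grpK {G : Type*} [Group G] {u s t : G} (hu : u * u = 1) (hs : s * s = 1) (ht : t * t = 1)
    (hut : u * t = t * u) (hst : s * t * s = t * s * t)
    (h : (u * s * u) * (t * s * t) * (u * s * u) = t * s * t) (y : G) (hy : y = u * s * u * s * u * s) :
    y * y = 1 ∧ y * u = u * y ∧ y * s = s * y ∧ y * t = t * y ∧ (u * y) * s * (u * y) = s * (u * y) * s := by
  have hui : u⁻¹ = u := by rw [inv_eq_iff_mul_eq_one]; exact hu
  have hsi : s⁻¹ = s := by rw [inv_eq_iff_mul_eq_one]; exact hs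
  have hti : t⁻¹ = t := by rw [inv_eq_iff_mul_eq_one]; exact ht
  have hus : ∀ x, u * (u * x) = x := fun x => by rw [← mul_assoc, hu, one_mul]
  have hss : ∀ x, s * (s * x) = x := fun x => by rw [← mul_assoc, hs, one_mul]
  have hts : ∀ x, t * (t * x) = x := fun x => by rw [← mul_assoc, ht, one_mul]
  have hyi : y⁻¹ = s * u * s * u * s * u := by
    rw [hy]; simp only [mul_inv_rev, hui, hsi, mul_assoc]
  have e1 : (s * (u * s * u) * s) * t * (s * (u * s * u) * s) = t := by
    rw [← hst] at h
    have := congrArg (fun x => s * x * s) h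
    simp only [mul_assoc, hss, hs, mul_one] at this ⊢
    exact this
  have e2 : (s * (u * s * u) * s) * t = t * (s * (u * s * u) * s) := by
    have e3 : (s * (u * s * u) * s) * (s * (u * s * u) * s) = 1 := by simp only [mul_assoc, hus, hss, hs]
    calc (s * (u * s * u) * s) * t = (s * (u * s * u) * s) * t * ((s * (u * s * u) * s) * (s * (u * s * u) * s)) := by rw [e3, mul_one]
      _ = ((s * (u * s * u) * s) * t * (s * (u * s * u) * s)) * (s * (u * s * u) * s) := by simp only [mul_assoc]
      _ = _ := by rw [e1]
  have hyt : y * t = t * y := by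
    have : y = u * (s * (u * s * u) * s) := by rw [hy]; simp only [mul_assoc]
    rw [this, mul_assoc, e2, ← mul_assoc, hut, mul_assoc]
  have hys : s * y = y⁻¹ * s := by rw [hyi, hy]; simp only [mul_assoc, hss, hus, hs]
  have hyu : u * y = y⁻¹ * u := by rw [hyi, hy]; simp only [mul_assoc, hss, hus, hu, mul_one]
  have hys' : s * y⁻¹ = y * s := by rw [hyi, hy]; simp only [mul_assoc, hss, hus, hs, mul_one]
  have hyt' : t * y⁻¹ = y⁻¹ * t := by
    rw [eq_inv_mul_iff_mul_eq, ← mul_assoc, hyt, mul_assoc, mul_inv_cancel, mul_one]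
  have hinv : y⁻¹ = y := by
    have a1 : (s * t * s) * y = y * (s * t * s) := by
      rw [mul_assoc, hys, ← mul_assoc, mul_assoc s t, hyt', ← mul_assoc, hys']; simp only [mul_assoc]
    have a2 : (t * s * t) * y = y⁻¹ * (t * s * t) := by
      rw [mul_assoc, ← hyt, ← mul_assoc, mul_assoc t s y, hys, ← mul_assoc, hyt']; simp only [mul_assoc]
    rw [hst, a2] at a1
    exact mul_right_cancel a1
  refine ⟨?_, ?_, ?_, hyt, ?_⟩
  · nth_rw 1 [← hinv]; simp
  · rw [hyu, hinv]
  · rw [hys, hinv]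
  · have b1 : u * y = y * u := by rw [hyu, hinv]
    have b2 : s * y = y * s := by rw [hys, hinv]
    have b3 : y * y = 1 := by nth_rw 1 [← hinv]; simp
    have l : (u * y) * s * (u * y) = u * s * u := by
      rw [mul_assoc u y s, ← b2, b1]
      calc u * (s * y) * (y * u) = u * s * (y * y) * u := by group
        _ = _ := by rw [b3, mul_one]
    have r : s * (u * y) * s = u * s * u := by
      rw [mul_assoc s (u*y) s, mul_assoc u y s, ← b2]
      rw [← hinv, hyi]; simp only [mul_assoc, hss, hus]
    rw [l, r]

/-- elements conjugated back into the range -/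
def cpre {G K : Type*} [Group G] [Group K] (φ : K →* G) (u : G) : Subgroup K :=
  φ.range.comap ((MulAut.conj u).toMonoidHom.comp φ)

theorem mem_cpre {G K : Type*} [Group G] [Group K] {φ : K →* G} {u : G} (hu : u * u = 1) {σ : K} :
    σ ∈ cpre φ u ↔ u * φ σ * u ∈ φ.range := by
  have hui : u⁻¹ = u := by rw [inv_eq_iff_mul_eq_one]; exact hu
  unfold cpre
  rw [Subgroup.mem_comap]
  simp [MulAut.conj_apply, hui]

namespace Sys
variable {n : ℕ} {Ω : Type} {S : Sys n Ω} [Finite Ω]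

variable (S) in
def T1 (a b : ℕ) : Prop := ∃ y ∈ S.W a (a+2), y * y = 1 ∧ (∀ i, a ≤ i → i < b → y * S.r i = S.r i * y) ∧
  (S.r a * y) * S.r (a+1) * (S.r a * y) = S.r (a+1) * (S.r a * y) * S.r (a+1) ∧
  orderOf y * (b-a+1) ≤ S.v a b ∧ ((y = 1 ∧ S.v a (a+2) = 3) ∨ orderOf y = 2)

variable (S) in
def T2 (a b : ℕ) : Prop := S.v a (a+2) = 4 ∧ ∀ j, a + 2 ≤ j → j ≤ b → ∃ e, S.v a j = 2 ^ e

variable (S) in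
def T3 (a b : ℕ) : Prop := 5 ≤ S.v a (a+2) ∧ (b-a)*(b-a) + 1 ≤ S.v a b ∧
  (∀ E : Subgroup (Equiv.Perm Ω), S.W (a+1) b ≤ E → E ≤ S.W a b → 2 * Nat.card E = Nat.card (S.W a b) →
    2 * (1 + (b-a)*(b-a-1)) ≤ S.v a b) ∧ (b - a = 4 → S.v a b = 17 ∨ 20 ≤ S.v a b)

theorem pathPS {a m : ℕ} (hb : a + (m+4) ≤ n) (hF : S.Free a (a+(m+4))) (hnf : ¬ S.Flat a (a+(m+4)))
    (h3 : S.All3 (a+1) (a+(m+4))) : ∃ φ : Equiv.Perm (Fin (m+4)) →* Equiv.Perm Ω, PS φ (S.r a) ∧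
      φ.range = S.W (a+1) (a+(m+4)) ∧ ∀ i (hi : i + 1 < m + 4), φ (Equiv.swap ⟨i, by omega⟩ ⟨i+1, hi⟩) = S.r (a+1+i) := by
  have hTA := h3.TA hb (fun j h1 h2 => hF.mono (by omega) h2)
  have hN := h3.N (by omega) hb (hF.mono (by omega) le_rfl) (Or.inl (nonflat_sub hnf (by omega) (by omega) le_rfl hb))
  rw [← card_W_eq hb (hF.mono (by omega) le_rfl), show a + (m+4) - (a+1) + 1 = m + 3 + 1 by omega] at hN
  rw [show a + (m+4) = a + 1 + (m+3) by omega] at hTA hN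
  obtain ⟨φ, h1, h2, h4⟩ := hTA.exists_iso hN
  have h4' : ∀ i (hi : i + 1 < m + 4), φ (Equiv.swap ⟨i, by omega⟩ ⟨i+1, hi⟩) = S.r (a+1+i) :=
    fun i hi => h4 i (by omega)
  have h2' : φ.range = S.W (a+1) (a+(m+4)) := by rw [h2, show a + (m+4) = a + 1 + (m+3) by omega]; rfl
  refine ⟨φ, ?_, h2', h4'⟩
  have hcm : ∀ i (hi : i + 1 < m + 4), 1 ≤ i →
    S.r a * φ (Equiv.swap (⟨i, by omega⟩ : Fin (m+4)) ⟨i+1, hi⟩) = φ (Equiv.swap (⟨i, by omega⟩ : Fin (m+4)) ⟨i+1, hi⟩) * S.r a := by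
    intro i hi i1
    rw [h4' i hi]; exact S.r_comm (by omega) (by omega)
  refine ⟨h1, S.r_mul_self a, hcm, ?_⟩
  let A : Subgroup (Equiv.Perm (Fin (m+4))) := cpre φ (S.r a)
  have hA : ∀ σ, σ ∈ A ↔ S.r a * φ σ * S.r a ∈ φ.range := fun _ => mem_cpre (S.r_mul_self a)
  have hs := swaps_of_adj A 1 (fun i hi i1 => by
    rw [hA, hcm i hi i1, mul_assoc, S.r_mul_self, mul_one]; exact ⟨_, rfl⟩)
  have hfix : ∀ σ : Equiv.Perm (Fin (m+4)), σ 0 = 0 → σ ∈ A := by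
    intro σ hσ
    apply perm_mem_of_swaps A {x | 1 ≤ x.1} (fun x hx y hy => hs x y hx hy)
    intro x hx
    have : x = 0 := Fin.ext (by simp at hx ⊢; exact hx)
    rw [this, hσ]
  intro σ hσ
  by_contra h0
  obtain ⟨π, κ, hπ, hκ, rfl⟩ := PS.fact h0
  have h5 : Equiv.swap 0 1 ∈ A := by
    have := mul_mem (mul_mem (inv_mem (hfix π hπ)) ((hA _).2 hσ)) (inv_mem (hfix κ hκ))
    simpa [mul_assoc] using this
  rw [hA, h2'] at h5
  have h6 := h4' 0 (by omega)
  rw [show (Equiv.swap (0 : Fin (m+4)) 1) = Equiv.swap ⟨0, by omega⟩ ⟨0+1, by omega⟩ from rfl, h6] at h5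
  exact rho_notin (by omega) hb hF (v_three (by omega) (nonflat_sub hnf le_rfl (by omega) (by omega) hb)) h5

end Sys

open scoped Classical
set_option linter.unusedSectionVars false
set_option linter.unusedVariables false
set_option linter.unusedTactic false
set_option linter.unusedSimpArgs false

/-- a central involution outside `H` makes the index even -/
theorem even_index {G : Type*} [Group G] [Finite G] {W H : Subgroup G} (hH : H ≤ W) {y : G} (hy : y ∈ W) (hyH : y ∉ H)
    (hyy : y * y = 1) (hc : ∀ h ∈ H, y * h = h * y) : 2 ∣ (cos W H).ncard := by
  have hyi : y⁻¹ = y := by rw [inv_eq_iff_mul_eq_one]; exact hyy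
  let H' : Subgroup G :=
    { carrier := {g | g ∈ H ∨ y * g ∈ H}
      one_mem' := Or.inl (one_mem _)
      mul_mem' := by
        rintro p q (hp | hp) (hq | hq)
        · left; exact mul_mem hp hq
        · right; rw [← mul_assoc, hc p hp, mul_assoc]; exact mul_mem hp hq
        · right; rw [← mul_assoc]; exact mul_mem hp hq
        · left
          have h2 := mul_mem hp hq
          rw [← mul_assoc, ← hc _ hp, ← mul_assoc, hyy, one_mul] at h2
          exact h2
      inv_mem' := by
        rintro p (hp | hp)
        · left; exact inv_mem hp
        · right
          have h1 := inv_mem hp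
          rw [mul_inv_rev, hyi] at h1
          have h2 := hc _ h1
          rw [mul_assoc, hyy, mul_one] at h2
          change y * p⁻¹ ∈ H
          rw [← h2, ← mul_assoc, hyy, one_mul]; exact h1 }
  have hle : H' ≤ W := by
    rintro p (hp | hp)
    · exact hH hp
    · have := mul_mem hy (hH hp)
      rwa [← mul_assoc, hyy, one_mul] at this
  have hcard : Nat.card H' = 2 * Nat.card H := by
    have e : (H' : Set G) = (H : Set G) ∪ (fun g => y * g) '' (H : Set G) := by
      ext g; constructor
      · rintro (h | h)
        · left; exact h
        · right; exact ⟨_, h, by simp [← mul_assoc, hyy]⟩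
      · rintro (h | ⟨g, h, rfl⟩)
        · left; exact h
        · right; change y * (y * g) ∈ H; rw [← mul_assoc, hyy, one_mul]; exact h
    rw [← ncard_coe_sub, e, Set.ncard_union_eq, Set.ncard_image_of_injective _ (mul_right_injective y), ncard_coe_sub]
    · ring
    · rw [Set.disjoint_left]
      rintro _ h1 ⟨g, h2, rfl⟩
      exact hyH (by have := mul_mem h1 (inv_mem h2); simpa using this)
  have h1 := Subgroup.card_dvd_of_le hle
  rw [hcard, ← card_cos hH] at h1
  exact Nat.dvd_of_mul_dvd_mul_right Nat.card_pos h1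

theorem index_two {G : Type*} [Group G] [Finite G] {W E : Subgroup G} (hE : E ≤ W) (hc : 2 * Nat.card E = Nat.card W) :
    ∀ x ∈ W, ∀ y ∈ W, x * y ∈ E ↔ (x ∈ E ↔ y ∈ E) := by
  intro x hx y hy
  have h1 : (E.subgroupOf W).index = 2 := by
    have h2 := (E.subgroupOf W).card_mul_index
    rw [Nat.card_congr (Subgroup.subgroupOfEquivOfLe hE).toEquiv, ← hc, mul_comm] at h2
    exact Nat.eq_of_mul_eq_mul_right Nat.card_pos h2
  have := Subgroup.mul_mem_iff_of_index_two h1 (a := ⟨x, hx⟩) (b := ⟨y, hy⟩)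
  simpa [Subgroup.mem_subgroupOf] using this

/-- elements of a symmetric group of degree 3 -/
theorem six_elems {G : Type*} [Group G] {s t : G} (hs : s * s = 1) (ht : t * t = 1) (hst : s * t * s = t * s * t) {p : G → Prop}
    (w : G) (h : ∃ x, (x = 1 ∨ x = s ∨ x = t ∨ x = s * t ∨ x = t * s ∨ x = t * s * t) ∧ (w = s * x ∨ w = t * x)) :
    (w = 1 ∨ w = s ∨ w = t ∨ w = s * t ∨ w = t * s ∨ w = t * s * t) := by
  have hss : ∀ x, s * (s * x) = x := fun x => by rw [← mul_assoc, hs, one_mul]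
  have hts : ∀ x, t * (t * x) = x := fun x => by rw [← mul_assoc, ht, one_mul]
  have e1 : s * (t * s) = t * (s * t) := by simpa only [mul_assoc] using hst
  have e2 : s * (t * (s * t)) = t * s := by rw [← e1, hss]
  obtain ⟨x, (rfl | rfl | rfl | rfl | rfl | rfl), (rfl | rfl)⟩ := h <;> simp only [mul_assoc, hss, hts, hs, ht, e1, e2, mul_one] <;> tauto

namespace Sys
variable {n : ℕ} {Ω : Type} {S : Sys n Ω} [Finite Ω]

theorem W_gen {a b : ℕ} (p : Equiv.Perm Ω → Prop) (h1 : p 1) (h2 : ∀ w ∈ S.W a b, p w → p (S.r a * w))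
    (h3 : ∀ h ∈ S.W (a+1) b, ∀ w ∈ S.W a b, p w → p (h * w)) : ∀ w ∈ S.W a b, p w := by
  refine S.W_ind h1 ?_
  intro i i1 i2 w hw hp
  by_cases e : i = a
  · subst e; exact h2 w hw hp
  · exact h3 _ (S.r_mem (by omega) i2) w hw hp

theorem W_six {a : ℕ} (hbr : S.r a * S.r (a+1) * S.r a = S.r (a+1) * S.r a * S.r (a+1)) :
    ∀ w ∈ S.W a (a+2), (w = 1 ∨ w = S.r a ∨ w = S.r (a+1) ∨ w = S.r a * S.r (a+1) ∨ w = S.r (a+1) * S.r a ∨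
      w = S.r (a+1) * S.r a * S.r (a+1)) := by
  refine S.W_ind (Or.inl rfl) ?_
  intro i i1 i2 w _ ih
  apply six_elems (S.r_mul_self _) (S.r_mul_self _) hbr (p := fun _ => True)
  refine ⟨w, ih, ?_⟩
  rcases (show i = a ∨ i = a+1 by omega) with rfl | rfl
  · left; rfl
  · right; rfl

theorem T2.ge {a b : ℕ} (h : S.T2 a b) (hb : b ≤ n) (hnf : ¬ S.Flat a b) : ∀ e, a + 2 + e ≤ b → 2 ^ (e+2) ≤ S.v a (a+2+e) := by
  intro e
  induction e with
  | zero => intro _; simp [h.1]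
  | succ e ih =>
    intro he
    have h1 := ih (by omega)
    have h2 := v_lt (S := S) (a := a) (b := a+2+(e+1)) (by omega) (by omega) (nonflat_sub hnf le_rfl (by omega) he hb)
    rw [show a + 2 + (e+1) - 1 = a + 2 + e by omega] at h2
    obtain ⟨x, hx⟩ := h.2 (a+2+(e+1)) (by omega) he
    rw [hx] at h2 ⊢
    have : e + 2 < x := by
      by_contra hc
      have := Nat.pow_le_pow_right (n := 2) (by norm_num) (show x ≤ e + 2 by omega)
      omega
    exact Nat.pow_le_pow_right (by norm_num) (by omega)

set_option maxHeartbeats 1000000 in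
theorem path {a m : ℕ} (hb : a + (m+4) ≤ n) (hF : S.Free a (a+(m+4))) (hnf : ¬ S.Flat a (a+(m+4)))
    (h3 : S.All3 (a+1) (a+(m+4))) : S.T1 a (a+(m+4)) ∨ S.T2 a (a+(m+4)) ∨ S.T3 a (a+(m+4)) := by
  have hp3 : 3 ≤ S.v a (a+2) := v_three (by omega) (nonflat_sub hnf le_rfl (by omega) (by omega) hb)
  have hF2 : S.Free a (a+2) := hF.mono le_rfl (by omega)
  have hord := orderOf_eq (by omega) hF2
  by_cases e3 : S.v a (a+2) = 3
  · left
    refine ⟨1, one_mem _, by simp, by simp, ?_, ?_, Or.inl ⟨rfl, e3⟩⟩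
    · rw [mul_one]; exact braid_of_three (by omega) hF2 e3
    · rw [orderOf_one, one_mul]; exact nonflat_v (by omega) hb hnf
  obtain ⟨φ, hPS, hR, hφ⟩ := pathPS hb hF hnf h3
  have f01 : φ (Equiv.swap 0 1) = S.r (a+1) := hφ 0 (by omega)
  have f12 : φ (Equiv.swap 1 2) = S.r (a+2) := hφ 1 (by omega)
  by_cases e4 : S.v a (a+2) = 4
  · right; left
    refine ⟨e4, ?_⟩
    intro j j1 j2
    rw [← cos_v (by omega) (by omega) (hF.mono le_rfl j2)]
    apply pow_two_index (S.W_le (by omega) le_rfl) (S.r_mem le_rfl (by omega)) (S.r_mul_self a) W_gen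
    intro h hh
    have : h ∈ φ.range := by rw [hR]; exact S.W_le le_rfl j2 hh
    obtain ⟨σ, rfl⟩ := this
    apply hPS.comm_conj
    rw [f01]; exact comm_of_four (by omega) hF2 e4
  -- p ≥ 5
  set ρ := S.r a * S.r (a+1) * S.r a with hρ
  have hρ2 : ρ * ρ = 1 := by
    calc ρ * ρ = S.r a * S.r (a+1) * (S.r a * S.r a) * S.r (a+1) * S.r a := by rw [hρ]; group
      _ = S.r a * (S.r (a+1) * S.r (a+1)) * S.r a := by rw [S.r_mul_self]; group
      _ = 1 := by rw [S.r_mul_self, mul_one, S.r_mul_self]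
  have hra : S.r a ∈ S.W a (a+2) := S.r_mem le_rfl (by omega)
  have hra1 : S.r (a+1) ∈ S.W a (a+2) := S.r_mem (by omega) (by omega)
  have hρW : ρ ∈ S.W a (a+2) := mul_mem (mul_mem hra hra1) hra
  let L := cpre φ ρ
  have hL : ∀ σ, σ ∈ L ↔ ρ * φ σ * ρ ∈ φ.range := fun _ => mem_cpre hρ2
  have s2 := swaps_of_adj L 2 (fun i hi i2 => by
    rw [hL, hφ i hi]
    have e1 : S.r a * S.r (a+1+i) = S.r (a+1+i) * S.r a := S.r_comm (by omega) (by omega)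
    have e2 : S.r (a+1) * S.r (a+1+i) = S.r (a+1+i) * S.r (a+1) := S.r_comm (by omega) (by omega)
    have e5 : ρ * S.r (a+1+i) = S.r (a+1+i) * ρ := by
      rw [hρ, mul_assoc, e1, ← mul_assoc, mul_assoc (S.r a), e2, ← mul_assoc, e1]; simp only [mul_assoc]
    rw [e5, mul_assoc, hρ2, mul_one, ← hφ i hi]; exact ⟨_, rfl⟩)
  have h01 : Equiv.swap (0 : Fin (m+4)) 1 ∉ L := by
    rw [hL, f01, hR]
    intro hm
    have h1 := hF2.ip (by omega) hb (mul_mem (mul_mem hρW hra1) hρW) hm (e := a+1) (f := a+2) (by omega) (by omega) (by omega) le_rfl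
    rcases W_one _ h1 with e | e
    · have : S.r (a+1) = 1 := by
        calc S.r (a+1) = (ρ * ρ) * S.r (a+1) * (ρ * ρ) := by rw [hρ2]; group
          _ = ρ * (ρ * S.r (a+1) * ρ) * ρ := by group
          _ = 1 := by rw [e, mul_one, hρ2]
      exact r_ne_one (by omega) this
    · have : (S.r a * S.r (a+1)) ^ 4 = 1 := by
        calc (S.r a * S.r (a+1)) ^ 4 = (ρ * S.r (a+1) * ρ) * S.r (a+1) := by
              rw [hρ]; simp only [pow_succ, pow_zero, one_mul, mul_assoc]
          _ = 1 := by rw [e, S.r_mul_self]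
      have := orderOf_le_of_pow_eq_one (by norm_num) this
      omega
  have hbr : S.r (a+1) * S.r (a+1+1) * S.r (a+1) = S.r (a+1+1) * S.r (a+1) * S.r (a+1+1) :=
    braid_of_three (by omega) (hF.mono (by omega) (by omega)) (h3 (a+1) le_rfl (by omega))
  rw [show a + 1 + 1 = a + 2 by omega] at hbr
  have f20 : (2 : Fin (m+4)) ≠ 0 := by
    intro h
    have h2 : 2 % (m + 4) = 0 := congrArg Fin.val h
    rw [Nat.mod_eq_of_lt (show 2 < m + 4 by omega)] at h2
    omega
  have f02 : φ (Equiv.swap 0 2) = S.r (a+2) * S.r (a+1) * S.r (a+2) := by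
    have e1 : Equiv.swap (0 : Fin (m+4)) 2 = Equiv.swap 1 2 * Equiv.swap 0 1 * Equiv.swap 1 2 := by
      rw [Equiv.swap_mul_swap_mul_swap, Equiv.swap_comm]
      · intro h; simpa using congrArg Fin.val h
      · exact f20.symm
    rw [e1, map_mul, map_mul, f01, f12]
  have hrc : S.r a * S.r (a+2) = S.r (a+2) * S.r a := S.r_comm (by omega) (by omega)
  have h12 : Equiv.swap (1 : Fin (m+4)) 2 ∉ L := by
    rw [hL, f12]
    intro hm
    have e1 : ρ * S.r (a+2) * ρ = S.r a * φ (Equiv.swap 0 2) * S.r a := by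
      rw [f02, ← hbr, hρ]
      calc S.r a * S.r (a+1) * S.r a * S.r (a+2) * (S.r a * S.r (a+1) * S.r a) =
          S.r a * S.r (a+1) * (S.r a * S.r (a+2)) * S.r a * S.r (a+1) * S.r a := by group
        _ = S.r a * S.r (a+1) * S.r (a+2) * (S.r a * S.r a) * S.r (a+1) * S.r a := by rw [hrc]; group
        _ = _ := by rw [S.r_mul_self]; group
    rw [e1] at hm
    have := hPS.hK _ hm
    rw [Equiv.swap_apply_left] at this
    exact f20 this
  by_cases h02 : Equiv.swap (0 : Fin (m+4)) 2 ∈ L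
  · left
    have hm := (hL _).1 h02
    rw [f02] at hm
    have key : ρ * (S.r (a+2) * S.r (a+1) * S.r (a+2)) * ρ = S.r (a+2) * S.r (a+1) * S.r (a+2) := by
      have hm' := hm
      rw [hR] at hm'
      have hr2 : S.r (a+2) ∈ S.W a (a+3) := S.r_mem (by omega) (by omega)
      have hρ3 : ρ ∈ S.W a (a+3) := S.W_le le_rfl (by omega) hρW
      have h1 := (hF.mono le_rfl (by omega : a + 3 ≤ a+(m+4))).ip (by omega) hb
        (mul_mem (mul_mem hρ3 (mul_mem (mul_mem hr2 (S.W_le le_rfl (by omega) hra1)) hr2)) hρ3) hm'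
        (e := a+1) (f := a+3) (by omega) (by omega) (by omega) le_rfl
      have h6 := W_six (S := S) (a := a+1) (by rw [show a + 1 + 1 = a + 2 by omega]; exact hbr) _ h1
      rw [show a + 1 + 1 = a + 2 by omega] at h6
      have back : ∀ x, ρ * (S.r (a+2) * S.r (a+1) * S.r (a+2)) * ρ = x → ρ * x * ρ = S.r (a+2) * S.r (a+1) * S.r (a+2) := by
        rintro x rfl
        calc ρ * (ρ * (S.r (a+2) * S.r (a+1) * S.r (a+2)) * ρ) * ρ = (ρ * ρ) * (S.r (a+2) * S.r (a+1) * S.r (a+2)) * (ρ * ρ) := by group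
          _ = _ := by rw [hρ2]; group
      have hτ : S.r (a+2) * S.r (a+1) * S.r (a+2) ∈ φ.range := ⟨_, f02⟩
      have Φ := S.nonempty.some
      have hχ : S.χ ((ρ * (S.r (a+2) * S.r (a+1) * S.r (a+2)) * ρ) Φ) ↔ ¬ S.χ Φ := by
        rw [hρ]
        simp only [Equiv.Perm.mul_apply]
        simp only [S.χ_r _ _ (show a < n by omega), S.χ_r _ _ (show a + 1 < n by omega), S.χ_r _ _ (show a + 2 < n by omega)]
        tauto
      rcases h6 with e | e | e | e | e | e
      · rw [e] at hχ; simp at hχ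
      · exfalso; apply h01; rw [hL, f01, back _ e]; exact hτ
      · exfalso; apply h12; rw [hL, f12, back _ e]; exact hτ
      · rw [e] at hχ
        simp only [Equiv.Perm.mul_apply, S.χ_r _ _ (show a + 1 < n by omega), S.χ_r _ _ (show a + 2 < n by omega)] at hχ
        tauto
      · rw [e] at hχ
        simp only [Equiv.Perm.mul_apply, S.χ_r _ _ (show a + 1 < n by omega), S.χ_r _ _ (show a + 2 < n by omega)] at hχ
        tauto
      · exact e
    obtain ⟨k1, k2, k3, k4, k5⟩ := grpK (S.r_mul_self a) (S.r_mul_self (a+1)) (S.r_mul_self (a+2)) hrc hbr key _ rfl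
    set y := S.r a * S.r (a+1) * S.r a * S.r (a+1) * S.r a * S.r (a+1) with hy
    have hyW : y ∈ S.W a (a+2) := mul_mem (mul_mem (mul_mem (mul_mem (mul_mem hra hra1) hra) hra1) hra) hra1
    have hy3 : y = (S.r a * S.r (a+1)) ^ 3 := by rw [hy]; simp only [pow_succ, pow_zero, one_mul, mul_assoc]
    have hy1 : y ≠ 1 := by
      rw [hy3]; intro h
      have := orderOf_le_of_pow_eq_one (by norm_num) h
      omega
    have hp6 : S.v a (a+2) = 6 := by
      have : (S.r a * S.r (a+1)) ^ 6 = 1 := by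
        rw [show 6 = 3 * 2 by norm_num, pow_mul, ← hy3, pow_two, k1]
      have h1 := orderOf_dvd_of_pow_eq_one this
      rw [hord] at h1
      have h2 := Nat.le_of_dvd (by norm_num) h1
      have h5 : S.v a (a+2) = 5 ∨ S.v a (a+2) = 6 := by omega
      rcases h5 with h5 | h5
      · rw [h5] at h1; omega
      · exact h5
    have hyc : ∀ i, a ≤ i → i < a+(m+4) → y * S.r i = S.r i * y := by
      intro i i1 i2
      rcases (show i = a ∨ i = a+1 ∨ i = a+2 ∨ a + 2 < i by omega) with rfl | rfl | rfl | h
      · exact k2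
      · exact k3
      · exact k4
      · exact (r_W_comm (by omega) h hyW).symm
    have hyH : y ∉ S.W (a+1) (a+(m+4)) := by
      intro hm
      have h1 := hF2.ip (by omega) hb hyW hm (e := a+1) (f := a+2) (by omega) (by omega) (by omega) le_rfl
      rcases W_one _ h1 with e | e
      · exact hy1 e
      · rw [e] at k2
        have : (S.r a * S.r (a+1)) ^ 2 = 1 := by
          rw [pow_two]
          calc S.r a * S.r (a+1) * (S.r a * S.r (a+1)) = S.r a * (S.r (a+1) * S.r a) * S.r (a+1) := by group
            _ = (S.r a * S.r a) * (S.r (a+1) * S.r (a+1)) := by rw [k2]; group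
            _ = 1 := by rw [S.r_mul_self, S.r_mul_self, one_mul]
        have := orderOf_le_of_pow_eq_one (by norm_num) this
        omega
    have hycc : ∀ h ∈ S.W a (a+(m+4)), y * h = h * y := by
      refine S.W_ind (by simp) ?_
      intro i i1 i2 w _ ih
      rw [← mul_assoc, hyc i i1 i2, mul_assoc, ih, mul_assoc]
    have heven : ∀ j, a + 2 ≤ j → j ≤ a+(m+4) → 2 ∣ S.v a j := by
      intro j j1 j2
      rw [← cos_v (by omega) (by omega) (hF.mono le_rfl j2)]
      exact even_index (S.W_le (by omega) le_rfl) (S.W_le le_rfl j1 hyW) (fun h => hyH (S.W_le le_rfl j2 h)) k1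
        (fun h hh => hycc h (S.W_le (by omega) j2 hh))
    have hgrow : ∀ e, a + 2 + e ≤ a + (m+4) → 6 + 2 * e ≤ S.v a (a+2+e) := by
      intro e
      induction e with
      | zero => intro _; simp [hp6]
      | succ e ih =>
        intro he
        have h1 := ih (by omega)
        have h2 := v_lt (S := S) (a := a) (b := a+2+(e+1)) (by omega) (by omega) (nonflat_sub hnf le_rfl (by omega) he hb)
        rw [show a + 2 + (e+1) - 1 = a + 2 + e by omega] at h2
        have h5 := heven (a+2+(e+1)) (by omega) he
        have h6 := heven (a+2+e) (by omega) (by omega)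
        omega
    have ho2 : orderOf y = 2 := orderOf_eq_prime (by rw [pow_two]; exact k1) hy1
    refine ⟨y, hyW, k1, hyc, k5, ?_, Or.inr ho2⟩
    have := hgrow (m+2) (by omega)
    rw [show a + 2 + (m+2) = a + (m+4) by omega] at this
    rw [ho2]; omega
  · right; right
    have hfix := perm_fix L s2 h01 h12 h02
    have hL' : ∀ σ, (S.r a * φ (Equiv.swap 0 1) * S.r a) * φ σ * (S.r a * φ (Equiv.swap 0 1) * S.r a) ∈ φ.range → σ 0 = 0 ∧ σ 1 = 1 := by
      intro σ hσ
      rw [f01] at hσ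
      exact hfix σ ((hL σ).2 hσ)
    have hHW : φ.range ≤ S.W a (a+(m+4)) := by rw [hR]; exact S.W_le (by omega) le_rfl
    have hraW : S.r a ∈ S.W a (a+(m+4)) := S.r_mem le_rfl (by omega)
    have hcos := cos_v (by omega) hb hF
    refine ⟨by omega, ?_, ?_, ?_⟩
    · have := (hPS.total hL' hHW hraW).2.2
      rw [hR, hcos] at this
      rw [show a + (m+4) - a = m + 4 by omega]
      nlinarith
    · intro E hHE hEW hcard
      have hρE : ρ ∈ E := by
        have i2 : S.r a ∈ S.W a (a+(m+4)) := hraW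
        have i3 : S.r (a+1) ∈ E := hHE (S.r_mem le_rfl (by omega))
        have i4 := index_two hEW hcard
        have i5 := i4 _ (mul_mem i2 (hEW i3)) _ i2
        have i6 := i4 _ i2 _ (hEW i3)
        rw [hρ]; tauto
      have h1 := hPS.even_total hL' (E := E) (by rw [hR]; exact hHE) (by rw [f01]; exact hρE)
      rw [hR] at h1
      have h2 := card_cos hHE
      have h5 := card_cos (hHE.trans hEW)
      rw [hcos, ← hcard, ← h2, ← mul_assoc] at h5
      have h6 := Nat.eq_of_mul_eq_mul_right Nat.card_pos h5
      rw [h6, show a + (m+4) - a = m + 4 by omega, show m + 4 - 1 = m + 3 by omega]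
      omega
    · intro h4
      have : m = 0 := by omega
      subst this
      have := hPS.total17 hL' hHW hraW (by
        intro p p1 p2 p3
        exact W_gen p p1 p2 (by rw [hR] at p3; exact p3))
      rw [hR, hcos] at this
      exact this

end Sys

open scoped Classical
set_option linter.unusedSectionVars false
set_option linter.unusedVariables false
set_option linter.unusedTactic false
set_option linter.unusedSimpArgs false
namespace Sys
variable {n : ℕ} {Ω : Type} {S : Sys n Ω} [Finite Ω]

theorem fv_V (S : Sys n Ω) : S.fv 1 n = S.dual.v 0 (n-1) := by unfold fv; rw [Nat.sub_self]
theorem fv_B (hn : 7 ≤ n) (S : Sys n Ω) : S.fv 2 (n-1) = S.dual.v 1 (n-2) := by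
  unfold fv; rw [show n - (n-1) = 1 by omega]
theorem fv_M (hn : 7 ≤ n) (S : Sys n Ω) : S.fv 1 (n-1) = S.dual.v 1 (n-1) := by
  unfold fv; rw [show n - (n-1) = 1 by omega]

theorem total_ge (hn : 7 ≤ n) (S : Sys n Ω) : S.v 0 (n-1) * S.dual.v 0 (n-1) * S.N 1 (n-1) ≤ S.N 0 n := by
  have h1 := v_mul (S := S) (a := 0) (b := n) (by omega) le_rfl
  have h2 := v_mono (S := S) (a := 0) (b := n-1) (c := n) (by omega) (by omega) le_rfl
  have h3 := fv_mul (S := S) (a := 1) (b := n) (by omega) le_rfl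
  rw [fv_V] at h3
  rw [← h1, zero_add, ← h3]
  calc _ = S.v 0 (n-1) * (S.dual.v 0 (n-1) * S.N 1 (n-1)) := by ring
    _ ≤ _ := Nat.mul_le_mul_right _ h2

theorem N_M1 (hn : 7 ≤ n) (S : Sys n Ω) : S.v 1 (n-1) * (S.dual.v 1 (n-2) * S.N 2 (n-2)) = S.N 1 (n-1) := by
  have h1 := v_mul (S := S) (a := 1) (b := n-1) (by omega) (by omega)
  have h2 := fv_mul (S := S) (a := 2) (b := n-1) (by omega) (by omega)
  rw [fv_B hn] at h2
  rw [← h1, show (1+1) = 2 from rfl, ← h2, show n - 1 - 1 = n - 2 by omega]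

theorem N_M2 (hn : 7 ≤ n) (S : Sys n Ω) : S.v 1 (n-2) * (S.dual.v 1 (n-1) * S.N 2 (n-2)) = S.N 1 (n-1) := by
  have h1 := v_mul (S := S) (a := 1) (b := n-2) (by omega) (by omega)
  have h2 := fv_mul (S := S) (a := 1) (b := n-1) (by omega) (by omega)
  rw [fv_M hn] at h2
  rw [← h2, show n - 1 - 1 = n - 2 by omega, ← h1]; ring

theorem dual_N' {a b : ℕ} (ha : a ≤ n) (hb : b ≤ n) (S : Sys n Ω) {c d : ℕ} (hc : n - b = c) (hd : n - a = d) : S.dual.N a b = S.N c d := by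
  rw [dual_N hb, hc, hd]

theorem dd_N {a b : ℕ} (ha : a ≤ n) (hb : b ≤ n) : S.dual.dual.N a b = S.N a b := by
  rw [dual_N hb, dual_N (by omega), show n - (n-a) = a by omega, show n - (n-b) = b by omega]

theorem dd_v {a b : ℕ} (ha : a < n) (hb : b ≤ n) : S.dual.dual.v a b = S.v a b := by
  unfold v; rw [dd_N (by omega) hb, dd_N (by omega) hb]

theorem free_R (hn : 7 ≤ n) : S.Free 0 (n-2) := free_right (by omega)
theorem free_A (hn : 7 ≤ n) : S.Free 1 (n-2) := free_right (by omega)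
theorem free_B (hn : 7 ≤ n) : S.Free 2 (n-1) := free_left (by omega) (by omega) (by omega)
theorem dual_free_M (hn : 7 ≤ n) : S.dual.Free 1 (n-1) ↔ S.Free 1 (n-1) := by
  rw [dual_free (by omega), show n - (n-1) = 1 by omega]

theorem nonflat_A (hn : 7 ≤ n) (hM : ¬ S.Free 1 (n-1)) : ¬ S.Flat 1 (n-2) := by
  intro h
  apply hM
  have := free_of_flat (S := S) (a := 1) (b := n-2) (by omega) (by omega) (free_A hn)
    (by rw [show n - 2 + 1 = n - 1 by omega]; exact free_B hn) h
  rwa [show n - 2 + 1 = n - 1 by omega] at this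

theorem nonflat_R (hn : 7 ≤ n) (hM : S.Free 1 (n-1)) : ¬ S.Flat 0 (n-2) := by
  intro h
  apply S.nf1
  have := free_of_flat (S := S) (a := 0) (b := n-2) (by omega) (by omega) (free_R hn)
    (by rw [show n - 2 + 1 = n - 1 by omega]; exact hM) h
  rw [show n - 2 + 1 = n - 1 by omega] at this
  exact this

theorem nonflat_M (hn : 7 ≤ n) (hM : S.Free 1 (n-1)) : ¬ S.Flat 1 (n-1) := by
  intro h
  apply S.nf2
  have := free_of_flat (S := S) (a := 1) (b := n-1) (by omega) (by omega) hM
    (by rw [show n - 1 + 1 = n by omega]; exact free_left (by omega) le_rfl (by omega)) h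
  rw [show n - 1 + 1 = n by omega] at this
  exact this

/-- colour counting on the section `[0,b)` -/
theorem colour (hn : 7 ≤ n) (h : ¬ S.Flat 1 (n-2)) : ∀ b, 2 ≤ b → b ≤ n - 2 → b + 1 ≤ S.c 0 b + S.s 0 b := by
  have hQ := Q3_zero (by omega) S
  intro b hb
  induction b, hb using Nat.le_induction with
  | base => intro _; rw [c_two hQ (by omega), s_two hQ (by omega)]
  | succ b hb ih =>
    intro hb2
    have h1 := ih (by omega)
    have e1 := c_mul_s hQ (by omega : 0 + 2 ≤ b) (by omega)
    have e2 := c_mul_s hQ (by omega : 0 + 2 ≤ b+1) (by omega)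
    have h2 : S.v 1 b < S.v 1 (b+1) := by
      rcases Nat.lt_or_ge b 3 with h' | h'
      · have : b = 2 := by omega
        subst this
        rw [v_one (by omega)]
        have := v_three (S := S) (a := 1) (by omega) (nonflat_sub h le_rfl (by omega) (by omega) (by omega))
        exact this
      · exact v_lt (S := S) (a := 1) (b := b+1) (by omega) (by omega) (nonflat_sub h le_rfl (by omega) (by omega) (by omega))
    have c1 := c_mono hQ (by omega : 0 + 2 ≤ b) (by omega) (Nat.le_succ b) (by omega)
    have s1 := s_mono hQ (by omega : 0 + 2 ≤ b) (by omega) (Nat.le_succ b) (by omega)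
    simp only [Nat.succ_eq_add_one, zero_add] at *
    by_contra hc
    have e3 : S.c 0 (b+1) = S.c 0 b := by omega
    have e4 : S.s 0 (b+1) = S.s 0 b := by omega
    rw [e3, e4] at e2
    omega

theorem colour_data (hn : 7 ≤ n) (h : ¬ S.Flat 1 (n-2)) : ∃ c s, c = S.c 0 (n-2) ∧ s = S.s 0 (n-2) ∧ 2 ≤ c ∧ 1 ≤ s ∧ n - 1 ≤ c + s ∧
    c * s = S.v 1 (n-2) ∧ c + 1 ≤ S.v 0 (n-1) ∧ c ≤ S.c 0 (n-1) := by
  have hQ := Q3_zero (by omega) S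
  refine ⟨_, _, rfl, rfl, ?_, s_pos hQ (by omega) (by omega), ?_, c_mul_s hQ (by omega) (by omega), ?_, ?_⟩
  · have h1 := c_mono hQ (by omega : 0 + 2 ≤ 2) (by omega) (by omega : 2 ≤ n - 2) (by omega)
    have h2 := c_two hQ (by omega : 0 + 2 ≤ n)
    rw [zero_add] at h2
    omega
  · have := colour hn h (n-2) (by omega) le_rfl
    omega
  · have h1 := c_mono hQ (by omega : 0 + 2 ≤ n-2) (by omega) (by omega : n - 2 ≤ n-1) (by omega)
    have h2 := c_lt_v hQ (by omega : 0 + 2 ≤ n-1) (by omega)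
    omega
  · exact c_mono hQ (by omega : 0 + 2 ≤ n-2) (by omega) (by omega : n - 2 ≤ n-1) (by omega)

theorem colour_arith {k c s : ℕ} (hk : 2 ≤ k) (hc : 2 ≤ c) (hs : 1 ≤ s) (h : k + 2 ≤ c + s) : 6 * k ≤ (c+1) * (c * s) := by
  obtain ⟨i, rfl⟩ : ∃ i, c = 2 + i := ⟨c - 2, by omega⟩
  obtain ⟨j, rfl⟩ : ∃ j, s = 1 + j := ⟨s - 1, by omega⟩
  rcases Nat.eq_zero_or_pos i with rfl | hi
  · nlinarith
  · nlinarith [mul_pos hi hi, Nat.zero_le (i*j), Nat.zero_le (i*i*j)]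

theorem side (hn : 7 ≤ n) (h : ¬ S.Flat 1 (n-2)) : 6 * (n-3) ≤ S.v 0 (n-1) * S.v 1 (n-2) ∧ 3 ≤ S.v 0 (n-1) := by
  obtain ⟨c, s, -, -, h1, h2, h3, h4, h5, -⟩ := colour_data hn h
  have := colour_arith (k := n-3) (by omega) h1 h2 (by omega)
  rw [← h4]
  exact ⟨this.trans (Nat.mul_le_mul_right _ h5), by omega⟩

theorem dual_all3 {a b : ℕ} (hb : b ≤ n) (h : S.All3 a b) : S.dual.All3 (n-b) (n-a) := by
  intro j j1 j2
  have := fv_two (S := S) (a := n-j-2) (by omega)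
  unfold fv at this
  rw [show n - (n-j-2+2) = j by omega, show n - (n-j-2) = j+2 by omega] at this
  rw [this]
  exact h _ (by omega) (by omega)

theorem dual_all3D (hn : 7 ≤ n) (h : S.All3 2 (n-2)) : S.dual.All3 2 (n-2) := by
  have := dual_all3 (by omega) h
  rwa [show n - (n-2) = 2 by omega] at this

theorem dual_A (hn : 7 ≤ n) (hM : ¬ S.Free 1 (n-1)) : ¬ S.dual.Flat 1 (n-2) := nonflat_A hn (by rwa [dual_free_M hn])

theorem pathA (hn : 7 ≤ n) (hA : ¬ S.Flat 1 (n-2)) (h3 : S.All3 2 (n-2)) : S.T1 1 (n-2) ∨ S.T2 1 (n-2) ∨ S.T3 1 (n-2) := by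
  obtain ⟨m, rfl⟩ : ∃ m, n = m + 7 := ⟨n - 7, by omega⟩
  have e : m + 7 - 2 = 1 + (m + 4) := by omega
  rw [e] at hA h3 ⊢
  exact path (by omega) (by rw [← e]; exact free_A hn) hA h3

theorem W_r_comm_left {a b i : ℕ} (hb : b ≤ n) (hi : i + 1 < a) {w : Equiv.Perm Ω} (hw : w ∈ S.W a b) :
    w * S.r i = S.r i * w := by
  refine S.W_ind (p := fun w => w * S.r i = S.r i * w) (by simp) ?_ w hw
  intro j j1 j2 w _ ih
  change w * S.r i = S.r i * w at ih
  rw [mul_assoc, ih, ← mul_assoc, ← S.r_comm (by omega : i + 1 < j) (by omega), mul_assoc]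

theorem W_comm {a b : ℕ} {y : Equiv.Perm Ω} (h : ∀ i, a ≤ i → i < b → y * S.r i = S.r i * y) : ∀ w ∈ S.W a b, y * w = w * y := by
  refine S.W_ind (by simp) ?_
  intro i i1 i2 w _ ih
  rw [← mul_assoc, h i i1 i2, mul_assoc, ih, mul_assoc]

/-- both ends of type one: the middle section is free -/
theorem twist_free (hn : 7 ≤ n) (h1 : S.T1 1 (n-2)) (h2 : S.dual.T1 1 (n-2)) (h3 : S.All3 2 (n-2))
    (hD : ¬ S.Flat 2 (n-2)) : S.Free 1 (n-1) := by
  obtain ⟨y, yW, ysq, yc, ybr, yv, -⟩ := h1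
  obtain ⟨z, zW, zsq, zc, zbr, zv, -⟩ := h2
  rw [dual_W (by omega), show n - (1+2) = n - 3 by omega] at zW
  rw [dual_r _ (by omega), dual_r _ (by omega), show n - 1 - 1 = n - 2 by omega, show n - 1 - (1+1) = n - 3 by omega] at zbr
  have yc' : ∀ i, 1 ≤ i → i < n-1 → y * S.r i = S.r i * y := by
    intro i i1 i2
    by_cases e : i < n - 2
    · exact yc i i1 e
    · exact (r_W_comm (by omega) (by omega) yW).symm
  have zc' : ∀ i, 1 ≤ i → i < n-1 → z * S.r i = S.r i * z := by
    intro i i1 i2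
    by_cases e : 2 ≤ i
    · have := zc (n-1-i) (by omega) (by omega)
      rwa [dual_r _ (by omega), show n - 1 - (n-1-i) = i by omega] at this
    · exact W_r_comm_left (by omega) (by omega) zW
  have yz : z * y = y * z := W_comm (fun i i1 i2 => zc' i i1 (by omega)) y yW
  set s1 : ℕ → Equiv.Perm Ω := fun i => if i = 1 then S.r 1 * y else S.r i with hs1
  set s2 : ℕ → Equiv.Perm Ω := fun i => if i = n - 2 then s1 i * z else s1 i with hs2
  have s1y : ∀ i, 1 ≤ i → i < n - 1 → y * s1 i = s1 i * y := by
    intro i i1 i2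
    simp only [hs1]; split_ifs with e
    · rw [← mul_assoc, yc' 1 le_rfl (by omega), mul_assoc]
    · exact yc' i i1 i2
  have s1z : ∀ i, 1 ≤ i → i < n - 1 → z * s1 i = s1 i * z := by
    intro i i1 i2
    simp only [hs1]; split_ifs with e
    · rw [← mul_assoc, zc' 1 le_rfl (by omega), mul_assoc, yz, mul_assoc]
    · exact zc' i i1 i2
  have s2z : ∀ i, 1 ≤ i → i < n - 1 → z * s2 i = s2 i * z := by
    intro i i1 i2
    simp only [hs2]; split_ifs with e
    · rw [← mul_assoc, s1z i i1 i2, mul_assoc]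
    · exact s1z i i1 i2
  have s1sq : ∀ i, 1 ≤ i → i < n - 1 → s1 i * s1 i = 1 := by
    intro i i1 i2
    simp only [hs1]; split_ifs with e
    · rw [mul_assoc, ← mul_assoc y, yc' 1 le_rfl (by omega), mul_assoc, ysq, mul_one, S.r_mul_self]
    · exact S.r_mul_self i
  have s2sq : ∀ i, 1 ≤ i → i < n - 1 → s2 i * s2 i = 1 := by
    intro i i1 i2
    simp only [hs2]; split_ifs with e
    · rw [mul_assoc, ← mul_assoc z, s1z i i1 i2, mul_assoc, zsq, mul_one, s1sq i i1 i2]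
    · exact s1sq i i1 i2
  have e1 : s2 1 = S.r 1 * y := by simp only [hs2, hs1]; rw [if_neg (by omega), if_pos trivial]
  have e2 : s2 (n-2) = S.r (n-2) * z := by simp only [hs2, hs1]; rw [if_pos trivial, if_neg (by omega)]
  have e3 : ∀ i, i ≠ 1 → i ≠ n - 2 → s2 i = S.r i := by
    intro i i1 i2; simp only [hs2, hs1]; rw [if_neg i2, if_neg i1]
  have hTA : TA s2 1 (n-1) := by
    refine ⟨s2sq, ?_, ?_⟩
    · intro i i1 i2
      rcases (show i = 1 ∨ i = n - 3 ∨ (2 ≤ i ∧ i + 1 < n - 2) by omega) with rfl | rfl | ⟨i3, i4⟩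
      · rw [e1, e3 (1+1) (by omega) (by omega)]; exact ybr
      · rw [show n - 3 + 1 = n - 2 by omega, e2, e3 (n-3) (by omega) (by omega)]; exact zbr.symm
      · rw [e3 i (by omega) (by omega), e3 (i+1) (by omega) (by omega)]
        exact braid_of_three (by omega) ((free_A (S := S) hn).mono (by omega) (by omega)) (h3 i i3 (by omega))
    · intro i j i1 ij j2
      have hc := S.r_comm (i := i) (j := j) ij (by omega)
      have hz1 : ∀ i, 1 ≤ i → i < n-1 → z * s2 i = s2 i * z := s2z
      have hj : S.r i * s2 j = s2 j * S.r i := by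
        by_cases e : j = n - 2
        · subst e; rw [e2, ← mul_assoc, hc, mul_assoc, ← zc' i i1 (by omega), mul_assoc]
        · rw [e3 j (by omega) e, hc]
      have hjy : y * s2 j = s2 j * y := by
        by_cases e : j = n - 2
        · subst e; rw [e2, ← mul_assoc, yc' _ (by omega) j2, mul_assoc, ← yz, mul_assoc]
        · rw [e3 j (by omega) e, yc' j (by omega) j2]
      by_cases e : i = 1
      · subst e; rw [e1, mul_assoc, hjy, ← mul_assoc, hj, mul_assoc]
      · rw [e3 i e (by omega), hj]
  have b1 := card_twist (r := S.r) (s := s1) (a := 1) (b := n-1) ysq (fun i _ _ => S.r_mul_self i) s1y (by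
    intro i i1 i2
    by_cases e : i = 1
    · right; subst e; simp only [hs1]; rw [if_pos trivial, mul_assoc, ysq, mul_one]
    · left; simp only [hs1]; rw [if_neg e])
  have b2 := card_twist (r := s1) (s := s2) (a := 1) (b := n-1) zsq s1sq s2z (by
    intro i i1 i2
    by_cases e : i = n - 2
    · right; simp only [hs2]; rw [if_pos e, mul_assoc, zsq, mul_one]
    · left; simp only [hs2]; rw [if_neg e])
  have b3 := hTA.card_le (by omega)
  apply free_of_card (by omega)
  have hN := N_M1 hn S
  have hND : S.N 2 (n-2) = (n-3).factorial := by
    have := h3.N (by omega) (by omega) ((free_A (S := S) hn).mono (by omega) le_rfl) (Or.inl hD)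
    rw [this]; congr 1; omega
  have hv := v_mono (S := S) (a := 1) (b := n-2) (c := n-1) (by omega) (by omega) (by omega)
  have hy0 : 0 < orderOf y := orderOf_pos y
  have hz0 : 0 < orderOf z := orderOf_pos z
  obtain ⟨k, rfl⟩ : ∃ k, n = k + 3 := ⟨n - 3, by omega⟩
  rw [show k + 3 - 2 - 1 + 1 = k + 1 by omega] at yv zv
  rw [show k + 3 - 1 - 1 + 1 = k + 2 by omega, Nat.factorial_succ, Nat.factorial_succ] at b3
  rw [show k + 3 - 3 = k by omega] at hND
  rw [← hN, hND]
  change Nat.card (GW S.r 1 (k+3-1)) < _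
  have hf := Nat.factorial_pos k
  calc Nat.card (GW S.r 1 (k+3-1)) ≤ ((k+1+1) * ((k+1) * k.factorial)) * orderOf z * orderOf y :=
        b1.trans (Nat.mul_le_mul_right _ (b2.trans (Nat.mul_le_mul_right _ b3)))
    _ < 2 * ((orderOf y * (k+1)) * ((orderOf z * (k+1)) * k.factorial)) := by
        have : 0 < orderOf y * orderOf z * k.factorial * (k+1) := by positivity
        nlinarith
    _ ≤ _ := Nat.mul_le_mul_left _ (Nat.mul_le_mul (yv.trans hv) (Nat.mul_le_mul_right _ zv))

end Sys

open scoped Classical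
set_option linter.unusedSectionVars false
set_option linter.unusedVariables false
set_option linter.unusedTactic false
set_option linter.unusedSimpArgs false
namespace Sys
variable {n : ℕ} {Ω : Type} {S : Sys n Ω} [Finite Ω]

theorem freeM_X (hn : 7 ≤ n) (hM : S.Free 1 (n-1)) : n - 1 ≤ S.v 0 (n-1) := by
  have h1 := nonflat_v (S := S) (by omega) (by omega) (nonflat_R hn hM)
  have h2 := v_mono (S := S) (a := 0) (b := n-2) (c := n-1) (by omega) (by omega) (by omega)
  omega

theorem freeM_N (hn : 7 ≤ n) (hM : S.Free 1 (n-1)) : (n-1).factorial ≤ S.N 1 (n-1) := by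
  have := nonflat_N (S := S) (by omega) (by omega) (Or.inl (nonflat_M hn hM))
  rwa [show n - 1 - 1 + 1 = n - 1 by omega] at this

theorem freeM_8 (hn : 8 ≤ n) (hM : S.Free 1 (n-1)) : 48 * (n-2) * (n-2).factorial ≤ S.N 0 n := by
  have h1 := total_ge (by omega) S
  have h2 := freeM_X (by omega) hM
  have h3 := freeM_X (by omega) ((dual_free_M (by omega)).2 hM)
  have h4 := freeM_N (by omega) hM
  refine le_trans ?_ h1
  refine le_trans ?_ (Nat.mul_le_mul (Nat.mul_le_mul h2 h3) h4)
  obtain ⟨k, rfl⟩ : ∃ k, n = k + 8 := ⟨n - 8, by omega⟩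
  rw [show k + 8 - 1 = k + 6 + 1 by omega, show k + 8 - 2 = k + 6 by omega, Nat.factorial_succ (k+6)]
  have hf := Nat.factorial_pos (k+6)
  have : 48 * (k+6) ≤ (k+6+1)*(k+6+1)*(k+6+1) := by nlinarith [Nat.zero_le (k*k*k)]
  calc _ ≤ (k+6+1)*(k+6+1)*(k+6+1) * (k+6).factorial := Nat.mul_le_mul_right _ this
    _ = _ := by ring

theorem notfree_8 (hn : 8 ≤ n) (hM : ¬ S.Free 1 (n-1)) : 48 * (n-2) * (n-2).factorial ≤ S.N 0 n := by
  have hA := nonflat_A (by omega) hM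
  have hA' := dual_A (by omega) hM
  have hD : ¬ S.Flat 2 (n-2) := nonflat_sub hA (by omega) (by omega) le_rfl (by omega)
  have h1 := total_ge (by omega) S
  rw [← N_M1 (by omega)] at h1
  obtain ⟨s1, x1⟩ := side (by omega) hA
  obtain ⟨s2, x2⟩ := side (by omega) hA'
  have hv := v_mono (S := S) (a := 1) (b := n-2) (c := n-1) (by omega) (by omega) (by omega)
  have h2 : (S.v 0 (n-1) * S.v 1 (n-2)) * (S.dual.v 0 (n-1) * S.dual.v 1 (n-2)) * S.N 2 (n-2) ≤ S.N 0 n := by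
    refine le_trans ?_ h1
    calc _ = S.v 0 (n-1) * S.dual.v 0 (n-1) * (S.v 1 (n-2) * (S.dual.v 1 (n-2) * S.N 2 (n-2))) := by ring
      _ ≤ _ := Nat.mul_le_mul_left _ (Nat.mul_le_mul_right _ hv)
  refine le_trans ?_ h2
  have hfac : (n-2).factorial = (n-2) * (n-3).factorial := by
    rw [show n - 2 = n - 3 + 1 by omega, Nat.factorial_succ]
  by_cases h3 : S.All3 2 (n-2)
  · have hND : (n-3).factorial ≤ S.N 2 (n-2) := by
      have := nonflat_N (S := S) (by omega) (by omega) (Or.inl hD)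
      rwa [show n - 2 - 2 + 1 = n - 3 by omega] at this
    have big : ∀ {T : Sys n Ω}, ¬ T.Flat 1 (n-2) → T.T2 1 (n-2) ∨ T.T3 1 (n-2) → 4 * (n-2) ≤ T.v 1 (n-2) := by
      intro T hT h
      rcases h with h | h
      · have := h.ge (by omega) hT (n-5) (by omega)
        rw [show 1 + 2 + (n-5) = n - 2 by omega, show n - 5 + 2 = n - 3 by omega] at this
        refine le_trans ?_ this
        obtain ⟨k, rfl⟩ : ∃ k, n = k + 8 := ⟨n - 8, by omega⟩
        rw [show k + 8 - 2 = k + 6 by omega, show k + 8 - 3 = k + 5 by omega]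
        have : k + 1 ≤ 2 ^ k := Nat.lt_two_pow_self
        rw [pow_add]; omega
      · refine le_trans ?_ h.2.1
        obtain ⟨k, rfl⟩ : ∃ k, n = k + 8 := ⟨n - 8, by omega⟩
        rw [show k + 8 - 2 = k + 6 by omega, show k + 6 - 1 = k + 5 by omega]
        nlinarith
    have fin : ∀ x y : ℕ, 4 * (n-2) ≤ x → 3 * (4 * (n-2)) ≤ y → 48 * (n-2) * (n-2).factorial ≤ x * y * S.N 2 (n-2) := by
      intro x y hx hy
      rw [hfac]
      calc _ = (4 * (n-2)) * (3 * (4 * (n-2))) * (n-3).factorial := by ring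
        _ ≤ _ := Nat.mul_le_mul (Nat.mul_le_mul hx hy) hND
    rcases pathA (by omega) hA h3 with t1 | t1
    · rcases pathA (by omega) hA' (dual_all3D (by omega) h3) with t2 | t2
      · exact absurd (twist_free (by omega) t1 t2 h3 hD) hM
      · exact fin _ _ (by omega) (Nat.mul_le_mul x2 (big hA' t2))
    · rw [mul_comm (S.v 0 (n-1) * S.v 1 (n-2))]
      exact fin _ _ (by omega) (Nat.mul_le_mul x1 (big hA t1))
  · have hND := not_all3_N (S := S) (by omega) (by omega) hD (fun j j1 j2 => (free_A (S := S) (by omega)).mono (by omega) (by omega)) h3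
    rw [show n - 2 - 2 + 1 = n - 3 by omega] at hND
    refine le_trans ?_ (Nat.mul_le_mul (Nat.mul_le_mul s1 s2) hND)
    rw [hfac]
    have : 48 * ((n-2)*(n-2)) ≤ 72 * ((n-3)*(n-3)) := by
      obtain ⟨k, rfl⟩ : ∃ k, n = k + 8 := ⟨n - 8, by omega⟩
      rw [show k + 8 - 2 = k + 6 by omega, show k + 8 - 3 = k + 5 by omega]
      nlinarith
    calc _ = 48 * ((n-2)*(n-2)) * (n-3).factorial := by ring
      _ ≤ 72 * ((n-3)*(n-3)) * (n-3).factorial := Nat.mul_le_mul_right _ this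
      _ = _ := by ring

end Sys

namespace Sys
variable {Ω : Type} {S : Sys 7 Ω} [Finite Ω]

theorem freeM_side_all3 (hM : S.Free 1 6) (h3 : S.All3 1 6) : 12 ≤ S.v 0 6 := by
  have hR : ¬ S.Flat 0 5 := nonflat_R (n := 7) (by norm_num) hM
  have hmono := v_mono (S := S) (a := 0) (b := 5) (c := 6) (by omega) (by omega) (by omega)
  rcases path (S := S) (a := 0) (m := 1) (by norm_num) (free_R (n := 7) (by norm_num)) hR
    (fun j j1 j2 => h3 j (by omega) (by omega)) with h | h | h
  · obtain ⟨y, -, -, -, -, h1, (⟨rfl, h2⟩ | h2)⟩ := h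
    · exfalso
      apply S.nf1
      have h02 : S.All3 0 6 := by
        intro j j1 j2
        rcases Nat.eq_zero_or_pos j with rfl | hj
        · exact h2
        · exact h3 j hj j2
      have hTA := h02.TA (by norm_num) (fun j j1 j2 => by
        rcases Nat.eq_zero_or_pos j with rfl | hj
        · exact (free_R (S := S) (n := 7) (by norm_num)).mono le_rfl (by norm_num)
        · exact hM.mono hj j2)
      have hc := hTA.card_le (by norm_num)
      have : S.Free 0 6 := by
        apply free_of_card (by norm_num)
        change Nat.card (GW S.r 0 6) < _
        refine lt_of_le_of_lt hc ?_
        have e1 := v_mul (S := S) (a := 0) (b := 6) (by norm_num) (by norm_num)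
        have e2 : 6 ≤ S.v 0 6 := freeM_X (n := 7) (by norm_num) hM
        have e3 : Nat.factorial 6 ≤ S.N 1 6 := freeM_N (n := 7) (by norm_num) hM
        have e4 := Nat.mul_le_mul e2 e3
        rw [zero_add] at e1
        rw [e1] at e4
        have f6 : Nat.factorial 6 = 720 := rfl
        have f7 : Nat.factorial (6-0+1) = 5040 := rfl
        rw [f6] at e4
        rw [f7]; omega
      exact this
    · rw [h2] at h1
      change _ ≤ S.v 0 5 at h1
      omega
  · have := h.ge (by norm_num) hR 3 (by norm_num)
    change _ ≤ S.v 0 5 at this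
    norm_num at this
    omega
  · have := h.2.1
    change _ ≤ S.v 0 5 at this
    omega

theorem freeM_side_six (hM : S.Free 1 6) (hX : S.v 0 6 = 6) : 10 ≤ S.v 1 6 := by
  have hR : ¬ S.Flat 0 5 := nonflat_R (n := 7) (by norm_num) hM
  have hQ := Q3_zero (by norm_num) S
  have h1 := c_ge hR (by norm_num) (by norm_num)
  have h2 := c_lt_v hQ (by norm_num : 0 + 2 ≤ 6) (by norm_num)
  have h3 := c_mono hQ (by norm_num : 0 + 2 ≤ 5) (by norm_num) (by norm_num : 5 ≤ 6) (by norm_num)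
  have h4 := c_mul_s hQ (by norm_num : 0 + 2 ≤ 6) (by norm_num)
  have h5 : S.c 0 6 = 5 := by omega
  have h6 := nonflat_v (S := S) (a := 1) (b := 6) (by norm_num) (by norm_num) (nonflat_M (n := 7) (by norm_num) hM)
  rw [h5, zero_add] at h4
  omega

theorem freeM_7 (hM : S.Free 1 6) : 55296 ≤ S.N 0 7 := by
  have hM' : S.dual.Free 1 6 := (dual_free_M (n := 7) (by norm_num)).2 hM
  have h1 : S.v 0 6 * S.dual.v 0 6 * S.N 1 6 ≤ S.N 0 7 := total_ge (n := 7) (by norm_num) S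
  have hN : 720 ≤ S.N 1 6 := freeM_N (n := 7) (by norm_num) hM
  have x1 : 6 ≤ S.v 0 6 := freeM_X (n := 7) (by norm_num) hM
  have x2 : 6 ≤ S.dual.v 0 6 := freeM_X (n := 7) (by norm_num) hM'
  have hnM : ¬ S.Flat 1 6 := nonflat_M (n := 7) (by norm_num) hM
  refine le_trans ?_ h1
  by_cases h3 : S.All3 1 6
  · have y1 := freeM_side_all3 hM h3
    have y2 := freeM_side_all3 hM' (dual_all3 (by norm_num) h3)
    calc 55296 ≤ 12 * 12 * 720 := by norm_num
      _ ≤ _ := Nat.mul_le_mul (Nat.mul_le_mul y1 y2) hN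
  have hN2 : 1440 ≤ S.N 1 6 := not_all3_N (S := S) (a := 1) (b := 6) (by norm_num) (by norm_num) hnM (fun j j1 j2 => hM.mono j1 j2) h3
  by_cases hXY : S.v 0 6 = 6 ∧ S.dual.v 0 6 = 6
  · have y1 := freeM_side_six hM hXY.1
    have y2 := freeM_side_six hM' hXY.2
    have e1 := v_mul (S := S) (a := 1) (b := 6) (by norm_num) (by norm_num)
    have e2 := fv_mul (S := S) (a := 1) (b := 6) (by norm_num) (by norm_num)
    have e3 : S.fv 1 6 = S.dual.v 1 6 := rfl
    rw [e3] at e2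
    rw [hXY.1, hXY.2]
    have : S.All3 2 6 ∨ 240 ≤ S.N 2 6 := by
      by_cases h : S.All3 2 6
      · left; exact h
      · right; exact not_all3_N (S := S) (a := 2) (b := 6) (by norm_num) (by norm_num) (nonflat_sub hnM (by norm_num) (by norm_num) (by norm_num) (by norm_num))
          (fun j j1 j2 => hM.mono (by omega) j2) h
    rcases this with g1 | g1
    · have : S.All3 1 5 ∨ 240 ≤ S.N 1 5 := by
        by_cases h : S.All3 1 5
        · left; exact h
        · right; exact not_all3_N (S := S) (a := 1) (b := 5) (by norm_num) (by norm_num) (nonflat_sub hnM (by norm_num) (by norm_num) (by norm_num) (by norm_num))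
            (fun j j1 j2 => hM.mono (by omega) (by omega)) h
      rcases this with g2 | g2
      · exfalso; apply h3
        intro j j1 j2
        by_cases e : 2 ≤ j
        · exact g1 j e j2
        · exact g2 j j1 (by omega)
      · have := Nat.mul_le_mul y2 g2
        have e4 : S.N 1 (6-1) = S.N 1 5 := rfl
        rw [e4] at e2
        omega
    · have := Nat.mul_le_mul y1 g1
      have e4 : S.N (1+1) 6 = S.N 2 6 := rfl
      rw [e4] at e1
      omega
  · have : 39 ≤ S.v 0 6 * S.dual.v 0 6 := by
      rcases (show 7 ≤ S.v 0 6 ∨ 7 ≤ S.dual.v 0 6 by omega) with h | h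
      · exact le_trans (by norm_num) (Nat.mul_le_mul h x2)
      · exact le_trans (by norm_num) (Nat.mul_le_mul x1 h)
    exact le_trans (by norm_num) (Nat.mul_le_mul this hN2)

end Sys

open scoped Classical
set_option linter.unusedSectionVars false
set_option linter.unusedVariables false
set_option linter.unusedTactic false
set_option linter.unusedSimpArgs false

section NN
variable {G : Type*} [Group G]
/-- products of commuting involutions -/
def nn (p q r s : G) (b0 b1 b2 b3 : Bool) : G := cond b0 p 1 * (cond b1 q 1 * (cond b2 r 1 * cond b3 s 1))

theorem nn_mul {p q r s : G} (hp : p * p = 1) (hq : q * q = 1) (hr : r * r = 1) (hs : s * s = 1)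
    (qp : q * p = p * q) (rp : r * p = p * r) (sp : s * p = p * s) (rq : r * q = q * r) (sq : s * q = q * s)
    (sr : s * r = r * s) (b0 b1 b2 b3 : Bool) :
    (p * nn p q r s b0 b1 b2 b3 = nn p q r s (!b0) b1 b2 b3 ∧ q * nn p q r s b0 b1 b2 b3 = nn p q r s b0 (!b1) b2 b3 ∧
    r * nn p q r s b0 b1 b2 b3 = nn p q r s b0 b1 (!b2) b3 ∧ s * nn p q r s b0 b1 b2 b3 = nn p q r s b0 b1 b2 (!b3)) ∧
    ((b0 ^^ b1 ^^ b2 ^^ b3) = true → nn q p s r b0 b1 b2 b3 * nn p q r s b0 b1 b2 b3 = p * q ∨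
      nn q p s r b0 b1 b2 b3 * nn p q r s b0 b1 b2 b3 = r * s) ∧
    nn p q r s b0 b1 b2 b3 * nn p q r s b0 b1 b2 b3 = 1 := by
  have hp' : ∀ x, p * (p * x) = x := fun x => by rw [← mul_assoc, hp, one_mul]
  have hq' : ∀ x, q * (q * x) = x := fun x => by rw [← mul_assoc, hq, one_mul]
  have hr' : ∀ x, r * (r * x) = x := fun x => by rw [← mul_assoc, hr, one_mul]
  have hs' : ∀ x, s * (s * x) = x := fun x => by rw [← mul_assoc, hs, one_mul]
  have qp' : ∀ x, q * (p * x) = p * (q * x) := fun x => by rw [← mul_assoc, qp, mul_assoc]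
  have rp' : ∀ x, r * (p * x) = p * (r * x) := fun x => by rw [← mul_assoc, rp, mul_assoc]
  have sp' : ∀ x, s * (p * x) = p * (s * x) := fun x => by rw [← mul_assoc, sp, mul_assoc]
  have rq' : ∀ x, r * (q * x) = q * (r * x) := fun x => by rw [← mul_assoc, rq, mul_assoc]
  have sq' : ∀ x, s * (q * x) = q * (s * x) := fun x => by rw [← mul_assoc, sq, mul_assoc]
  have sr' : ∀ x, s * (r * x) = r * (s * x) := fun x => by rw [← mul_assoc, sr, mul_assoc]
  cases b0 <;> cases b1 <;> cases b2 <;> cases b3 <;>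
    simp [nn, mul_assoc, hp, hq, hr, hs, hp', hq', hr', hs', qp, rp, sp, rq, sq, sr, qp', rp', sp', rq', sq', sr']

theorem nn_conj {p q r s p' q' r' s' g : G} (hp : p * g = g * p') (hq : q * g = g * q') (hr : r * g = g * r') (hs : s * g = g * s')
    (b0 b1 b2 b3 : Bool) : nn p q r s b0 b1 b2 b3 * g = g * nn p' q' r' s' b0 b1 b2 b3 := by
  have h : ∀ (b : Bool) (x x' : G), x * g = g * x' → cond b x 1 * g = g * cond b x' 1 := by
    intro b x x' h; cases b <;> simp [h]
  unfold nn
  rw [mul_assoc, mul_assoc, mul_assoc, h b3 s s' hs, ← mul_assoc (cond b2 r 1), h b2 r r' hr, ← mul_assoc (cond b1 q 1),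
    ← mul_assoc (cond b1 q 1), h b1 q q' hq, ← mul_assoc (cond b0 p 1), ← mul_assoc (cond b0 p 1), ← mul_assoc (cond b0 p 1), h b0 p p' hp]
  simp only [mul_assoc]
end NN

namespace PS
open Equiv
variable {G : Type*} [Group G] {m : ℕ} {φ : Perm (Fin (m+4)) →* G} {u : G}

def tt (φ : Perm (Fin (m+4)) →* G) (u : G) (x : Fin (m+4)) : G := φ (swap 0 x) * u * φ (swap 0 x)

theorem phi_swap_sq (x y : Fin (m+4)) : φ (swap x y) * φ (swap x y) = 1 := by rw [← map_mul, swap_mul_self, map_one]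

theorem tt_zero : tt φ u 0 = u := by
  unfold tt
  rw [show swap (0 : Fin (m+4)) 0 = 1 from swap_self 0, map_one, one_mul, mul_one]

theorem tt_conj (h : PS φ u) (σ : Perm (Fin (m+4))) (x : Fin (m+4)) : φ σ * tt φ u x = tt φ u (σ x) * φ σ := by
  have hκ : (swap 0 (σ x) * σ * swap 0 x) 0 = 0 := by simp
  have hc := h.cent hκ
  have e1 : φ σ * φ (swap 0 x) = φ (swap 0 (σ x)) * φ (swap 0 (σ x) * σ * swap 0 x) := by
    rw [← map_mul, ← map_mul, mul_assoc, swap_mul_self_mul]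
  have e2 : φ (swap 0 (σ x) * σ * swap 0 x) * φ (swap 0 x) = φ (swap 0 (σ x)) * φ σ := by
    rw [← map_mul, ← map_mul, mul_assoc, swap_mul_self, mul_one]
  unfold tt
  rw [← mul_assoc, ← mul_assoc, e1, mul_assoc (φ (swap 0 (σ x))) _ u, ← hc, ← mul_assoc, mul_assoc _ _ (φ (swap 0 x)), e2]
  simp only [mul_assoc]

theorem tt_sq (h : PS φ u) (x : Fin (m+4)) : tt φ u x * tt φ u x = 1 := by
  unfold tt
  calc φ (swap 0 x) * u * φ (swap 0 x) * (φ (swap 0 x) * u * φ (swap 0 x)) =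
      φ (swap 0 x) * u * (φ (swap 0 x) * φ (swap 0 x)) * u * φ (swap 0 x) := by group
    _ = φ (swap 0 x) * (u * u) * φ (swap 0 x) := by rw [phi_swap_sq]; group
    _ = 1 := by rw [h.usq, mul_one, phi_swap_sq]

theorem tt_comm (h : PS φ u) (h4 : u * (φ (swap 0 1) * u * φ (swap 0 1)) = (φ (swap 0 1) * u * φ (swap 0 1)) * u)
    (x y : Fin (m+4)) : tt φ u x * tt φ u y = tt φ u y * tt φ u x := by
  have h0 : ∀ z, u * tt φ u z = tt φ u z * u := by
    intro z
    have := h.comm_conj h4 (swap 0 z)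
    have e : (φ (swap 0 z))⁻¹ = φ (swap 0 z) := by rw [← map_inv, swap_inv]
    rw [e] at this
    exact this
  have e1 : φ (swap 0 x) * tt φ u y = tt φ u (swap 0 x y) * φ (swap 0 x) := h.tt_conj _ _
  have e2 : φ (swap 0 x) * tt φ u (swap 0 x y) = tt φ u y * φ (swap 0 x) := by
    have := h.tt_conj (swap 0 x) (swap 0 x y)
    rwa [swap_apply_self] at this
  calc tt φ u x * tt φ u y = φ (swap 0 x) * u * (φ (swap 0 x) * tt φ u y) := by unfold tt; group
    _ = φ (swap 0 x) * (u * tt φ u (swap 0 x y)) * φ (swap 0 x) := by rw [e1]; group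
    _ = (φ (swap 0 x) * tt φ u (swap 0 x y)) * u * φ (swap 0 x) := by rw [h0]; group
    _ = tt φ u y * tt φ u x := by rw [e2]; unfold tt; group

theorem tt_pair (h : PS φ u) {x y : Fin (m+4)} (hxy : x ≠ y) : tt φ u x * tt φ u y ∉ φ.range := by
  rintro ⟨σ, hσ⟩
  have e2 : φ (swap 0 x) * (tt φ u x * tt φ u y) * φ (swap 0 x) = u * tt φ u (swap 0 x y) := by
    rw [← mul_assoc, h.tt_conj, swap_apply_right, tt_zero, mul_assoc u, h.tt_conj, ← mul_assoc u, mul_assoc, phi_swap_sq, mul_one]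
  have e3 : u * φ (swap 0 (swap 0 x y)) * u = φ (swap 0 x) * φ σ * φ (swap 0 x) * φ (swap 0 (swap 0 x y)) := by
    rw [hσ, e2]; unfold tt
    simp only [mul_assoc, phi_swap_sq, mul_one]
  have := h.hK (swap 0 (swap 0 x y)) (by rw [e3]; exact ⟨swap 0 x * σ * swap 0 x * swap 0 (swap 0 x y), by simp [map_mul]⟩)
  rw [swap_apply_left] at this
  have h2 := congrArg (swap 0 x) this
  rw [swap_apply_self, swap_apply_left] at h2
  exact hxy h2.symm

end PS

namespace Sys
variable {n : ℕ} {Ω : Type} {S : Sys n Ω} [Finite Ω]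

theorem kap_two {b : ℕ} (hQ : S.Q3 0) (hb2 : 2 ≤ b) (hb : b ≤ n) (hc : S.c 0 b = 2) {Φ Ψ Θ : Ω} (h1 : Ψ ∈ S.O 1 b Φ) (h2 : Θ ∈ S.O 1 b Φ)
    (n1 : S.kap 0 Ψ ≠ S.kap 0 Φ) (n2 : S.kap 0 Θ ≠ S.kap 0 Φ) : S.kap 0 Ψ = S.kap 0 Θ := by
  have h := ncard_kap hQ (by omega : 0 + 2 ≤ b) hb Φ
  rw [hc, Set.ncard_eq_two] at h
  obtain ⟨x, y, hxy, h⟩ := h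
  have m1 : S.kap 0 Ψ ∈ S.kap 0 '' S.O (0+1) b Φ := ⟨_, h1, rfl⟩
  have m2 : S.kap 0 Θ ∈ S.kap 0 '' S.O (0+1) b Φ := ⟨_, h2, rfl⟩
  have m3 : S.kap 0 Φ ∈ S.kap 0 '' S.O (0+1) b Φ := ⟨_, O_self _ _ _ _, rfl⟩
  rw [h] at m1 m2 m3
  simp only [Set.mem_insert_iff, Set.mem_singleton_iff] at m1 m2 m3
  rcases m1 with m1 | m1 <;> rcases m2 with m2 | m2 <;> rcases m3 with m3 | m3 <;> rw [m1, m2] <;> simp_all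

theorem kap_r_one (hQ : S.Q3 0) (Ψ : Ω) : S.kap 0 (S.r 1 Ψ) ≠ S.kap 0 Ψ := hQ Ψ

theorem bip_deg {b : ℕ} (hQ : S.Q3 0) (hQ1 : S.Q3 1) (hb3 : 3 ≤ b) (hb : b ≤ n) (hc : S.c 0 b = 2) : S.c 1 b ≤ S.s 0 b := by
  have Φ := S.nonempty.some
  rw [← ncard_kap hQ1 (by omega : 1 + 2 ≤ b) hb Φ, ← ncard_s' hQ (by omega : 0 + 2 ≤ b) hb (S.r 1 Φ)]
  have : Finite (S.f (0+1) '' S.Kf 0 b (S.r 1 Φ)) := Set.Finite.image _ (Set.toFinite _)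
  refine Set.ncard_le_ncard ?_ (Set.Finite.image _ (Set.toFinite _))
  rintro _ ⟨Ψ, hΨ, rfl⟩
  have hk : S.kap 0 Ψ = S.kap 0 Φ := kap_O hb hΨ
  have hΨ1 : S.r 1 Ψ ∈ S.O 1 b Φ := O_r' le_rfl (by omega) (O_le (by omega) le_rfl hΨ)
  have hΦ1 : S.r 1 Φ ∈ S.O 1 b Φ := O_r le_rfl (by omega)
  refine ⟨S.r 1 Ψ, ⟨O_trans (O_symm hΦ1) hΨ1, ?_⟩, rfl⟩
  exact kap_two hQ (by omega) hb hc hΨ1 hΦ1 (by rw [← hk]; exact kap_r_one hQ Ψ) (kap_r_one hQ Φ)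

end Sys

open scoped Classical
set_option linter.unusedSectionVars false
set_option linter.unusedVariables false
set_option linter.unusedTactic false
set_option linter.unusedSimpArgs false
namespace Sys
variable {Ω : Type} {T : Sys 7 Ω} [Finite Ω]

theorem flat_contra (h3 : T.All3 2 5) (hA : ¬ T.Flat 1 5) (h4 : T.v 1 3 = 4) {s : Equiv.Perm Ω} (hs : s ∈ T.W 4 6)
    (hss : s * s = 1) (c1 : s * T.r 1 = T.r 1 * s) (c2 : s * T.r 2 = T.r 2 * s) (c3 : s * T.r 3 = T.r 3 * s)
    (br : s * T.r 4 * s = T.r 4 * s * T.r 4) (hfl : T.Flat 1 6) (hc : T.c 0 6 = 2) : False := by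
  have hF : T.Free 1 5 := free_A (n := 7) (by norm_num)
  obtain ⟨φ, hPS, hR, hφ⟩ := pathPS (S := T) (a := 1) (m := 0) (by norm_num) hF hA h3
  have hR' : φ.range = T.W 2 5 := hR
  have f01 : φ (Equiv.swap 0 1) = T.r 2 := hφ 0 (by omega)
  have f12 : φ (Equiv.swap 1 2) = T.r 3 := hφ 1 (by omega)
  have f23 : φ (Equiv.swap 2 3) = T.r 4 := hφ 2 (by omega)
  have hcom := hPS.tt_comm (by rw [f01]; exact comm_of_four (a := 1) (by norm_num) (hF.mono le_rfl (by norm_num)) h4)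
  have hQ := Q3_zero (by norm_num) T
  obtain ⟨t0, ht0⟩ : ∃ t, t = PS.tt φ (T.r 1) 0 := ⟨_, rfl⟩
  obtain ⟨t1, ht1⟩ : ∃ t, t = PS.tt φ (T.r 1) 1 := ⟨_, rfl⟩
  obtain ⟨t2, ht2⟩ : ∃ t, t = PS.tt φ (T.r 1) 2 := ⟨_, rfl⟩
  obtain ⟨t3, ht3⟩ : ∃ t, t = PS.tt φ (T.r 1) 3 := ⟨_, rfl⟩
  have e0 : t0 = T.r 1 := by rw [ht0, PS.tt_zero]
  have nnm := nn_mul (p := t0) (q := t1) (r := t2) (s := t3) (by rw [ht0]; exact hPS.tt_sq _) (by rw [ht1]; exact hPS.tt_sq _)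
    (by rw [ht2]; exact hPS.tt_sq _) (by rw [ht3]; exact hPS.tt_sq _) (by rw [ht0, ht1]; exact hcom _ _)
    (by rw [ht0, ht2]; exact hcom _ _) (by rw [ht0, ht3]; exact hcom _ _) (by rw [ht1, ht2]; exact hcom _ _)
    (by rw [ht1, ht3]; exact hcom _ _) (by rw [ht2, ht3]; exact hcom _ _)
  -- decomposition
  have hdec : ∀ w ∈ T.W 1 5, ∃ d ∈ T.W 2 5, ∃ b0 b1 b2 b3, w = d * nn t0 t1 t2 t3 b0 b1 b2 b3 := by
    intro w hw
    refine T.W_ind (p := fun w => ∃ d ∈ T.W 2 5, ∃ b0 b1 b2 b3, w = d * nn t0 t1 t2 t3 b0 b1 b2 b3)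
      ⟨1, one_mem _, false, false, false, false, by simp [nn]⟩ ?_ w hw
    rintro i i1 i2 w hw ⟨d, hd, b0, b1, b2, b3, rfl⟩
    rcases Nat.lt_or_ge 1 i with hi | hi
    · exact ⟨T.r i * d, mul_mem (T.r_mem hi i2) hd, b0, b1, b2, b3, by rw [mul_assoc]⟩
    · obtain rfl : i = 1 := by omega
      have hd' := hd
      rw [← hR'] at hd'
      obtain ⟨σ, rfl⟩ := hd'
      have hx := hPS.tt_conj σ (σ⁻¹ 0)
      rw [show σ (σ⁻¹ 0) = 0 from σ.apply_symm_apply 0, PS.tt_zero] at hx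
      have key : ∀ x : Fin (0+4), ∃ c0 c1 c2 c3, PS.tt φ (T.r 1) x * nn t0 t1 t2 t3 b0 b1 b2 b3 = nn t0 t1 t2 t3 c0 c1 c2 c3 := by
        obtain ⟨⟨n0, n1, n2, n3⟩, -⟩ := nnm b0 b1 b2 b3
        intro x
        have : x = 0 ∨ x = 1 ∨ x = 2 ∨ x = 3 := by revert x; decide
        rcases this with rfl | rfl | rfl | rfl
        · rw [← ht0]; exact ⟨_, _, _, _, n0⟩
        · rw [← ht1]; exact ⟨_, _, _, _, n1⟩
        · rw [← ht2]; exact ⟨_, _, _, _, n2⟩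
        · rw [← ht3]; exact ⟨_, _, _, _, n3⟩
      obtain ⟨c0, c1, c2, c3, hk⟩ := key (σ⁻¹ 0)
      exact ⟨φ σ, hd, c0, c1, c2, c3, by rw [← mul_assoc, ← hx, mul_assoc, hk]⟩
  -- parity
  let par : Bool → Equiv.Perm Ω → Prop := fun b w => w ∈ T.W 1 6 ∧ ∀ Ψ, (T.kap 0 (w Ψ) = T.kap 0 Ψ ↔ b = false)
  have pmul : ∀ b b' w w', par b w → par b' w' → par (b ^^ b') (w * w') := by
    rintro b b' w w' ⟨hw, h⟩ ⟨hw', h'⟩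
    refine ⟨mul_mem hw hw', fun Ψ => ?_⟩
    rw [Equiv.Perm.mul_apply]
    have g1 := h (w' Ψ)
    have g2 := h' Ψ
    cases b <;> cases b' <;> simp only [iff_true, Bool.true_eq_false, iff_false, Bool.xor_false, Bool.xor_true, Bool.not_true, Bool.not_false] at g1 g2 ⊢
    · rw [g1, g2]
    · rw [g1]; exact g2
    · rw [← g2]; exact g1
    · exact kap_two hQ (by norm_num) (by norm_num) hc (Φ := w' Ψ) ⟨w, hw, rfl⟩ (O_symm ⟨w', hw', rfl⟩) g1 (fun e => g2 e.symm)
  have pone : par false 1 := ⟨one_mem _, fun Ψ => by simp⟩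
  have pr1 : par true (T.r 1) := ⟨T.r_mem le_rfl (by norm_num), fun Ψ => by simpa using kap_r_one hQ Ψ⟩
  have pW : ∀ w ∈ T.W 2 6, par false w := fun w hw => ⟨T.W_le (by norm_num) le_rfl hw, fun Ψ => by
    simpa using kap_O (b := 6) (a := 0) (by norm_num) ⟨w, hw, rfl⟩⟩
  have pW5 : ∀ w ∈ T.W 2 5, par false w := fun w hw => pW w (T.W_le le_rfl (by norm_num) hw)
  have ptt : ∀ x, par true (PS.tt φ (T.r 1) x) := by
    intro x
    have : φ (Equiv.swap 0 x) ∈ T.W 2 5 := by rw [← hR']; exact ⟨_, rfl⟩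
    exact pmul _ _ _ _ (pmul _ _ _ _ (pW5 _ this) pr1) (pW5 _ this)
  have pnn : ∀ b0 b1 b2 b3, par (b0 ^^ (b1 ^^ (b2 ^^ b3))) (nn t0 t1 t2 t3 b0 b1 b2 b3) := by
    have hb : ∀ (b : Bool) w, par true w → par b (cond b w 1) := by
      intro b w h; cases b
      · exact pone
      · exact h
    intro b0 b1 b2 b3
    exact pmul _ _ _ _ (hb _ _ (ht0 ▸ ptt 0)) (pmul _ _ _ _ (hb _ _ (ht1 ▸ ptt 1)) (pmul _ _ _ _ (hb _ _ (ht2 ▸ ptt 2)) (hb _ _ (ht3 ▸ ptt 3))))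
  have nn5 : ∀ w, w ∈ T.W 1 5 → True := fun _ _ => trivial
  have tt5 : ∀ x, PS.tt φ (T.r 1) x ∈ T.W 1 5 := by
    intro x
    have : φ (Equiv.swap 0 x) ∈ T.W 1 5 := T.W_le (a := 2) (by norm_num) le_rfl (by rw [← hR']; exact ⟨_, rfl⟩)
    exact mul_mem (mul_mem this (T.r_mem le_rfl (by norm_num))) this
  have nnW : ∀ {p q r u : Equiv.Perm Ω}, p ∈ T.W 1 5 → q ∈ T.W 1 5 → r ∈ T.W 1 5 → u ∈ T.W 1 5 → ∀ b0 b1 b2 b3,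
      nn p q r u b0 b1 b2 b3 ∈ T.W 1 5 := by
    have hb : ∀ (b : Bool) w, w ∈ T.W 1 5 → cond b w 1 ∈ T.W 1 5 := by
      intro b w h; cases b
      · exact one_mem _
      · exact h
    intro p q r u hp hq hr hu b0 b1 b2 b3
    exact mul_mem (hb _ _ hp) (mul_mem (hb _ _ hq) (mul_mem (hb _ _ hr) (hb _ _ hu)))
  -- the element t
  obtain ⟨t, ht⟩ : ∃ t, t = s * t3 * s := ⟨_, rfl⟩
  have hs6 : s ∈ T.W 2 6 := T.W_le (by norm_num) le_rfl hs
  have pt : par true t := by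
    rw [ht]
    exact pmul _ _ _ _ (pmul _ _ _ _ (pW _ hs6) (ht3 ▸ ptt 3)) (pW _ hs6)
  have a01 : T.r 2 * t3 = t3 * T.r 2 := by
    have := hPS.tt_conj (Equiv.swap 0 1) 3
    rwa [f01, show Equiv.swap (0 : Fin (0+4)) 1 3 = 3 by decide, ← ht3] at this
  have a12 : T.r 3 * t1 = t2 * T.r 3 := by
    have := hPS.tt_conj (Equiv.swap 1 2) 1
    rwa [f12, show Equiv.swap (1 : Fin (0+4)) 2 1 = 2 by decide, ← ht1, ← ht2] at this
  have a23 : T.r 4 * t2 = t3 * T.r 4 := by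
    have := hPS.tt_conj (Equiv.swap 2 3) 2
    rwa [f23, show Equiv.swap (2 : Fin (0+4)) 3 2 = 3 by decide, ← ht3, ← ht2] at this
  have a1 : t1 = T.r 2 * T.r 1 * T.r 2 := by rw [ht1, PS.tt, f01]
  have st1 : s * t1 = t1 * s := by
    have c1' : Commute s (T.r 1) := c1
    have c2' : Commute s (T.r 2) := c2
    rw [a1]; exact (c2'.mul_right c1').mul_right c2'
  have a2 : t2 = T.r 3 * t1 * T.r 3 := by rw [a12, mul_assoc, T.r_mul_self, mul_one]
  have st2 : s * t2 = t2 * s := by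
    have c1' : Commute s t1 := st1
    have c3' : Commute s (T.r 3) := c3
    rw [a2]; exact (c3'.mul_right c1').mul_right c3'
  have a3 : t3 = T.r 4 * t2 * T.r 4 := by rw [a23, mul_assoc, T.r_mul_self, mul_one]
  have tr2 : Commute t (T.r 2) := by
    have c2' : Commute s (T.r 2) := c2
    have c3' : Commute t3 (T.r 2) := a01.symm
    rw [ht]; exact (c2'.mul_left c3').mul_left c2'
  have tr4 : Commute t (T.r 4) := by
    have h44 := T.r_mul_self 4
    have e1 : t = s * T.r 4 * t2 * (T.r 4 * s) := by rw [ht, a3]; group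
    have e2 : T.r 4 * t * T.r 4 = t := by
      calc T.r 4 * t * T.r 4 = (T.r 4 * s * T.r 4) * t2 * (T.r 4 * s * T.r 4) := by rw [e1]; group
        _ = s * T.r 4 * (s * t2) * s * T.r 4 * s := by rw [← br]; group
        _ = s * T.r 4 * t2 * (s * s) * T.r 4 * s := by rw [st2]; group
        _ = t := by rw [hss, e1]; group
    calc t * T.r 4 = (T.r 4 * t * T.r 4) * T.r 4 := by rw [e2]
      _ = T.r 4 * t := by rw [mul_assoc, h44, mul_one]
  obtain ⟨g, hg⟩ : ∃ g, g = T.r 2 * T.r 4 := ⟨_, rfl⟩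
  have tg : t * g = g * t := by rw [hg]; exact tr2.mul_right tr4
  have hgφ : g = φ (Equiv.swap 0 1 * Equiv.swap 2 3) := by rw [map_mul, f01, f23, hg]
  have hg5 : g ∈ T.W 2 5 := by rw [hg]; exact mul_mem (T.r_mem le_rfl (by norm_num)) (T.r_mem (by norm_num) (by norm_num))
  have gc : ∀ x, PS.tt φ (T.r 1) ((Equiv.swap 0 1 * Equiv.swap 2 3 : Equiv.Perm (Fin (0+4))) x) * g = g * PS.tt φ (T.r 1) x := by
    intro x; rw [hgφ]; exact (hPS.tt_conj _ x).symm
  have g0 : t0 * g = g * t1 := by have := gc 1; rwa [show (Equiv.swap 0 1 * Equiv.swap 2 3 : Equiv.Perm (Fin (0+4))) 1 = 0 by decide, ← ht0, ← ht1] at this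
  have g1 : t1 * g = g * t0 := by have := gc 0; rwa [show (Equiv.swap 0 1 * Equiv.swap 2 3 : Equiv.Perm (Fin (0+4))) 0 = 1 by decide, ← ht0, ← ht1] at this
  have g2 : t2 * g = g * t3 := by have := gc 3; rwa [show (Equiv.swap 0 1 * Equiv.swap 2 3 : Equiv.Perm (Fin (0+4))) 3 = 2 by decide, ← ht2, ← ht3] at this
  have g3 : t3 * g = g * t2 := by have := gc 2; rwa [show (Equiv.swap 0 1 * Equiv.swap 2 3 : Equiv.Perm (Fin (0+4))) 2 = 3 by decide, ← ht2, ← ht3] at this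
  have Φ := T.nonempty.some
  obtain ⟨_, ⟨u, hu, rfl⟩, hΘ⟩ := hfl Φ (t Φ) ⟨t, pt.1, rfl⟩
  obtain ⟨d, hd, b0, b1, b2, b3, rfl⟩ := hdec u hu
  have hO : t Φ ∈ T.O 2 6 (nn t0 t1 t2 t3 b0 b1 b2 b3 Φ) := by
    refine O_trans ?_ hΘ
    exact ⟨d, T.W_le le_rfl (by norm_num) hd, rfl⟩
  have hxor : (b0 ^^ b1 ^^ b2 ^^ b3) = true := by
    have k1 := kap_O (a := 0) (by norm_num) hO
    have k2 := pt.2 Φ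
    have k3 := (pnn b0 b1 b2 b3).2 Φ
    rw [← k1, k2] at k3
    revert k3
    cases b0 <;> cases b1 <;> cases b2 <;> cases b3 <;> simp
  have m0 := ht0 ▸ tt5 0
  have m1 := ht1 ▸ tt5 1
  have m2 := ht2 ▸ tt5 2
  have m3 := ht3 ▸ tt5 3
  obtain ⟨nw, hnw⟩ : ∃ w, w = nn t0 t1 t2 t3 b0 b1 b2 b3 := ⟨_, rfl⟩
  obtain ⟨nw', hnw'⟩ : ∃ w, w = nn t1 t0 t3 t2 b0 b1 b2 b3 := ⟨_, rfl⟩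
  have hconj : nw * g = g * nw' := by rw [hnw, hnw']; exact nn_conj g0 g1 g2 g3 _ _ _ _
  have mw : nw ∈ T.W 1 5 := by rw [hnw]; exact nnW m0 m1 m2 m3 _ _ _ _
  have mw' : nw' ∈ T.W 1 5 := by rw [hnw']; exact nnW m1 m0 m3 m2 _ _ _ _
  rw [← hnw] at hO
  have hχ : T.χ Φ ↔ T.χ (g Φ) := by
    rw [hg, Equiv.Perm.mul_apply, T.χ_r 2 _ (by norm_num), T.χ_r 4 _ (by norm_num)]; tauto
  obtain ⟨α, hα, hαr⟩ := T.aut Φ (g Φ) hχ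
  have f1 : T.f 1 (t Φ) = T.f 1 (nw Φ) := O_f hO (by norm_num)
  have tO : t Φ ∈ T.O 1 6 (nw Φ) := O_le (by norm_num) le_rfl hO
  have f2 := (aut_f hαr (a := 1) (b := 6) (by norm_num) (by norm_num) tO).2 f1
  rw [aut_W hαr (by norm_num) pt.1, aut_W hαr (b := 5) (by norm_num) mw, hα, ← Equiv.Perm.mul_apply, ← Equiv.Perm.mul_apply, tg, hconj,
    Equiv.Perm.mul_apply, Equiv.Perm.mul_apply, W_f hg5 _ (by norm_num), W_f hg5 _ (by norm_num), f1] at f2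
  have h5 : nw' Φ ∈ T.O 1 5 (nw Φ) := O_trans (O_symm ⟨nw, mw, rfl⟩) ⟨nw', mw', rfl⟩
  obtain ⟨w, hw, hwe⟩ := (O_vertex (by norm_num) (by norm_num) h5).1 f2.symm
  have e := hF.eq mw' (mul_mem (T.W_le (by norm_num) le_rfl hw) mw) (Φ := Φ) (by rw [Equiv.Perm.mul_apply]; exact hwe.symm)
  obtain ⟨-, hcase, hsq⟩ := nnm b0 b1 b2 b3
  have hmem : nw' * nw ∈ φ.range := by
    rw [e, mul_assoc, hnw, hsq, mul_one, hR']; exact hw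
  rcases hcase hxor with h | h
  · rw [hnw, hnw', h, ht0, ht1] at hmem
    exact hPS.tt_pair (by decide) hmem
  · rw [hnw, hnw', h, ht2, ht3] at hmem
    exact hPS.tt_pair (by decide) hmem
end Sys

open scoped Classical
set_option linter.unusedSectionVars false
set_option linter.unusedVariables false
set_option linter.unusedTactic false
set_option linter.unusedSimpArgs false
namespace Sys
variable {Ω : Type} {S : Sys 7 Ω} [Finite Ω]

theorem cd7 (h : ¬ S.Flat 1 5) : ∃ c s, c = S.c 0 5 ∧ s = S.s 0 5 ∧ 2 ≤ c ∧ 1 ≤ s ∧ 6 ≤ c + s ∧ c * s = S.v 1 5 ∧ c + 1 ≤ S.v 0 6 ∧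
    c ≤ S.c 0 6 := colour_data (n := 7) (by norm_num) h

theorem v67 : S.v 1 5 ≤ S.v 1 6 := v_mono (by norm_num) (by norm_num) (by norm_num)

/-- the T1 side -/
theorem t1_side (hA : ¬ S.Flat 1 5) (h3 : S.All3 2 5) (t1 : S.T1 1 5) :
    (6 ≤ S.v 0 6 ∧ 5 ≤ S.v 1 5) ∨ (3 ≤ S.v 0 6 ∧ 10 ≤ S.v 1 5) := by
  obtain ⟨c, s, -, -, c2, s1, cs, e, X, -⟩ := cd7 hA
  obtain ⟨y, -, -, -, -, h1, (⟨rfl, h2⟩ | h2)⟩ := t1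
  · left
    have hF : S.Free 1 5 := free_A (n := 7) (by norm_num)
    have h15 : S.All3 1 5 := by
      intro j j1 j2
      rcases Nat.lt_or_ge 1 j with hj | hj
      · exact h3 j hj j2
      · obtain rfl : j = 1 := by omega
        exact h2
    have hN := h15.N (by norm_num) (by norm_num) hF (Or.inl hA)
    have hN' := h3.N (by norm_num) (by norm_num) (hF.mono (by norm_num) le_rfl) (Or.inl (nonflat_sub hA (by norm_num) (by norm_num) le_rfl (by norm_num)))
    have hv := v_mul (S := S) (a := 1) (b := 5) (by norm_num) (by norm_num)
    rw [show 1 + 1 = 2 from rfl, hN, hN'] at hv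
    have f1 : Nat.factorial (5-2+1) = 24 := rfl
    have f2 : Nat.factorial (5-1+1) = 120 := rfl
    rw [f1, f2] at hv
    have hv5 : S.v 1 5 = 5 := by omega
    rw [hv5] at e
    have : c ≤ 5 := Nat.le_of_dvd (by norm_num) ⟨s, e.symm⟩
    interval_cases c <;> omega
  · right
    rw [h2] at h1
    refine ⟨by omega, by omega⟩

theorem index_CC (hc : S.c 0 5 = 2) : 2 * Nat.card (CC (S.W 1 5) (S.r 0)) = Nat.card (S.W 1 5) := by
  have hQ := Q3_zero (by norm_num) S
  have h1 := card_CC hQ (by norm_num : 0 + 2 ≤ 5) (by norm_num) (free_R (n := 7) (by norm_num))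
  have h2 := c_mul_k hQ (by norm_num : 0 + 2 ≤ 5) (by norm_num)
  rw [zero_add] at h1 h2
  rw [h1, card_W_eq (by norm_num) (free_A (n := 7) (by norm_num)), ← h2, hc]

theorem t3_side (hA : ¬ S.Flat 1 5) (t3 : S.T3 1 5) : 77 ≤ S.v 0 6 * S.v 1 5 := by
  obtain ⟨c, s, hc, -, c2, s1, cs, e, X, -⟩ := cd7 hA
  obtain ⟨-, h17, hE, h20⟩ := t3
  have h20 := h20 (by norm_num)
  rcases (show c = 2 ∨ c = 3 ∨ 4 ≤ c by omega) with rfl | rfl | c4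
  · have h := hE (CC (S.W 1 5) (S.r 0)) ?_ ?_ (index_CC hc.symm)
    · nlinarith
    · intro w hw
      have hw' : w ∈ S.W 2 5 := hw
      rw [mem_CC]
      refine ⟨S.W_le (by norm_num) le_rfl hw', ?_⟩
      rw [mul_assoc, W_r_comm_left (by norm_num) (by norm_num) hw', ← mul_assoc, inv_mul_cancel, one_mul]
      exact S.W_le (by norm_num) le_rfl hw'
    · intro w hw; exact (mem_CC.1 hw).1
  · have : 20 ≤ S.v 1 5 := by omega
    nlinarith
  · have : 17 ≤ S.v 1 5 := by omega
    nlinarith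

theorem t2_contra (hA : ¬ S.Flat 1 5) (hA' : ¬ S.dual.Flat 1 5) (h3 : S.All3 2 5) (t1 : S.T1 1 5) (t2 : S.dual.T2 1 5)
    (hY : S.dual.v 0 6 ≤ 4) (hv : S.dual.v 1 5 = 16) : 48 ≤ S.v 0 6 * S.v 1 6 := by
  have h3' : S.dual.All3 2 5 := dual_all3D (n := 7) (by norm_num) h3
  obtain ⟨t24, t2p⟩ := t2
  have hQ := Q3_zero (by norm_num) S
  have hQ1 : S.Q3 1 := Q3_nonflat hA (by norm_num) (by norm_num)
  have v14 : S.dual.v 1 4 = 8 := by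
    have l1 := v_lt (S := S.dual) (a := 1) (b := 5) (by norm_num) (by norm_num) hA'
    have l2 := v_lt (S := S.dual) (a := 1) (b := 4) (by norm_num) (by norm_num) (nonflat_sub hA' (by norm_num) (by norm_num) (by norm_num) (by norm_num))
    change S.dual.v 1 4 < _ at l1
    change S.dual.v 1 3 < _ at l2
    change S.dual.v 1 3 = 4 at t24
    obtain ⟨e, he⟩ := t2p 4 (by norm_num) (by norm_num)
    rw [hv, he] at l1
    rw [t24, he] at l2
    rw [he]
    have e1 : e < 4 := (Nat.pow_lt_pow_iff_right (by norm_num : 1 < 2)).1 (by simpa using l1)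
    have e2 : 2 < e := (Nat.pow_lt_pow_iff_right (by norm_num : 1 < 2)).1 (by simpa using l2)
    obtain rfl : e = 3 := by omega
    rfl
  have v26 : S.v 2 6 = 8 := by
    have n1 := N_two (S := S.dual) (a := 2) (by norm_num)
    have n2 := h3' 2 (by norm_num) (by norm_num)
    rw [n2] at n1
    have n3 := v_mul (S := S.dual) (a := 1) (b := 4) (by norm_num) (by norm_num)
    rw [show 1 + 1 = 2 from rfl, n1, v14] at n3
    have n4 := v_mul (S := S.dual) (a := 1) (b := 5) (by norm_num) (by norm_num)
    have n5 := h3'.N (by norm_num) (by norm_num) (free_A (n := 7) (S := S.dual) (by norm_num) |>.mono (by norm_num) le_rfl)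
      (Or.inl (nonflat_sub hA' (by norm_num) (by norm_num) le_rfl (by norm_num)))
    rw [show 1 + 1 = 2 from rfl, n5, hv] at n4
    rw [dual_N' (by norm_num) (by norm_num) S (c := 3) (d := 6) rfl rfl] at n3
    rw [dual_N' (by norm_num) (by norm_num) S (c := 2) (d := 6) rfl rfl] at n4
    have n6 := v_mul (S := S) (a := 2) (b := 6) (by norm_num) (by norm_num)
    have f1 : Nat.factorial (5-2+1) = 24 := rfl
    rw [show 2 + 1 = 3 from rfl, ← n3, ← n4, f1] at n6
    omega
  have cA : 4 ≤ S.c 1 5 := c_ge hA (by norm_num) (by norm_num)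
  have cAM := c_mono hQ1 (by norm_num : 1 + 2 ≤ 5) (by norm_num) (by norm_num : 5 ≤ 6) (by norm_num)
  have cM := c_mul_s hQ1 (by norm_num : 1 + 2 ≤ 6) (by norm_num)
  rw [show 1 + 1 = 2 from rfl, v26] at cM
  have cMd : S.c 1 6 ∣ 8 := ⟨_, cM.symm⟩
  have cM8 : S.c 1 6 ≤ 8 := Nat.le_of_dvd (by norm_num) cMd
  rcases (show S.c 1 6 = 4 ∨ S.c 1 6 = 8 by
    generalize S.c 1 6 = x at *
    interval_cases x <;> omega) with c4 | c8
  · exfalso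
    have hfl : S.Flat 1 6 := flat_of_c hQ1 (by norm_num) (by norm_num) (by norm_num) (by show S.c 1 6 ≤ S.c 1 5; omega)
    have hfl' : S.dual.Flat 1 6 := (dual_flat (by norm_num) (by norm_num)).2 hfl
    have hv6 := v_of_flat (by norm_num) (by norm_num) hfl'
    change _ = S.dual.v 1 5 at hv6
    obtain ⟨c, s, -, -, c2, -, -, -, X, c6⟩ := cd7 hA'
    have hQ' := Q3_zero (by norm_num) S.dual
    have q1 := c_lt_v hQ' (by norm_num : 0 + 2 ≤ 6) (by norm_num)
    have q2 := c_mul_s hQ' (by norm_num : 0 + 2 ≤ 6) (by norm_num)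
    rw [zero_add, hv6, hv] at q2
    have hc2 : S.dual.c 0 6 = 2 := by
      generalize S.dual.c 0 6 = x at *
      have : x ≤ 3 := by omega
      interval_cases x <;> omega
    obtain ⟨y, hy, yy, yc, ybr, -⟩ := t1
    have y1 : Commute y (S.r 1) := yc 1 (by norm_num) (by norm_num)
    have r1 : S.dual.r 1 = S.r 5 := dual_r 1 (by norm_num)
    have r2 : S.dual.r 2 = S.r 4 := dual_r 2 (by norm_num)
    have r3 : S.dual.r 3 = S.r 3 := dual_r 3 (by norm_num)
    have r4 : S.dual.r 4 = S.r 2 := dual_r 4 (by norm_num)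
    have m1 : S.r 1 ∈ S.W 1 3 := S.r_mem le_rfl (by norm_num)
    have cm : ∀ i, 3 ≤ i → i < 7 → S.r 1 * S.r i = S.r i * S.r 1 := fun i i1 i2 => S.r_comm (by omega) i2
    refine flat_contra (T := S.dual) h3' hA' t24 (s := S.r 1 * y) ?_ ?_ ?_ ?_ ?_ ?_ hfl' hc2
    · rw [dual_W (by norm_num)]
      exact mul_mem m1 hy
    · calc S.r 1 * y * (S.r 1 * y) = S.r 1 * (y * S.r 1) * y := by group
        _ = (S.r 1 * S.r 1) * (y * y) := by rw [y1.eq]; group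
        _ = 1 := by rw [yy, S.r_mul_self, one_mul]
    · rw [r1]
      exact (r_W_comm (by norm_num) (by norm_num) (mul_mem m1 hy)).symm
    · rw [r2]
      exact Commute.mul_left (cm 4 (by norm_num) (by norm_num)) (yc 4 (by norm_num) (by norm_num))
    · rw [r3]
      exact Commute.mul_left (cm 3 (by norm_num) (by norm_num)) (yc 3 (by norm_num) (by norm_num))
    · rw [r4]; exact ybr
  · have vM := c_lt_v hQ1 (by norm_num : 1 + 2 ≤ 6) (by norm_num)
    rw [c8] at vM
    rcases t1_side hA h3 t1 with ⟨x6, -⟩ | ⟨x3, v10⟩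
    · nlinarith
    · have hv6 : 10 ≤ S.v 1 6 := le_trans v10 v67
      obtain ⟨c, s, -, -, c2, -, -, -, X, c6⟩ := cd7 hA
      have q1 := c_lt_v hQ (by norm_num : 0 + 2 ≤ 6) (by norm_num)
      have q2 := c_mul_s hQ (by norm_num : 0 + 2 ≤ 6) (by norm_num)
      rw [zero_add] at q2
      rcases (show S.c 0 6 = 2 ∨ S.c 0 6 = 3 ∨ 4 ≤ S.c 0 6 by omega) with e | e | e
      · have := bip_deg hQ hQ1 (by norm_num) (by norm_num) e
        have : 16 ≤ S.v 1 6 := by rw [← q2, e]; omega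
        nlinarith
      · rw [e] at q1 q2
        have : 12 ≤ S.v 1 6 := by omega
        nlinarith
      · nlinarith

theorem tetra_side (hA : ¬ S.Flat 1 5) (hA' : ¬ S.dual.Flat 1 5) (h3 : S.All3 2 5) (t1 : S.T1 1 5)
    (t2 : S.dual.T2 1 5 ∨ S.dual.T3 1 5) : 2304 ≤ (S.v 0 6 * S.v 1 6) * (S.dual.v 0 6 * S.dual.v 1 5) := by
  have ha : 30 ≤ S.v 0 6 * S.v 1 6 := by
    refine le_trans ?_ (Nat.mul_le_mul_left _ v67)
    rcases t1_side hA h3 t1 with ⟨h1, h2⟩ | ⟨h1, h2⟩ <;> nlinarith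
  suffices 77 ≤ S.dual.v 0 6 * S.dual.v 1 5 ∨ (48 ≤ S.dual.v 0 6 * S.dual.v 1 5 ∧ 48 ≤ S.v 0 6 * S.v 1 6) by
    rcases this with h | ⟨h, h'⟩ <;> nlinarith
  rcases t2 with t2 | t3
  swap
  · exact Or.inl (t3_side hA' t3)
  obtain ⟨c, s, hc, -, c2, s1, cs, e, X, -⟩ := cd7 hA'
  have h16 := t2.ge (by norm_num) hA' 2 (by norm_num)
  change 2 ^ 4 ≤ S.dual.v 1 5 at h16
  obtain ⟨x, hx⟩ := t2.2 5 (by norm_num) le_rfl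
  rcases Nat.lt_or_ge 4 (S.dual.v 0 6) with hY | hY
  · left; nlinarith
  rcases Nat.lt_or_ge 4 x with h5 | h4
  · left
    have : 2 ^ 5 ≤ S.dual.v 1 5 := by rw [hx]; exact Nat.pow_le_pow_right (by norm_num) h5
    nlinarith
  · right
    have : S.dual.v 1 5 ≤ 2 ^ 4 := by rw [hx]; exact Nat.pow_le_pow_right (by norm_num) h4
    have hv : S.dual.v 1 5 = 16 := by omega
    exact ⟨by nlinarith, t2_contra hA hA' h3 t1 t2 hY hv⟩

theorem tetra (hM : ¬ S.Free 1 6) (h3 : S.All3 2 5) : 55296 ≤ S.N 0 7 := by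
  have hA : ¬ S.Flat 1 5 := nonflat_A (n := 7) (by norm_num) hM
  have hA' : ¬ S.dual.Flat 1 5 := dual_A (n := 7) (by norm_num) hM
  have h3' : S.dual.All3 2 5 := dual_all3D (n := 7) (by norm_num) h3
  have hD : ¬ S.Flat 2 5 := nonflat_sub hA (by norm_num) (by norm_num) le_rfl (by norm_num)
  have hM' : ¬ S.dual.Free 1 6 := fun h => hM ((dual_free_M (n := 7) (by norm_num)).1 h)
  have hD' : ¬ S.dual.Flat 2 5 := nonflat_sub hA' (by norm_num) (by norm_num) le_rfl (by norm_num)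
  have hN := h3.N (by norm_num) (by norm_num) (free_A (n := 7) (S := S) (by norm_num) |>.mono (by norm_num) le_rfl) (Or.inl hD)
  have f1 : Nat.factorial (5-2+1) = 24 := rfl
  rw [f1] at hN
  have tot : S.v 0 6 * S.dual.v 0 6 * S.N 1 6 ≤ S.N 0 7 := total_ge (n := 7) (by norm_num) S
  have m1 : S.v 1 6 * (S.dual.v 1 5 * S.N 2 5) = S.N 1 6 := N_M1 (n := 7) (by norm_num) S
  have m2 : S.v 1 5 * (S.dual.v 1 6 * S.N 2 5) = S.N 1 6 := N_M2 (n := 7) (by norm_num) S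
  have big : ∀ {T : Sys 7 Ω}, ¬ T.Flat 1 5 → T.T2 1 5 ∨ T.T3 1 5 → 48 ≤ T.v 0 6 * T.v 1 5 := by
    intro T hT h
    obtain ⟨c, s, hc, -, c2, s1, cs, e, X, -⟩ := cd7 hT
    have : 16 ≤ T.v 1 5 := by
      rcases h with h | h
      · exact h.ge (by norm_num) hT 2 (by norm_num)
      · have := h.2.1; omega
    nlinarith
  have fin1 : 2304 ≤ (S.v 0 6 * S.v 1 6) * (S.dual.v 0 6 * S.dual.v 1 5) → 55296 ≤ S.N 0 7 := by
    intro h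
    refine le_trans ?_ tot
    rw [← m1, hN]
    calc 55296 = 2304 * 24 := by norm_num
      _ ≤ _ := Nat.mul_le_mul_right 24 h
      _ = _ := by ring
  rcases pathA (n := 7) (by norm_num) hA h3 with t1 | t1
  · rcases pathA (n := 7) (by norm_num) hA' h3' with t2 | t2
    · exact absurd (twist_free (n := 7) (by norm_num) t1 t2 h3 hD) hM
    · exact fin1 (tetra_side hA hA' h3 t1 t2)
  · rcases pathA (n := 7) (by norm_num) hA' h3' with t2 | t2
    · have hA'' : ¬ S.dual.dual.Flat 1 5 := dual_A (n := 7) (by norm_num) hM'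
      rcases pathA (n := 7) (by norm_num) hA'' (dual_all3D (n := 7) (by norm_num) h3') with t3 | t3
      · exact absurd (twist_free (n := 7) (by norm_num) t2 t3 h3' hD') hM'
      · have h := tetra_side hA' hA'' h3' t2 t3
        rw [dd_v (by norm_num) (by norm_num), dd_v (by norm_num) (by norm_num)] at h
        refine le_trans ?_ tot
        rw [← m2, hN]
        calc 55296 = 2304 * 24 := by norm_num
          _ ≤ _ := Nat.mul_le_mul_right 24 h
          _ = _ := by ring
    · apply fin1
      have h1 := big hA t1
      have h2 := big hA' t2
      have h3 : S.v 0 6 * S.v 1 5 ≤ S.v 0 6 * S.v 1 6 := Nat.mul_le_mul_left _ v67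
      exact le_trans (by norm_num) (Nat.mul_le_mul (le_trans h1 h3) h2)
end Sys

open scoped Classical
set_option linter.unusedSectionVars false
set_option linter.unusedVariables false
set_option linter.unusedTactic false
set_option linter.unusedSimpArgs false

section Four
open scoped Pointwise
theorem inj4 {X : Type*} {x0 x1 x2 x3 : X} (n01 : x1 ≠ x0) (n02 : x2 ≠ x0) (n12 : x2 ≠ x1) (n03 : x3 ≠ x0) (n13 : x3 ≠ x1)
    (n23 : x3 ≠ x2) : Function.Injective (![x0, x1, x2, x3] : Fin 4 → X) := by
  intro i j h
  fin_cases i <;> fin_cases j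
  · rfl
  · exact absurd h.symm n01
  · exact absurd h.symm n02
  · exact absurd h.symm n03
  · exact absurd h n01
  · rfl
  · exact absurd h.symm n12
  · exact absurd h.symm n13
  · exact absurd h n02
  · exact absurd h n12
  · rfl
  · exact absurd h.symm n23
  · exact absurd h n03
  · exact absurd h n13
  · exact absurd h n23
  · rfl

set_option maxHeartbeats 1000000 in
theorem four_action {H : Type*} [Group H] [Finite H] (K : Subgroup H) (hK : K.index = 4) {a b c : H} (aa : a * a = 1)
    (bb : b * b = 1) (cc : c * c = 1) (gen : ∀ M : Subgroup H, a ∈ M → b ∈ M → c ∈ M → ∀ h, h ∈ M) (ha : a ∉ K) (hb : b ∈ K) (hc : c ∈ K)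
    (ac : a * c = c * a) (h3 : a * b * a ∉ K → a * b * a * b * a ∈ K) :
    ∃ ψ : H →* Equiv.Perm (Fin 4), ψ a = Equiv.swap 0 1 ∧ ψ b = Equiv.swap 1 2 ∧ ψ c = Equiv.swap 2 3 ∧
      ∀ h, ψ h 0 = 0 ↔ h ∈ K := by
  let X := H ⧸ K
  have hX : Nat.card X = 4 := hK
  have ai : a⁻¹ = a := inv_eq_of_mul_eq_one_right aa
  have bi : b⁻¹ = b := inv_eq_of_mul_eq_one_right bb
  have ci : c⁻¹ = c := inv_eq_of_mul_eq_one_right cc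
  obtain ⟨x0, hx0⟩ : ∃ x : X, x = ((1 : H) : X) := ⟨_, rfl⟩
  have sx : ∀ h : H, h • x0 = ((h : H) : X) := by
    intro h; rw [hx0, MulAction.Quotient.smul_coe, smul_eq_mul, mul_one]
  have st : ∀ h : H, h • x0 = x0 ↔ h ∈ K := by
    intro h; rw [sx, hx0, eq_comm, QuotientGroup.eq]; simp
  have tr : ∀ x : X, ∃ h : H, x = h • x0 := by
    intro x
    obtain ⟨h, rfl⟩ := QuotientGroup.mk_surjective x
    exact ⟨h, (sx h).symm⟩
  have inv : ∀ (g : H), g * g = 1 → ∀ x y : X, g • x = y → g • y = x := by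
    rintro g hg x _ rfl; rw [smul_smul, hg, one_smul]
  have key : ∀ A : Finset X, x0 ∈ A → (∀ x ∈ A, a • x ∈ A ∧ b • x ∈ A ∧ c • x ∈ A) → 4 ≤ A.card := by
    intro A h0 hA
    have hs : ∀ g : H, (∀ x ∈ A, g • x ∈ A) → g ∈ MulAction.stabilizer H (A : Set X) := by
      intro g hg
      rw [MulAction.mem_stabilizer_iff]
      apply Set.eq_of_subset_of_ncard_le
      · rintro _ ⟨x, hx, rfl⟩; exact hg x hx
      · exact (Set.ncard_image_of_injective _ (MulAction.injective g)).ge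
      · exact Set.toFinite _
    have hall : ∀ x : X, x ∈ A := by
      intro x
      obtain ⟨h, rfl⟩ := tr x
      have := gen (MulAction.stabilizer H (A : Set X)) (hs a fun x hx => (hA x hx).1) (hs b fun x hx => (hA x hx).2.1)
        (hs c fun x hx => (hA x hx).2.2) h
      rw [MulAction.mem_stabilizer_iff] at this
      have h1 : h • x0 ∈ h • (A : Set X) := Set.smul_mem_smul_set h0
      rw [this] at h1; exact h1
    haveI : Fintype X := Fintype.ofFinite X
    rw [← hX, Nat.card_eq_fintype_card, Finset.eq_univ_of_forall hall, Finset.card_univ]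
  obtain ⟨x1, a0⟩ : ∃ x1, a • x0 = x1 := ⟨_, rfl⟩
  obtain ⟨x2, b1⟩ : ∃ x2, b • x1 = x2 := ⟨_, rfl⟩
  obtain ⟨x3, c2⟩ : ∃ x3, c • x2 = x3 := ⟨_, rfl⟩
  have a1 := inv a aa _ _ a0
  have b2 := inv b bb _ _ b1
  have c3 := inv c cc _ _ c2
  have b0 : b • x0 = x0 := (st b).2 hb
  have c0 : c • x0 = x0 := (st c).2 hc
  have c1 : c • x1 = x1 := by rw [← a0, smul_smul, ← ac, ← smul_smul, c0]
  have n01 : x1 ≠ x0 := by rw [← a0]; exact fun h => ha ((st a).1 h)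
  have n02 : x2 ≠ x0 := by
    intro h; rw [h, b0] at b2; exact n01 b2.symm
  have n12 : x2 ≠ x1 := by
    intro h
    have := key {x0, x1} (by simp) (by
      intro x hx
      simp only [Finset.mem_insert, Finset.mem_singleton] at hx
      rcases hx with rfl | rfl
      · rw [a0, b0, c0]; simp
      · rw [a1, b1, c1, h]; simp)
    have h2 := Finset.card_le_two (a := x0) (b := x1)
    omega
  have a2 : a • x2 = x2 := by
    have : a * b * a ∉ K := by
      rw [← st, mul_smul, mul_smul, a0, b1]
      intro h
      have := inv a aa _ _ h
      rw [a0] at this; exact n12 this.symm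
    have := h3 this
    rw [← st, mul_smul, mul_smul, mul_smul, mul_smul, a0, b1] at this
    have := inv a aa _ _ this
    rw [a0] at this
    have := inv b bb _ _ this.symm
    rw [b1] at this; exact this.symm
  have n03 : x3 ≠ x0 := by
    intro h; rw [h, c0] at c3; exact n02 c3.symm
  have n13 : x3 ≠ x1 := by
    intro h; rw [h, c1] at c3; exact n12 c3.symm
  have n23 : x3 ≠ x2 := by
    intro h
    have := key {x0, x1, x2} (by simp) (by
      intro x hx
      simp only [Finset.mem_insert, Finset.mem_singleton] at hx
      rcases hx with rfl | rfl | rfl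
      · rw [a0, b0, c0]; simp
      · rw [a1, b1, c1]; simp
      · rw [a2, b2, c2, h]; simp)
    have h2 := Finset.card_le_three (a := x0) (b := x1) (c := x2)
    omega
  have a3 : a • x3 = x3 := by rw [← c2, smul_smul, ac, ← smul_smul, a2]
  let f : Fin 4 → X := ![x0, x1, x2, x3]
  have finj : Function.Injective f := inj4 n01 n02 n12 n03 n13 n23
  have fbij : Function.Bijective f := by
    haveI : Fintype X := Fintype.ofFinite X
    rw [Fintype.bijective_iff_injective_and_card]
    exact ⟨finj, by rw [Fintype.card_fin, ← Nat.card_eq_fintype_card, hX]⟩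
  have b3 : b • x3 = x3 := by
    obtain ⟨i, hi⟩ := fbij.2 (b • x3)
    fin_cases i
    · have hi : x0 = b • x3 := hi
      have := inv b bb _ _ hi.symm
      rw [b0] at this; exact absurd this.symm n03
    · have hi : x1 = b • x3 := hi
      have := inv b bb _ _ hi.symm
      rw [b1] at this; exact absurd this.symm n23
    · have hi : x2 = b • x3 := hi
      have := inv b bb _ _ hi.symm
      rw [b2] at this; exact absurd this.symm n13
    · exact hi.symm
  let e : Fin 4 ≃ X := Equiv.ofBijective f fbij
  let ψ : H →* Equiv.Perm (Fin 4) := (e.symm.permCongrHom.toMonoidHom).comp (MulAction.toPermHom H X)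
  have hψ : ∀ h i, f (ψ h i) = h • f i := by
    intro h i
    have : ψ h i = e.symm (h • e i) := rfl
    rw [this]
    exact e.apply_symm_apply _
  refine ⟨ψ, ?_, ?_, ?_, ?_⟩
  · ext1 i; apply finj; rw [hψ]
    fin_cases i
    · exact a0
    · exact a1
    · exact a2
    · exact a3
  · ext1 i; apply finj; rw [hψ]
    fin_cases i
    · exact b0
    · exact b1
    · exact b2
    · exact b3
  · ext1 i; apply finj; rw [hψ]
    fin_cases i
    · exact c0
    · exact c1
    · exact c2
    · exact c3
  · intro h
    rw [← st, ← finj.eq_iff, hψ]; rfl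

theorem bip_group {G : Type*} [Group G] [Finite G] {W E H : Subgroup G} (hHE : H ≤ E) (hEW : E ≤ W) (hc : 2 * Nat.card E = Nat.card W)
    {u a : G} (hu : u ∈ W) (huE : u ∉ E) (uu : u * u = 1) (ha : a ∈ H) (hρ : u * a * u ∉ H) {d m : ℕ} (hd : (dcs H u).ncard = d)
    (hm : (cos W H).ncard = 2 * m) (hdm : m < 2 * d)
    (hK : ∀ h ∈ H, h ∈ CC H u ∨ ∃ k ∈ CC H u, ∃ k' ∈ CC H u, h = k * a * k') : (dcs H (u * a * u)).ncard + 1 = m := by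
  have ui : u⁻¹ = u := inv_eq_of_mul_eq_one_right uu
  have i2 := index_two hEW hc
  have cE : (cos E H).ncard = m := by
    have h1 := card_cos hHE
    have h2 := card_cos (hHE.trans hEW)
    rw [hm, ← hc, ← h1] at h2
    have : 0 < Nat.card H := Nat.card_pos
    have : (2 * m) * Nat.card H = (2 * (cos E H).ncard) * Nat.card H := by rw [h2]; ring
    have := Nat.eq_of_mul_eq_mul_right ‹_› this
    omega
  have hsub : cos E H ⊆ cos W H := Set.image_mono hEW
  have cO : (cos W H \ cos E H).ncard = m := by
    have := Set.ncard_sdiff_add_ncard_of_subset hsub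
    omega
  have notE : ∀ g : G, g ∈ W → g ∉ E → ((g : G) : G ⧸ H) ∈ cos W H \ cos E H := by
    intro g hg hgE
    refine ⟨⟨g, hg, rfl⟩, ?_⟩
    rintro ⟨g', hg', e⟩
    have e' : ((g' : G) : G ⧸ H) = (g : G ⧸ H) := e
    rw [QuotientGroup.eq] at e'
    exact hgE (by simpa using mul_mem hg' (hHE e'))
  have odd : ∀ g ∈ E, ∀ h ∈ H, g * h * u ∉ E := by
    intro g hg h hh hm
    exact huE (by simpa [mul_assoc] using mul_mem (inv_mem (mul_mem hg (hHE hh))) hm)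
  have hρE : u * a * u ∈ E := by
    rw [mul_assoc, i2 u hu _ (mul_mem (hEW (hHE ha)) hu)]
    have := odd 1 (one_mem _) a ha
    rw [one_mul] at this
    tauto
  have main : cos E H = dcs H 1 ∪ dcs H (u * a * u) := by
    apply Set.Subset.antisymm
    · rintro _ ⟨g, hg, rfl⟩
      let A : Set (G ⧸ H) := dcs H u
      let B : Set (G ⧸ H) := (fun x => g • x) '' A
      have hA : A ⊆ cos W H \ cos E H := by
        rintro _ ⟨h, hh, rfl⟩
        exact notE _ (mul_mem (hEW (hHE hh)) hu) (by simpa using odd 1 (one_mem _) h hh)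
      have hB : B ⊆ cos W H \ cos E H := by
        rintro _ ⟨_, ⟨h, hh, rfl⟩, rfl⟩
        have := notE _ (mul_mem (mul_mem (hEW hg) (hEW (hHE hh))) hu) (odd g hg h hh)
        rw [mul_assoc] at this
        exact this
      have cB : B.ncard = d := by rw [← hd]; exact Set.ncard_image_of_injective _ (MulAction.injective g)
      have : ¬ Disjoint A B := by
        intro hdj
        have h1 := Set.ncard_union_eq hdj
        have h2 := Set.ncard_le_ncard (Set.union_subset hA hB)
        rw [h1, cB, cO] at h2
        change (dcs H u).ncard + d ≤ m at h2
        omega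
      rw [Set.not_disjoint_iff] at this
      obtain ⟨_, ⟨h', hh', rfl⟩, ⟨_, ⟨h, hh, rfl⟩, e⟩⟩ := this
      have e' : ((g * (h * u) : G) : G ⧸ H) = ((h' * u : G) : G ⧸ H) := e
      rw [eq_comm, QuotientGroup.eq] at e'
      obtain ⟨x, hx⟩ : ∃ x, x = (h' * u)⁻¹ * (g * (h * u)) := ⟨_, rfl⟩
      rw [← hx] at e'
      have hg' : g = h' * (u * x * u) * h⁻¹ := by rw [hx, mul_inv_rev, ui]; simp only [mul_assoc, ← mul_assoc u u, uu]; simp [← mul_assoc, uu]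
      have hcc : ∀ k ∈ CC H u, u * k * u ∈ H := by
        intro k hk; have := hk.2; rwa [ui] at this
      rcases hK x e' with hk | ⟨k, hk, k', hk', rfl⟩
      · left
        exact ⟨g, by rw [hg']; exact mul_mem (mul_mem hh' (hcc _ hk)) (inv_mem hh), by simp⟩
      · right
        refine ⟨h' * (u * k * u), mul_mem hh' (hcc _ hk), ?_⟩
        change ((g : G) : G ⧸ H) = _
        rw [eq_comm, QuotientGroup.eq]
        have : (h' * (u * k * u) * (u * a * u))⁻¹ * g = (u * k' * u) * h⁻¹ := by
          rw [inv_mul_eq_iff_eq_mul, hg']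
          have uu' : ∀ x, u * (u * x) = x := fun x => by rw [← mul_assoc, uu, one_mul]
          simp only [mul_assoc, uu']
        rw [this]
        exact mul_mem (hcc _ hk') (inv_mem hh)
    · exact Set.union_subset (dcs_sub hHE (one_mem _)) (dcs_sub hHE hρE)
  have := Set.ncard_union_eq (dcs_disj (dcs_ne_one hρ).symm)
  rw [← main, cE, dcs_one] at this
  omega
end Four

open scoped Classical
set_option linter.unusedSectionVars false
set_option linter.unusedVariables false
set_option linter.unusedTactic false
set_option linter.unusedSimpArgs false
namespace Sys
variable {Ω : Type} {S : Sys 7 Ω} [Finite Ω]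

theorem p0 : 3 ≤ S.v 0 2 := by
  have hQ := Q3_zero (by norm_num) S
  have h1 := c_two hQ (by norm_num)
  have h2 := c_lt_v hQ (by norm_num : 0 + 2 ≤ 2) (by norm_num)
  rw [zero_add] at h1
  omega

theorem rho1 (hA : ¬ S.Flat 1 5) : S.r 1 * S.r 2 * S.r 1 ∉ S.W 2 5 :=
  rho_notin (a := 1) (by norm_num) (by norm_num) (free_A (n := 7) (by norm_num))
    (v_three (by norm_num) (nonflat_sub hA le_rfl (by norm_num) (by norm_num) (by norm_num)))

theorem h3_aux (hA : ¬ S.Flat 1 5) (h4 : S.c 1 4 = 3) (h : S.r 2 * S.r 3 * S.r 2 ∉ CC (S.W 2 5) (S.r 1)) :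
    S.r 2 * S.r 3 * S.r 2 * S.r 3 * S.r 2 ∈ CC (S.W 2 5) (S.r 1) := by
  have hQ1 : S.Q3 1 := Q3_nonflat hA (by norm_num) (by norm_num)
  have hF4 : S.Free 1 4 := (free_A (n := 7) (by norm_num)).mono le_rfl (by norm_num)
  have hd : (dcs (S.W 2 4) (S.r 1)).ncard = 3 := by
    rw [← h4]; exact dcs_c hQ1 (by norm_num : 1 + 2 ≤ 4) (by norm_num) hF4
  have r11 := S.r_inv 1
  have r22 := S.r_inv 2
  have r33 := S.r_inv 3
  have m2 : S.r 2 ∈ S.W 2 4 := S.r_mem le_rfl (by norm_num)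
  have m3 : S.r 3 ∈ S.W 2 4 := S.r_mem (by norm_num) (by norm_num)
  have le : S.W 2 4 ≤ S.W 2 5 := S.W_le le_rfl (by norm_num)
  set K := CC (S.W 2 5) (S.r 1) with hK
  have key : ∀ x ∈ S.W 2 4, ∀ y ∈ S.W 2 4, ((x * S.r 1 : Equiv.Perm Ω) : Equiv.Perm Ω ⧸ S.W 2 4) = ((y * S.r 1 : Equiv.Perm Ω) : Equiv.Perm Ω ⧸ S.W 2 4) → x⁻¹ * y ∈ K := by
    intro x hx y hy e
    rw [QuotientGroup.eq] at e
    rw [hK, mem_CC]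
    refine ⟨le (mul_mem (inv_mem hx) hy), le ?_⟩
    simpa [mul_assoc] using e
  have a2 : S.r 2 ∉ K := by
    intro hh
    have := (mem_CC.1 hh).2
    rw [r11] at this; exact rho1 hA this
  have b3 : S.r 3 ∈ K := by
    rw [hK, mem_CC]
    have : S.r 1 * S.r 3 = S.r 3 * S.r 1 := S.r_comm (by norm_num) (by norm_num)
    refine ⟨le m3, ?_⟩
    rw [r11, this, mul_assoc, S.r_mul_self, mul_one]; exact le m3
  by_contra hcon
  have e22 := S.r_mul_self 2
  have e33 := S.r_mul_self 3
  have e22' : ∀ x, S.r 2 * (S.r 2 * x) = x := fun x => by rw [← mul_assoc, e22, one_mul]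
  have e33' : ∀ x, S.r 3 * (S.r 3 * x) = x := fun x => by rw [← mul_assoc, e33, one_mul]
  have n32 : S.r 3 * S.r 2 ∉ K := fun hh => a2 (by
    have := mul_mem b3 hh
    rwa [e33'] at this)
  have m32 := mul_mem m3 m2
  have m232 := mul_mem m2 m32
  have inj := inj4 (x0 := ((1 * S.r 1 : Equiv.Perm Ω) : Equiv.Perm Ω ⧸ S.W 2 4)) (x1 := ((S.r 2 * S.r 1 : Equiv.Perm Ω) : Equiv.Perm Ω ⧸ S.W 2 4))
    (x2 := ((S.r 3 * S.r 2 * S.r 1 : Equiv.Perm Ω) : Equiv.Perm Ω ⧸ S.W 2 4)) (x3 := ((S.r 2 * (S.r 3 * S.r 2) * S.r 1 : Equiv.Perm Ω) : Equiv.Perm Ω ⧸ S.W 2 4))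
    (fun e => a2 (by simpa using key _ (one_mem _) _ m2 e.symm))
    (fun e => n32 (by simpa using key _ (one_mem _) _ m32 e.symm))
    (fun e => h (by simpa [r22, mul_assoc] using key _ m2 _ m32 e.symm))
    (fun e => h (by simpa [mul_assoc] using key _ (one_mem _) _ m232 e.symm))
    (fun e => n32 (by simpa [mul_assoc] using key _ m2 _ m232 e.symm))
    (fun e => hcon (by simpa [r22, r33, mul_assoc] using key _ m32 _ m232 e.symm))
  have h4' : (Set.range ![((1 * S.r 1 : Equiv.Perm Ω) : Equiv.Perm Ω ⧸ S.W 2 4), ((S.r 2 * S.r 1 : Equiv.Perm Ω) : Equiv.Perm Ω ⧸ S.W 2 4),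
     ((S.r 3 * S.r 2 * S.r 1 : Equiv.Perm Ω) : Equiv.Perm Ω ⧸ S.W 2 4), ((S.r 2 * (S.r 3 * S.r 2) * S.r 1 : Equiv.Perm Ω) : Equiv.Perm Ω ⧸ S.W 2 4)]).ncard = 4 := by
    rw [← Set.image_univ, Set.ncard_image_of_injective _ inj]; simp
  have sub : Set.range ![((1 * S.r 1 : Equiv.Perm Ω) : Equiv.Perm Ω ⧸ S.W 2 4), ((S.r 2 * S.r 1 : Equiv.Perm Ω) : Equiv.Perm Ω ⧸ S.W 2 4),
     ((S.r 3 * S.r 2 * S.r 1 : Equiv.Perm Ω) : Equiv.Perm Ω ⧸ S.W 2 4), ((S.r 2 * (S.r 3 * S.r 2) * S.r 1 : Equiv.Perm Ω) : Equiv.Perm Ω ⧸ S.W 2 4)] ⊆ dcs (S.W 2 4) (S.r 1) := by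
    rintro _ ⟨i, rfl⟩
    fin_cases i
    · exact ⟨_, one_mem _, rfl⟩
    · exact ⟨_, m2, rfl⟩
    · exact ⟨_, m32, rfl⟩
    · exact ⟨_, m232, rfl⟩
  have := Set.ncard_le_ncard sub
  omega

theorem CC_comm {G : Type*} [Group G] {H : Subgroup G} {u x : G} (hx : x ∈ H) (h : u * x = x * u) : x ∈ CC H u := by
  rw [mem_CC]; refine ⟨hx, ?_⟩
  rw [mul_assoc, ← h, inv_mul_cancel_left]; exact hx

theorem four (hA : ¬ S.Flat 1 5) (hc : S.c 1 5 = 4) : ∃ ψ : ↥(S.W 2 5) →* Equiv.Perm (Fin 4),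
    ψ ⟨S.r 2, S.r_mem le_rfl (by norm_num)⟩ = Equiv.swap 0 1 ∧ ψ ⟨S.r 3, S.r_mem (by norm_num) (by norm_num)⟩ = Equiv.swap 1 2 ∧
    ψ ⟨S.r 4, S.r_mem (by norm_num) (by norm_num)⟩ = Equiv.swap 2 3 ∧ ∀ h, ψ h 0 = 0 ↔ (h : Equiv.Perm Ω) ∈ CC (S.W 2 5) (S.r 1) := by
  have hQ1 : S.Q3 1 := Q3_nonflat hA (by norm_num) (by norm_num)
  have hF : S.Free 1 5 := free_A (n := 7) (by norm_num)
  have h14 : S.c 1 4 = 3 := by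
    have h1 := c_lt hA (by norm_num) (by norm_num)
    have h2 := c_ge (nonflat_sub hA (le_refl 1) (by norm_num : 1 + 1 < 4) (by norm_num) (by norm_num)) (by norm_num) (by norm_num)
    change S.c 1 4 < _ at h1
    change 3 ≤ _ at h2
    omega
  have hle : CC (S.W 2 5) (S.r 1) ≤ S.W 2 5 := fun x hx => (mem_CC.1 hx).1
  have hidx : ((CC (S.W 2 5) (S.r 1)).subgroupOf (S.W 2 5)).index = 4 := by
    have h1 := card_CC hQ1 (by norm_num : 1 + 2 ≤ 5) (by norm_num) hF
    have h2 := c_mul_k hQ1 (by norm_num : 1 + 2 ≤ 5) (by norm_num)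
    change Nat.card (CC (S.W 2 5) (S.r 1)) = _ at h1
    change _ = S.N 2 5 at h2
    rw [← card_W_eq (by norm_num) (hF.mono (by norm_num) le_rfl), hc, ← h1] at h2
    have h3 := Subgroup.card_mul_index ((CC (S.W 2 5) (S.r 1)).subgroupOf (S.W 2 5))
    have h4 : Nat.card ((CC (S.W 2 5) (S.r 1)).subgroupOf (S.W 2 5)) = Nat.card (CC (S.W 2 5) (S.r 1)) :=
      Nat.card_congr (Subgroup.subgroupOfEquivOfLe hle).toEquiv
    rw [h4, ← h2, mul_comm] at h3
    exact Nat.eq_of_mul_eq_mul_right Nat.card_pos h3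
  have := four_action ((CC (S.W 2 5) (S.r 1)).subgroupOf (S.W 2 5)) hidx (a := ⟨S.r 2, S.r_mem le_rfl (by norm_num)⟩)
    (b := ⟨S.r 3, S.r_mem (by norm_num) (by norm_num)⟩) (c := ⟨S.r 4, S.r_mem (by norm_num) (by norm_num)⟩)
    (Subtype.ext (S.r_mul_self 2)) (Subtype.ext (S.r_mul_self 3)) (Subtype.ext (S.r_mul_self 4)) ?_ ?_ ?_ ?_ ?_ ?_
  · exact this
  · rintro M h2 h3 h4 ⟨h, hh⟩
    have := S.W_ind (a := 2) (b := 5) (p := fun w => w ∈ M.map (S.W 2 5).subtype) (one_mem _) (by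
      intro i i1 i2 w _ hw
      refine mul_mem ?_ hw
      interval_cases i
      · exact ⟨_, h2, rfl⟩
      · exact ⟨_, h3, rfl⟩
      · exact ⟨_, h4, rfl⟩) h hh
    obtain ⟨x, hx, e⟩ := this
    have : x = ⟨h, hh⟩ := Subtype.ext e
    rw [← this]; exact hx
  · rw [Subgroup.mem_subgroupOf]
    intro hh
    have := (mem_CC.1 hh).2
    rw [S.r_inv 1] at this; exact rho1 hA this
  · exact CC_comm (S.r_mem (by norm_num) (by norm_num)) (S.r_comm (by norm_num) (by norm_num))
  · exact CC_comm (S.r_mem (by norm_num) (by norm_num)) (S.r_comm (by norm_num) (by norm_num))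
  · exact Subtype.ext (S.r_comm (by norm_num) (by norm_num))
  · exact h3_aux hA h14

theorem bip7 (hA : ¬ S.Flat 1 5) (h2 : S.c 0 5 = 2) (hc : S.c 1 5 = 4) {m : ℕ} (hv : S.v 1 5 = 2 * m) (hm : m < 8) :
    (dcs (S.W 2 5) (S.r 1 * S.r 2 * S.r 1)).ncard + 1 = m := by
  have hQ1 : S.Q3 1 := Q3_nonflat hA (by norm_num) (by norm_num)
  have hF : S.Free 1 5 := free_A (n := 7) (by norm_num)
  obtain ⟨ψ, e2, e3, e4, eK⟩ := four hA hc
  have hd : (dcs (S.W 2 5) (S.r 1)).ncard = 4 := by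
    rw [← hc]; exact dcs_c hQ1 (by norm_num : 1 + 2 ≤ 5) (by norm_num) hF
  have hcv : (cos (S.W 1 5) (S.W 2 5)).ncard = 2 * m := by
    rw [← hv]; exact cos_v (a := 1) (by norm_num) (by norm_num) hF
  have k3 : S.r 3 ∈ CC (S.W 2 5) (S.r 1) := CC_comm (S.r_mem (by norm_num) (by norm_num)) (S.r_comm (by norm_num) (by norm_num))
  have k4 : S.r 4 ∈ CC (S.W 2 5) (S.r 1) := CC_comm (S.r_mem (by norm_num) (by norm_num)) (S.r_comm (by norm_num) (by norm_num))
  refine bip_group (E := CC (S.W 1 5) (S.r 0)) ?_ (fun w hw => (mem_CC.1 hw).1) (index_CC h2) (u := S.r 1) (a := S.r 2)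
    (S.r_mem le_rfl (by norm_num)) ?_ (S.r_mul_self 1) (S.r_mem le_rfl (by norm_num)) (rho1 hA) hd hcv (by omega) ?_
  · intro w hw
    refine CC_comm (S.W_le (by norm_num) le_rfl hw) ?_
    exact (W_r_comm_left (by norm_num) (by norm_num) hw).symm
  · intro hh
    have := (mem_CC.1 hh).2
    rw [S.r_inv 0] at this
    exact rho_notin (a := 0) (b := 5) (by norm_num) (by norm_num) (free_R (n := 7) (by norm_num)) p0 this
  · intro h hh
    have main : ∀ k ∈ CC (S.W 2 5) (S.r 1), ∀ hk : k ∈ S.W 2 5, ψ ⟨h, hh⟩ 0 = ψ ⟨k, hk⟩ 1 →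
        ∃ k ∈ CC (S.W 2 5) (S.r 1), ∃ k' ∈ CC (S.W 2 5) (S.r 1), h = k * S.r 2 * k' := by
      intro k kk hk e
      refine ⟨k, kk, (k * S.r 2)⁻¹ * h, ?_, by group⟩
      have hm : S.r 2 ∈ S.W 2 5 := S.r_mem le_rfl (by norm_num)
      have := eK ((⟨k, hk⟩ * ⟨S.r 2, hm⟩)⁻¹ * ⟨h, hh⟩)
      apply this.1
      rw [map_mul, map_inv, map_mul, e2, Equiv.Perm.mul_apply, e, Equiv.Perm.inv_eq_iff_eq]
      simp
    obtain ⟨j, hj⟩ : ∃ j, j = ψ ⟨h, hh⟩ 0 := ⟨_, rfl⟩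
    fin_cases j
    · left; exact (eK ⟨h, hh⟩).1 hj.symm
    · right; exact main 1 (one_mem _) (one_mem _) (by
        rw [← hj]; have : ψ 1 = 1 := ψ.map_one
        exact (congrArg (fun g : Equiv.Perm (Fin 4) => g 1) this).symm)
    · right; exact main _ k3 (S.r_mem (by norm_num) (by norm_num)) (by
        rw [← hj, e3]; rfl)
    · right; exact main _ (mul_mem k4 k3) (mul_mem (S.r_mem (by norm_num) (by norm_num)) (S.r_mem (by norm_num) (by norm_num))) (by
        rw [← hj]
        have : ψ (⟨S.r 4, S.r_mem (by norm_num) (by norm_num)⟩ * ⟨S.r 3, S.r_mem (by norm_num) (by norm_num)⟩) 1 = 3 := by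
          rw [map_mul, e3, e4]; decide
        exact this.symm)
end Sys

open scoped Classical
set_option linter.unusedSectionVars false
set_option linter.unusedVariables false
set_option linter.unusedTactic false
set_option linter.unusedSimpArgs false
section Beta
open Equiv

abbrev Good4 (σ : Perm (Fin 4)) : Prop := σ 0 = 0 → σ = 1 ∨ σ = swap 2 3

theorem dec1 : ∀ σ : Perm (Fin 4), σ * swap 0 1 = swap 0 1 * σ → σ * swap 1 2 = swap 1 2 * σ → σ * swap 2 3 = swap 2 3 * σ → σ = 1 := by decide
theorem dec2 : ∀ σ : Perm (Fin 4), σ 0 = 0 → σ * swap 1 2 = swap 1 2 * σ → σ * swap 2 3 = swap 2 3 * σ → σ = 1 := by decide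
theorem dec3 : ∀ σ : Perm (Fin 4), σ 0 = 0 → σ 1 = 1 → σ = 1 ∨ σ = swap 2 3 := by decide
theorem dec4 : ∀ g : Perm (Fin 4), g * g * g = 1 → g ≠ 1 → Good4 g → Good4 (swap 2 3 * g * g * swap 2 3 * g) →
    Good4 (swap 2 3 * g * swap 2 3 * g * g) → g * swap 2 3 = swap 0 2 ∨ g * g * swap 2 3 = swap 0 2 := by decide
theorem dec5 : ∀ σ : Perm (Fin 4), σ * σ = 1 → σ 3 = 3 → Good4 σ → Good4 (swap 0 2 * σ * swap 0 2) → σ = 1 ∨ σ = swap 0 2 := by decide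
theorem dec6 : ¬ Good4 (swap 0 2 * swap 0 1 * swap 0 2) := by decide

theorem range_top {H : Type*} [Group H] (ψ : H →* Perm (Fin 4)) {a b c : H} (ha : ψ a = swap 0 1) (hb : ψ b = swap 1 2) (hc : ψ c = swap 2 3) :
    ψ.range = ⊤ := by
  rw [eq_top_iff]
  intro σ _
  refine perm_mem_of_swaps ψ.range Set.univ (fun x _ y _ => ?_) (by simp)
  refine swaps_of_adj ψ.range 0 ?_ x y (Nat.zero_le _) (Nat.zero_le _)
  intro i hi _
  have : i < 3 := by omega
  interval_cases i
  · exact ⟨a, ha⟩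
  · exact ⟨b, hb⟩
  · exact ⟨c, hc⟩

theorem ker_two {H : Type*} [Group H] [Finite H] (ψ : H →* Perm (Fin 4)) {a b c : H} (ha : ψ a = swap 0 1) (hb : ψ b = swap 1 2) (hc : ψ c = swap 2 3)
    (hH : Nat.card H = 48) : ∃ z : H, z ≠ 1 ∧ z * z = 1 ∧ ψ z = 1 ∧ (∀ x, ψ x = 1 → x = 1 ∨ x = z) ∧ ∀ x, z * x = x * z := by
  have h1 : Nat.card ψ.ker = 2 := by
    have h2 := Subgroup.card_mul_index ψ.ker
    rw [Subgroup.index_ker, range_top ψ ha hb hc, hH, Subgroup.card_top, Nat.card_perm, Nat.card_fin] at h2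
    rw [show Nat.factorial 4 = 24 from rfl] at h2
    omega
  rw [Nat.card_eq_two_iff' (1 : ψ.ker)] at h1
  obtain ⟨⟨z, hz⟩, hz1, hu⟩ := h1
  have hz' : ψ z = 1 := hz
  have u : ∀ x, ψ x = 1 → x = 1 ∨ x = z := by
    intro x hx
    by_cases h : x = 1
    · exact Or.inl h
    · right
      have := hu ⟨x, hx⟩ (fun e => h (congrArg Subtype.val e))
      exact congrArg Subtype.val this
  have zn : z ≠ 1 := fun e => hz1 (Subtype.ext e)
  refine ⟨z, zn, ?_, hz', u, ?_⟩
  · rcases u (z * z) (by rw [map_mul, hz', one_mul]) with h | h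
    · exact h
    · exact absurd (mul_eq_left.1 h) zn
  · intro x
    rcases u (x * z * x⁻¹) (by rw [map_mul, map_mul, hz', mul_one, ← map_mul, mul_inv_cancel, map_one]) with h | h
    · exact absurd (by simpa using h) zn
    · nth_rewrite 1 [← h]; group

theorem beta_tail {G : Type*} [Group G] {a b c d z u w : G}
    (aa : a * a = 1) (bb : b * b = 1) (cc : c * c = 1) (ac : a * c = c * a) (ad : a * d = d * a) (bd : b * d = d * b)
    (z1 : z ≠ 1) (zz : z * z = 1) (za' : z * a = a * z) (zb : z * b = b * z) (zcc : z * c = c * z) (zd : z * d = d * z)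
    (hp6 : (a * b) ^ 6 = 1) (hu : u = 1 ∨ u = z) (eu : (a * b * a) * (b * c * b) * (a * b * a) = b * c * b * u)
    (hw : w = b * c * b * c * b * c) (w01 : w = 1 ∨ w = z) : (b * w) * c * (b * w) = c * (b * w) * c ∧
      ∃ y, y * y = 1 ∧ (y * a = a * y ∧ y * b = b * y ∧ y * c = c * y ∧ y * d = d * y) ∧
        (∀ x, x * a = a * x → x * b = b * x → x * z = z * x → x * y = y * x) ∧ (a * y) * (b * w) * (a * y) = (b * w) * (a * y) * (b * w) := by
  have ai : a⁻¹ = a := inv_eq_of_mul_eq_one_right aa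
  have bi : b⁻¹ = b := inv_eq_of_mul_eq_one_right bb
  have ci : c⁻¹ = c := inv_eq_of_mul_eq_one_right cc
  have aa' : ∀ x, a * (a * x) = x := fun x => by rw [← mul_assoc, aa, one_mul]
  have bb' : ∀ x, b * (b * x) = x := fun x => by rw [← mul_assoc, bb, one_mul]
  have cc' : ∀ x, c * (c * x) = x := fun x => by rw [← mul_assoc, cc, one_mul]
  have cen : ∀ v, (v = 1 ∨ v = z) → v * v = 1 ∧ v * a = a * v ∧ v * b = b * v ∧ v * c = c * v ∧ v * d = d * v ∧ v * z = z * v := by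
    rintro v (rfl | rfl)
    · simp
    · exact ⟨zz, za', zb, zcc, zd, rfl⟩
  obtain ⟨ww, wa, wb, wc, wd, wz⟩ := cen w w01
  obtain ⟨uu, ua, ub, uc, ud, uz⟩ := cen u hu
  have com1 : ∀ {p q : G}, p * q = q * p → ∀ x, p * (q * x) = q * (p * x) := fun h x => by rw [← mul_assoc, h, mul_assoc]
  have hw' : w = c * b * c * b * c * b := by
    rw [eq_inv_of_mul_eq_one_left ww, hw]; simp [mul_assoc, bi, ci]
  have br : b * w * c * (b * w) = c * (b * w) * c := by
    have e1 : b * w * c * (b * w) = b * c * b * (w * w) := by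
      simp only [mul_assoc, com1 wc, com1 wb]
    have e2 : c * (b * w) * c = c * b * c * w := by simp only [mul_assoc, wc]
    rw [e1, e2, ww, mul_one, hw']; simp only [mul_assoc, cc', bb']
  refine ⟨br, ?_⟩
  have baw : (a * b) * w = w * (a * b) := by rw [mul_assoc, ← wb, ← mul_assoc, ← wa, mul_assoc]
  obtain ⟨t, ht⟩ : ∃ t, t = a * b * a * b * a * b := ⟨_, rfl⟩
  have p3 : (a * b) ^ 3 = t := by rw [pow_succ, pow_two, ht]; simp only [mul_assoc]
  have tt : t * t = 1 := by rw [← p3, ← pow_add, hp6]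
  have ht' : t = b * a * b * a * b * a := by
    rw [eq_inv_of_mul_eq_one_left tt, ht]; simp [mul_assoc, ai, bi]
  have tw : t * w = w * t := by
    rw [← p3]; exact Commute.pow_left baw 3
  have ta : t * a = a * t := by
    nth_rewrite 1 [ht']; rw [ht]; simp only [mul_assoc, aa, aa', mul_one]
  have tb : t * b = b * t := by
    nth_rewrite 1 [ht]; rw [ht']; simp only [mul_assoc, bb, bb', mul_one]
  have cmt : ∀ x, x * a = a * x → x * b = b * x → x * t = t * x := by
    intro x xa xb
    have h1 : Commute x (a * b) := (show Commute x a from xa).mul_right xb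
    rw [← p3]; exact h1.pow_right 3
  have xw : ∀ x, x * z = z * x → x * w = w * x := by
    intro x h
    rcases w01 with e | e
    · rw [e]; simp
    · rw [e, h]
  obtain ⟨y, hy⟩ : ∃ y, y = t * w := ⟨_, rfl⟩
  have tm : ∀ x, t * x = x * t → w * x = x * w → y * x = x * y := by
    intro x h1 h2
    rw [hy, mul_assoc, h2, ← mul_assoc, h1, mul_assoc]
  have yy : y * y = 1 := by
    rw [hy]
    calc t * w * (t * w) = t * (w * t) * w := by simp only [mul_assoc]
      _ = (t * t) * (w * w) := by rw [← tw]; simp only [mul_assoc]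
      _ = 1 := by rw [ww, tt, mul_one]
  have ya : y * a = a * y := tm a ta wa
  have yb : y * b = b * y := tm b tb wb
  have yd : y * d = d * y := tm d (cmt d ad.symm bd.symm).symm wd
  have yu : y * u = u * y := tm u (cmt u ua ub).symm (xw u uz).symm
  have yw : y * w = w * y := tm w tw rfl
  have yz : y * z = z * y := tm z (cmt z za' zb).symm wz
  have tct : t * c * t = c * u := by
    calc t * c * t = (a * b * a * b * a * b) * c * (b * a * b * a * b * a) := by rw [← ht, ← ht']
      _ = a * b * ((a * b * a) * (b * c * b) * (a * b * a)) * (b * a) := by simp only [mul_assoc, aa', bb']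
      _ = a * b * (b * c * b * u) * (b * a) := by rw [eu]
      _ = a * c * (b * u) * b * a := by simp only [mul_assoc, bb']
      _ = a * c * (u * a) := by rw [← ub]; simp only [mul_assoc, bb']
      _ = (a * c) * a * u := by rw [ua]; simp only [mul_assoc]
      _ = c * u := by rw [ac]; simp only [mul_assoc, aa']
  have ycy : y * c * y = c * u := by
    calc y * c * y = t * (w * c) * (t * w) := by rw [hy]; simp only [mul_assoc]
      _ = t * c * (w * t) * w := by rw [wc]; simp only [mul_assoc]
      _ = (t * c * t) * (w * w) := by rw [← tw]; simp only [mul_assoc]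
      _ = c * u := by rw [tct, ww, mul_one]
  obtain ⟨s, hs⟩ : ∃ s, s = b * w := ⟨_, rfl⟩
  have ys : y * s = s * y := by rw [hs, ← mul_assoc, yb, mul_assoc, yw, mul_assoc]
  have us : u * s = s * u := by rw [hs, ← mul_assoc, ub, mul_assoc, xw u uz, mul_assoc]
  have ss : s * s = 1 := by
    rw [hs]
    calc b * w * (b * w) = b * (w * b) * w := by simp only [mul_assoc]
      _ = (b * b) * (w * w) := by rw [wb]; simp only [mul_assoc]
      _ = 1 := by rw [ww, bb, mul_one]
  have br' : s * c * s = c * s * c := by rw [hs]; exact br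
  have yy' : ∀ x, y * (y * x) = x := fun x => by rw [← mul_assoc, yy, one_mul]
  have u1 : u = 1 := by
    have h1 : y * (s * c * s) * y = s * c * s * u := by
      calc y * (s * c * s) * y = (y * s) * c * (s * y) := by simp only [mul_assoc]
        _ = (s * y) * c * (s * y) := congrArg (fun g => g * c * (s * y)) ys
        _ = (s * y) * c * (y * s) := congrArg (fun g => (s * y) * c * g) ys.symm
        _ = s * (y * c * y) * s := by simp only [mul_assoc]
        _ = s * c * (u * s) := by rw [ycy]; simp only [mul_assoc]
        _ = s * c * s * u := by rw [us]; simp only [mul_assoc]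
    have h2 : y * (c * s * c) * y = c * s * c := by
      calc y * (c * s * c) * y = (y * c * y) * (y * s) * (c * y) := by simp only [mul_assoc, yy']
        _ = (y * c * y) * s * (y * c * y) := by rw [ys]; simp only [mul_assoc]
        _ = c * (u * s) * (c * u) := by rw [ycy]; simp only [mul_assoc]
        _ = c * s * (u * c) * u := by rw [us]; simp only [mul_assoc]
        _ = c * s * c * (u * u) := by rw [uc]; simp only [mul_assoc]
        _ = c * s * c := by rw [uu, mul_one]
    rw [br', h2, eq_comm, mul_eq_left] at h1
    exact h1
  have yc : y * c = c * y := by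
    calc y * c = (y * c * y) * y := by rw [mul_assoc (y * c), yy, mul_one]
      _ = c * y := by rw [ycy, u1, mul_one]
  refine ⟨y, yy, ⟨ya, yb, yc, yd⟩, ?_, ?_⟩
  · intro x xa xb xz
    exact (tm x (cmt x xa xb).symm (xw x xz).symm).symm
  · rw [← hs]
    have aw : ∀ x, w * (a * x) = a * (w * x) := com1 wa
    have bw : ∀ x, w * (b * x) = b * (w * x) := com1 wb
    have e1 : a * y * s * (a * y) = a * s * a := by
      calc a * y * s * (a * y) = a * (y * s) * (a * y) := by simp only [mul_assoc]
        _ = a * s * (y * a) * y := by rw [ys]; simp only [mul_assoc]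
        _ = a * s * a := by rw [ya]; simp only [mul_assoc, yy, mul_one]
    have e2 : s * (a * y) * s = s * a * s * y := by
      calc s * (a * y) * s = s * a * (y * s) := by simp only [mul_assoc]
        _ = s * a * s * y := by rw [ys]; simp only [mul_assoc]
    rw [e1, e2, hy, ht', hs]
    have wm : ∀ x, w * (w * x) = x := fun x => by rw [← mul_assoc, ww, one_mul]
    simp only [mul_assoc, aw, bw, wm, aa', bb', wa, wb, ww, mul_one]

/-- the structure of the exceptional `β` situation -/
theorem beta_group {G : Type*} [Group G] [Finite G] {H : Subgroup G} {a b c d : G} (hb : b ∈ H) (hc : c ∈ H) (hd : d ∈ H)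
    (aa : a * a = 1) (bb : b * b = 1) (cc : c * c = 1) (dd : d * d = 1) (ac : a * c = c * a) (ad : a * d = d * a) (bd : b * d = d * b)
    (ψ : H →* Perm (Fin 4)) (eb : ψ ⟨b, hb⟩ = swap 0 1) (ec : ψ ⟨c, hc⟩ = swap 1 2) (ed : ψ ⟨d, hd⟩ = swap 2 3)
    (hK : ∀ h, ψ h 0 = 0 ↔ (h : G) ∈ CC H a) (hH : Nat.card H = 48) (hL : Nat.card (CC H (a * b * a)) = 12)
    (hp : a * (b * a * b) = b * a * b * a ∨ (a * b) ^ 6 = 1)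
    (hip : ∀ h : (a * b * a) * (b * c * b) * (a * b * a) ∈ H, ψ ⟨_, h⟩ 3 = 3) :
    ∃ z ∈ H, z ≠ 1 ∧ z * z = 1 ∧ (z * a = a * z ∧ z * b = b * z ∧ z * c = c * z ∧ z * d = d * z) ∧
      (∀ x ∈ H, x * b = b * x → x * c = c * x → x * d = d * x → x = 1 ∨ x = z) ∧
      ∃ w, (w = 1 ∨ w = z) ∧ (b * w) * c * (b * w) = c * (b * w) * c ∧
      ∃ y, y * y = 1 ∧ (y * a = a * y ∧ y * b = b * y ∧ y * c = c * y ∧ y * d = d * y) ∧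
        (∀ x, x * a = a * x → x * b = b * x → x * z = z * x → x * y = y * x) ∧ (a * y) * (b * w) * (a * y) = (b * w) * (a * y) * (b * w) := by
  have ai : a⁻¹ = a := inv_eq_of_mul_eq_one_right aa
  have bi : b⁻¹ = b := inv_eq_of_mul_eq_one_right bb
  have aa' : ∀ x, a * (a * x) = x := fun x => by rw [← mul_assoc, aa, one_mul]
  have bb' : ∀ x, b * (b * x) = x := fun x => by rw [← mul_assoc, bb, one_mul]
  have cc' : ∀ x, c * (c * x) = x := fun x => by rw [← mul_assoc, cc, one_mul]
  obtain ⟨⟨z, hz⟩, z1, zz, ψz, kz, zc⟩ := ker_two ψ eb ec ed hH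
  have z1 : z ≠ 1 := fun e => z1 (Subtype.ext e)
  have zz : z * z = 1 := congrArg Subtype.val zz
  have zH : ∀ x ∈ H, z * x = x * z := fun x hx => congrArg Subtype.val (zc ⟨x, hx⟩)
  have kz : ∀ x (hx : x ∈ H), ψ ⟨x, hx⟩ = 1 → x = 1 ∨ x = z := by
    intro x hx e
    rcases kz _ e with h | h
    · exact Or.inl (congrArg Subtype.val h)
    · exact Or.inr (congrArg Subtype.val h)
  have mulψ : ∀ x (hx : x ∈ H) y (hy : y ∈ H), ψ ⟨x * y, mul_mem hx hy⟩ = ψ ⟨x, hx⟩ * ψ ⟨y, hy⟩ := fun x hx y hy => map_mul ψ ⟨x, hx⟩ ⟨y, hy⟩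
  have eqz : ∀ x (hx : x ∈ H) y (hy : y ∈ H), ψ ⟨x, hx⟩ = ψ ⟨y, hy⟩ → x = y ∨ x = y * z := by
    intro x hx y hy e
    have := kz (y⁻¹ * x) (mul_mem (inv_mem hy) hx) (by
      rw [mulψ _ (inv_mem hy) _ hx, e]
      have : ψ ⟨y⁻¹, inv_mem hy⟩ = (ψ ⟨y, hy⟩)⁻¹ := map_inv ψ ⟨y, hy⟩
      rw [this, inv_mul_cancel])
    rcases this with h | h
    · left; exact (inv_mul_eq_one.1 h).symm
    · right; rw [← h]; group
  have comψ : ∀ x (hx : x ∈ H) y (hy : y ∈ H), x * y = y * x → ψ ⟨x, hx⟩ * ψ ⟨y, hy⟩ = ψ ⟨y, hy⟩ * ψ ⟨x, hx⟩ := by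
    intro x hx y hy e
    rw [← mulψ _ hx _ hy, ← mulψ _ hy _ hx]; congr 1; exact Subtype.ext e
  have kc : ∀ k ∈ CC H a, a * k * a ∈ H := by
    intro k hk; have := (mem_CC.1 hk).2; rwa [ai] at this
  have ck : ∀ k ∈ H, a * k * a ∈ H → k ∈ CC H a := by
    intro k hk h; rw [mem_CC, ai]; exact ⟨hk, h⟩
  -- z commutes with a
  have zK : z ∈ CC H a := (hK ⟨z, hz⟩).1 (by rw [ψz]; rfl)
  have za : a * z * a = z := by
    have m := kc z zK
    have mK : a * z * a ∈ CC H a := ck _ m (by simpa [mul_assoc, aa', aa] using hz)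
    have com : ∀ k ∈ H, a * k = k * a → (a * z * a) * k = k * (a * z * a) := by
      intro k hk e
      calc a * z * a * k = a * (z * k) * a := by simp only [mul_assoc, e]
        _ = (a * k) * z * a := by rw [zH k hk]; simp only [mul_assoc]
        _ = k * (a * z * a) := by rw [e]; simp only [mul_assoc]
    have e1 := dec2 (ψ ⟨_, m⟩) ((hK ⟨_, m⟩).2 mK) (by rw [← ec]; exact comψ _ m _ hc (com c hc ac)) (by rw [← ed]; exact comψ _ m _ hd (com d hd ad))
    rcases kz _ m e1 with h | h
    · exfalso; apply z1
      calc z = a * (a * z * a) * a := by simp [mul_assoc, aa', aa]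
        _ = 1 := by rw [h, mul_one, aa]
    · exact h
  have za' : z * a = a * z := by
    calc z * a = (a * z * a) * a := by rw [za]
      _ = a * z := by rw [mul_assoc, aa, mul_one]
  -- L
  obtain ⟨L, hLd⟩ : ∃ L, L = CC H (a * b * a) := ⟨_, rfl⟩
  have ρi : (a * b * a)⁻¹ = a * b * a := by simp [mul_assoc, ai, bi]
  have Ldef : ∀ l, l ∈ L ↔ l ∈ H ∧ (a * b * a) * l * (a * b * a) ∈ H := by
    intro l; rw [hLd, mem_CC, ρi]
  have LH : ∀ l ∈ L, l ∈ H := fun l hl => ((Ldef l).1 hl).1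
  have LCC : ∀ x ∈ H, x * a = a * x → x * b = b * x → x ∈ L := by
    intro x hx xa xb
    rw [hLd]
    refine Sys.CC_comm hx ?_
    calc a * b * a * x = a * b * (x * a) := by rw [xa]; simp only [mul_assoc]
      _ = a * (x * b) * a := by rw [xb]; simp only [mul_assoc]
      _ = (x * a) * b * a := by rw [xa]; simp only [mul_assoc]
      _ = x * (a * b * a) := by simp only [mul_assoc]
  have zL : z ∈ L := LCC z hz za' (zH b hb)
  have dL : d ∈ L := LCC d hd ad.symm bd.symm
  have good : ∀ l (hl : l ∈ L), Good4 (ψ ⟨l, LH l hl⟩) := by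
    intro l hl h0
    have lK := (hK ⟨l, LH l hl⟩).1 h0
    have kH := kc l lK
    obtain ⟨k, hk⟩ : ∃ k, k = a * l * a := ⟨_, rfl⟩
    have hl' : l = a * k * a := by rw [hk]; simp [mul_assoc, aa', aa]
    rw [← hk] at kH
    have kK : k ∈ CC H a := ck k kH (by rw [← hl']; exact LH l hl)
    have bkb := mul_mem (mul_mem hb kH) hb
    have bK : b * k * b ∈ CC H a := by
      refine ck _ bkb ?_
      have := ((Ldef l).1 hl).2
      rw [hl'] at this
      simpa [mul_assoc, aa', aa] using this
    have f1 := (hK ⟨_, bkb⟩).2 bK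
    have f0 := (hK ⟨_, kH⟩).2 kK
    rw [mulψ _ (mul_mem hb kH) _ hb, mulψ _ hb _ kH, eb] at f1
    have f1 : ψ ⟨k, kH⟩ 1 = 1 := by
      have : swap (0 : Fin 4) 1 (ψ ⟨k, kH⟩ 1) = 0 := by simpa using f1
      have := congrArg (swap (0 : Fin 4) 1) this
      simpa using this
    have lk : k = l := by
      have com : ∀ x, x * a = a * x → k = x → k = l := by
        intro x e h; rw [hl', h, ← e, mul_assoc, aa, mul_one]
      rcases dec3 _ f0 f1 with h | h
      · rcases kz _ kH h with h | h
        · exact com 1 (by simp) h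
        · exact com z za' h
      · rcases eqz _ kH _ hd (h.trans ed.symm) with h | h
        · exact com d ad.symm h
        · exact com (d * z) (by rw [mul_assoc, za', ← mul_assoc, ← ad, mul_assoc]) h
    subst lk
    exact dec3 _ f0 f1
  -- an element of order three
  have τH := mul_mem (mul_mem hb hc) hb
  have eτ : ψ ⟨_, τH⟩ = swap 0 2 := by
    rw [mulψ _ (mul_mem hb hc) _ hb, mulψ _ hb _ hc, eb, ec]; decide
  have τL : b * c * b ∈ L := by
    haveI : Fact (Nat.Prime 3) := ⟨by norm_num⟩
    obtain ⟨⟨g, hg⟩, og⟩ := exists_prime_orderOf_dvd_card' (G := L) 3 (by rw [hLd, hL]; norm_num)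
    have g3 : g * g * g = 1 := by
      have := pow_orderOf_eq_one (⟨g, hg⟩ : L)
      rw [og, pow_succ, pow_two] at this
      exact congrArg Subtype.val this
    have g1 : g ≠ 1 := by
      rintro rfl
      have : (⟨1, hg⟩ : L) = 1 := rfl
      rw [this, orderOf_one] at og; omega
    have gH := LH g hg
    have fin : ∀ x (hx : x ∈ L), ψ ⟨x, LH x hx⟩ = swap 0 2 → b * c * b ∈ L := by
      intro x hx e
      rcases eqz _ τH _ (LH x hx) (eτ.trans e.symm) with h | h
      · rw [h]; exact hx
      · rw [h]; exact mul_mem hx zL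
    have w1 := mul_mem (mul_mem (mul_mem dL hg) dL) hg
    have w2 := mul_mem w1 hg
    have w3 := mul_mem (mul_mem (mul_mem (mul_mem dL hg) hg) dL) hg
    have := dec4 (ψ ⟨g, gH⟩) (by rw [← mulψ _ gH _ gH, ← mulψ _ (mul_mem gH gH) _ gH]; rw [← map_one ψ]; congr 1; exact Subtype.ext g3)
      (by
        intro e
        rcases kz _ gH e with h | h
        · exact g1 h
        · rw [h, zz, one_mul] at g3; exact z1 g3)
      (good g hg)
      (by
        have := good _ w3
        rwa [mulψ _ (mul_mem (mul_mem (mul_mem hd gH) gH) hd) _ gH, mulψ _ (mul_mem (mul_mem hd gH) gH) _ hd, mulψ _ (mul_mem hd gH) _ gH, mulψ _ hd _ gH, ed] at this)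
      (by
        have := good _ w2
        rwa [mulψ _ (mul_mem (mul_mem (mul_mem hd gH) hd) gH) _ gH, mulψ _ (mul_mem (mul_mem hd gH) hd) _ gH, mulψ _ (mul_mem hd gH) _ hd, mulψ _ hd _ gH, ed] at this)
    rcases this with h | h
    · exact fin (g * d) (mul_mem hg dL) (by rw [mulψ _ gH _ hd, ed]; exact h)
    · exact fin (g * g * d) (mul_mem (mul_mem hg hg) dL) (by rw [mulψ _ (mul_mem gH gH) _ hd, mulψ _ gH _ gH, ed]; exact h)
  have conjτ : ∀ x (hx : x ∈ L), Good4 (swap 0 2 * ψ ⟨x, LH x hx⟩ * swap 0 2) := by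
    intro x hx
    have := good _ (mul_mem (mul_mem τL hx) τL)
    rwa [mulψ _ (mul_mem τH (LH x hx)) _ τH, mulψ _ τH _ (LH x hx), eτ] at this
  -- p = 6
  have bL : b ∉ L := by
    intro h
    have := conjτ b h
    rw [eb] at this
    exact dec6 this
  have hp6 : (a * b) ^ 6 = 1 := by
    rcases hp with h | h
    · exfalso; apply bL
      rw [Ldef]
      refine ⟨hb, ?_⟩
      have : a * b * a * b * (a * b * a) = b := by
        calc a * b * a * b * (a * b * a) = (a * (b * a * b)) * (a * b * a) := by simp only [mul_assoc]
          _ = b := by rw [h]; simp [mul_assoc, aa', bb', aa, bb]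
      rw [this]; exact hb
    · exact h
  -- conjugating τ
  have στ := ((Ldef _).1 τL).2
  have σL : (a * b * a) * (b * c * b) * (a * b * a) ∈ L := by
    rw [Ldef]; refine ⟨στ, ?_⟩
    have : a * b * a * (a * b * a * (b * c * b) * (a * b * a)) * (a * b * a) = b * c * b := by simp [mul_assoc, aa', bb', aa, bb]
    rw [this]; exact τH
  have hzi : ∃ u, (u = 1 ∨ u = z) ∧ (a * b * a) * (b * c * b) * (a * b * a) = b * c * b * u := by
    have h := dec5 (ψ ⟨_, στ⟩) (by
      rw [← mulψ _ στ _ στ, ← map_one ψ]; congr 1; apply Subtype.ext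
      show a * b * a * (b * c * b) * (a * b * a) * (a * b * a * (b * c * b) * (a * b * a)) = 1
      simp [mul_assoc, aa', bb', cc', aa, bb, cc]) (hip στ) (good _ σL) (conjτ _ σL)
    have zρ : ∀ x, x = 1 ∨ x = z → (a * b * a) * x * (a * b * a) = x := by
      rintro x (rfl | rfl)
      · simp [mul_assoc, aa', bb', aa, bb]
      · have zb := zH b hb
        calc a * b * a * x * (a * b * a) = a * b * (a * x * a) * b * a := by simp only [mul_assoc]
          _ = a * b * (x * b) * a := by rw [za]; simp only [mul_assoc]
          _ = a * x * a := by rw [zb]; simp only [mul_assoc, bb']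
          _ = x := za
    rcases h with h | h
    · exfalso
      have h1 := kz _ στ h
      have h2 := zρ _ h1
      have h3 : b * c * b = a * b * a * (b * c * b) * (a * b * a) := by
        rw [← h2]; simp [mul_assoc, aa', bb', aa, bb]
      rw [← h3] at h1
      have : ψ ⟨_, τH⟩ = 1 := by
        rcases h1 with h1 | h1
        · have : (⟨_, τH⟩ : H) = 1 := Subtype.ext h1
          rw [this, map_one]
        · have : (⟨_, τH⟩ : H) = ⟨z, hz⟩ := Subtype.ext h1
          rw [this, ψz]
      rw [eτ] at this
      revert this; decide
    · rcases eqz _ στ _ τH (h.trans eτ.symm) with h | h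
      · exact ⟨1, Or.inl rfl, by rw [mul_one]; exact h⟩
      · exact ⟨z, Or.inr rfl, h⟩
  have uniq : ∀ x ∈ H, x * b = b * x → x * c = c * x → x * d = d * x → x = 1 ∨ x = z := by
    intro x hx xb xc xd
    refine kz x hx (dec1 _ ?_ ?_ ?_)
    · rw [← eb]; exact comψ _ hx _ hb xb
    · rw [← ec]; exact comψ _ hx _ hc xc
    · rw [← ed]; exact comψ _ hx _ hd xd
  obtain ⟨u, hu, eu⟩ := hzi
  have wH := mul_mem (mul_mem (mul_mem (mul_mem (mul_mem hb hc) hb) hc) hb) hc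
  have w01 : b * c * b * c * b * c = 1 ∨ b * c * b * c * b * c = z := by
    refine kz _ wH ?_
    rw [mulψ _ (mul_mem (mul_mem (mul_mem (mul_mem hb hc) hb) hc) hb) _ hc, mulψ _ (mul_mem (mul_mem (mul_mem hb hc) hb) hc) _ hb,
      mulψ _ (mul_mem (mul_mem hb hc) hb) _ hc, mulψ _ (mul_mem hb hc) _ hb, mulψ _ hb _ hc, eb, ec]
    decide
  exact ⟨z, hz, z1, zz, ⟨za', zH b hb, zH c hc, zH d hd⟩, uniq, _, w01,
    beta_tail aa bb cc ac ad bd z1 zz za' (zH b hb) (zH c hc) (zH d hd) hp6 hu eu rfl w01⟩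
end Beta

open scoped Classical
set_option linter.unusedSectionVars false
set_option linter.unusedVariables false
set_option linter.unusedTactic false
set_option linter.unusedSimpArgs false

theorem mul_sq_comm {G : Type*} [Group G] {a y : G} (aa : a * a = 1) (yy : y * y = 1) (h : Commute a y) : (a * y) * (a * y) = 1 := by
  calc (a * y) * (a * y) = a * (y * a) * y := by simp only [mul_assoc]
    _ = a * (a * y) * y := by rw [h.eq]
    _ = (a * a) * (y * y) := by simp only [mul_assoc]
    _ = 1 := by rw [aa, yy, mul_one]

theorem order_two_le {G : Type*} [Group G] {y : G} (yy : y * y = 1) : orderOf y ≤ 2 :=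
  orderOf_le_of_pow_eq_one (by norm_num) (by rw [pow_two, yy])

theorem bb_group {G : Type*} [Group G] [Finite G] {r : ℕ → G} {y y' z w w' : G}
    (sq : ∀ i, r i * r i = 1) (cm : ∀ i j, 1 ≤ i → i + 1 < j → j < 6 → Commute (r i) (r j))
    (yy : y * y = 1) (yy' : y' * y' = 1) (zz : z * z = 1) (hw : w = 1 ∨ w = z) (hw' : w' = 1 ∨ w' = z)
    (yc : ∀ i, 1 ≤ i → i < 6 → Commute y (r i)) (yc' : ∀ i, 1 ≤ i → i < 6 → Commute y' (r i)) (zc : ∀ i, 1 ≤ i → i < 6 → Commute z (r i))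
    (yy1 : Commute y y') (yz : Commute y z) (yz' : Commute y' z)
    (b1 : (r 1 * y) * (r 2 * w) * (r 1 * y) = (r 2 * w) * (r 1 * y) * (r 2 * w))
    (b2 : (r 2 * w) * r 3 * (r 2 * w) = r 3 * (r 2 * w) * r 3)
    (b3 : (r 4 * w') * r 3 * (r 4 * w') = r 3 * (r 4 * w') * r 3)
    (b4 : (r 5 * y') * (r 4 * w') * (r 5 * y') = (r 4 * w') * (r 5 * y') * (r 4 * w')) :
    Nat.card (GW r 1 6) ≤ 5760 := by
  have ww : w * w = 1 := by rcases hw with rfl | rfl <;> simp [*]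
  have ww' : w' * w' = 1 := by rcases hw' with rfl | rfl <;> simp [*]
  have wc : ∀ x, Commute z x → Commute w x := by
    intro x hx; rcases hw with rfl | rfl
    · exact Commute.one_left _
    · exact hx
  have wc' : ∀ x, Commute z x → Commute w' x := by
    intro x hx; rcases hw' with rfl | rfl
    · exact Commute.one_left _
    · exact hx
  let s1 : ℕ → G := fun i => if i = 1 then r 1 * y else r i
  let s2 : ℕ → G := fun i => if i = 1 then r 1 * y else if i = 5 then r 5 * y' else r i
  let s3 : ℕ → G := fun i => if i = 1 then r 1 * y else if i = 5 then r 5 * y' else if i = 2 then r 2 * w else if i = 4 then r 4 * w' else r i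
  have zw : Commute z w := by
    rcases hw with rfl | rfl
    · exact Commute.one_right _
    · exact Commute.refl _
  have zw' : Commute z w' := by
    rcases hw' with rfl | rfl
    · exact Commute.one_right _
    · exact Commute.refl _
  have q1 : r 1 * y * (r 1 * y) = 1 := mul_sq_comm (sq 1) yy (yc 1 (by norm_num) (by norm_num)).symm
  have q5 : r 5 * y' * (r 5 * y') = 1 := mul_sq_comm (sq 5) yy' (yc' 5 (by norm_num) (by norm_num)).symm
  have q2 : r 2 * w * (r 2 * w) = 1 := mul_sq_comm (sq 2) ww (wc _ (zc 2 (by norm_num) (by norm_num))).symm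
  have q4 : r 4 * w' * (r 4 * w') = 1 := mul_sq_comm (sq 4) ww' (wc' _ (zc 4 (by norm_num) (by norm_num))).symm
  have cy : ∀ i, 1 ≤ i → i < 6 → y * s1 i = s1 i * y := by
    intro i h1 h2
    simp only [s1]; split_ifs with h
    · exact ((yc 1 (by norm_num) (by norm_num)).mul_right (Commute.refl y)).eq
    · exact (yc i h1 h2).eq
  have cy' : ∀ i, 1 ≤ i → i < 6 → y' * s2 i = s2 i * y' := by
    intro i h1 h2
    simp only [s2]; split_ifs with h
    · exact ((yc' 1 (by norm_num) (by norm_num)).mul_right yy1.symm).eq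
    · exact ((yc' 5 (by norm_num) (by norm_num)).mul_right (Commute.refl y')).eq
    · exact (yc' i h1 h2).eq
  have cz : ∀ i, 1 ≤ i → i < 6 → z * s3 i = s3 i * z := by
    intro i h1 h2
    simp only [s3]; split_ifs with h
    · exact ((zc 1 (by norm_num) (by norm_num)).mul_right yz.symm).eq
    · exact ((zc 5 (by norm_num) (by norm_num)).mul_right yz'.symm).eq
    · exact ((zc 2 (by norm_num) (by norm_num)).mul_right zw).eq
    · exact ((zc 4 (by norm_num) (by norm_num)).mul_right zw').eq
    · exact (zc i h1 h2).eq
  have t1 := card_twist (r := r) (s := s1) (a := 1) (b := 6) yy (fun i _ _ => sq i) cy (by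
    intro i h1 h2
    simp only [s1]; split_ifs with h
    · right; rw [h, mul_assoc, yy, mul_one]
    · left; rfl)
  have t2 := card_twist (r := s1) (s := s2) (a := 1) (b := 6) yy' (by
    intro i h1 h2
    simp only [s1]; split_ifs with h
    · exact q1
    · exact sq i) cy' (by
    intro i h1 h2
    simp only [s1, s2]; split_ifs with h h'
    · left; rfl
    · right; rw [h', mul_assoc, yy', mul_one]
    · left; rfl)
  have t3 := card_twist (r := s2) (s := s3) (a := 1) (b := 6) zz (by
    intro i h1 h2
    simp only [s2]; split_ifs with h
    · exact q1
    · exact q5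
    · exact sq i) cz (by
    intro i h1 h2
    simp only [s2, s3]; split_ifs with h h' h'' h'''
    · left; rfl
    · left; rfl
    · subst h''
      rcases hw with rfl | rfl
      · left; rw [mul_one]
      · right; rw [mul_assoc, zz, mul_one]
    · subst h'''
      rcases hw' with rfl | rfl
      · left; rw [mul_one]
      · right; rw [mul_assoc, zz, mul_one]
    · left; rfl)
  have e1 : s3 1 = r 1 * y := rfl
  have e2 : s3 2 = r 2 * w := rfl
  have e3 : s3 3 = r 3 := rfl
  have e4 : s3 4 = r 4 * w' := rfl
  have e5 : s3 5 = r 5 * y' := rfl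
  have ta : TA s3 1 6 := by
    refine ⟨?_, ?_, ?_⟩
    · intro i h1 h2
      simp only [s3]; split_ifs with h
      · exact q1
      · exact q5
      · exact q2
      · exact q4
      · exact sq i
    · intro i h1 h2
      obtain rfl | rfl | rfl | rfl : i = 1 ∨ i = 2 ∨ i = 3 ∨ i = 4 := by omega
      · rw [show 1 + 1 = 2 from rfl, e1, e2]; exact b1
      · rw [show 2 + 1 = 3 from rfl, e2, e3]; exact b2
      · rw [show 3 + 1 = 4 from rfl, e3, e4]; exact b3.symm
      · rw [show 4 + 1 = 5 from rfl, e4, e5]; exact b4.symm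
    · intro i j h1 h2 h3
      have Y : ∀ i, 1 ≤ i → i < 6 → Commute y (s3 i) := by
        intro i h1 h2
        simp only [s3]; split_ifs with h
        · exact (yc 1 (by norm_num) (by norm_num)).mul_right (Commute.refl y)
        · exact (yc 5 (by norm_num) (by norm_num)).mul_right yy1
        · exact (yc 2 (by norm_num) (by norm_num)).mul_right (wc _ yz.symm).symm
        · exact (yc 4 (by norm_num) (by norm_num)).mul_right (wc' _ yz.symm).symm
        · exact yc i h1 h2
      have wz : ∀ i, 1 ≤ i → i < 6 → Commute z (s3 i) := fun i h1 h2 => cz i h1 h2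
      have R : ∀ i j, 1 ≤ i → i + 1 < j → j < 6 → Commute (r i) (s3 j) := by
        intro i j h1 h2 h3
        simp only [s3]; split_ifs with h h' h'' h'''
        · omega
        · subst h'; exact (cm i 5 h1 h2 h3).mul_right (yc' i h1 (by omega)).symm
        · omega
        · subst h'''; exact (cm i 4 h1 h2 h3).mul_right (wc' _ (zc i h1 (by omega))).symm
        · exact cm i j h1 h2 h3
      obtain rfl | rfl | rfl : i = 1 ∨ i = 2 ∨ i = 3 := by omega
      · rw [e1]; exact (R 1 j h1 h2 h3).mul_left (Y j (by omega) h3)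
      · rw [e2]; exact (R 2 j h1 h2 h3).mul_left (wc _ (wz j (by omega) h3))
      · rw [e3]; exact R 3 j h1 h2 h3
  have t4 := TA.card_le ta (by norm_num)
  have o1 := order_two_le yy
  have o2 := order_two_le yy'
  have o3 := order_two_le zz
  have f : (6 - 1 + 1).factorial = 720 := by decide
  rw [f] at t4
  calc Nat.card (GW r 1 6) ≤ Nat.card (GW s1 1 6) * 2 := t1.trans (Nat.mul_le_mul_left _ o1)
    _ ≤ Nat.card (GW s2 1 6) * 2 * 2 := Nat.mul_le_mul_right _ (t2.trans (Nat.mul_le_mul_left _ o2))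
    _ ≤ Nat.card (GW s3 1 6) * 2 * 2 * 2 := Nat.mul_le_mul_right _ (Nat.mul_le_mul_right _ (t3.trans (Nat.mul_le_mul_left _ o3)))
    _ ≤ 5760 := by omega

namespace Sys
variable {Ω : Type} {S : Sys 7 Ω} [Finite Ω]

theorem beta_struct (hA : ¬ S.Flat 1 5) (h2 : S.c 0 5 = 2) (hv : S.v 1 5 = 10) (hc : S.c 1 5 = 4) (hD : S.N 2 5 = 48)
    (hp : S.v 1 3 = 4 ∨ S.v 1 3 = 6) :
    ∃ z ∈ S.W 2 5, z ≠ 1 ∧ z * z = 1 ∧ (z * S.r 1 = S.r 1 * z ∧ z * S.r 2 = S.r 2 * z ∧ z * S.r 3 = S.r 3 * z ∧ z * S.r 4 = S.r 4 * z) ∧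
      (∀ x ∈ S.W 2 5, x * S.r 2 = S.r 2 * x → x * S.r 3 = S.r 3 * x → x * S.r 4 = S.r 4 * x → x = 1 ∨ x = z) ∧
      ∃ w, (w = 1 ∨ w = z) ∧ (S.r 2 * w) * S.r 3 * (S.r 2 * w) = S.r 3 * (S.r 2 * w) * S.r 3 ∧
      ∃ y, y * y = 1 ∧ (y * S.r 1 = S.r 1 * y ∧ y * S.r 2 = S.r 2 * y ∧ y * S.r 3 = S.r 3 * y ∧ y * S.r 4 = S.r 4 * y) ∧
        (∀ x, x * S.r 1 = S.r 1 * x → x * S.r 2 = S.r 2 * x → x * z = z * x → x * y = y * x) ∧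
        (S.r 1 * y) * (S.r 2 * w) * (S.r 1 * y) = (S.r 2 * w) * (S.r 1 * y) * (S.r 2 * w) := by
  obtain ⟨ψ, e2, e3, e4, hK⟩ := four hA hc
  have hF : S.Free 1 5 := free_A (n := 7) (by norm_num)
  have hF2 : S.Free 2 5 := hF.mono (by norm_num) le_rfl
  have hF3 : S.Free 1 3 := hF.mono le_rfl (by norm_num)
  have hH : Nat.card (S.W 2 5) = 48 := by rw [card_W_eq (by norm_num) hF2, hD]
  have hb := bip7 hA h2 hc (m := 5) hv (by norm_num)
  have hL : Nat.card (CC (S.W 2 5) (S.r 1 * S.r 2 * S.r 1)) = 12 := by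
    have := card_dcs (S.W 2 5) (S.r 1 * S.r 2 * S.r 1)
    rw [hH, show (dcs (S.W 2 5) (S.r 1 * S.r 2 * S.r 1)).ncard = 4 by omega] at this
    omega
  refine beta_group (S.r_mem le_rfl (by norm_num)) (S.r_mem (by norm_num) (by norm_num)) (S.r_mem (by norm_num) (by norm_num))
    (S.r_mul_self 1) (S.r_mul_self 2) (S.r_mul_self 3) (S.r_mul_self 4) (S.r_comm (by norm_num) (by norm_num))
    (S.r_comm (by norm_num) (by norm_num)) (S.r_comm (by norm_num) (by norm_num)) ψ e2 e3 e4 hK hH hL ?_ ?_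
  · rcases hp with hp | hp
    · left; exact comm_of_four (a := 1) (by norm_num) hF3 hp
    · right
      have := orderOf_eq (a := 1) (by norm_num) hF3
      rw [show 1 + 2 = 3 from rfl, hp] at this
      rw [show 1 + 1 = 2 from rfl] at this
      rw [← this]; exact pow_orderOf_eq_one _
  · have key : ∀ w ∈ S.W 2 4, ∀ h : w ∈ S.W 2 5, ψ ⟨w, h⟩ 3 = 3 := by
      intro w hw
      refine S.W_ind (p := fun w => ∀ h : w ∈ S.W 2 5, ψ ⟨w, h⟩ 3 = 3) ?_ ?_ w hw
      · intro h
        have : (⟨1, h⟩ : S.W 2 5) = 1 := rfl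
        rw [this, map_one]; rfl
      · intro i h1 h2 w hw ih h
        have hw5 : w ∈ S.W 2 5 := S.W_le le_rfl (by norm_num) hw
        have hi : S.r i ∈ S.W 2 5 := S.r_mem h1 (by omega)
        have : (⟨S.r i * w, h⟩ : S.W 2 5) = ⟨S.r i, hi⟩ * ⟨w, hw5⟩ := rfl
        rw [this, map_mul, Equiv.Perm.mul_apply, ih hw5]
        obtain rfl | rfl : i = 2 ∨ i = 3 := by omega
        · rw [e2]; decide
        · rw [e3]; decide
    intro h
    apply key
    have m1 : S.r 1 ∈ S.W 1 4 := S.r_mem le_rfl (by norm_num)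
    have m2 : S.r 2 ∈ S.W 1 4 := S.r_mem (by norm_num) (by norm_num)
    have m3 : S.r 3 ∈ S.W 1 4 := S.r_mem (by norm_num) (by norm_num)
    have mm : S.r 1 * S.r 2 * S.r 1 * (S.r 2 * S.r 3 * S.r 2) * (S.r 1 * S.r 2 * S.r 1) ∈ S.W 1 4 :=
      mul_mem (mul_mem (mul_mem (mul_mem m1 m2) m1) (mul_mem (mul_mem m2 m3) m2)) (mul_mem (mul_mem m1 m2) m1)
    exact hF2.ip (by norm_num) (by norm_num) h mm (by norm_num) (by norm_num) (by norm_num) (by norm_num)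

theorem bb_free (hA : ¬ S.Flat 1 5) (h2 : S.c 0 5 = 2) (hv : S.v 1 5 = 10) (hc : S.c 1 5 = 4) (hD : S.N 2 5 = 48)
    (hp : S.v 1 3 = 4 ∨ S.v 1 3 = 6) (hA' : ¬ S.dual.Flat 1 5) (h2' : S.dual.c 0 5 = 2) (hv' : S.dual.v 1 5 = 10)
    (hc' : S.dual.c 1 5 = 4) (hp' : S.dual.v 1 3 = 4 ∨ S.dual.v 1 3 = 6) : S.Free 1 6 := by
  obtain ⟨z, zH, z1, zz, ⟨za, zb, zc, zd⟩, hz, w, hw, bw, y, yy, ⟨ya, yb, yc, yd⟩, hy, by1⟩ := beta_struct hA h2 hv hc hD hp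
  have hD' : S.dual.N 2 5 = 48 := by rw [← hD]; exact dual_N' (by norm_num) (by norm_num) S (by norm_num) (by norm_num)
  have := beta_struct hA' h2' hv' hc' hD' hp'
  have hW : S.dual.W 2 5 = S.W 2 5 := S.dual_W (by norm_num)
  have d1 : S.dual.r 1 = S.r 5 := S.dual_r 1 (by norm_num)
  have d2 : S.dual.r 2 = S.r 4 := S.dual_r 2 (by norm_num)
  have d3 : S.dual.r 3 = S.r 3 := S.dual_r 3 (by norm_num)
  have d4 : S.dual.r 4 = S.r 2 := S.dual_r 4 (by norm_num)
  rw [hW, d1, d2, d3, d4] at this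
  obtain ⟨z', zH', z1', zz', ⟨za', zb', zc', zd'⟩, hz', w', hw', bw', y', yy', ⟨ya', yb', yc', yd'⟩, hy', by1'⟩ := this
  have ez : z' = z := (hz z' zH' zd' zc' zb').resolve_left z1'
  subst ez
  have yr5 : S.r 5 * y = y * S.r 5 := hy (S.r 5) (S.r_comm (by norm_num) (by norm_num)).symm (S.r_comm (by norm_num) (by norm_num)).symm za'.symm
  have yr1 : S.r 1 * y' = y' * S.r 1 := hy' (S.r 1) (S.r_comm (by norm_num) (by norm_num)) (S.r_comm (by norm_num) (by norm_num)) za.symm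
  have yz : y * z' = z' * y := W_comm (S := S) (a := 2) (b := 5) (by
    intro i h1 h2
    obtain rfl | rfl | rfl : i = 2 ∨ i = 3 ∨ i = 4 := by omega
    · exact yb
    · exact yc
    · exact yd) z' zH
  have yz' : y' * z' = z' * y' := W_comm (S := S) (a := 2) (b := 5) (by
    intro i h1 h2
    obtain rfl | rfl | rfl : i = 2 ∨ i = 3 ∨ i = 4 := by omega
    · exact yd'
    · exact yc'
    · exact yb') z' zH
  have yy1 : y' * y = y * y' := hy y' yr1.symm yd' yz'
  have card := bb_group (r := S.r) S.r_mul_self (fun i j h1 h2 h3 => S.r_comm h2 (by omega)) yy yy' zz hw hw'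
    (by
      intro i h1 h2
      obtain rfl | rfl | rfl | rfl | rfl : i = 1 ∨ i = 2 ∨ i = 3 ∨ i = 4 ∨ i = 5 := by omega
      · exact ya
      · exact yb
      · exact yc
      · exact yd
      · exact yr5.symm)
    (by
      intro i h1 h2
      obtain rfl | rfl | rfl | rfl | rfl : i = 1 ∨ i = 2 ∨ i = 3 ∨ i = 4 ∨ i = 5 := by omega
      · exact yr1.symm
      · exact yd'
      · exact yc'
      · exact yb'
      · exact ya')
    (by
      intro i h1 h2
      obtain rfl | rfl | rfl | rfl | rfl : i = 1 ∨ i = 2 ∨ i = 3 ∨ i = 4 ∨ i = 5 := by omega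
      · exact za
      · exact zb
      · exact zc
      · exact zd
      · exact za') yy1.symm yz yz' by1 bw bw' by1'
  have card' : Nat.card (S.W 1 6) ≤ 5760 := card
  have hN : S.v 1 5 * (S.dual.v 1 6 * S.N 2 5) = S.N 1 6 := N_M2 (n := 7) (by norm_num) S
  have hm : S.dual.v 1 5 ≤ S.dual.v 1 6 := v67
  apply free_of_card (by norm_num)
  rw [← hN, hv, hD]; omega
end Sys

open scoped Classical
set_option linter.unusedSectionVars false
set_option linter.unusedVariables false
set_option linter.unusedTactic false
set_option linter.unusedSimpArgs false

/-- Arithmetic constraints attached to one side of a rank 7 system. -/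
structure SideArith (c s p vE vA cE cA q t vD fD fA fE D : ℕ) : Prop where
  p3 : 3 ≤ p
  pE : p < vE
  EA : vE < vA
  cE3 : 3 ≤ cE
  cEA : cE < cA
  cAv : cA + 1 ≤ vA
  cEv : cE + 1 ≤ vE
  cEq : cE ∣ q
  cAD : cA ∣ vD
  Dt : D = 2 * (t * vD)
  Dq : D = 2 * (q * fD)
  fAE : vA * fD = fA * vE
  fEp : vE * q = fE * p
  two : c = 2 → 2 ∣ p ∧ 2 ∣ vE ∧ cA ≤ s
  cs : c * s = vA
  c2 : 2 ≤ c
  s1 : 1 ≤ s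
  c6 : 6 ≤ c + s

theorem mul_eq_24 {q f : ℕ} (h3 : 3 ∣ q) (hf : 4 ≤ f) (h : q * f = 24) : (q = 3 ∧ f = 8) ∨ (q = 6 ∧ f = 4) := by
  obtain ⟨u, rfl⟩ := h3
  have : u * f = 8 := by nlinarith
  have hu : u ≤ 2 := by by_contra hc; nlinarith
  interval_cases u <;> omega

theorem alpha_ar {c s p vE vA cE cA q t vD fD fA fE D : ℕ} (h : SideArith c s p vE vA cE cA q t vD fD fA fE D)
    (hc : c = 2) (hs : s = 4) : 6 ∣ q ∧ 3 ∣ fD ∧ 72 ∣ D := by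
  obtain ⟨p3, pE, EA, cE3, cEA, cAv, cEv, cEq, cAD, Dt, Dq, fAE, fEp, two, cs, -, -, -⟩ := h
  obtain ⟨e1, e2, e3⟩ := two hc
  subst hc hs
  have hvA : vA = 8 := by omega
  subst hvA
  have hp : p = 4 := by omega
  have hE : vE = 6 := by omega
  have hcA : cA = 4 := by omega
  have hcE : cE = 3 := by omega
  subst hp hE hcA hcE
  have h3f : 3 ∣ fD := by omega
  have h6 : 6 ∣ q := by omega
  refine ⟨h6, h3f, ?_⟩
  obtain ⟨a, rfl⟩ := h6
  obtain ⟨b, rfl⟩ := h3f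
  obtain ⟨d, rfl⟩ := cAD
  have e : D = 36 * (a * b) := by rw [Dq]; ring
  have e' : D = 8 * (t * d) := by rw [Dt]; ring
  omega

theorem beta_ar {c s p vE vA cE cA q t vD fD fA fE D : ℕ} (h : SideArith c s p vE vA cE cA q t vD fD fA fE D)
    (hc : c = 2) (hs : s = 5) (hf : 4 ≤ fD) (h48 : 48 ≤ D) (h72 : D < 72) :
    D = 48 ∧ cA = 4 ∧ (p = 4 ∨ p = 6) ∧ (fA = 5 ∨ fA = 10) ∧ (fD = 4 ∨ fD = 8) := by
  obtain ⟨p3, pE, EA, cE3, cEA, cAv, cEv, cEq, cAD, Dt, Dq, fAE, fEp, two, cs, -, -, -⟩ := h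
  obtain ⟨e1, e2, e3⟩ := two hc
  subst hc hs
  have hvA : vA = 10 := by omega
  subst hvA
  have hE : vE = 6 ∨ vE = 8 := by omega
  have hp : p = 4 ∨ p = 6 := by omega
  obtain hcA | hcA : cA = 4 ∨ cA = 5 := by omega
  · have hcE : cE = 3 := by omega
    subst hcA hcE
    have h24 : q * fD = 24 := by
      obtain ⟨a, rfl⟩ := cEq
      obtain ⟨d, rfl⟩ := cAD
      have e : D = 6 * (a * fD) := by rw [Dq]; ring
      have e' : D = 8 * (t * d) := by rw [Dt]; ring
      omega
    have := mul_eq_24 cEq hf h24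
    refine ⟨by omega, rfl, hp, ?_, by omega⟩
    rcases hE with rfl | rfl <;> omega
  · exfalso
    subst hcA
    have h5 : 5 ∣ q * fD := by
      obtain ⟨d, rfl⟩ := cAD
      have e' : D = 10 * (t * d) := by rw [Dt]; ring
      omega
    have hq : 3 ∣ q ∨ 4 ∣ q := by
      obtain h | h : cE = 3 ∨ cE = 4 := by omega
      · left; rwa [h] at cEq
      · right; rwa [h] at cEq
    have hfq : q * fD = 30 ∧ 3 ∣ q := by
      rcases hq with ⟨a, rfl⟩ | ⟨a, rfl⟩
      · have e : D = 6 * (a * fD) := by rw [Dq]; ring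
        have e' : 3 * a * fD = 3 * (a * fD) := by ring
        rw [e'] at h5 ⊢
        exact ⟨by omega, by omega⟩
      · have e : D = 8 * (a * fD) := by rw [Dq]; ring
        have e' : 4 * a * fD = 4 * (a * fD) := by ring
        rw [e'] at h5
        omega
    obtain ⟨h30, a, rfl⟩ := hfq
    have : a * fD = 10 := by nlinarith
    have ha : a ≤ 2 := by by_contra hc; nlinarith
    interval_cases a <;> rcases hE with rfl | rfl <;> omega

theorem gamma_ar {c s p vE vA cE cA q t vD fD fA fE D : ℕ} (h : SideArith c s p vE vA cE cA q t vD fD fA fE D)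
    (hc : c = 5) (hs : s = 1) (hf : 4 ≤ fD) (h48 : 48 ≤ D) (h72 : D < 72) :
    D = 48 ∧ cA = 4 ∧ (fA = 5 ∨ fA = 10) ∧ (fD = 4 ∨ fD = 8) := by
  obtain ⟨p3, pE, EA, cE3, cEA, cAv, cEv, cEq, cAD, Dt, Dq, fAE, fEp, two, cs, -, -, -⟩ := h
  subst hc hs
  have hvA : vA = 5 := by omega
  have hE : vE = 4 := by omega
  have hcA : cA = 4 := by omega
  have hcE : cE = 3 := by omega
  subst hvA hE hcA hcE
  have h24 : q * fD = 24 := by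
    have h4 : 4 ∣ fD := by omega
    obtain ⟨a, rfl⟩ := cEq
    obtain ⟨d, rfl⟩ := h4
    have e : D = 24 * (a * d) := by rw [Dq]; ring
    omega
  have := mul_eq_24 cEq hf h24
  refine ⟨by omega, rfl, by omega, by omega⟩

theorem side_class {c s X : ℕ} (c2 : 2 ≤ c) (s1 : 1 ≤ s) (c6 : 6 ≤ c + s) (hX : c + 1 ≤ X) :
    24 ≤ X * (c * s) ∧ (¬ (c = 2 ∧ s = 4) → 30 ≤ X * (c * s)) ∧
    (¬ (c = 2 ∧ s = 4) → X * (c * s) < 36 → (c = 5 ∧ s = 1) ∨ (c = 2 ∧ s = 5)) ∧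
    (¬ (c = 2 ∧ s = 4) → X * (c * s) < 40 → (c = 5 ∧ s = 1) ∨ (c = 2 ∧ s = 5) ∨ (c = 3 ∧ s = 3) ∨ (c = 2 ∧ s = 6)) := by
  have h0 : (c + 1) * (c * s) ≤ X * (c * s) := Nat.mul_le_mul_right _ hX
  obtain h | h : 6 ≤ c ∨ c < 6 := by omega
  · have h1 : 7 * (6 * 1) ≤ (c + 1) * (c * s) := Nat.mul_le_mul (by omega) (Nat.mul_le_mul h s1)
    refine ⟨by omega, by omega, by omega, by omega⟩
  · interval_cases c <;> refine ⟨by omega, by omega, by omega, by omega⟩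

theorem alpha_other {c s X cA vA : ℕ} (c2 : 2 ≤ c) (s1 : 1 ≤ s) (hX : c + 1 ≤ X) (two : c = 2 → cA ≤ s) (h6 : 6 ≤ cA) (h7 : 7 ≤ c * s) : 36 ≤ X * (c * s) := by
  have h0 : (c + 1) * (c * s) ≤ X * (c * s) := Nat.mul_le_mul_right _ hX
  obtain h | h : 5 ≤ c ∨ c < 5 := by omega
  · have h1 : 6 * 7 ≤ (c + 1) * (c * s) := Nat.mul_le_mul (by omega) h7
    omega
  · interval_cases c <;> omega

namespace Sys
variable {Ω : Type} {S : Sys 7 Ω} [Finite Ω]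

theorem side_arith (hA : ¬ S.Flat 1 5) : SideArith (S.c 0 5) (S.s 0 5) (S.v 1 3) (S.v 1 4) (S.v 1 5) (S.c 1 4) (S.c 1 5) (S.v 2 4) (S.v 3 5)
    (S.v 2 5) (S.dual.v 2 5) (S.dual.v 2 6) (S.dual.v 3 6) (S.N 2 5) := by
  have hQ : S.Q3 0 := Q3_zero (by norm_num) S
  have hQ1 : S.Q3 1 := Q3_nonflat hA (by norm_num) (by norm_num)
  have hE : ¬ S.Flat 1 4 := nonflat_sub hA le_rfl (by norm_num) (by norm_num) (by norm_num)
  have hP : ¬ S.Flat 1 3 := nonflat_sub hA le_rfl (by norm_num) (by norm_num) (by norm_num)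
  obtain ⟨c, s, rfl, rfl, c2, s1, c6, cs, -, -⟩ := cd7 hA
  have n24 : S.N 2 4 = 2 * S.v 2 4 := N_two (a := 2) (by norm_num)
  have n35 : S.N 3 5 = 2 * S.v 3 5 := N_two (a := 3) (by norm_num)
  have n13 : S.N 1 3 = 2 * S.v 1 3 := N_two (a := 1) (by norm_num)
  have n25 : S.v 2 5 * S.N 3 5 = S.N 2 5 := v_mul (by norm_num) (by norm_num)
  have n15 : S.v 1 5 * S.N 2 5 = S.N 1 5 := v_mul (by norm_num) (by norm_num)
  have n14 : S.v 1 4 * S.N 2 4 = S.N 1 4 := v_mul (by norm_num) (by norm_num)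
  have m25 : S.dual.v 2 5 * S.dual.N 3 5 = S.dual.N 2 5 := v_mul (by norm_num) (by norm_num)
  have m26 : S.dual.v 2 6 * S.dual.N 3 6 = S.dual.N 2 6 := v_mul (by norm_num) (by norm_num)
  have m36 : S.dual.v 3 6 * S.dual.N 4 6 = S.dual.N 3 6 := v_mul (by norm_num) (by norm_num)
  rw [dual_N' (by norm_num) (by norm_num) S (c := 2) (d := 4) (by norm_num) (by norm_num), dual_N' (by norm_num) (by norm_num) S (c := 2) (d := 5) (by norm_num) (by norm_num)] at m25
  rw [dual_N' (by norm_num) (by norm_num) S (c := 1) (d := 4) (by norm_num) (by norm_num), dual_N' (by norm_num) (by norm_num) S (c := 1) (d := 5) (by norm_num) (by norm_num)] at m26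
  rw [dual_N' (by norm_num) (by norm_num) S (c := 1) (d := 3) (by norm_num) (by norm_num), dual_N' (by norm_num) (by norm_num) S (c := 1) (d := 4) (by norm_num) (by norm_num)] at m36
  have p24 : 0 < S.N 2 4 := N_pos S 2 4
  refine ⟨v_three (a := 1) (by norm_num) hP, v_lt (a := 1) (b := 4) (by norm_num) (by norm_num) hE, v_lt (a := 1) (b := 5) (by norm_num) (by norm_num) hA, c_ge (a := 1) (b := 4) hE (by norm_num) (by norm_num),
    c_lt (a := 1) (b := 5) hA (by norm_num) (by norm_num), c_lt_v hQ1 (by norm_num) (by norm_num), c_lt_v hQ1 (by norm_num) (by norm_num),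
    ⟨_, (c_mul_s hQ1 (by norm_num) (by norm_num)).symm⟩, ⟨_, (c_mul_s hQ1 (by norm_num) (by norm_num)).symm⟩, ?_, ?_, ?_, ?_, ?_, cs, c2, s1, c6⟩
  · rw [← n25, n35]; ring
  · rw [← m25, n24]; ring
  · apply Nat.eq_of_mul_eq_mul_right p24
    calc S.v 1 5 * S.dual.v 2 5 * S.N 2 4 = S.N 1 5 := by rw [← n15, ← m25]; ring
      _ = _ := by rw [← m26, ← n14]; ring
  · have : 2 * (S.v 1 4 * S.v 2 4) = 2 * (S.dual.v 3 6 * S.v 1 3) := by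
      calc 2 * (S.v 1 4 * S.v 2 4) = S.N 1 4 := by rw [← n14, n24]; ring
        _ = _ := by rw [← m36, n13]; ring
    omega
  · intro h2
    have h02 : S.c 0 2 = 2 := c_two hQ (by norm_num)
    have h03 := c_mono hQ (by norm_num : 0 + 2 ≤ 2) (by norm_num) (by norm_num : 2 ≤ 3) (by norm_num)
    have h04 := c_mono hQ (by norm_num : 0 + 2 ≤ 3) (by norm_num) (by norm_num : 3 ≤ 4) (by norm_num)
    have h05 := c_mono hQ (by norm_num : 0 + 2 ≤ 4) (by norm_num) (by norm_num : 4 ≤ 5) (by norm_num)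
    have e3 : S.c 0 3 * S.s 0 3 = S.v 1 3 := c_mul_s hQ (by norm_num) (by norm_num)
    have e4 : S.c 0 4 * S.s 0 4 = S.v 1 4 := c_mul_s hQ (by norm_num) (by norm_num)
    rw [show S.c 0 3 = 2 by omega] at e3
    rw [show S.c 0 4 = 2 by omega] at e4
    exact ⟨⟨_, e3.symm⟩, ⟨_, e4.symm⟩, bip_deg hQ hQ1 (by norm_num) (by norm_num) h2⟩

/-- Common setup for both sides. -/
structure Both (S : Sys 7 Ω) : Prop where
  M : ¬ S.Free 1 6
  A : ¬ S.Flat 1 5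
  A' : ¬ S.dual.Flat 1 5
  D : 48 ≤ S.N 2 5

theorem Both.dual (h : S.Both) : S.dual.Both := by
  have hM : ¬ S.dual.Free 1 6 := by rw [show S.dual.Free 1 6 ↔ S.Free 1 6 from dual_free_M (n := 7) (by norm_num)]; exact h.M
  refine ⟨hM, h.A', dual_A (n := 7) (by norm_num) hM, ?_⟩
  rw [dual_N' (by norm_num) (by norm_num) S (c := 2) (d := 5) (by norm_num) (by norm_num)]
  exact h.D

theorem N_dual07 : S.dual.N 0 7 = S.N 0 7 := dual_N' (by norm_num) (by norm_num) S (by norm_num) (by norm_num)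
theorem N_dual25 : S.dual.N 2 5 = S.N 2 5 := dual_N' (by norm_num) (by norm_num) S (by norm_num) (by norm_num)

/-- the lower bounds for the total number of flags. -/
theorem tot1 (S : Sys 7 Ω) : (S.v 0 6 * S.v 1 6) * (S.dual.v 0 6 * S.dual.v 1 5) * S.N 2 5 ≤ S.N 0 7 := by
  have h1 : S.v 0 6 * S.dual.v 0 6 * S.N 1 6 ≤ S.N 0 7 := total_ge (n := 7) (by norm_num) S
  have h2 : S.v 1 6 * (S.dual.v 1 5 * S.N 2 5) = S.N 1 6 := N_M1 (n := 7) (by norm_num) S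
  refine le_trans (le_of_eq ?_) h1
  rw [← h2]; ring

theorem tot2 (S : Sys 7 Ω) : (S.v 0 6 * S.v 1 5) * (S.dual.v 0 6 * S.dual.v 1 5) * S.N 2 5 ≤ S.N 0 7 :=
  (Nat.mul_le_mul_right _ (Nat.mul_le_mul_right _ (Nat.mul_le_mul_left _ v67))).trans (tot1 S)

theorem tot3 (S : Sys 7 Ω) : (S.v 0 6 * S.v 1 5) * (S.dual.v 0 6 * S.dual.v 1 6) * S.N 2 5 ≤ S.N 0 7 := by
  have h := tot1 S.dual
  rw [N_dual07, N_dual25, dd_v (by norm_num) (by norm_num), dd_v (by norm_num) (by norm_num)] at h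
  exact le_trans (le_of_eq (by ring)) h

theorem fD_ge (h : S.Both) : 4 ≤ S.dual.v 2 5 := by
  have h1 := side_arith h.A'
  have h3 := h1.cE3
  have h4 := h1.cEA
  have h5 := h1.cAD
  have h6 := h1.Dt
  have h7 := h.dual.D
  have : 0 < S.dual.v 2 5 := by
    rcases Nat.eq_zero_or_pos (S.dual.v 2 5) with h0 | h0
    · rw [h0, mul_zero, mul_zero] at h6; omega
    · exact h0
  have := Nat.le_of_dvd this h5
  omega

theorem class7 (h : S.Both) : 24 ≤ S.v 0 6 * S.v 1 5 ∧ (¬ (S.c 0 5 = 2 ∧ S.s 0 5 = 4) → 30 ≤ S.v 0 6 * S.v 1 5) ∧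
    (¬ (S.c 0 5 = 2 ∧ S.s 0 5 = 4) → S.v 0 6 * S.v 1 5 < 36 → (S.c 0 5 = 5 ∧ S.s 0 5 = 1) ∨ (S.c 0 5 = 2 ∧ S.s 0 5 = 5)) ∧
    (¬ (S.c 0 5 = 2 ∧ S.s 0 5 = 4) → S.v 0 6 * S.v 1 5 < 40 → (S.c 0 5 = 5 ∧ S.s 0 5 = 1) ∨ (S.c 0 5 = 2 ∧ S.s 0 5 = 5) ∨ (S.c 0 5 = 3 ∧ S.s 0 5 = 3) ∨ (S.c 0 5 = 2 ∧ S.s 0 5 = 6)) := by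
  obtain ⟨c, s, rfl, rfl, c2, s1, c6, cs, hX, -⟩ := cd7 h.A
  rw [← cs]
  exact side_class c2 s1 c6 hX

theorem final_mul {a b c k l m N : ℕ} (h : a * b * c ≤ N) (ha : k ≤ a) (hb : l ≤ b) (hc : m ≤ c) (hh : 55296 ≤ k * l * m) : 55296 ≤ N :=
  hh.trans ((Nat.mul_le_mul (Nat.mul_le_mul ha hb) hc).trans h)

theorem alpha7 (h : S.Both) (hc : S.c 0 5 = 2) (hs : S.s 0 5 = 4) : 55296 ≤ S.N 0 7 := by
  obtain ⟨h6, h3, h72⟩ := alpha_ar (side_arith h.A) hc hs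
  have hD := h.D
  obtain ⟨a24, -⟩ := class7 h
  obtain ⟨b24, -⟩ := class7 h.dual
  obtain hD | hD : S.N 2 5 = 72 ∨ 144 ≤ S.N 2 5 := by omega
  · refine final_mul (tot2 S) a24 (?_ : 36 ≤ _) hD.ge (by norm_num)
    have hf := fD_ge h
    have hq := (side_arith h.A).Dq
    have f6 : S.dual.v 2 5 = 6 := by
      obtain ⟨u, hu⟩ := h6
      obtain ⟨w, hw⟩ := h3
      rw [hu, hw] at hq
      have : u * w = 2 := by nlinarith
      have hw2 : w ≤ 2 := Nat.le_of_dvd (by norm_num) ⟨u, by rw [← this]; ring⟩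
      omega
    have B := side_arith h.A'
    have h1 := B.cE3
    have h2 := B.cEA
    have h5 := B.cAD
    rw [f6] at h5
    have h7 := B.cAv
    have hle := Nat.le_of_dvd (by norm_num) h5
    have hc6 : S.dual.c 1 5 = 6 := by
      obtain h | h | h : S.dual.c 1 5 = 4 ∨ S.dual.c 1 5 = 5 ∨ S.dual.c 1 5 = 6 := by omega
      · rw [h] at h5; omega
      · rw [h] at h5; omega
      · exact h
    obtain ⟨c, s, rfl, rfl, c2, s1, c6, cs, hX, -⟩ := cd7 h.A'
    rw [← cs]
    exact alpha_other (vA := 0) c2 s1 hX (fun h => (B.two h).2.2) hc6.ge (by omega)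
  · exact final_mul (tot2 S) a24 b24 hD (by norm_num)

theorem nf_gamma (h : S.Both) (hF : ¬ S.Flat 1 6) (hc : S.c 0 5 = 5) (hs : S.s 0 5 = 1) : 42 ≤ S.v 0 6 * S.v 1 6 := by
  have hQ : S.Q3 0 := Q3_zero (by norm_num) S
  obtain ⟨c, s, hc', hs', c2, s1, c6, cs, hX, hc6⟩ := cd7 h.A
  have h1 : S.v 1 5 < S.v 1 6 := v_lt (a := 1) (b := 6) (by norm_num) (by norm_num) hF
  have h2 : S.c 0 6 * S.s 0 6 = S.v 1 6 := c_mul_s hQ (by norm_num) (by norm_num)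
  have h3 : S.c 0 6 + 1 ≤ S.v 0 6 := c_lt_v hQ (by norm_num) (by norm_num)
  rw [hc', hs', hc, hs] at cs
  obtain h | h : S.v 1 6 = 6 ∨ 7 ≤ S.v 1 6 := by omega
  · have h7 : 7 ≤ S.v 0 6 := by
      rw [h] at h2
      by_contra hcon
      have : S.c 0 6 = 5 := by omega
      rw [this] at h2; omega
    rw [h]; omega
  · exact (by norm_num : 42 ≤ 6 * 7).trans (Nat.mul_le_mul (by omega) h)

theorem nf_beta (h : S.Both) (hF : ¬ S.Flat 1 6) (hc : S.c 0 5 = 2) (hs : S.s 0 5 = 5) : 36 ≤ S.v 0 6 * S.v 1 6 := by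
  have hQ : S.Q3 0 := Q3_zero (by norm_num) S
  obtain ⟨c, s, hc', hs', c2, s1, c6, cs, hX, hc6⟩ := cd7 h.A
  have h1 : S.v 1 5 < S.v 1 6 := v_lt (a := 1) (b := 6) (by norm_num) (by norm_num) hF
  have h2 : S.c 0 6 * S.s 0 6 = S.v 1 6 := c_mul_s hQ (by norm_num) (by norm_num)
  have h3 : S.c 0 6 + 1 ≤ S.v 0 6 := c_lt_v hQ (by norm_num) (by norm_num)
  rw [hc', hs', hc, hs] at cs
  obtain h | h : S.v 1 6 = 11 ∨ 12 ≤ S.v 1 6 := by omega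
  · have h7 : 4 ≤ S.v 0 6 := by
      rw [h] at h2
      by_contra hcon
      have : S.c 0 6 = 2 := by omega
      rw [this] at h2; omega
    rw [h]; omega
  · exact (by norm_num : 36 ≤ 3 * 12).trans (Nat.mul_le_mul (by omega) h)

theorem sx_contra (h : S.Both) (hD : S.N 2 5 = 48) (hf : S.v 2 5 = 4 ∨ S.v 2 5 = 8) (hc : S.c 0 5 = 2) (hs : S.s 0 5 = 6) : False := by
  have B := side_arith h.A
  have h1 := B.cE3
  have h2 := B.cEA
  have h3 := (B.two hc).2.2
  have h5 := B.cAD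
  have hcA : S.c 1 5 = 4 := by
    obtain h | h | h : S.c 1 5 = 4 ∨ S.c 1 5 = 5 ∨ S.c 1 5 = 6 := by omega
    · exact h
    · rw [h] at h5; omega
    · rw [h] at h5; omega
  have cs := B.cs
  rw [hc, hs] at cs
  have hb := bip7 h.A hc hcA cs.symm (by norm_num)
  have hcard := card_dcs (S.W 2 5) (S.r 1 * S.r 2 * S.r 1)
  have hF2 : S.Free 2 5 := Free.mono (free_A (n := 7) (by norm_num) : S.Free 1 5) (by norm_num) le_rfl
  rw [card_W_eq (by norm_num) hF2, hD, show (dcs (S.W 2 5) (S.r 1 * S.r 2 * S.r 1)).ncard = 5 by omega] at hcard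
  omega

/-- in the flat case a side restricts the other one. -/
theorem flat_c (h : S.Both) (hF : S.Flat 1 6) (hv : S.v 2 6 = 5 ∨ S.v 2 6 = 10) : 6 ≤ S.v 1 5 ∧ S.v 1 5 ≠ 9 := by
  have hQ1 : S.Q3 1 := Q3_nonflat h.A (by norm_num) (by norm_num)
  have B := side_arith h.A
  have h1 := B.cE3
  have h2 := B.cEA
  have e : S.v 1 6 = S.v 1 5 := v_of_flat (by norm_num) (by norm_num) hF
  have h3 := c_mono hQ1 (by norm_num : 1 + 2 ≤ 5) (by norm_num) (by norm_num : 5 ≤ 6) (by norm_num)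
  have h4 : S.c 1 6 * S.s 1 6 = S.v 2 6 := c_mul_s hQ1 (by norm_num) (by norm_num)
  have h5 : S.c 1 6 + 1 ≤ S.v 1 6 := c_lt_v hQ1 (by norm_num) (by norm_num)
  have h6 : 2 ∣ S.v 1 6 * S.c 1 6 := handshake hQ1 (by norm_num) (by norm_num)
  have hd : S.c 1 6 ∣ 10 := by
    have : S.c 1 6 ∣ S.v 2 6 := ⟨_, h4.symm⟩
    rcases hv with hv | hv <;> rw [hv] at this
    · exact this.trans (by norm_num)
    · exact this
  have hle := Nat.le_of_dvd (by norm_num) hd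
  have h510 : S.c 1 6 = 5 ∨ S.c 1 6 = 10 := by
    obtain ⟨k, hk⟩ : ∃ k, k = S.c 1 6 := ⟨_, rfl⟩
    rw [← hk] at hd hle h3 ⊢
    have : 4 ≤ k := by omega
    interval_cases k <;> omega
  refine ⟨by omega, ?_⟩
  intro h9
  rw [e, h9] at h6 h5
  have : S.c 1 6 = 5 := by omega
  rw [this] at h6
  omega

theorem bg7 (h : S.Both) (h72 : S.N 2 5 < 72) (hS : (S.c 0 5 = 5 ∧ S.s 0 5 = 1) ∨ (S.c 0 5 = 2 ∧ S.s 0 5 = 5))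
    (hna : ¬ (S.dual.c 0 5 = 2 ∧ S.dual.s 0 5 = 4)) : 55296 ≤ S.N 0 7 := by
  have hna0 : ¬ (S.c 0 5 = 2 ∧ S.s 0 5 = 4) := by omega
  obtain ⟨-, a30, -⟩ := class7 h
  have a30 := a30 hna0
  obtain ⟨-, b30, b36, b40⟩ := class7 h.dual
  have b30 := b30 hna
  have b36 := b36 hna
  have b40 := b40 hna
  have hdd : S.dual.dual.v 2 6 = S.v 2 6 := dd_v (by norm_num) (by norm_num)
  have h72' : S.dual.N 2 5 < 72 := by rw [N_dual25]; exact h72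
  have data : S.N 2 5 = 48 ∧ (S.dual.v 2 6 = 5 ∨ S.dual.v 2 6 = 10) ∧ (S.dual.v 2 5 = 4 ∨ S.dual.v 2 5 = 8) := by
    rcases hS with ⟨h1, h2⟩ | ⟨h1, h2⟩
    · obtain ⟨x1, x2, x3, x4⟩ := gamma_ar (side_arith h.A) h1 h2 (fD_ge h) h.D h72
      exact ⟨x1, x3, x4⟩
    · obtain ⟨x1, x2, x3, x4, x5⟩ := beta_ar (side_arith h.A) h1 h2 (fD_ge h) h.D h72
      exact ⟨x1, x4, x5⟩
  obtain ⟨hD, hfA, hfD⟩ := data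
  have bb : (S.c 0 5 = 2 ∧ S.s 0 5 = 5) → ¬ (S.dual.c 0 5 = 2 ∧ S.dual.s 0 5 = 5) := by
    rintro ⟨h1, h2⟩ ⟨h3, h4⟩
    obtain ⟨x1, x2, x3, x4, x5⟩ := beta_ar (side_arith h.A) h1 h2 (fD_ge h) h.D h72
    obtain ⟨y1, y2, y3, y4, y5⟩ := beta_ar (side_arith h.A') h3 h4 (fD_ge h.dual) h.dual.D h72'
    have e1 := (side_arith h.A).cs
    have e2 := (side_arith h.A').cs
    rw [h1, h2] at e1
    rw [h3, h4] at e2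
    exact h.M (bb_free h.A h1 e1.symm x2 hD x3 h.A' h3 e2.symm y2 y3)
  by_cases h40 : 40 ≤ S.dual.v 0 6 * S.dual.v 1 5
  · exact final_mul (tot2 S) a30 h40 hD.ge (by norm_num)
  have hcl := b40 (by omega)
  have hfl : S.dual.Flat 1 6 ↔ S.Flat 1 6 := dual_flat (by norm_num) (by norm_num)
  by_cases hF : S.Flat 1 6
  · exfalso
    have hF' := hfl.2 hF
    obtain ⟨g6, g9⟩ := flat_c h.dual hF' hfA
    have e2 := (side_arith h.A').cs
    rcases hcl with ⟨h1, h2⟩ | ⟨h1, h2⟩ | ⟨h1, h2⟩ | ⟨h1, h2⟩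
    · rw [h1, h2] at e2; omega
    · rcases hS with hS | hS
      · obtain ⟨y1, y2, y3, y4, y5⟩ := beta_ar (side_arith h.A') h1 h2 (fD_ge h.dual) h.dual.D h72'
        rw [hdd] at y4
        obtain ⟨k6, -⟩ := flat_c h hF y4
        have e1 := (side_arith h.A).cs
        rw [hS.1, hS.2] at e1
        omega
      · exact bb hS ⟨h1, h2⟩
    · rw [h1, h2] at e2; omega
    · exact sx_contra h.dual (by rw [N_dual25]; exact hD) hfD h1 h2
  · have hF' : ¬ S.dual.Flat 1 6 := by rwa [hfl]
    rcases hS with hS | hS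
    · exact final_mul (tot1 S) (nf_gamma h hF hS.1 hS.2) b30 hD.ge (by norm_num)
    · have x36 := nf_beta h hF hS.1 hS.2
      by_cases y36 : 36 ≤ S.dual.v 0 6 * S.dual.v 1 5
      · exact final_mul (tot1 S) x36 y36 hD.ge (by norm_num)
      · rcases b36 (by omega) with hg | hb
        · exact final_mul (tot3 S) a30 (nf_gamma h.dual hF' hg.1 hg.2) hD.ge (by norm_num)
        · exact absurd hb (bb hS)

theorem both7 (h : S.Both) : 55296 ≤ S.N 0 7 := by
  by_cases ha : S.c 0 5 = 2 ∧ S.s 0 5 = 4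
  · exact alpha7 h ha.1 ha.2
  by_cases hb : S.dual.c 0 5 = 2 ∧ S.dual.s 0 5 = 4
  · rw [← N_dual07]; exact alpha7 h.dual hb.1 hb.2
  obtain ⟨-, a30, a36, -⟩ := class7 h
  obtain ⟨-, b30, b36, -⟩ := class7 h.dual
  by_cases h72 : 72 ≤ S.N 2 5
  · exact final_mul (tot2 S) (a30 ha) (b30 hb) h72 (by norm_num)
  by_cases x36 : S.v 0 6 * S.v 1 5 < 36
  · exact bg7 h (by omega) (a36 ha x36) hb
  by_cases y36 : S.dual.v 0 6 * S.dual.v 1 5 < 36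
  · have hbg := b36 hb y36
    by_cases x40 : 40 ≤ S.v 0 6 * S.v 1 5
    · exact final_mul (tot2 S) x40 (b30 hb) h.D (by norm_num)
    · by_cases hc : S.dual.dual.c 0 5 = 2 ∧ S.dual.dual.s 0 5 = 4
      · rw [← N_dual07, ← N_dual07]; exact alpha7 h.dual.dual hc.1 hc.2
      · rw [← N_dual07]; exact bg7 h.dual (by rw [N_dual25]; omega) hbg hc
  · exact final_mul (tot2 S) (not_lt.1 x36) (not_lt.1 y36) h.D (by norm_num)
end Sys

open scoped Classical

namespace Sys
theorem N_total {n : ℕ} {Ω : Type} [Finite Ω] (S : Sys n Ω) : S.N 0 n = Nat.card Ω := by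
  unfold N
  rw [← Set.ncard_univ]
  congr 1
  rw [Set.eq_univ_iff_forall]
  intro Ψ
  exact S.conn 0 n S.nonempty.some Ψ (Nat.zero_le _) le_rfl (fun j hj h => by omega)

theorem main_7 {Ω : Type} [Finite Ω] (S : Sys 7 Ω) : 55296 ≤ S.N 0 7 := by
  by_cases hM : S.Free 1 6
  · exact freeM_7 hM
  by_cases h3 : S.All3 2 5
  · exact tetra hM h3
  have hA : ¬ S.Flat 1 5 := nonflat_A (n := 7) (by norm_num) hM
  have hF : S.Free 2 5 := Free.mono (free_A (n := 7) (by norm_num) : S.Free 1 5) (by norm_num) le_rfl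
  have hD : ¬ S.Flat 2 5 := nonflat_sub hA (by norm_num) (by norm_num) le_rfl (by norm_num)
  have h48 : 48 ≤ S.N 2 5 := by
    rcases rank3 (a := 2) (by norm_num) hD hF with h | ⟨h1, h2⟩
    · exact h
    · exfalso
      apply h3
      intro j hj1 hj2
      obtain rfl | rfl : j = 2 ∨ j = 3 := by omega
      · exact h1
      · exact h2
  exact both7 ⟨hM, hA, dual_A (n := 7) (by norm_num) hM, h48⟩

theorem main_8 {n : ℕ} {Ω : Type} [Finite Ω] (hn : 8 ≤ n) (S : Sys n Ω) : 48 * (n-2) * (n-2).factorial ≤ S.N 0 n := by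
  by_cases hM : S.Free 1 (n-1)
  · exact freeM_8 hn hM
  · exact notfree_8 hn hM
end Sys

/-- Let `P` be a finite chiral `n`-polytope whose facets and
vertex-figures are all chiral. If `n = 7`, then `P` has at least `55296` flags; if
`n ≥ 8`, then `P` has at least `48 * (n-2) * (n-2)!` flags. -/
theorem smallest_chiral_chiral_facets_chiral_vertex_figures
    (n : ℕ) (P : AbstractPolytope n) (hfin : Finite P.Face)
    (hchiral : P.IsChiral)
    (hfacets : ∀ (F : P.Face) (Q : AbstractPolytope (n - 1)),
      P.IsFacet F → P.IsSection Q P.bot F → Q.IsChiral)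
    (hvfs : ∀ (v : P.Face) (Q : AbstractPolytope (n - 1)),
      P.IsVertex v → P.IsSection Q v P.top → Q.IsChiral) :
    (n = 7 → 55296 ≤ P.numFlags) ∧
    (8 ≤ n → 48 * (n - 2) * Nat.factorial (n - 2) ≤ P.numFlags) := by
  have hfl : Finite (Flag P.Face) :=
    Finite.of_injective (fun Φ : Flag P.Face => (Φ : Set P.Face)) SetLike.coe_injective
  constructor
  · rintro rfl
    obtain ⟨S⟩ := AbstractPolytope.exists_sys P (by norm_num) hchiral hfacets hvfs
    have := S.main_7
    rw [S.N_total] at this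
    exact this
  · intro hn
    obtain ⟨S⟩ := AbstractPolytope.exists_sys P (by omega) hchiral hfacets hvfs
    have := S.main_8 hn
    rw [S.N_total] at this
    exact this
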